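/- For every ε > 0 there exists N₀ such that every odd integer N ≥ N₀ can be written as N = q₁ + q₂ + q₃ with prime numbers q₁, q₂, q₃ satisfying N/(3+ε) < q_i < ((3+2ε)/(9+3ε))·N for i = 1, 2, 3. -/

import Mathlib

open Filter Pointwise

/-- `nthPrime n` is the `n`-th prime number (1-indexed): `nthPrime 1 = 2`, etc. -/
noncomputable def nthPrime (n : ℕ) : ℕ := Nat.nth Nat.Prime (n - 1)

/-- `S n` is the additive submonoid of `ℕ` generated by the primes `q ≥ nthPrime n`. -/
def S (n : ℕ) : AddSubmonoid ℕ :=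
  AddSubmonoid.closure {q : ℕ | q.Prime ∧ nthPrime n ≤ q}

/-- `frob n` is the Frobenius number of `S n`: the largest natural number not in `S n`. -/
noncomputable def frob (n : ℕ) : ℕ := sSup {m : ℕ | m ∉ S n}

/-- `genus n` is the number of natural numbers not in `S n`. -/
noncomputable def genus (n : ℕ) : ℕ := {m : ℕ | m ∉ S n}.ncard

/-- `atoms n` is the minimal generating set `S n \ {0} \ ((S n \ {0}) + (S n \ {0}))`. -/
def atoms (n : ℕ) : Set ℕ :=
  ((S n : Set ℕ) \ {0}) \ (((S n : Set ℕ) \ {0}) + ((S n : Set ℕ) \ {0}))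

/-- `u n` is the largest atom of `S n`. -/
noncomputable def u (n : ℕ) : ℕ := sSup (atoms n)

/-- `e n` is the embedding dimension of `S n`: the number of atoms. -/
noncomputable def e (n : ℕ) : ℕ := (atoms n).ncard

namespace Vinogradov

open Complex MeasureTheory Set Asymptotics Topology

/-! ### Mellin transforms of bounded functions supported away from zero -/

section Mellin

variable {B : ℝ → ℂ} {K x₀ : ℝ}

lemma differentiableAt_mellin_neg (hB : Measurable B) (hK : ∀ t, ‖B t‖ ≤ K) (hx₀ : 0 < x₀)
    (h0 : ∀ t < x₀, B t = 0) {s : ℂ} (hs : 0 < s.re) :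
    DifferentiableAt ℂ (fun z ↦ mellin B (-z)) s := by
  have h1 : DifferentiableAt ℂ (mellin B) (-s) := by
    refine mellin_differentiableAt_of_isBigO_rpow (a := 0) (b := -s.re - 1) ?_ ?_ ?_ ?_ ?_
    · apply LocallyIntegrable.locallyIntegrableOn
      exact (locallyIntegrable_const K).mono hB.aestronglyMeasurable
        (Eventually.of_forall fun t ↦ (hK t).trans (Real.le_norm_self _))
    · exact IsBigO.of_bound K (Eventually.of_forall fun t ↦ by simpa using hK t)
    · simpa using hs
    · refine EventuallyEq.trans_isBigO (f₂ := fun _ ↦ (0 : ℂ)) ?_ (isBigO_zero _ _)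
      exact mem_nhdsWithin_of_mem_nhds ((eventually_lt_nhds hx₀).mono fun t ht ↦ h0 t ht)
    · simp
  exact h1.comp s differentiableAt_id.neg

lemma norm_mellin_neg_le (hK : ∀ t, ‖B t‖ ≤ K) (hx₀ : 0 < x₀)
    (h0 : ∀ t < x₀, B t = 0) {s : ℂ} (hs : 0 < s.re) :
    ‖mellin B (-s)‖ ≤ K * (x₀ ^ (-s.re) / s.re) := by
  have h_int : IntegrableOn (fun t : ℝ ↦ K * t ^ (-s.re - 1)) (Ioi x₀) :=
    (integrableOn_Ioi_rpow_of_lt (by linarith) hx₀).const_mul K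
  have e1 : mellin B (-s) = ∫ t in Ioi x₀, (t : ℂ) ^ (-s - 1) • B t := by
    rw [mellin, ← integral_indicator measurableSet_Ioi, ← integral_indicator measurableSet_Ioi]
    refine integral_congr_ae ?_
    have : ∀ᵐ t : ℝ, t ≠ x₀ := by simp [ae_iff, measure_singleton]
    filter_upwards [this] with t ht
    rcases lt_or_gt_of_ne ht with h | h
    · simp [indicator, h0 t h]
    · rw [indicator_of_mem (mem_Ioi.mpr h), indicator_of_mem (mem_Ioi.mpr (hx₀.trans h))]
  rw [e1]
  refine (norm_integral_le_of_norm_le h_int ?_).trans ?_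
  · filter_upwards [ae_restrict_mem measurableSet_Ioi] with t ht
    have ht' : 0 < t := hx₀.trans ht
    rw [norm_smul, norm_cpow_eq_rpow_re_of_pos ht', mul_comm]
    simpa using mul_le_mul_of_nonneg_right (hK t) (Real.rpow_nonneg ht'.le (-s.re - 1))
  · rw [integral_const_mul, integral_Ioi_rpow_of_lt (by linarith) hx₀]
    simp only [sub_add_cancel, neg_div_neg_eq]
    exact le_rfl

end Mellin

/-- Analytic continuation from `1 < re s` to `0 < re s`. -/
lemma eq_of_eq_on_one_lt_re {f g : ℂ → ℂ}
    (hf : ∀ s : ℂ, 0 < s.re → DifferentiableAt ℂ f s)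
    (hg : ∀ s : ℂ, 0 < s.re → DifferentiableAt ℂ g s)
    (h : ∀ s : ℂ, 1 < s.re → f s = g s) {s : ℂ} (hs : 0 < s.re) : f s = g s := by
  have hU : IsOpen {z : ℂ | 0 < z.re} := isOpen_lt continuous_const continuous_re
  have hpre : IsPreconnected {z : ℂ | 0 < z.re} := (convex_halfSpace_re_gt 0).isPreconnected
  have hfa : AnalyticOnNhd ℂ f {z : ℂ | 0 < z.re} :=
    DifferentiableOn.analyticOnNhd (fun z hz ↦ (hf z hz).differentiableWithinAt) hU
  have hga : AnalyticOnNhd ℂ g {z : ℂ | 0 < z.re} :=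
    DifferentiableOn.analyticOnNhd (fun z hz ↦ (hg z hz).differentiableWithinAt) hU
  refine hfa.eqOn_of_preconnected_of_eventuallyEq hga hpre (z₀ := 2) (by simp) ?_ hs
  have : {z : ℂ | 1 < z.re} ∈ 𝓝 (2 : ℂ) :=
    (isOpen_lt continuous_const continuous_re).mem_nhds (by simp)
  filter_upwards [this] with z hz using h z hz

/-! ### Tails of Dirichlet series -/

/-- Separating the terms with `n ≤ N` of a Dirichlet series with bounded coefficients and applying
partial summation to the other ones. -/
lemma LSeries_eq_sum_add_integral {a : ℕ → ℂ} {M : ℝ} (ha : ∀ n, ‖a n‖ ≤ M) (N : ℕ)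
    {s : ℂ} (hs : 1 < s.re) :
    LSeries a s = ∑ n ∈ Finset.Icc 1 N, a n * (n : ℂ) ^ (-s) +
      s * ∫ t in Ioi (1 : ℝ), (∑ k ∈ Finset.Ioc N ⌊t⌋₊, a k) * (t : ℂ) ^ (-(s + 1)) := by
  set b : ℕ → ℂ := fun n ↦ if N < n then a n else 0 with hb
  set h : ℕ → ℂ := fun n ↦ if N < n then 0 else a n with hh
  have hM : 0 ≤ M := (norm_nonneg _).trans (ha 0)
  have hbM : ∀ n, ‖b n‖ ≤ M := fun n ↦ by
    simp only [hb]; split_ifs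
    · exact ha n
    · simpa using hM
  have hhM : ∀ n, ‖h n‖ ≤ M := fun n ↦ by
    simp only [hh]; split_ifs
    · simpa using hM
    · exact ha n
  have hbs : LSeriesSummable b s := LSeriesSummable_of_bounded_of_one_lt_re (fun n _ ↦ hbM n) hs
  have hhs : LSeriesSummable h s := LSeriesSummable_of_bounded_of_one_lt_re (fun n _ ↦ hhM n) hs
  have hsum : a = h + b := by
    ext n; simp only [hb, hh, Pi.add_apply]; split_ifs <;> simp
  have hO : (fun n ↦ ∑ k ∈ Finset.Icc 1 n, ‖b k‖) =O[atTop] fun n ↦ (n : ℝ) ^ (1 : ℝ) := by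
    refine IsBigO.of_bound M (Eventually.of_forall fun n ↦ ?_)
    rw [Real.norm_of_nonneg (by positivity), Real.rpow_one, Real.norm_of_nonneg (by positivity)]
    refine (Finset.sum_le_sum fun k _ ↦ hbM k).trans ?_
    simp [mul_comm]
  have e1 : LSeries h s = ∑ n ∈ Finset.Icc 1 N, a n * (n : ℂ) ^ (-s) := by
    rw [LSeries, tsum_eq_sum (s := Finset.Icc 1 N)]
    · refine Finset.sum_congr rfl fun n hn ↦ ?_
      rw [Finset.mem_Icc] at hn
      rw [LSeries.term_of_ne_zero (by lia), cpow_neg, ← div_eq_mul_inv]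
      simp [hh, not_lt.mpr hn.2]
    · intro n hn
      rcases Nat.eq_zero_or_pos n with rfl | hn0
      · simp
      · have : N < n := by simp at hn; lia
        rw [LSeries.term_of_ne_zero (by lia)]; simp [hh, this]
  rw [hsum, LSeries_add hhs hbs, e1, LSeries_eq_mul_integral' b zero_le_one hs hO, ← hsum]
  congr 3
  ext t
  congr 1
  have : ∀ k ∈ Finset.Icc 1 ⌊t⌋₊, b k = if k ∈ Finset.Ioc N ⌊t⌋₊ then a k else 0 := by
    intro k hk
    simp only [Finset.mem_Icc] at hk
    simp [hb, hk.2]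
  rw [Finset.sum_congr rfl this, ← Finset.sum_filter]
  congr 1
  ext k
  simp only [Finset.mem_filter, Finset.mem_Icc, Finset.mem_Ioc]
  lia

/-- An interval of length `q` is a complete residue system. -/
lemma sum_Ioc_add_eq_sum_zmod {M : Type*} [AddCommMonoid M] (q : ℕ) [NeZero q] (f : ZMod q → M)
    (d : ℕ) : ∑ k ∈ Finset.Ioc d (d + q), f k = ∑ a, f a := by
  have hinj : Set.InjOn (fun k : ℕ ↦ (k : ZMod q)) (Finset.Ioc d (d + q)) := by
    intro a ha b hb hab
    simp only [Finset.coe_Ioc, Set.mem_Ioc] at ha hb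
    have h1 : a ≡ b [MOD q] := (ZMod.natCast_eq_natCast_iff _ _ _).1 hab
    rcases le_total a b with h | h
    · have := Nat.eq_zero_of_dvd_of_lt ((Nat.modEq_iff_dvd' h).1 h1) (by lia)
      lia
    · have := Nat.eq_zero_of_dvd_of_lt ((Nat.modEq_iff_dvd' h).1 h1.symm) (by lia)
      lia
  rw [← Finset.sum_image (g := fun k : ℕ ↦ (k : ZMod q)) (f := f) hinj]
  congr 1
  apply Finset.eq_univ_of_card
  rw [Finset.card_image_of_injOn hinj]
  simp [ZMod.card]

/-- The sum of a nontrivial Dirichlet character over an interval is bounded by the modulus. -/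
lemma norm_sum_Ioc_char_le {q : ℕ} [NeZero q] {χ : DirichletCharacter ℂ q} (hχ : χ ≠ 1) (m n : ℕ) :
    ‖∑ k ∈ Finset.Ioc m n, χ k‖ ≤ q := by
  induction hd : n - m using Nat.strong_induction_on generalizing m with
  | _ d ih =>
    rcases lt_or_ge d q with h | h
    · have h1 : ∀ k ∈ Finset.Ioc m n, ‖χ (k : ZMod q)‖ ≤ 1 := fun k _ ↦ χ.norm_le_one _
      refine (norm_sum_le_of_le _ h1).trans ?_
      simp only [Finset.sum_const, Nat.card_Ioc, nsmul_eq_mul, mul_one, hd]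
      exact_mod_cast h.le
    · have hq : 0 < q := NeZero.pos q
      rw [← Finset.sum_Ioc_consecutive _ (Nat.le_add_right m q) (by lia),
        sum_Ioc_add_eq_sum_zmod q χ, χ.sum_eq_zero_of_ne_one hχ, zero_add]
      exact ih (n - (m + q)) (by lia) (m + q) rfl

/-- Partial sums of the Dirichlet series of a nontrivial character approximate the `L`-function. -/
lemma norm_LFunction_sub_sum_le {q : ℕ} [NeZero q] {χ : DirichletCharacter ℂ q} (hχ : χ ≠ 1)
    {N : ℕ} (hN : 1 ≤ N) {s : ℂ} (hs : 0 < s.re) :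
    ‖DirichletCharacter.LFunction χ s - ∑ n ∈ Finset.Icc 1 N, χ n * (n : ℂ) ^ (-s)‖ ≤
      ‖s‖ * (q * ((N : ℝ) ^ (-s.re) / s.re)) := by
  set B : ℝ → ℂ := fun t ↦ ∑ k ∈ Finset.Ioc N ⌊t⌋₊, χ k with hB
  have hmeas : Measurable B := (measurable_of_countable (fun m : ℕ ↦ ∑ k ∈ Finset.Ioc N m, χ k)).comp
    Nat.measurable_floor
  have hK : ∀ t, ‖B t‖ ≤ q := fun t ↦ norm_sum_Ioc_char_le hχ _ _
  have hx₀ : (0 : ℝ) < (N : ℝ) := by positivity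
  have h0 : ∀ t < (N : ℝ), B t = 0 := by
    intro t ht
    rw [hB]
    have : ⌊t⌋₊ ≤ N := by
      exact ((Nat.floor_lt' (by lia)).2 ht).le
    simp [this]
  have key : DirichletCharacter.LFunction χ s =
      ∑ n ∈ Finset.Icc 1 N, χ n * (n : ℂ) ^ (-s) + s * mellin B (-s) := by
    refine eq_of_eq_on_one_lt_re
      (f := DirichletCharacter.LFunction χ)
      (g := fun s ↦ ∑ n ∈ Finset.Icc 1 N, χ n * (n : ℂ) ^ (-s) + s * mellin B (-s))
      (fun s _ ↦ (DirichletCharacter.differentiable_LFunction hχ) s) ?_ ?_ hs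
    · intro s hs
      refine DifferentiableAt.add ?_ (differentiableAt_id.mul
        (differentiableAt_mellin_neg hmeas hK hx₀ h0 hs))
      refine DifferentiableAt.fun_sum fun n hn ↦ ?_
      have : (n : ℂ) ≠ 0 := by
        rw [Finset.mem_Icc] at hn
        exact_mod_cast (by lia)
      exact (differentiableAt_id.neg.const_cpow (Or.inl this)).const_mul _
    · intro s hs
      rw [DirichletCharacter.LFunction_eq_LSeries χ hs,
        LSeries_eq_sum_add_integral (fun n ↦ χ.norm_le_one n) N hs, mellin]
      congr 2
      symm
      rw [setIntegral_eq_of_subset_of_forall_sdiff_eq_zero (s := Ioi 1) measurableSet_Ioi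
        (Ioi_subset_Ioi zero_le_one)]
      · refine setIntegral_congr_fun measurableSet_Ioi fun t _ ↦ ?_
        simp only [smul_eq_mul, hB, neg_add']
        ring
      · intro t ht
        have h1 : ⌊t⌋₊ ≤ 1 := Nat.floor_le_one_of_le_one (by simpa using ht.2)
        simp [hB, Finset.Ioc_eq_empty_of_le (h1.trans hN)]
  rw [key, add_sub_cancel_left, norm_mul]
  exact mul_le_mul_of_nonneg_left (norm_mellin_neg_le hK hx₀ h0 hs) (norm_nonneg _)

/-- Partial sums of the Dirichlet series approximate the Riemann zeta function. -/
lemma norm_riemannZeta_sub_sum_le {N : ℕ} (hN : 1 ≤ N) {s : ℂ} (hs : 0 < s.re) (hs1 : s ≠ 1) :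
    ‖riemannZeta s - ∑ n ∈ Finset.Icc 1 N, (n : ℂ) ^ (-s) - (N : ℂ) ^ (1 - s) / (s - 1)‖ ≤
      ‖s‖ * ((N : ℝ) ^ (-s.re) / s.re) := by
  set B : ℝ → ℂ := fun t ↦ if t < N then 0 else ((⌊t⌋₊ : ℝ) - t : ℝ) with hB
  have hmeas : Measurable B := by
    refine Measurable.ite measurableSet_Iio measurable_const ?_
    exact measurable_ofReal.comp
      (((measurable_of_countable (fun m : ℕ ↦ (m : ℝ))).comp Nat.measurable_floor).sub
        measurable_id)
  have hK : ∀ t, ‖B t‖ ≤ 1 := by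
    intro t
    simp only [hB]
    split_ifs with h
    · simp
    · have h1 : (0 : ℝ) ≤ t := le_trans (by positivity) (not_lt.1 h)
      rw [norm_real, Real.norm_eq_abs, abs_le]
      constructor <;> linarith [Nat.floor_le h1, Nat.lt_floor_add_one t]
  have hN0 : (0 : ℝ) < N := by exact_mod_cast hN
  have hNc : (N : ℂ) ≠ 0 := by exact_mod_cast hN0.ne'
  have h0 : ∀ t < (N : ℝ), B t = 0 := fun t ht ↦ by simp [hB, ht]
  have key : DirichletCharacter.LFunctionTrivChar₁ 1 s = (s - 1) *
      ∑ n ∈ Finset.Icc 1 N, (n : ℂ) ^ (-s) + (N : ℂ) ^ (1 - s) +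
        (s - 1) * (s * mellin B (-s)) := by
    refine eq_of_eq_on_one_lt_re (f := DirichletCharacter.LFunctionTrivChar₁ 1)
      (g := fun s ↦ (s - 1) * ∑ n ∈ Finset.Icc 1 N, (n : ℂ) ^ (-s) + (N : ℂ) ^ (1 - s) +
        (s - 1) * (s * mellin B (-s)))
      (fun s _ ↦ (DirichletCharacter.differentiable_LFunctionTrivChar₁ 1) s) ?_ ?_ hs
    · intro s hs
      refine DifferentiableAt.add (DifferentiableAt.add ?_ ?_)
        ((differentiableAt_id.sub_const 1).mul (differentiableAt_id.mul
        (differentiableAt_mellin_neg hmeas hK hN0 h0 hs)))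
      · refine (differentiableAt_id.sub_const 1).mul (DifferentiableAt.fun_sum fun n hn ↦ ?_)
        have : (n : ℂ) ≠ 0 := by
          rw [Finset.mem_Icc] at hn
          exact_mod_cast (by lia)
        exact (differentiableAt_id.neg.const_cpow (Or.inl this))
      · exact (differentiableAt_id.const_sub 1).const_cpow (Or.inl hNc)
    · intro s hs
      have hs1 : s ≠ 1 := fun h ↦ by simp [h] at hs
      have hs0 : s ≠ 0 := fun h ↦ by simp [h] at hs; linarith
      have hs1' : s - 1 ≠ 0 := sub_ne_zero.2 hs1
      have hz := LSeries_eq_sum_add_integral (a := 1) (M := 1) (fun n ↦ by simp) N hs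
      rw [LSeries_one_eq_riemannZeta hs] at hz
      have e2 : ∫ t in Ioi (N : ℝ), (t : ℂ) ^ (-s) = -(N : ℂ) ^ (-s + 1) / (-s + 1) :=
        integral_Ioi_cpow_of_lt (by simpa using hs) hN0
      have e3 : ∫ t in Ioi (N : ℝ), (t : ℂ) ^ (-s - 1) = -(N : ℂ) ^ (-s - 1 + 1) / (-s - 1 + 1) :=
        integral_Ioi_cpow_of_lt (by simp; linarith) hN0
      have i2 : IntegrableOn (fun t : ℝ ↦ (t : ℂ) ^ (-s)) (Ioi (N : ℝ)) :=
        integrableOn_Ioi_cpow_of_lt (by simpa using hs) hN0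
      have i3 : IntegrableOn (fun t : ℝ ↦ (t : ℂ) ^ (-s - 1)) (Ioi (N : ℝ)) :=
        integrableOn_Ioi_cpow_of_lt (by simp; linarith) hN0
      have i4 : IntegrableOn (fun t : ℝ ↦ (t : ℂ) ^ (-s - 1) * B t) (Ioi (N : ℝ)) := by
        refine Integrable.mono i3 (i3.aestronglyMeasurable.mul hmeas.aestronglyMeasurable)
          (Eventually.of_forall fun t ↦ ?_)
        rw [norm_mul]
        exact mul_le_of_le_one_right (norm_nonneg _) (hK t)
      have e1 : ∫ t in Ioi (1 : ℝ), (∑ k ∈ Finset.Ioc N ⌊t⌋₊, (1 : ℕ → ℂ) k) *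
          (t : ℂ) ^ (-(s + 1)) = (∫ t in Ioi (N : ℝ), (t : ℂ) ^ (-s)) -
            N * (∫ t in Ioi (N : ℝ), (t : ℂ) ^ (-s - 1)) +
            ∫ t in Ioi (N : ℝ), (t : ℂ) ^ (-s - 1) * B t := by
        have i5 : IntegrableOn (fun t : ℝ ↦ (t : ℂ) ^ (-s) - N * (t : ℂ) ^ (-s - 1))
          (Ioi (N : ℝ)) := i2.sub (i3.const_mul _)
        rw [← integral_const_mul, ← integral_sub i2 (i3.const_mul _), ← integral_add i5 i4]
        rw [setIntegral_eq_of_subset_of_forall_sdiff_eq_zero (s := Ioi (N : ℝ)) measurableSet_Ioi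
          (Ioi_subset_Ioi (by exact_mod_cast hN))]
        · refine setIntegral_congr_fun measurableSet_Ioi fun t ht ↦ ?_
          have ht' : (N : ℝ) < t := ht
          have ht0 : (t : ℂ) ≠ 0 := by exact_mod_cast (hN0.trans ht').ne'
          have hfl : N ≤ ⌊t⌋₊ := Nat.le_floor ht'.le
          have : (t : ℂ) ^ (-s) = t * (t : ℂ) ^ (-s - 1) := by
            rw [cpow_sub _ _ ht0, cpow_one]; field_simp
          simp only [hB, not_lt.2 ht'.le, if_false, Pi.one_apply, Finset.sum_const, Nat.card_Ioc,
            Nat.cast_sub hfl, nsmul_eq_mul, mul_one, neg_add', this]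
          push_cast
          ring
        · intro t ht
          have h1 : ⌊t⌋₊ ≤ N := Nat.floor_le_of_le (by simpa using ht.2)
          simp [Finset.Ioc_eq_empty_of_le h1]
      have e4 : mellin B (-s) = ∫ t in Ioi (N : ℝ), (t : ℂ) ^ (-s - 1) * B t := by
        rw [mellin, setIntegral_eq_of_subset_of_ae_sdiff_eq_zero (s := Ioi (N : ℝ))
          measurableSet_Ioi.nullMeasurableSet (Ioi_subset_Ioi hN0.le)]
        · simp only [smul_eq_mul]
        · have : ∀ᵐ t : ℝ, t ≠ N := by simp [ae_iff, measure_singleton]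
          filter_upwards [this] with t ht ht'
          have : t < N := lt_of_le_of_ne (by simpa using ht'.2) ht
          simp [h0 t this]
      have e5 : (N : ℂ) ^ (-s + 1) = N * (N : ℂ) ^ (-s) := by
        rw [cpow_add _ _ hNc, cpow_one, mul_comm]
      have e6 : (N : ℂ) ^ (1 - s) = N * (N : ℂ) ^ (-s) := by rw [← e5]; congr 1; ring
      have hs1'' : -s + 1 ≠ 0 := fun h ↦ hs1' (by linear_combination -h)
      simp only [DirichletCharacter.LFunctionTrivChar₁, Function.update_of_ne hs1,
        DirichletCharacter.LFunctionTrivChar, DirichletCharacter.LFunction_modOne_eq]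
      rw [hz, e1, e4, e2, e3, sub_add_cancel, e5, e6]
      simp only [Pi.one_apply, one_mul]
      field_simp
      ring
  have hs1' : s - 1 ≠ 0 := sub_ne_zero.2 hs1
  simp only [DirichletCharacter.LFunctionTrivChar₁, Function.update_of_ne hs1,
        DirichletCharacter.LFunctionTrivChar, DirichletCharacter.LFunction_modOne_eq] at key
  have : riemannZeta s - ∑ n ∈ Finset.Icc 1 N, (n : ℂ) ^ (-s) - (N : ℂ) ^ (1 - s) / (s - 1) =
      s * mellin B (-s) := by
    apply mul_left_cancel₀ hs1'
    rw [mul_sub, mul_sub, key, mul_div_cancel₀ _ hs1']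
    ring
  rw [this, norm_mul]
  refine mul_le_mul_of_nonneg_left ?_ (norm_nonneg _)
  simpa using norm_mellin_neg_le hK hN0 h0 hs

end Vinogradov

namespace Vinogradov

open Complex MeasureTheory Set Asymptotics Topology

/-! ### Growth of `L`-functions near the line `re s = 1` -/

lemma norm_sum_Icc_cpow_le {a : ℕ → ℂ} (ha : ∀ n, ‖a n‖ ≤ 1) {η : ℝ} (hη : 0 < η) (N : ℕ) {s : ℂ}
    (hs : 1 - η ≤ s.re) :
    ‖∑ n ∈ Finset.Icc 1 N, a n * (n : ℂ) ^ (-s)‖ ≤ (1 + 1 / η) * (N : ℝ) ^ (2 * η) := by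
  rcases Nat.eq_zero_or_pos N with rfl | hN
  · simp; positivity
  have hN1 : (1 : ℝ) ≤ N := by exact_mod_cast hN
  have hNη : 1 ≤ (N : ℝ) ^ η := Real.one_le_rpow hN1 hη.le
  have h1 : ∀ n ∈ Finset.Icc 1 N, ‖a n * (n : ℂ) ^ (-s)‖ ≤ (N : ℝ) ^ η * (n : ℝ)⁻¹ := by
    intro n hn
    rw [Finset.mem_Icc] at hn
    have hn0 : (0 : ℝ) < n := by exact_mod_cast hn.1
    have hn1 : (1 : ℝ) ≤ n := by exact_mod_cast hn.1
    have hnN : (n : ℝ) ≤ N := by exact_mod_cast hn.2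
    rw [norm_mul, ← ofReal_natCast, norm_cpow_eq_rpow_re_of_pos hn0, neg_re]
    refine (mul_le_of_le_one_left (by positivity) (ha n)).trans ?_
    calc (n : ℝ) ^ (-s.re) ≤ (n : ℝ) ^ (η + -1) := Real.rpow_le_rpow_of_exponent_le hn1 (by linarith)
      _ = (n : ℝ) ^ η * (n : ℝ)⁻¹ := by rw [Real.rpow_add hn0, Real.rpow_neg_one]
      _ ≤ _ := by gcongr
  refine (norm_sum_le_of_le _ h1).trans ?_
  rw [← Finset.mul_sum]
  have h2 : ∑ n ∈ Finset.Icc 1 N, (n : ℝ)⁻¹ ≤ 1 + Real.log N := by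
    have := harmonic_le_one_add_log N
    rw [harmonic_eq_sum_Icc] at this
    push_cast at this
    exact this
  have h3 : Real.log N ≤ (N : ℝ) ^ η / η := Real.log_le_rpow_div (by positivity) hη
  have h4 : ∑ n ∈ Finset.Icc 1 N, (n : ℝ)⁻¹ ≤ (1 + 1 / η) * (N : ℝ) ^ η := by
    calc _ ≤ (N : ℝ) ^ η + (N : ℝ) ^ η / η := by linarith
      _ = _ := by ring
  calc (N : ℝ) ^ η * ∑ n ∈ Finset.Icc 1 N, (n : ℝ)⁻¹ ≤
      (N : ℝ) ^ η * ((1 + 1 / η) * (N : ℝ) ^ η) := by gcongr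
    _ = (1 + 1 / η) * (N : ℝ) ^ (2 * η) := by
      rw [two_mul, Real.rpow_add (by positivity)]; ring

lemma exists_norm_LFunction_le {η : ℝ} (hη : 0 < η) (hη' : η ≤ 1 / 2) : ∃ C : ℝ, 0 < C ∧
    ∀ (q : ℕ) [NeZero q] (χ : DirichletCharacter ℂ q), χ ≠ 1 → ∀ s : ℂ, 1 - η ≤ s.re → s.re ≤ 4 →
      ‖DirichletCharacter.LFunction χ s‖ ≤ C * (q * (|s.im| + 2)) ^ (2 * η) := by
  refine ⟨(1 + 1 / η + 8) * 2 ^ (2 * η), by positivity, fun q _ χ hχ s hs hs' ↦ ?_⟩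
  set Q : ℝ := q * (|s.im| + 2) with hQ
  have hq1 : (1 : ℝ) ≤ q := by exact_mod_cast NeZero.one_le
  have hQ1 : 2 ≤ Q := by nlinarith [abs_nonneg s.im]
  have hs0 : 0 < s.re := by linarith
  set N := ⌈Q⌉₊ with hN
  have hNQ : Q ≤ N := Nat.le_ceil Q
  have hN2 : (N : ℝ) ≤ 2 * Q := by linarith [Nat.ceil_lt_add_one (by linarith : 0 ≤ Q)]
  have hN1 : (1 : ℝ) ≤ N := by linarith
  have hN1' : 1 ≤ N := by exact_mod_cast hN1
  have h1 := norm_LFunction_sub_sum_le hχ hN1' hs0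
  have h2 := norm_sum_Icc_cpow_le (fun n ↦ χ.norm_le_one n) hη N hs
  have hns : ‖s‖ ≤ 2 * (|s.im| + 2) := by
    refine (norm_le_abs_re_add_abs_im s).trans ?_
    rw [abs_of_pos hs0]; linarith [abs_nonneg s.im]
  have h3 : ‖s‖ * (q * ((N : ℝ) ^ (-s.re) / s.re)) ≤ 8 * (N : ℝ) ^ (2 * η) := by
    have h4 : (N : ℝ) ^ (-s.re) / s.re ≤ 2 * (N : ℝ) ^ (η - 1) := by
      rw [div_le_iff₀ hs0]
      have : (N : ℝ) ^ (-s.re) ≤ (N : ℝ) ^ (η - 1) :=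
        Real.rpow_le_rpow_of_exponent_le hN1 (by linarith)
      have h5 : 0 ≤ (N : ℝ) ^ (η - 1) := by positivity
      nlinarith
    have h6 : ‖s‖ * q ≤ 2 * N := by
      calc ‖s‖ * q ≤ 2 * (|s.im| + 2) * q := by gcongr
        _ = 2 * Q := by rw [hQ]; ring
        _ ≤ 2 * N := by linarith
    calc ‖s‖ * (q * ((N : ℝ) ^ (-s.re) / s.re)) = (‖s‖ * q) * ((N : ℝ) ^ (-s.re) / s.re) := by ring
      _ ≤ (2 * N) * (2 * (N : ℝ) ^ (η - 1)) := by gcongr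
      _ = 4 * (N : ℝ) ^ η := by
        rw [Real.rpow_sub_one (by positivity)]; field_simp; ring
      _ ≤ 8 * (N : ℝ) ^ (2 * η) := by
        gcongr <;> linarith
  have h7 : ‖DirichletCharacter.LFunction χ s‖ ≤ (1 + 1 / η + 8) * (N : ℝ) ^ (2 * η) := by
    have := norm_le_norm_sub_add (DirichletCharacter.LFunction χ s)
      (∑ n ∈ Finset.Icc 1 N, χ n * (n : ℂ) ^ (-s))
    linarith
  refine h7.trans ?_
  rw [mul_assoc, ← Real.mul_rpow (by norm_num) (by linarith)]
  gcongr

lemma exists_norm_riemannZeta_le {η : ℝ} (hη : 0 < η) (hη' : η ≤ 1 / 2) : ∃ C : ℝ, 0 < C ∧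
    ∀ s : ℂ, s ≠ 1 → 1 - η ≤ s.re → s.re ≤ 4 →
      ‖riemannZeta s‖ ≤ C * (|s.im| + 2) ^ (2 * η) * (1 + 1 / ‖s - 1‖) := by
  refine ⟨(1 + 1 / η + 8) * 2 ^ (2 * η), by positivity, fun s hs1 hs hs' ↦ ?_⟩
  set Q : ℝ := |s.im| + 2 with hQ
  have hQ1 : 2 ≤ Q := by linarith [abs_nonneg s.im]
  have hs0 : 0 < s.re := by linarith
  set N := ⌈Q⌉₊ with hN
  have hNQ : Q ≤ N := Nat.le_ceil Q
  have hN2 : (N : ℝ) ≤ 2 * Q := by linarith [Nat.ceil_lt_add_one (by linarith : 0 ≤ Q)]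
  have hN1 : (1 : ℝ) ≤ N := by linarith
  have hN0 : (0 : ℝ) < N := by linarith
  have hN1' : 1 ≤ N := by exact_mod_cast hN1
  have h1 := norm_riemannZeta_sub_sum_le hN1' hs0 hs1
  have h2 := norm_sum_Icc_cpow_le (a := fun _ ↦ 1) (fun n ↦ by simp) hη N hs
  simp only [one_mul] at h2
  have hns : ‖s‖ ≤ 2 * Q := by
    refine (norm_le_abs_re_add_abs_im s).trans ?_
    rw [abs_of_pos hs0]; linarith [abs_nonneg s.im]
  have h3 : ‖s‖ * ((N : ℝ) ^ (-s.re) / s.re) ≤ 8 * (N : ℝ) ^ (2 * η) := by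
    have h4 : (N : ℝ) ^ (-s.re) / s.re ≤ 2 * (N : ℝ) ^ (η - 1) := by
      rw [div_le_iff₀ hs0]
      have : (N : ℝ) ^ (-s.re) ≤ (N : ℝ) ^ (η - 1) :=
        Real.rpow_le_rpow_of_exponent_le hN1 (by linarith)
      have h5 : 0 ≤ (N : ℝ) ^ (η - 1) := by positivity
      nlinarith
    calc ‖s‖ * ((N : ℝ) ^ (-s.re) / s.re) ≤ (2 * N) * (2 * (N : ℝ) ^ (η - 1)) := by
          gcongr; linarith
      _ = 4 * (N : ℝ) ^ η := by
        rw [Real.rpow_sub_one (by positivity)]; field_simp; ring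
      _ ≤ 8 * (N : ℝ) ^ (2 * η) := by
        gcongr <;> linarith
  have h8 : ‖(N : ℂ) ^ (1 - s) / (s - 1)‖ ≤ (N : ℝ) ^ (2 * η) * (1 / ‖s - 1‖) := by
    rw [norm_div, ← ofReal_natCast, norm_cpow_eq_rpow_re_of_pos hN0, div_eq_mul_one_div]
    gcongr
    rw [sub_re, one_re]; linarith
  set P : ℝ := (N : ℝ) ^ (2 * η) with hP
  have hP0 : 0 < P := by positivity
  have h7 : ‖riemannZeta s‖ ≤ (1 + 1 / η + 8) * P * (1 + 1 / ‖s - 1‖) := by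
    set x := ∑ n ∈ Finset.Icc 1 N, (n : ℂ) ^ (-s)
    set y := (N : ℂ) ^ (1 - s) / (s - 1)
    have e1 : riemannZeta s = (riemannZeta s - x - y) + x + y := by ring
    have e2 : ‖riemannZeta s‖ ≤ ‖riemannZeta s - x - y‖ + ‖x‖ + ‖y‖ := by
      conv_lhs => rw [e1]
      exact norm_add₃_le
    have e3 : 0 ≤ (1 / η + 8) * P * (1 / ‖s - 1‖) := by positivity
    nlinarith
  refine h7.trans ?_
  rw [mul_assoc _ ((2 : ℝ) ^ _), ← Real.mul_rpow (by norm_num) (by linarith)]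
  have h9 : P ≤ (2 * Q) ^ (2 * η) := by rw [hP]; gcongr
  gcongr

/-! ### A lower bound for the totient function -/

lemma one_div_card_succ_le_prod (P : Finset ℕ) (hP : ∀ p ∈ P, 2 ≤ p) :
    1 / ((P.card : ℝ) + 1) ≤ ∏ p ∈ P, (1 - (p : ℝ)⁻¹) := by
  induction P using Finset.induction_on_max with
  | empty => simp
  | insert a s hs ih =>
    have ha : a ∉ s := fun h ↦ lt_irrefl _ (hs a h)
    rw [Finset.prod_insert ha, Finset.card_insert_of_notMem ha]
    have h1 := ih fun p hp ↦ hP p (Finset.mem_insert_of_mem hp)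
    have hcard : s.card + 2 ≤ a := by
      have : s ⊆ Finset.Ico 2 a := fun x hx ↦
        Finset.mem_Ico.2 ⟨hP x (Finset.mem_insert_of_mem hx), hs x hx⟩
      have h2 := Finset.card_le_card this
      have h3 := hP a (Finset.mem_insert_self _ _)
      simp at h2; lia
    have hcard' : (s.card : ℝ) + 2 ≤ a := by exact_mod_cast hcard
    have h4 : (a : ℝ)⁻¹ ≤ ((s.card : ℝ) + 2)⁻¹ := by gcongr
    have h5 : 1 - ((s.card : ℝ) + 2)⁻¹ = ((s.card : ℝ) + 1) / (s.card + 2) := by field_simp; ring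
    calc 1 / (((s.card + 1 : ℕ) : ℝ) + 1) =
        (1 - ((s.card : ℝ) + 2)⁻¹) * (1 / ((s.card : ℝ) + 1)) := by
          rw [h5]; push_cast; field_simp; ring
      _ ≤ _ := by
          have h6 : 0 ≤ 1 - (a : ℝ)⁻¹ := by
            have : 0 < ((s.card : ℝ) + 1) / (s.card + 2) := by positivity
            linarith
          gcongr

lemma card_primeFactors_le_log {n : ℕ} (hn : n ≠ 0) : n.primeFactors.card ≤ Nat.log 2 n := by
  refine Nat.le_log_of_pow_le (by norm_num) ?_
  calc 2 ^ n.primeFactors.card ≤ ∏ p ∈ n.primeFactors, p :=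
        Finset.pow_card_le_prod _ _ _ fun p hp ↦ (Nat.prime_of_mem_primeFactors hp).two_le
    _ ≤ n := Nat.le_of_dvd (Nat.pos_of_ne_zero hn) (Nat.prod_primeFactors_dvd n)

lemma one_div_le_prod_one_sub_inv {n : ℕ} (hn : n ≠ 0) :
    1 / (2 * Real.log n + 1) ≤ ∏ p ∈ n.primeFactors, (1 - (p : ℝ)⁻¹) := by
  refine le_trans ?_
    (one_div_card_succ_le_prod _ fun p hp ↦ (Nat.prime_of_mem_primeFactors hp).two_le)
  have h1 : (n.primeFactors.card : ℝ) ≤ Nat.log 2 n := by exact_mod_cast card_primeFactors_le_log hn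
  have h2 : (Nat.log 2 n : ℝ) ≤ Real.logb 2 n := by
    simpa using Real.natLog_le_logb n 2
  have h3 : Real.logb 2 n ≤ 2 * Real.log n := by
    have : 0 ≤ Real.log n := Real.log_natCast_nonneg n
    rw [Real.logb, div_le_iff₀ (Real.log_pos (by norm_num))]
    nlinarith [Real.log_two_gt_d9]
  gcongr
  linarith

/-- `n / φ(n)` grows at most logarithmically. -/
lemma le_totient_mul_log {n : ℕ} (hn : n ≠ 0) :
    (n : ℝ) ≤ n.totient * (2 * Real.log n + 1) := by
  have h1 := one_div_le_prod_one_sub_inv hn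
  have h2 : (n.totient : ℝ) = n * ∏ p ∈ n.primeFactors, (1 - (p : ℝ)⁻¹) := by
    have := congrArg (fun x : ℚ ↦ (x : ℝ)) (Nat.totient_eq_mul_prod_factors n)
    push_cast at this
    exact this
  have h0 : 0 < 2 * Real.log n + 1 := by linarith [Real.log_natCast_nonneg n]
  rw [div_le_iff₀ h0] at h1
  rw [h2]
  calc (n : ℝ) = n * 1 := by ring
    _ ≤ n * ((∏ p ∈ n.primeFactors, (1 - (p : ℝ)⁻¹)) * (2 * Real.log n + 1)) := by gcongr
    _ = _ := by ring

end Vinogradov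

namespace Vinogradov

open Complex MeasureTheory Set Asymptotics Topology
open scoped ComplexOrder

/-! ### Products of `L`-functions with nonnegative coefficients -/

section Positivity

variable {q : ℕ} {X : Finset (DirichletCharacter ℂ q)}

/-- The Dirichlet coefficients of the negative of the logarithmic derivative of `zetaProd X`. -/
noncomputable def zetaProdCoeff (X : Finset (DirichletCharacter ℂ q)) (n : ℕ) : ℂ :=
  (1 + ∑ χ ∈ X, χ n) * ArithmeticFunction.vonMangoldt n

lemma zetaProdCoeff_nonneg (hX : ∀ n : ℕ, 0 ≤ 1 + ∑ χ ∈ X, χ n) : 0 ≤ zetaProdCoeff X := by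
  intro n
  refine mul_nonneg (hX n) ?_
  exact zero_le_real.2 ArithmeticFunction.vonMangoldt_nonneg

variable [NeZero q]

/-- The product of the zeta function with the `L`-functions of the characters in `X`. -/
noncomputable def zetaProd (X : Finset (DirichletCharacter ℂ q)) (s : ℂ) : ℂ :=
  riemannZeta s * ∏ χ ∈ X, DirichletCharacter.LFunction χ s

lemma differentiableAt_zetaProd {s : ℂ} (hs : s ≠ 1) : DifferentiableAt ℂ (zetaProd X) s := by
  refine (differentiableAt_riemannZeta hs).mul (DifferentiableAt.fun_finsetProd fun χ _ ↦ ?_)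
  exact DirichletCharacter.differentiableAt_LFunction χ s (Or.inl hs)

lemma LSeriesHasSum_zetaProdCoeff (X : Finset (DirichletCharacter ℂ q)) {s : ℂ} (hs : 1 < s.re) :
    LSeriesHasSum (zetaProdCoeff X) s (-logDeriv (zetaProd X) s) := by
  have hs1 : s ≠ 1 := fun h ↦ by simp [h] at hs
  have h1 : zetaProdCoeff X = (fun n ↦ (ArithmeticFunction.vonMangoldt n : ℂ)) +
      ∑ χ ∈ X, fun n : ℕ ↦ χ n * (ArithmeticFunction.vonMangoldt n : ℂ) := by
    ext n
    simp [zetaProdCoeff, add_mul, Finset.sum_mul]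
  have h2 : logDeriv (zetaProd X) s = logDeriv riemannZeta s +
      ∑ χ ∈ X, logDeriv (DirichletCharacter.LFunction χ) s := by
    have hne : ∀ χ ∈ X, DirichletCharacter.LFunction χ s ≠ 0 := fun χ _ ↦
      DirichletCharacter.LFunction_ne_zero_of_one_le_re χ (Or.inr hs1) hs.le
    have hd : ∀ χ ∈ X, DifferentiableAt ℂ (DirichletCharacter.LFunction χ) s := fun χ _ ↦
      DirichletCharacter.differentiableAt_LFunction χ s (Or.inl hs1)
    rw [← logDeriv_prod hne hd]
    exact logDeriv_mul s (riemannZeta_ne_zero_of_one_lt_re hs) (Finset.prod_ne_zero_iff.2 hne)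
      (differentiableAt_riemannZeta hs1) (DifferentiableAt.fun_finsetProd hd)
  have h3 : LSeriesHasSum (fun n ↦ (ArithmeticFunction.vonMangoldt n : ℂ)) s
      (-logDeriv riemannZeta s) := by
    have := (ArithmeticFunction.LSeriesSummable_vonMangoldt hs).LSeriesHasSum
    rw [ArithmeticFunction.LSeries_vonMangoldt_eq_deriv_riemannZeta_div hs] at this
    rwa [logDeriv_apply, ← neg_div]
  have h4 : ∀ χ ∈ X, LSeriesHasSum (fun n : ℕ ↦ χ n * (ArithmeticFunction.vonMangoldt n : ℂ)) s
      (-logDeriv (DirichletCharacter.LFunction χ) s) := by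
    intro χ _
    have := (DirichletCharacter.LSeriesSummable_twist_vonMangoldt χ hs).LSeriesHasSum
    rw [DirichletCharacter.LSeries_twist_vonMangoldt_eq χ hs,
      ← DirichletCharacter.deriv_LFunction_eq_deriv_LSeries χ hs,
      ← DirichletCharacter.LFunction_eq_LSeries χ hs] at this
    rw [logDeriv_apply, ← neg_div]
    exact this
  rw [h1, h2, neg_add, ← Finset.sum_neg_distrib]
  refine h3.add ?_
  have h5 : LSeriesHasSum (∑ χ ∈ X, fun n : ℕ ↦ χ n * (ArithmeticFunction.vonMangoldt n : ℂ)) s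
      (∑ χ ∈ X, -logDeriv (DirichletCharacter.LFunction χ) s) := by
    unfold LSeriesHasSum
    have h6 : LSeries.term (∑ χ ∈ X, fun n : ℕ ↦ χ n * (ArithmeticFunction.vonMangoldt n : ℂ)) s =
        fun n ↦ ∑ χ ∈ X, LSeries.term
          (fun n : ℕ ↦ χ n * (ArithmeticFunction.vonMangoldt n : ℂ)) s n := by
      ext n
      rcases Nat.eq_zero_or_pos n with rfl | hn
      · simp
      · simp [LSeries.term_of_ne_zero hn.ne', Finset.sum_div]
    rw [h6]
    exact hasSum_sum h4
  exact h5

lemma abscissaOfAbsConv_zetaProdCoeff_le (X : Finset (DirichletCharacter ℂ q)) :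
    LSeries.abscissaOfAbsConv (zetaProdCoeff X) ≤ 1 := by
  refine LSeries.abscissaOfAbsConv_le_of_forall_lt_LSeriesSummable fun y hy ↦ ?_
  exact (LSeriesHasSum_zetaProdCoeff X (s := y) (by simpa using hy)).LSeriesSummable

lemma deriv_zetaProd (X : Finset (DirichletCharacter ℂ q)) {s : ℂ} (hs : 1 < s.re) :
    deriv (zetaProd X) s = -(LSeries (zetaProdCoeff X) s * zetaProd X s) := by
  have hs1 : s ≠ 1 := fun h ↦ by simp [h] at hs
  have h0 : zetaProd X s ≠ 0 := by
    refine mul_ne_zero (riemannZeta_ne_zero_of_one_lt_re hs) (Finset.prod_ne_zero_iff.2 fun χ _ ↦ ?_)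
    exact DirichletCharacter.LFunction_ne_zero_of_one_le_re χ (Or.inr hs1) hs.le
  rw [(LSeriesHasSum_zetaProdCoeff X hs).LSeries_eq, logDeriv_apply]
  field_simp

lemma one_le_zetaProd_two (hX : ∀ n : ℕ, 0 ≤ 1 + ∑ χ ∈ X, χ n) : 1 ≤ zetaProd X 2 := by
  have h2 : 1 < (2 : ℂ).re := by simp
  have e1 := riemannZeta_eulerProduct_exp_log h2
  have e2 := fun χ : DirichletCharacter ℂ q ↦ DirichletCharacter.LSeries_eulerProduct_exp_log χ h2
  have s1 : Summable fun p : Nat.Primes ↦ -Complex.log (1 - (p : ℂ) ^ (-(2 : ℂ))) := by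
    have := DirichletCharacter.summable_neg_log_one_sub_mul_prime_cpow
      (χ := (1 : DirichletCharacter ℂ 1)) h2
    simpa only [MulChar.one_apply (isUnit_of_subsingleton _), one_mul] using this
  have s2 := fun χ : DirichletCharacter ℂ q ↦
    DirichletCharacter.summable_neg_log_one_sub_mul_prime_cpow (χ := χ) h2
  have e3 : zetaProd X 2 = Complex.exp (∑' p : Nat.Primes, (-Complex.log (1 - (p : ℂ) ^ (-(2 : ℂ))) +
      ∑ χ ∈ X, -Complex.log (1 - χ p * (p : ℂ) ^ (-(2 : ℂ))))) := by
    rw [s1.tsum_add (summable_sum fun χ _ ↦ s2 χ), Complex.exp_add, e1,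
      Summable.tsum_finsetSum fun χ _ ↦ s2 χ, Complex.exp_sum, zetaProd]
    congr 1
    refine Finset.prod_congr rfl fun χ _ ↦ ?_
    rw [e2 χ, DirichletCharacter.LFunction_eq_LSeries χ h2]
  have h3 : 0 ≤ ∑' p : Nat.Primes, (-Complex.log (1 - (p : ℂ) ^ (-(2 : ℂ))) +
      ∑ χ ∈ X, -Complex.log (1 - χ p * (p : ℂ) ^ (-(2 : ℂ)))) := by
    refine tsum_nonneg fun p ↦ ?_
    have hp : (1 : ℝ) < (p : ℕ) := by exact_mod_cast p.2.one_lt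
    have hp0 : (0 : ℝ) < (p : ℕ) := by linarith
    have hn : ‖((p : ℕ) : ℂ) ^ (-(2 : ℂ))‖ < 1 := by
      rw [← ofReal_natCast, norm_cpow_eq_rpow_re_of_pos hp0]
      exact Real.rpow_lt_one_of_one_lt_of_neg hp (by simp)
    have hnn : 0 ≤ ((p : ℕ) : ℂ) ^ (-(2 : ℂ)) := by
      have : ((p : ℕ) : ℂ) ^ (-(2 : ℂ)) = (((p : ℕ) : ℝ) ^ (-(2 : ℝ)) : ℝ) := by
        rw [ofReal_cpow hp0.le]; simp
      rw [this]
      exact zero_le_real.2 (Real.rpow_nonneg hp0.le _)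
    have hnχ : ∀ χ : DirichletCharacter ℂ q, ‖χ p * ((p : ℕ) : ℂ) ^ (-(2 : ℂ))‖ < 1 := by
      intro χ
      rw [norm_mul]
      exact (mul_le_of_le_one_left (norm_nonneg _) (χ.norm_le_one _)).trans_lt hn
    have hs := (hasSum_taylorSeries_neg_log hn).add
      (hasSum_sum (s := X) fun χ _ ↦ hasSum_taylorSeries_neg_log (hnχ χ))
    refine hs.nonneg fun k ↦ ?_
    have : (((p : ℕ) : ℂ) ^ (-(2 : ℂ))) ^ k / k +
        ∑ χ ∈ X, (χ p * ((p : ℕ) : ℂ) ^ (-(2 : ℂ))) ^ k / k =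
        (1 + ∑ χ ∈ X, χ ((p : ℕ) ^ k : ℕ)) * ((((p : ℕ) : ℂ) ^ (-(2 : ℂ))) ^ k / k) := by
      rw [add_mul, one_mul, Finset.sum_mul]
      congr 1
      refine Finset.sum_congr rfl fun χ _ ↦ ?_
      rw [mul_pow, Nat.cast_pow, map_pow, mul_div_assoc]
    rw [this]
    refine mul_nonneg (hX _) (div_nonneg (pow_nonneg hnn _) (by exact_mod_cast Nat.zero_le k))
  rw [e3]
  obtain ⟨r, hr, hr'⟩ := RCLike.nonneg_iff_exists_ofReal.1 h3
  rw [← hr']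
  simp only [coe_algebraMap, ← ofReal_exp]
  exact_mod_cast Real.one_le_exp hr

lemma iteratedDeriv_zetaProd_alternating (hX : ∀ n : ℕ, 0 ≤ 1 + ∑ χ ∈ X, χ n) (n : ℕ) :
    0 ≤ (-1) ^ n * iteratedDeriv n (zetaProd X) 2 := by
  have hopen : IsOpen {z : ℂ | 1 < z.re} := isOpen_lt continuous_const continuous_re
  have hmem : {z : ℂ | 1 < z.re} ∈ 𝓝 (2 : ℂ) := hopen.mem_nhds (by simp)
  have hF : AnalyticAt ℂ (zetaProd X) 2 :=
    DifferentiableOn.analyticAt (s := {z : ℂ | 1 < z.re}) (fun z hz ↦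
      (differentiableAt_zetaProd fun h ↦ by simp [h] at hz).differentiableWithinAt) hmem
  have habs : LSeries.abscissaOfAbsConv (zetaProdCoeff X) < (2 : ℝ) :=
    (abscissaOfAbsConv_zetaProdCoeff_le X).trans_lt (by exact_mod_cast one_lt_two)
  have hL : AnalyticAt ℂ (LSeries (zetaProdCoeff X)) 2 :=
    LSeries_analyticOnNhd _ 2 (by simpa using habs)
  induction n using Nat.strong_induction_on with
  | _ n ih =>
    rcases n with _ | n
    · simpa using zero_le_one.trans (one_le_zetaProd_two hX)
    · have hev : deriv (zetaProd X) =ᶠ[𝓝 2] -(LSeries (zetaProdCoeff X) * zetaProd X) := by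
        filter_upwards [hmem] with s hs using deriv_zetaProd X hs
      rw [iteratedDeriv_succ', hev.iteratedDeriv_eq, iteratedDeriv_neg,
        iteratedDeriv_mul hL.contDiffAt hF.contDiffAt, pow_succ, mul_neg_one, neg_mul_neg,
        Finset.mul_sum]
      refine Finset.sum_nonneg fun i hi ↦ ?_
      have hi' : i ≤ n := by simpa [Nat.lt_succ_iff] using hi
      have h1 := LSeries.iteratedDeriv_alternating (zetaProdCoeff_nonneg hX) habs i
      have h2 := ih (n - i) (by lia)
      have : (-1 : ℂ) ^ n * (n.choose i * iteratedDeriv i (LSeries (zetaProdCoeff X)) 2 *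
          iteratedDeriv (n - i) (zetaProd X) 2) = n.choose i *
          (((-1) ^ i * iteratedDeriv i (LSeries (zetaProdCoeff X)) (2 : ℝ)) *
          ((-1) ^ (n - i) * iteratedDeriv (n - i) (zetaProd X) 2)) := by
        have e1 : (-1 : ℂ) ^ n = (-1) ^ i * (-1) ^ (n - i) := by rw [← pow_add]; congr 1; lia
        rw [e1]; push_cast; ring
      rw [this]
      exact mul_nonneg (by exact_mod_cast Nat.zero_le _) (mul_nonneg h1 h2)

end Positivity

end Vinogradov

namespace Vinogradov

open Complex MeasureTheory Set Asymptotics Topology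
open scoped ComplexOrder

/-! ### Estermann's inequality -/

section Estermann

variable {q : ℕ} [NeZero q] {X : Finset (DirichletCharacter ℂ q)}

/-- The entire function obtained by removing the pole of `zetaProd X` at `1`. -/
noncomputable def zetaProdReg (X : Finset (DirichletCharacter ℂ q)) : ℂ → ℂ :=
  dslope (fun s ↦ DirichletCharacter.LFunctionTrivChar₁ 1 s *
    ∏ χ ∈ X, DirichletCharacter.LFunction χ s) 1

lemma differentiable_zetaProdReg (hX : ∀ χ ∈ X, χ ≠ 1) : Differentiable ℂ (zetaProdReg X) := by
  rw [← differentiableOn_univ]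
  refine (differentiableOn_dslope univ_mem).2 (Differentiable.differentiableOn ?_)
  exact (DirichletCharacter.differentiable_LFunctionTrivChar₁ 1).mul
    (Differentiable.fun_finsetProd fun χ hχ ↦ DirichletCharacter.differentiable_LFunction (hX χ hχ))

lemma zetaProdReg_of_ne_one {s : ℂ} (hs : s ≠ 1) : zetaProdReg X s =
    zetaProd X s - (∏ χ ∈ X, DirichletCharacter.LFunction χ 1) * (s - 1)⁻¹ := by
  have hs' : s - 1 ≠ 0 := sub_ne_zero.2 hs
  rw [zetaProdReg, dslope_of_ne _ hs, slope_def_field]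
  simp only [DirichletCharacter.LFunctionTrivChar₁, Function.update_of_ne hs, Function.update_self,
    DirichletCharacter.LFunctionTrivChar, DirichletCharacter.LFunction_modOne_eq,
    Nat.primeFactors_one, Finset.prod_empty, one_mul, zetaProd]
  field_simp

lemma iteratedDeriv_sub_one_inv (n : ℕ) :
    iteratedDeriv n (fun s : ℂ ↦ (s - 1)⁻¹) 2 = (-1) ^ n * n.factorial := by
  have h := iteratedDeriv_comp_sub_const n (fun s : ℂ ↦ s⁻¹) 1
  have h1 := congrFun h 2
  rw [h1, iteratedDeriv_eq_iterate]
  have h2 : deriv^[n] (fun s : ℂ ↦ s⁻¹) = deriv^[n] Inv.inv := rfl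
  rw [h2, iter_deriv_inv]
  norm_num

lemma iteratedDeriv_zetaProdReg (n : ℕ) : iteratedDeriv n (zetaProdReg X) 2 =
    iteratedDeriv n (zetaProd X) 2 -
      (∏ χ ∈ X, DirichletCharacter.LFunction χ 1) * ((-1) ^ n * n.factorial) := by
  have hmem : {z : ℂ | z ≠ 1} ∈ 𝓝 (2 : ℂ) := isOpen_ne.mem_nhds (by simp)
  have hev : zetaProdReg X =ᶠ[𝓝 2] zetaProd X -
      fun s ↦ (∏ χ ∈ X, DirichletCharacter.LFunction χ 1) * (s - 1)⁻¹ := by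
    filter_upwards [hmem] with s hs using zetaProdReg_of_ne_one hs
  have hF : AnalyticAt ℂ (zetaProd X) 2 :=
    DifferentiableOn.analyticAt (s := {z : ℂ | z ≠ 1}) (fun z hz ↦
      (differentiableAt_zetaProd hz).differentiableWithinAt) hmem
  have hG : AnalyticAt ℂ (fun s : ℂ ↦ (∏ χ ∈ X, DirichletCharacter.LFunction χ 1) * (s - 1)⁻¹) 2 := by
    refine DifferentiableOn.analyticAt (s := {z : ℂ | z ≠ 1}) (fun z hz ↦ ?_) hmem
    have hd : DifferentiableAt ℂ (fun s : ℂ ↦ (s - 1)⁻¹) z := by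
      have hz' : z - 1 ≠ 0 := sub_ne_zero.2 hz
      fun_prop (disch := exact hz')
    exact (hd.const_mul _).differentiableWithinAt
  rw [hev.iteratedDeriv_eq, iteratedDeriv_sub hF.contDiffAt hG.contDiffAt,
    iteratedDeriv_const_mul_field, iteratedDeriv_sub_one_inv]

/-- Estermann's inequality: a lower bound for a product of values of `L`-functions at `1`. -/
lemma half_le_re_zetaProd_add (hX1 : ∀ χ ∈ X, χ ≠ 1) (hX : ∀ n : ℕ, 0 ≤ 1 + ∑ χ ∈ X, χ n)
    {B : ℝ} (hB : ∀ z ∈ Metric.sphere (2 : ℂ) (3 / 2), ‖zetaProdReg X z‖ ≤ B) {K : ℕ} (hK : 1 ≤ K)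
    (hBK : 4 * B * (3 / 4) ^ K ≤ 1 / 2) {σ : ℝ} (hσ : 7 / 8 ≤ σ) (hσ1 : σ < 1) :
    1 / 2 ≤ (zetaProd X σ).re +
      ‖∏ χ ∈ X, DirichletCharacter.LFunction χ 1‖ * ((2 - σ) ^ K / (1 - σ)) := by
  set l := ∏ χ ∈ X, DirichletCharacter.LFunction χ 1 with hl
  set H := zetaProdReg X
  have hH : Differentiable ℂ H := differentiable_zetaProdReg hX1
  set y : ℝ := 2 - σ with hy
  have hy1 : 1 < y := by linarith
  have hy2 : y ≤ 9 / 8 := by linarith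
  set c : ℕ → ℂ := fun n ↦ (n.factorial : ℂ)⁻¹ * ((-1) ^ n * iteratedDeriv n H 2) with hc
  have hsum : HasSum (fun n ↦ c n * (y : ℂ) ^ n) (H σ) := by
    refine (hasSum_taylorSeries_of_entire hH 2 σ).congr_fun ?_ |> fun h ↦ h
    intro n
    simp only [hc, hy, smul_eq_mul]
    have : ((σ : ℂ) - 2) ^ n = (-1) ^ n * ((2 - σ : ℝ) : ℂ) ^ n := by
      rw [← mul_pow]; congr 1; push_cast; ring
    rw [this]; ring
  have hre : HasSum (fun n ↦ (c n).re * y ^ n) (H σ).re := by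
    refine (hasSum_re hsum).congr_fun ?_ |> fun h ↦ h
    intro n
    rw [← ofReal_pow, re_mul_ofReal]
  have hcB : ∀ n, ‖c n‖ ≤ B / (3 / 2) ^ n := by
    intro n
    have h1 := norm_iteratedDeriv_le_of_forall_mem_sphere_norm_le n (by norm_num : (0 : ℝ) < 3 / 2)
      hH.diffContOnCl hB
    have hf : (0 : ℝ) < n.factorial := by exact_mod_cast n.factorial_pos
    simp only [hc, norm_mul, norm_pow, norm_neg, norm_one, one_pow, one_mul, norm_inv, norm_natCast]
    calc (n.factorial : ℝ)⁻¹ * ‖iteratedDeriv n H 2‖ ≤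
        (n.factorial : ℝ)⁻¹ * (n.factorial * B / (3 / 2) ^ n) := by gcongr
      _ = B / (3 / 2) ^ n := by field_simp
  have hB0 : 0 ≤ B := by simpa using (norm_nonneg _).trans (hcB 0)
  have hlow : ∀ n, (if n = 0 then 1 else 0) - ‖l‖ ≤ (c n).re := by
    intro n
    have hf : (n.factorial : ℂ) ≠ 0 := by exact_mod_cast n.factorial_ne_zero
    have e1 : c n = (n.factorial : ℂ)⁻¹ * ((-1) ^ n * iteratedDeriv n (zetaProd X) 2) - l := by
      simp only [hc, H]
      rw [iteratedDeriv_zetaProdReg, ← hl]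
      have : ((-1 : ℂ) ^ n) * (-1) ^ n = 1 := by rw [← mul_pow]; simp
      field_simp
      linear_combination (-(l * n.factorial)) * this
    have h1 : (if n = 0 then (1 : ℝ) else 0) ≤
        ((n.factorial : ℂ)⁻¹ * ((-1) ^ n * iteratedDeriv n (zetaProd X) 2)).re := by
      split_ifs with h
      · subst h
        simpa using (Complex.le_def.1 (one_le_zetaProd_two hX)).1
      · have := mul_nonneg (a := (n.factorial : ℂ)⁻¹) (by
          rw [← ofReal_natCast, ← ofReal_inv]; exact zero_le_real.2 (by positivity))
          (iteratedDeriv_zetaProd_alternating hX n)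
        simpa using (Complex.le_def.1 this).1
    rw [e1, sub_re]
    linarith [re_le_norm l]
  have hsplit := hre.summable.sum_add_tsum_nat_add K
  rw [hre.tsum_eq] at hsplit
  have hfin : 1 - ‖l‖ * ((y ^ K - 1) / (y - 1)) ≤ ∑ n ∈ Finset.range K, (c n).re * y ^ n := by
    rw [← geom_sum_eq hy1.ne', Finset.mul_sum]
    have : (1 : ℝ) = ∑ n ∈ Finset.range K, if n = 0 then 1 else 0 := by
      rw [Finset.sum_ite_eq' (Finset.range K) 0]; simp; lia
    conv_lhs => rw [this]
    rw [← Finset.sum_sub_distrib]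
    refine Finset.sum_le_sum fun n _ ↦ ?_
    refine le_trans (le_of_eq ?_) (mul_le_mul_of_nonneg_right (hlow n) (by positivity))
    split_ifs with h
    · simp [h]
    · ring
  have htail : -(4 * B * (3 / 4) ^ K) ≤ ∑' n, (c (n + K)).re * y ^ (n + K) := by
    have hg : HasSum (fun n : ℕ ↦ -(B * (3 / 4) ^ K) * (3 / 4 : ℝ) ^ n)
        (-(B * (3 / 4) ^ K) * (1 - 3 / 4)⁻¹) :=
      (hasSum_geometric_of_lt_one (by norm_num) (by norm_num)).mul_left _
    have e2 : -(4 * B * (3 / 4) ^ K) = -(B * (3 / 4) ^ K) * (1 - 3 / 4)⁻¹ := by ring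
    rw [e2]
    refine hasSum_le (fun n ↦ ?_) hg ((summable_nat_add_iff K).2 hre.summable).hasSum
    have h1 : |(c (n + K)).re| ≤ B / (3 / 2) ^ (n + K) := (abs_re_le_norm _).trans (hcB _)
    have h2 := (abs_le.1 h1).1
    calc -(B * (3 / 4) ^ K) * (3 / 4 : ℝ) ^ n = -(B / (3 / 2) ^ (n + K)) * (9 / 8) ^ (n + K) := by
          have h3 : (3 / 4 : ℝ) ^ (n + K) = (9 / 8) ^ (n + K) / (3 / 2) ^ (n + K) := by
            rw [← div_pow]; norm_num
          calc _ = -B * (3 / 4) ^ (n + K) := by ring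
            _ = _ := by rw [h3]; ring
      _ ≤ -(B / (3 / 2) ^ (n + K)) * y ^ (n + K) := by
          rw [neg_mul, neg_mul, neg_le_neg_iff]
          gcongr
      _ ≤ _ := by gcongr
  have hs1 : (σ : ℂ) ≠ 1 := by exact_mod_cast hσ1.ne
  have hFH : (zetaProd X σ).re = (H σ).re + (l * ((σ : ℂ) - 1)⁻¹).re := by
    have := zetaProdReg_of_ne_one (X := X) hs1
    rw [← add_re]; congr 1
    simp only [H]; rw [this]; ring
  have hpole : -(‖l‖ / (1 - σ)) ≤ (l * ((σ : ℂ) - 1)⁻¹).re := by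
    have h1 : ‖l * ((σ : ℂ) - 1)⁻¹‖ = ‖l‖ / (1 - σ) := by
      rw [norm_mul, norm_inv, ← ofReal_one, ← ofReal_sub, norm_real, Real.norm_eq_abs,
        abs_of_neg (by linarith), neg_sub, div_eq_mul_inv]
    rw [← h1]
    exact (abs_le.1 (abs_re_le_norm _)).1
  have e3 : ‖l‖ * ((y ^ K - 1) / (y - 1)) + ‖l‖ / (1 - σ) = ‖l‖ * (y ^ K / (1 - σ)) := by
    have : y - 1 = 1 - σ := by rw [hy]; ring
    rw [this]; field_simp [show (1 - σ) ≠ 0 by linarith]; ring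
  rw [hFH]
  linarith

lemma exists_half_le_re_zetaProd_add : ∃ C : ℝ, 0 < C ∧
    ∀ (q : ℕ) [NeZero q] (X : Finset (DirichletCharacter ℂ q)), X.card ≤ 3 → (∀ χ ∈ X, χ ≠ 1) →
      (∀ n : ℕ, 0 ≤ 1 + ∑ χ ∈ X, χ n) → ∀ σ : ℝ, 7 / 8 ≤ σ → σ < 1 →
      1 / 2 ≤ (zetaProd X σ).re + C * (q : ℝ) ^ (12 * (1 - σ)) / (1 - σ) *
        ‖∏ χ ∈ X, DirichletCharacter.LFunction χ 1‖ := by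
  obtain ⟨C₁, hC₁, h₁⟩ := exists_norm_riemannZeta_le (η := 1 / 2) (by norm_num) le_rfl
  obtain ⟨C₂, hC₂, h₂⟩ := exists_norm_LFunction_le (η := 1 / 2) (by norm_num) le_rfl
  set C₃ : ℝ := 1 + (C₁ * 4 * 3 + 2) * (1 + C₂ * 4) ^ 3 with hC₃
  have hC₃1 : 1 ≤ C₃ := by rw [hC₃]; linarith [show 0 ≤ (C₁ * 4 * 3 + 2) * (1 + C₂ * 4) ^ 3 by positivity]
  refine ⟨Real.exp 1 * (8 * C₃), by positivity, fun q _ X hcard hX1 hX σ hσ hσ1 ↦ ?_⟩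
  have hq1 : (1 : ℝ) ≤ q := by exact_mod_cast NeZero.one_le
  have hprod : ∀ s : ℂ, 1 / 2 ≤ s.re → s.re ≤ 4 → |s.im| ≤ 2 →
      ‖∏ χ ∈ X, DirichletCharacter.LFunction χ s‖ ≤ (1 + C₂ * 4) ^ 3 * (q : ℝ) ^ 3 := by
    intro s hs hs' him
    have h3 : ∀ χ ∈ X, ‖DirichletCharacter.LFunction χ s‖ ≤ (1 + C₂ * 4) * q := by
      intro χ hχ
      have h4 := h₂ q χ (hX1 χ hχ) s (by linarith) hs'
      rw [show (2 * (1 / 2) : ℝ) = 1 by norm_num, Real.rpow_one] at h4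
      refine h4.trans ?_
      have : (q : ℝ) * (|s.im| + 2) ≤ q * 4 := by gcongr; linarith
      nlinarith
    rw [norm_prod, ← mul_pow]
    refine (Finset.prod_le_prod (fun _ _ ↦ norm_nonneg _) h3).trans ?_
    rw [Finset.prod_const]
    exact pow_le_pow_right₀ (by nlinarith) hcard
  set B : ℝ := C₃ * (q : ℝ) ^ 3 with hBdef
  have hB : ∀ z ∈ Metric.sphere (2 : ℂ) (3 / 2), ‖zetaProdReg X z‖ ≤ B := by
    intro z hz
    rw [mem_sphere_iff_norm] at hz
    have hre := abs_le.1 ((abs_re_le_norm (z - 2)).trans hz.le)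
    have him := (abs_im_le_norm (z - 2)).trans hz.le
    simp only [sub_re, re_ofNat, sub_im, im_ofNat, sub_zero] at hre him
    have hz1 : 1 / 2 ≤ ‖z - 1‖ := by
      have := norm_sub_le (z - 1) (1 : ℂ)
      rw [show z - 1 - 1 = z - 2 by ring, hz, norm_one] at this
      linarith
    have hne : z ≠ 1 := fun h ↦ by simp [h] at hz1; linarith
    have h5 := hprod z (by linarith) (by linarith) (by linarith)
    have h6 := hprod 1 (by simp; norm_num) (by simp) (by simp)
    have h7 := h₁ z hne (by linarith) (by linarith)
    rw [show (2 * (1 / 2) : ℝ) = 1 by norm_num, Real.rpow_one] at h7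
    have h8 : 1 / ‖z - 1‖ ≤ 2 := by
      rw [div_le_iff₀ (by linarith)]; linarith
    have h9 : ‖riemannZeta z‖ ≤ C₁ * 4 * 3 := by
      refine h7.trans ?_
      gcongr <;> linarith
    rw [zetaProdReg_of_ne_one hne, zetaProd]
    refine (norm_sub_le _ _).trans ?_
    rw [norm_mul, norm_mul, norm_inv, ← one_div]
    calc _ ≤ C₁ * 4 * 3 * ((1 + C₂ * 4) ^ 3 * (q : ℝ) ^ 3) +
          ((1 + C₂ * 4) ^ 3 * (q : ℝ) ^ 3) * 2 := by gcongr
      _ = ((C₁ * 4 * 3 + 2) * (1 + C₂ * 4) ^ 3) * (q : ℝ) ^ 3 := by ring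
      _ ≤ B := by rw [hBdef, hC₃]; gcongr; linarith
  set M : ℝ := 8 * B with hM
  have hM8 : 8 ≤ M := by
    have : 1 ≤ (q : ℝ) ^ 3 := one_le_pow₀ hq1
    rw [hM, hBdef]; nlinarith
  have hlM : 0 < Real.log M := Real.log_pos (by linarith)
  have hl43 : 1 / 4 ≤ Real.log (4 / 3) := by
    have := Real.one_sub_inv_le_log_of_pos (show (0 : ℝ) < 4 / 3 by norm_num)
    linarith [show (1 : ℝ) - (4 / 3)⁻¹ = 1 / 4 by norm_num]
  set K : ℕ := ⌈4 * Real.log M⌉₊ with hK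
  have hK1 : 1 ≤ K := Nat.one_le_ceil_iff.2 (by positivity)
  have hKl : 4 * Real.log M ≤ K := Nat.le_ceil _
  have hKu : (K : ℝ) ≤ 4 * Real.log M + 1 := (Nat.ceil_lt_add_one (by positivity)).le
  have hBK : 4 * B * (3 / 4) ^ K ≤ 1 / 2 := by
    have h10 : M ≤ (4 / 3 : ℝ) ^ K := by
      rw [← Real.log_le_log_iff (by linarith) (by positivity), Real.log_pow]
      nlinarith
    have h11 : (3 / 4 : ℝ) ^ K * (4 / 3) ^ K = 1 := by rw [← mul_pow]; norm_num
    have h12 : (0 : ℝ) < (3 / 4) ^ K := by positivity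
    nlinarith
  have key := half_le_re_zetaProd_add hX1 hX hB hK1 hBK hσ hσ1
  refine key.trans ?_
  have hpow : (2 - σ) ^ K ≤ Real.exp 1 * (8 * C₃) * (q : ℝ) ^ (12 * (1 - σ)) := by
    calc (2 - σ) ^ K ≤ Real.exp (1 - σ) ^ K := by
          gcongr
          · linarith
          · linarith [Real.add_one_le_exp (1 - σ)]
      _ = Real.exp ((1 - σ) * K) := by rw [← Real.exp_nat_mul, mul_comm]
      _ ≤ Real.exp (1 + (4 * (1 - σ)) * Real.log M) := by
          apply Real.exp_le_exp.2
          nlinarith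
      _ = Real.exp 1 * M ^ (4 * (1 - σ)) := by
          rw [Real.exp_add, Real.rpow_def_of_pos (by linarith), mul_comm (Real.log M)]
      _ = Real.exp 1 * ((8 * C₃) ^ (4 * (1 - σ)) * (q : ℝ) ^ (12 * (1 - σ))) := by
          rw [hM, hBdef, ← mul_assoc, Real.mul_rpow (by positivity) (by positivity),
            ← Real.rpow_natCast, ← Real.rpow_mul (by positivity)]
          congr 3
          push_cast; ring
      _ ≤ Real.exp 1 * ((8 * C₃) ^ (1 : ℝ) * (q : ℝ) ^ (12 * (1 - σ))) := by
          gcongr <;> linarith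
      _ = Real.exp 1 * (8 * C₃) * (q : ℝ) ^ (12 * (1 - σ)) := by rw [Real.rpow_one]; ring
  rw [mul_comm ‖_‖]
  have := div_le_div_of_nonneg_right hpow (sub_nonneg.2 hσ1.le)
  exact add_le_add_right (mul_le_mul_of_nonneg_right this (norm_nonneg _)) _

end Estermann

end Vinogradov

namespace Vinogradov

open Complex MeasureTheory Set Asymptotics Topology
open scoped ComplexOrder

/-! ### Siegel's theorem -/

section Siegel

variable {q : ℕ} {χ : DirichletCharacter ℂ q}

lemma char_eq_of_sq_eq_one (hχ : χ ^ 2 = 1) (a : ZMod q) : χ a = 0 ∨ χ a = 1 ∨ χ a = -1 :=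
  MulChar.isQuadratic_iff_sq_eq_one.2 hχ a

lemma one_add_char_nonneg (hχ : χ ^ 2 = 1) (a : ZMod q) : 0 ≤ 1 + χ a := by
  rcases char_eq_of_sq_eq_one hχ a with h | h | h <;> rw [h]
  · simp
  · exact add_nonneg zero_le_one zero_le_one
  · simp

variable [NeZero q]

lemma im_LFunction_eq_zero (hχ1 : χ ≠ 1) (hχ : χ ^ 2 = 1) {σ : ℝ} (hσ : 0 < σ) :
    (DirichletCharacter.LFunction χ σ).im = 0 := by
  have h1 : ∀ N : ℕ, 1 ≤ N → |(DirichletCharacter.LFunction χ σ).im| ≤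
      σ * (q * ((N : ℝ) ^ (-σ) / σ)) := by
    intro N hN
    have h := norm_LFunction_sub_sum_le hχ1 hN (s := σ) (by simpa using hσ)
    have h2 : (∑ n ∈ Finset.Icc 1 N, χ n * (n : ℂ) ^ (-(σ : ℂ))).im = 0 := by
      rw [im_sum]
      refine Finset.sum_eq_zero fun n _ ↦ ?_
      have h3 : (n : ℂ) ^ (-(σ : ℂ)) = (((n : ℝ) ^ (-σ) : ℝ) : ℂ) := by
        rw [ofReal_cpow (Nat.cast_nonneg n)]; simp
      rw [h3]
      rcases char_eq_of_sq_eq_one hχ n with h | h | h <;> rw [h] <;> simp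
    have h4 := (abs_im_le_norm _).trans h
    rw [sub_im, h2, sub_zero, norm_real, Real.norm_eq_abs, abs_of_pos hσ, ofReal_re] at h4
    exact h4
  have h5 : Tendsto (fun N : ℕ ↦ σ * (q * ((N : ℝ) ^ (-σ) / σ))) atTop (𝓝 (σ * (q * (0 / σ)))) :=
    ((((tendsto_rpow_neg_atTop hσ).comp tendsto_natCast_atTop_atTop).div_const σ).const_mul
      _).const_mul _
  have h6 := ge_of_tendsto h5 (eventually_atTop.2 ⟨1, h1⟩)
  rw [zero_div, mul_zero, mul_zero] at h6
  exact abs_eq_zero.1 (le_antisymm h6 (abs_nonneg _))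

lemma re_LFunction_pos (hχ1 : χ ≠ 1) (hχ : χ ^ 2 = 1) {σ₀ : ℝ} (hσ₀ : 0 < σ₀) (hσ₀1 : σ₀ < 1)
    (h0 : ∀ σ : ℝ, σ₀ ≤ σ → σ < 1 → DirichletCharacter.LFunction χ σ ≠ 0) :
    0 < (DirichletCharacter.LFunction χ σ₀).re := by
  have hne : ∀ σ : ℝ, σ₀ ≤ σ → (DirichletCharacter.LFunction χ σ).re ≠ 0 := by
    intro σ hσ h
    have h1 : DirichletCharacter.LFunction χ σ = 0 :=
      Complex.ext h (im_LFunction_eq_zero hχ1 hχ (hσ₀.trans_le hσ))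
    rcases lt_or_ge σ 1 with h2 | h2
    · exact h0 σ hσ h2 h1
    · exact DirichletCharacter.LFunction_ne_zero_of_one_le_re χ (Or.inl hχ1) (s := σ)
        (by simpa using h2) h1
  have hcont : Continuous fun σ : ℝ ↦ (DirichletCharacter.LFunction χ σ).re :=
    continuous_re.comp ((DirichletCharacter.differentiable_LFunction hχ1).continuous.comp
      continuous_ofReal)
  have h2 : 0 < (DirichletCharacter.LFunction χ (2 : ℝ)).re := by
    have h := one_le_zetaProd_two (X := {χ}) (fun n ↦ by simpa using one_add_char_nonneg hχ n)
    simp only [zetaProd, Finset.prod_singleton] at h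
    have him := im_LFunction_eq_zero hχ1 hχ (show (0 : ℝ) < 2 by norm_num)
    have hz : 0 < (riemannZeta 2).re ∧ (riemannZeta 2).im = 0 := by
      rw [riemannZeta_two]
      have : ((Real.pi : ℂ) ^ 2 / 6) = ((Real.pi ^ 2 / 6 : ℝ) : ℂ) := by push_cast; ring
      rw [this]
      exact ⟨by simp only [ofReal_re]; positivity, ofReal_im _⟩
    have h3 := (Complex.le_def.1 h).1
    rw [mul_re, hz.2, zero_mul, sub_zero, one_re] at h3
    rw [ofReal_ofNat]
    by_contra! h4
    nlinarith [hz.1]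
  by_contra! h3
  obtain ⟨σ, hσ, hσ'⟩ := intermediate_value_Icc (show σ₀ ≤ 2 by linarith) hcont.continuousOn
    ⟨h3, h2.le⟩
  exact hne σ hσ.1 hσ'

lemma re_riemannZeta_nonpos {σ : ℝ} (hσ : 1 / 2 ≤ σ) (hσ1 : σ < 1) : (riemannZeta σ).re ≤ 0 := by
  have hne : (σ : ℂ) ≠ 1 := by exact_mod_cast hσ1.ne
  have h := norm_riemannZeta_sub_sum_le (N := 1) le_rfl (s := σ) (by simp; linarith) hne
  have h1 := (le_abs_self _).trans ((abs_re_le_norm _).trans h)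
  have h2 : (1 / ((σ : ℂ) - 1)).re = 1 / (σ - 1) := by
    rw [← ofReal_one, ← ofReal_sub, ← ofReal_div, ofReal_re]
  have h3 : 1 / (σ - 1) ≤ -2 := by
    rw [div_le_iff_of_neg (by linarith)]; linarith
  simp only [Finset.Icc_self, Finset.sum_singleton, Nat.cast_one, one_cpow, sub_re, one_re, h2,
    norm_real, Real.norm_eq_abs, abs_of_pos (show 0 < σ by linarith), Real.one_rpow, ofReal_re] at h1
  rw [mul_one_div_cancel (by linarith)] at h1
  linarith

lemma prod_one_add_inv_le {n : ℕ} (hn : n ≠ 0) :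
    ∏ p ∈ n.primeFactors, (1 + (p : ℝ)⁻¹) ≤ 2 * Real.log n + 1 := by
  have h := one_div_le_prod_one_sub_inv hn
  have hlog : 0 < 2 * Real.log n + 1 := by
    have := Real.log_natCast_nonneg n; linarith
  have hp : (∏ p ∈ n.primeFactors, (1 + (p : ℝ)⁻¹)) * ∏ p ∈ n.primeFactors, (1 - (p : ℝ)⁻¹) ≤ 1 := by
    rw [← Finset.prod_mul_distrib]
    refine Finset.prod_le_one (fun p hp ↦ ?_) fun p hp ↦ ?_ <;>
    · have h2 : (2 : ℝ) ≤ p := by exact_mod_cast (Nat.prime_of_mem_primeFactors hp).two_le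
      have h3 : (p : ℝ)⁻¹ ≤ 1 := inv_le_one_of_one_le₀ (by linarith)
      have h4 : 0 ≤ (p : ℝ)⁻¹ := by positivity
      nlinarith
  have h5 : 0 < ∏ p ∈ n.primeFactors, (1 - (p : ℝ)⁻¹) := lt_of_lt_of_le (by positivity) h
  rw [div_le_iff₀ hlog] at h
  nlinarith

lemma norm_LFunction_changeLevel_le {m : ℕ} [NeZero m] (hm : q ∣ m) (hχ : χ ≠ 1) :
    ‖DirichletCharacter.LFunction (DirichletCharacter.changeLevel hm χ) 1‖ ≤
      (2 * Real.log m + 1) * ‖DirichletCharacter.LFunction χ 1‖ ∧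
    ‖DirichletCharacter.LFunction χ 1‖ ≤ (2 * Real.log m + 1) *
      ‖DirichletCharacter.LFunction (DirichletCharacter.changeLevel hm χ) 1‖ := by
  have hlog : 0 < 2 * Real.log m + 1 := by
    have := Real.log_natCast_nonneg m; linarith
  rw [DirichletCharacter.LFunction_changeLevel hm χ (Or.inl hχ), norm_mul, norm_prod]
  have hb : ∀ p : ℕ, ‖χ p * (p : ℂ) ^ (-(1 : ℂ))‖ ≤ (p : ℝ)⁻¹ := by
    intro p
    rw [norm_mul, cpow_neg_one, norm_inv, norm_natCast]
    exact mul_le_of_le_one_left (by positivity) (χ.norm_le_one _)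
  have hu : ∏ p ∈ m.primeFactors, ‖1 - χ p * (p : ℂ) ^ (-(1 : ℂ))‖ ≤ 2 * Real.log m + 1 := by
    refine le_trans (Finset.prod_le_prod (fun _ _ ↦ norm_nonneg _) fun p _ ↦ ?_)
      (prod_one_add_inv_le (NeZero.ne m))
    refine (norm_sub_le _ _).trans ?_
    rw [norm_one]
    linarith [hb p]
  have hl : 1 / (2 * Real.log m + 1) ≤ ∏ p ∈ m.primeFactors, ‖1 - χ p * (p : ℂ) ^ (-(1 : ℂ))‖ := by
    refine (one_div_le_prod_one_sub_inv (NeZero.ne m)).trans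
      (Finset.prod_le_prod (fun p hp ↦ ?_) fun p _ ↦ ?_)
    · have h2 : (2 : ℝ) ≤ p := by exact_mod_cast (Nat.prime_of_mem_primeFactors hp).two_le
      have h3 : (p : ℝ)⁻¹ ≤ 1 := inv_le_one_of_one_le₀ (by linarith)
      linarith
    · have := norm_sub_norm_le (1 : ℂ) (χ p * (p : ℂ) ^ (-(1 : ℂ)))
      rw [norm_one] at this
      linarith [hb p]
  refine ⟨?_, ?_⟩
  · rw [mul_comm]; gcongr
  · rw [div_le_iff₀ hlog] at hl
    nlinarith [norm_nonneg (DirichletCharacter.LFunction χ 1)]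

lemma two_mul_log_add_one_le {κ : ℝ} (hκ : 0 < κ) {x : ℝ} (hx : 1 ≤ x) :
    2 * Real.log x + 1 ≤ (2 / κ + 1) * x ^ κ := by
  have h1 := Real.log_le_rpow_div (by linarith : 0 ≤ x) hκ
  have h2 := Real.one_le_rpow hx hκ.le
  calc _ ≤ 2 * (x ^ κ / κ) + x ^ κ := by linarith
    _ = _ := by ring

lemma exists_siegel_of_no_zero {ε : ℝ} (hε : 0 < ε) (hε' : ε ≤ 1 / 8)
    (h0 : ∀ (q : ℕ) [NeZero q] (χ : DirichletCharacter ℂ q), χ ≠ 1 → χ ^ 2 = 1 →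
      ∀ σ : ℝ, 1 - ε ≤ σ → σ < 1 → DirichletCharacter.LFunction χ σ ≠ 0) :
    ∃ c : ℝ, 0 < c ∧ ∀ (q : ℕ) [NeZero q] (χ : DirichletCharacter ℂ q), χ ≠ 1 → χ ^ 2 = 1 →
      c * (q : ℝ) ^ (-(12 * ε)) ≤ ‖DirichletCharacter.LFunction χ 1‖ := by
  obtain ⟨C, hC, h⟩ := exists_half_le_re_zetaProd_add
  refine ⟨ε / (2 * C), by positivity, fun q _ χ hχ1 hχ ↦ ?_⟩
  have h1 := h q {χ} (by simp) (by simpa using hχ1)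
    (fun n ↦ by simpa using one_add_char_nonneg hχ n) (1 - ε) (by linarith) (by linarith)
  rw [Finset.prod_singleton, zetaProd, Finset.prod_singleton, mul_re,
    im_LFunction_eq_zero hχ1 hχ (by linarith), mul_zero, sub_zero] at h1
  have h2 := re_LFunction_pos hχ1 hχ (by linarith) (by linarith) (h0 q χ hχ1 hχ)
  have h3 := re_riemannZeta_nonpos (σ := 1 - ε) (by linarith) (by linarith)
  have hq : (0 : ℝ) < q := by exact_mod_cast NeZero.pos q
  rw [Real.rpow_neg hq.le]
  have h4 : (0 : ℝ) < (q : ℝ) ^ (12 * ε) := by positivity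
  rw [sub_sub_cancel] at h1
  have h5 : 1 / 2 ≤ C * (q : ℝ) ^ (12 * ε) / ε * ‖DirichletCharacter.LFunction χ 1‖ := by
    nlinarith
  rw [div_mul_eq_mul_div, le_div_iff₀ hε] at h5
  rw [← div_eq_mul_inv, div_div, div_le_iff₀ (by positivity)]
  linarith

lemma exists_siegel_of_zero {ε : ℝ} (hε : 0 < ε) (hε' : ε ≤ 1 / 8) {q₁ : ℕ} [NeZero q₁]
    {χ₁ : DirichletCharacter ℂ q₁} (hχ₁ : χ₁ ≠ 1) (hχ₁' : χ₁ ^ 2 = 1) {β : ℝ} (hβ : 1 - ε ≤ β)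
    (hβ1 : β < 1) (h0 : DirichletCharacter.LFunction χ₁ β = 0) :
    ∃ c : ℝ, 0 < c ∧ ∀ (q : ℕ) [NeZero q] (χ : DirichletCharacter ℂ q), χ ≠ 1 → χ ^ 2 = 1 →
      c * (q : ℝ) ^ (-(18 * ε)) ≤ ‖DirichletCharacter.LFunction χ 1‖ := by
  classical
  obtain ⟨C, hC, h⟩ := exists_half_le_re_zetaProd_add
  obtain ⟨D, hD, hL⟩ := exists_norm_LFunction_le (η := ε) hε (by linarith)
  set E : ℝ := 2 / ε + 1 with hE
  have hE1 : 1 ≤ E := by rw [hE]; linarith [show 0 < 2 / ε by positivity]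
  set l₁ := ‖DirichletCharacter.LFunction χ₁ 1‖ with hl₁
  have hl₁0 : 0 < l₁ := norm_pos_iff.2
    (DirichletCharacter.LFunction_apply_one_ne_zero hχ₁)
  set c₁ : ℝ := l₁ / E ^ 2 with hc₁
  set c₂ : ℝ := (1 - β) / (2 * C * (D * 2 ^ (2 * ε)) ^ 2 * E) with hc₂
  have hb : 0 < 1 - β := by linarith
  have hq₁ : (1 : ℝ) ≤ q₁ := by exact_mod_cast NeZero.one_le
  refine ⟨min c₁ c₂ * (q₁ : ℝ) ^ (-(18 * ε)), by positivity, fun q _ χ hχ hχ' ↦ ?_⟩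
  have hq : (1 : ℝ) ≤ q := by exact_mod_cast NeZero.one_le
  have hm : ((q₁ * q : ℕ) : ℝ) = q₁ * q := by push_cast; ring
  set m : ℝ := ((q₁ * q : ℕ) : ℝ) with hmdef
  have hm1 : 1 ≤ m := by rw [hm]; nlinarith
  have hm0 : 0 < m := by linarith
  rw [mul_assoc, ← Real.mul_rpow (by linarith) (by linarith), ← hm]
  set ψ₁ := DirichletCharacter.changeLevel (Dvd.intro q rfl : q₁ ∣ q₁ * q) χ₁ with hψ₁
  set ψ := DirichletCharacter.changeLevel (Dvd.intro_left q₁ rfl : q ∣ q₁ * q) χ with hψ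
  have hψ1 : ψ ≠ 1 := (DirichletCharacter.changeLevel_eq_one_iff _).not.2 hχ
  have hψ₁1 : ψ₁ ≠ 1 := (DirichletCharacter.changeLevel_eq_one_iff _).not.2 hχ₁
  have hψ2 : ψ ^ 2 = 1 := by rw [hψ, ← map_pow, hχ', map_one]
  have hψ₁2 : ψ₁ ^ 2 = 1 := by rw [hψ₁, ← map_pow, hχ₁', map_one]
  have hlog := two_mul_log_add_one_le hε hm1
  have n1 := (norm_LFunction_changeLevel_le (Dvd.intro_left q₁ rfl : q ∣ q₁ * q) hχ).1
  have n2 := (norm_LFunction_changeLevel_le (Dvd.intro q rfl : q₁ ∣ q₁ * q) hχ₁).2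
  rw [← hψ, ← hmdef] at n1
  rw [← hψ₁, ← hmdef] at n2
  set l := ‖DirichletCharacter.LFunction χ 1‖ with hl
  have hl0 : 0 ≤ l := norm_nonneg _
  have n1' : ‖DirichletCharacter.LFunction ψ 1‖ ≤ E * m ^ ε * l :=
    n1.trans (mul_le_mul_of_nonneg_right hlog hl0)
  have n2' : l₁ ≤ E * m ^ ε * ‖DirichletCharacter.LFunction ψ₁ 1‖ :=
    n2.trans (mul_le_mul_of_nonneg_right hlog (norm_nonneg _))
  have hpow : ∀ a : ℝ, 0 < m ^ a := fun a ↦ by positivity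
  have key : ∀ c : ℝ, 0 ≤ c → c ≤ m ^ (18 * ε) * l → c * m ^ (-(18 * ε)) ≤ l := by
    intro c _ hc
    rw [Real.rpow_neg hm0.le, ← div_eq_mul_inv, div_le_iff₀ (hpow _)]
    linarith
  by_cases heq : ψ₁ = ψ
  · refine le_trans (mul_le_mul_of_nonneg_right (min_le_left c₁ c₂) (hpow _).le) ?_
    refine key _ (by positivity) ?_
    rw [hc₁, div_le_iff₀ (by positivity)]
    have h3 : m ^ ε * m ^ ε ≤ m ^ (18 * ε) := by
      rw [← Real.rpow_add hm0]
      exact Real.rpow_le_rpow_of_exponent_le hm1 (by linarith)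
    rw [heq] at n2'
    calc l₁ ≤ E * m ^ ε * (E * m ^ ε * l) := n2'.trans (by gcongr)
      _ = E ^ 2 * l * (m ^ ε * m ^ ε) := by ring
      _ ≤ E ^ 2 * l * m ^ (18 * ε) := by gcongr
      _ = _ := by ring
  · refine le_trans (mul_le_mul_of_nonneg_right (min_le_right c₁ c₂) (hpow _).le) ?_
    refine key _ (by positivity) ?_
    have hψψ : ψ₁ * ψ ≠ 1 := by
      intro h3
      apply heq
      calc ψ₁ = ψ₁ * ψ * ψ := by rw [mul_assoc, ← sq, hψ2, mul_one]
        _ = ψ := by rw [h3, one_mul]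
    have hn1 : ψ₁ ∉ ({ψ, ψ₁ * ψ} : Finset (DirichletCharacter ℂ (q₁ * q))) := by
      simp only [Finset.mem_insert, Finset.mem_singleton, not_or]
      exact ⟨heq, fun h3 ↦ hψ1 (by simpa using h3)⟩
    have hn2 : ψ ∉ ({ψ₁ * ψ} : Finset (DirichletCharacter ℂ (q₁ * q))) := by
      simp only [Finset.mem_singleton]
      exact fun h3 ↦ hψ₁1 (by simpa using h3)
    have h4 := h (q₁ * q) {ψ₁, ψ, ψ₁ * ψ} Finset.card_le_three (by
        intro ξ hξ
        simp only [Finset.mem_insert, Finset.mem_singleton] at hξ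
        rcases hξ with rfl | rfl | rfl <;> assumption) (by
        intro n
        rw [Finset.sum_insert hn1, Finset.sum_insert hn2, Finset.sum_singleton, MulChar.mul_apply,
          show 1 + (ψ₁ n + (ψ n + ψ₁ n * ψ n)) = (1 + ψ₁ n) * (1 + ψ n) by ring]
        exact mul_nonneg (one_add_char_nonneg hψ₁2 _) (one_add_char_nonneg hψ2 _))
        β (by linarith) hβ1
    have h5 : zetaProd {ψ₁, ψ, ψ₁ * ψ} (β : ℂ) = 0 := by
      rw [zetaProd, Finset.prod_insert hn1, hψ₁,
        DirichletCharacter.LFunction_changeLevel _ _ (Or.inl hχ₁), h0]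
      simp
    rw [h5, zero_re, zero_add, Finset.prod_insert hn1, Finset.prod_insert hn2,
      Finset.prod_singleton, norm_mul, norm_mul, ← hmdef] at h4
    have h6 : ∀ ξ : DirichletCharacter ℂ (q₁ * q), ξ ≠ 1 →
        ‖DirichletCharacter.LFunction ξ 1‖ ≤ D * 2 ^ (2 * ε) * m ^ (2 * ε) := by
      intro ξ hξ
      have := hL (q₁ * q) ξ hξ 1 (by simp; linarith) (by simp)
      rwa [one_im, abs_zero, zero_add, ← hmdef, Real.mul_rpow hm0.le (by norm_num),
        mul_comm (m ^ (2 * ε)), ← mul_assoc] at this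
    have h7 := h6 _ hψ₁1
    have h8 := h6 _ hψψ
    have h9 : m ^ (12 * (1 - β)) ≤ m ^ (12 * ε) :=
      Real.rpow_le_rpow_of_exponent_le hm1 (by linarith)
    have h10 : m ^ (12 * ε) * (m ^ (2 * ε) * (m ^ ε * m ^ (2 * ε))) ≤ m ^ (18 * ε) := by
      rw [← Real.rpow_add hm0, ← Real.rpow_add hm0, ← Real.rpow_add hm0]
      exact Real.rpow_le_rpow_of_exponent_le hm1 (by linarith)
    have h11 : 1 / 2 ≤ C * m ^ (12 * ε) / (1 - β) * (D * 2 ^ (2 * ε) * m ^ (2 * ε) *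
        (E * m ^ ε * l * (D * 2 ^ (2 * ε) * m ^ (2 * ε)))) := by
      refine h4.trans ?_
      gcongr
    have h12 : C * m ^ (12 * ε) / (1 - β) * (D * 2 ^ (2 * ε) * m ^ (2 * ε) *
        (E * m ^ ε * l * (D * 2 ^ (2 * ε) * m ^ (2 * ε)))) =
        C * (D * 2 ^ (2 * ε)) ^ 2 * E * l / (1 - β) *
          (m ^ (12 * ε) * (m ^ (2 * ε) * (m ^ ε * m ^ (2 * ε)))) := by ring
    have h13 : 1 / 2 ≤ C * (D * 2 ^ (2 * ε)) ^ 2 * E * l / (1 - β) * m ^ (18 * ε) := by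
      rw [h12] at h11
      refine h11.trans ?_
      gcongr
    rw [div_mul_eq_mul_div, le_div_iff₀ hb] at h13
    rw [hc₂, div_le_iff₀ (by positivity)]
    linarith

/-- Siegel's theorem. -/
theorem exists_le_norm_LFunction_one {ε : ℝ} (hε : 0 < ε) :
    ∃ c : ℝ, 0 < c ∧ ∀ (q : ℕ) [NeZero q] (χ : DirichletCharacter ℂ q), χ ≠ 1 → χ ^ 2 = 1 →
      c * (q : ℝ) ^ (-ε) ≤ ‖DirichletCharacter.LFunction χ 1‖ := by
  set ε' : ℝ := min (1 / 8) (ε / 18) with hε'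
  have h1 : 0 < ε' := by positivity
  have h2 : ε' ≤ 1 / 8 := min_le_left _ _
  have h3 : ε' ≤ ε / 18 := min_le_right _ _
  have h4 : ∀ κ : ℝ, κ ≤ 18 → (∃ c : ℝ, 0 < c ∧ ∀ (q : ℕ) [NeZero q] (χ : DirichletCharacter ℂ q),
      χ ≠ 1 → χ ^ 2 = 1 → c * (q : ℝ) ^ (-(κ * ε')) ≤ ‖DirichletCharacter.LFunction χ 1‖) →
      ∃ c : ℝ, 0 < c ∧ ∀ (q : ℕ) [NeZero q] (χ : DirichletCharacter ℂ q), χ ≠ 1 → χ ^ 2 = 1 →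
      c * (q : ℝ) ^ (-ε) ≤ ‖DirichletCharacter.LFunction χ 1‖ := by
    rintro κ hκ ⟨c, hc, h⟩
    refine ⟨c, hc, fun q _ χ hχ hχ' ↦ le_trans ?_ (h q χ hχ hχ')⟩
    have hq : (1 : ℝ) ≤ q := by exact_mod_cast NeZero.one_le
    gcongr
    nlinarith
  by_cases h0 : ∀ (q : ℕ) [NeZero q] (χ : DirichletCharacter ℂ q), χ ≠ 1 → χ ^ 2 = 1 →
      ∀ σ : ℝ, 1 - ε' ≤ σ → σ < 1 → DirichletCharacter.LFunction χ σ ≠ 0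
  · exact h4 12 (by norm_num) (exists_siegel_of_no_zero h1 h2 h0)
  · push Not at h0
    obtain ⟨q₁, _, χ₁, hχ₁, hχ₁', β, hβ, hβ1, h0⟩ := h0
    exact h4 18 le_rfl (exists_siegel_of_zero h1 h2 hχ₁ hχ₁' hβ hβ1 h0)

end Siegel

end Vinogradov

namespace Vinogradov

open Complex MeasureTheory Set Asymptotics Topology

/-! ### Lower bounds for `L`-functions near the line `re s = 1` -/

section LowerBounds

lemma norm_LSeries_le {a : ℕ → ℂ} (ha : ∀ n, ‖a n‖ ≤ 1) {s : ℂ} (hs : 1 < s.re) (hs' : s.re ≤ 2) :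
    ‖LSeries a s‖ ≤ 3 / (s.re - 1) := by
  set σ := s.re
  have hsum : Summable fun n : ℕ ↦ 1 / (n : ℝ) ^ σ := Real.summable_one_div_nat_rpow.2 hs
  have h1 : ∀ n, ‖LSeries.term a s n‖ ≤ 1 / (n : ℝ) ^ σ := by
    intro n
    rw [LSeries.norm_term_eq]
    split_ifs with h
    · positivity
    · gcongr; exact ha n
  have h2 : ‖LSeries a s‖ ≤ ∑' n : ℕ, 1 / (n : ℝ) ^ σ :=
    (tsum_of_norm_bounded hsum.hasSum h1)
  have hσ1 : (σ : ℂ) ≠ 1 := by exact_mod_cast hs.ne'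
  have h3 : ((∑' n : ℕ, 1 / (n : ℝ) ^ σ : ℝ) : ℂ) = riemannZeta σ := by
    rw [zeta_eq_tsum_one_div_nat_cpow (by simpa using hs), ofReal_tsum]
    congr 1 with n
    rw [ofReal_div, ofReal_one, ofReal_cpow (Nat.cast_nonneg n), ofReal_natCast]
  have h4 := norm_riemannZeta_sub_sum_le (N := 1) le_rfl (s := σ) (by simp; linarith) hσ1
  have h5 : ‖riemannZeta σ‖ ≤ 1 + 1 / (σ - 1) + 1 := by
    have e1 : ‖(σ : ℂ)‖ * (((1 : ℕ) : ℝ) ^ (-(σ : ℂ).re) / (σ : ℂ).re) = 1 := by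
      rw [norm_real, Real.norm_eq_abs, abs_of_pos (by linarith), ofReal_re, Nat.cast_one,
        Real.one_rpow, mul_one_div_cancel (by linarith)]
    have e2 : ‖(1 : ℂ) / ((σ : ℂ) - 1)‖ = 1 / (σ - 1) := by
      rw [norm_div, norm_one, ← ofReal_one, ← ofReal_sub, norm_real, Real.norm_eq_abs,
        abs_of_pos (by linarith)]
    rw [e1] at h4
    simp only [Finset.Icc_self, Finset.sum_singleton, Nat.cast_one, one_cpow] at h4
    calc ‖riemannZeta σ‖ = ‖1 + 1 / ((σ : ℂ) - 1) + (riemannZeta σ - 1 - 1 / ((σ : ℂ) - 1))‖ := by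
          congr 1; ring
      _ ≤ ‖(1 : ℂ)‖ + ‖1 / ((σ : ℂ) - 1)‖ + ‖riemannZeta σ - 1 - 1 / ((σ : ℂ) - 1)‖ :=
          norm_add₃_le
      _ ≤ _ := by rw [e2, norm_one]; linarith
  have h6 : (∑' n : ℕ, 1 / (n : ℝ) ^ σ) ≤ ‖riemannZeta σ‖ := by
    rw [← h3, norm_real]; exact le_abs_self _
  refine h2.trans (h6.trans (h5.trans ?_))
  rw [le_div_iff₀ (by linarith), add_mul, add_mul, one_div_mul_cancel (by linarith)]
  linarith

lemma le_norm_LFunction_of_one_lt_re {q : ℕ} [NeZero q] (χ : DirichletCharacter ℂ q) {s : ℂ}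
    (hs : 1 < s.re) (hs' : s.re ≤ 2) : (s.re - 1) / 3 ≤ ‖DirichletCharacter.LFunction χ s‖ := by
  have h1 := DirichletCharacter.LSeries.mul_mu_eq_one χ hs
  have h2 := norm_LSeries_le (a := (fun n : ℕ ↦ χ n) * fun n : ℕ ↦
    ((ArithmeticFunction.moebius n : ℤ) : ℂ)) (fun n ↦ by
      rw [Pi.mul_apply, norm_mul]
      refine mul_le_one₀ (χ.norm_le_one _) (norm_nonneg _) ?_
      rw [norm_intCast]
      exact_mod_cast ArithmeticFunction.abs_moebius_le_one) hs hs'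
  rw [DirichletCharacter.LFunction_eq_LSeries χ hs]
  have h3 := congrArg norm h1
  rw [norm_mul, norm_one] at h3
  have h4 : 1 ≤ ‖LSeries (fun n : ℕ ↦ χ n) s‖ * (3 / (s.re - 1)) := by
    exact h3.symm.le.trans (mul_le_mul_of_nonneg_left h2 (norm_nonneg _))
  rw [mul_div_assoc', le_div_iff₀ (by linarith)] at h4
  linarith

/-- A quantitative form of the `3-4-1` argument. -/
lemma le_norm_of_product_ge_one {f : ℂ → ℂ} {t M R x : ℝ} (hM : 1 ≤ M) (hR : 1 ≤ R) (hx : 0 < x)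
    (hxMR : x * (6912 * M ^ 4 * R) ≤ 1)
    (hd : ∀ s : ℂ, s.im = t → 1 - x ≤ s.re → s.re ≤ 2 → DifferentiableAt ℂ f s)
    (hb : ∀ s : ℂ, s.im = t → 1 - x ≤ s.re → s.re ≤ 2 → ‖deriv f s‖ ≤ M)
    (hp : ∀ x : ℝ, 0 < x → x ≤ 1 → 1 ≤ (3 / x) ^ 3 * ‖f (1 + x + I * t)‖ ^ 4 * R)
    (hl : ∀ s : ℂ, s.im = t → 1 < s.re → s.re ≤ 2 → (s.re - 1) / 3 ≤ ‖f s‖)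
    {s : ℂ} (hst : s.im = t) (hs : 1 - x ≤ s.re) (hs' : s.re ≤ 2) : x / 3 ≤ ‖f s‖ := by
  have hM4 : 1 ≤ M ^ 4 := one_le_pow₀ hM
  have hx1 : x ≤ 1 := by
    have : 1 ≤ 6912 * M ^ 4 * R := by nlinarith
    nlinarith
  rcases lt_or_ge (1 + x) s.re with h | h
  · have := hl s hst (by linarith) hs'
    linarith
  have h1 : 4 * x * M ≤ ‖f (1 + x + I * t)‖ := by
    refine le_of_pow_le_pow_left₀ (n := 4) (by norm_num) (norm_nonneg _) ?_
    have h2 := hp x hx hx1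
    set F := ‖f (1 + x + I * t)‖ ^ 4
    rw [div_pow, div_mul_eq_mul_div, div_mul_eq_mul_div, le_div_iff₀ (by positivity)] at h2
    have h3 : (4 * x * M) ^ 4 * (27 * R) ≤ x ^ 3 := by
      calc _ = x ^ 3 * (x * (6912 * M ^ 4 * R)) := by ring
        _ ≤ x ^ 3 * 1 := by gcongr
        _ = x ^ 3 := mul_one _
    refine le_of_mul_le_mul_right (a := 27 * R) ?_ (by positivity)
    linarith
  set S₀ : Set ℂ := {s : ℂ | s.im = t} ∩ ({s : ℂ | 1 - x ≤ s.re} ∩ {s : ℂ | s.re ≤ 2}) with hS₀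
  have hconv : Convex ℝ S₀ := by
    refine Convex.inter ?_ ((convex_halfSpace_re_ge _).inter (convex_halfSpace_re_le _))
    exact convex_hyperplane imLm.isLinear t
  have h4 := hconv.norm_image_sub_le_of_norm_deriv_le (f := f) (C := M)
    (fun z hz ↦ hd z hz.1 hz.2.1 hz.2.2) (fun z hz ↦ hb z hz.1 hz.2.1 hz.2.2)
    (x := 1 + x + I * t) (y := s) ⟨by simp, by simp; linarith, by simp; linarith⟩ ⟨hst, hs, hs'⟩
  have h5 : ‖s - (1 + x + I * t)‖ ≤ 2 * x := by
    have : s - (1 + x + I * t) = ((s.re - (1 + x) : ℝ) : ℂ) := by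
      apply Complex.ext <;> simp [hst]
    rw [this, norm_real, Real.norm_eq_abs, abs_le]
    constructor <;> linarith
  have h6 := norm_sub_norm_le (f (1 + x + I * t)) (f s)
  rw [norm_sub_rev] at h6
  have h7 : M * ‖s - (1 + x + I * t)‖ ≤ M * (2 * x) := by gcongr
  nlinarith

lemma exists_norm_deriv_LFunction_le {η : ℝ} (hη : 0 < η) (hη' : η ≤ 1 / 2) : ∃ C : ℝ, 1 ≤ C ∧
    ∀ (q : ℕ) [NeZero q] (χ : DirichletCharacter ℂ q), χ ≠ 1 → ∀ s : ℂ,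
      1 - η / 2 ≤ s.re → s.re ≤ 3 →
      ‖deriv (DirichletCharacter.LFunction χ) s‖ ≤ C * (q * (|s.im| + 2)) ^ (2 * η) := by
  obtain ⟨C, hC, h⟩ := exists_norm_LFunction_le hη hη'
  refine ⟨max 1 (C * 2 ^ (2 * η) / (η / 2)), le_max_left _ _, fun q _ χ hχ s hs hs' ↦ ?_⟩
  have hq : (0 : ℝ) < q := by exact_mod_cast NeZero.pos q
  refine le_trans ?_ (mul_le_mul_of_nonneg_right (le_max_right _ _) (by positivity))
  have h1 : ∀ z ∈ Metric.sphere s (η / 2), ‖DirichletCharacter.LFunction χ z‖ ≤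
      C * (2 * (q * (|s.im| + 2))) ^ (2 * η) := by
    intro z hz
    rw [mem_sphere_iff_norm] at hz
    have hre := abs_le.1 ((abs_re_le_norm (z - s)).trans hz.le)
    have him := (abs_im_le_norm (z - s)).trans hz.le
    rw [sub_re] at hre
    rw [sub_im] at him
    have him' : |z.im| ≤ |s.im| + 1 := by
      have := abs_sub_abs_le_abs_sub z.im s.im
      linarith
    refine (h q χ hχ z (by linarith) (by linarith)).trans ?_
    have : (q : ℝ) * (|z.im| + 2) ≤ 2 * (q * (|s.im| + 2)) := by
      nlinarith [abs_nonneg s.im]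
    gcongr
  have h2 := norm_deriv_le_of_forall_mem_sphere_norm_le (show 0 < η / 2 by linarith)
    (DirichletCharacter.differentiable_LFunction hχ).diffContOnCl h1
  rw [Real.mul_rpow (by norm_num) (by positivity)] at h2
  refine h2.trans (le_of_eq ?_)
  ring

lemma exists_norm_deriv_riemannZeta_le {η : ℝ} (hη : 0 < η) (hη' : η ≤ 1 / 2) : ∃ C : ℝ, 1 ≤ C ∧
    ∀ s : ℂ, 1 ≤ |s.im| → 1 - η / 2 ≤ s.re → s.re ≤ 3 →
      ‖deriv riemannZeta s‖ ≤ C * (|s.im| + 2) ^ (2 * η) := by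
  obtain ⟨C, hC, h⟩ := exists_norm_riemannZeta_le hη hη'
  refine ⟨max 1 (C * 2 ^ (2 * η) * 3 / (η / 2)), le_max_left _ _, fun s hst hs hs' ↦ ?_⟩
  refine le_trans ?_ (mul_le_mul_of_nonneg_right (le_max_right _ _) (by positivity))
  have him0 : ∀ z ∈ Metric.closedBall s (η / 2), 1 / 2 ≤ |z.im| := by
    intro z hz
    rw [mem_closedBall_iff_norm] at hz
    have him := (abs_im_le_norm (z - s)).trans hz
    rw [sub_im] at him
    have := abs_sub_abs_le_abs_sub s.im z.im
    rw [abs_sub_comm] at this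
    linarith
  have h1 : ∀ z ∈ Metric.sphere s (η / 2), ‖riemannZeta z‖ ≤
      C * (2 * (|s.im| + 2)) ^ (2 * η) * 3 := by
    intro z hz
    have hz0 := him0 z (Metric.sphere_subset_closedBall hz)
    rw [mem_sphere_iff_norm] at hz
    have hre := abs_le.1 ((abs_re_le_norm (z - s)).trans hz.le)
    have him := (abs_im_le_norm (z - s)).trans hz.le
    rw [sub_re] at hre
    rw [sub_im] at him
    have him' : |z.im| ≤ |s.im| + 1 := by
      have := abs_sub_abs_le_abs_sub z.im s.im
      linarith
    have hz1 : 1 / 2 ≤ ‖z - 1‖ := by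
      have := abs_im_le_norm (z - 1)
      simp only [sub_im, one_im, sub_zero] at this
      linarith
    have hne : z ≠ 1 := fun h ↦ by simp [h] at hz1; linarith
    refine (h z hne (by linarith) (by linarith)).trans ?_
    have h8 : 1 / ‖z - 1‖ ≤ 2 := by
      rw [div_le_iff₀ (by linarith)]; linarith
    gcongr
    · linarith [abs_nonneg s.im]
    · linarith
  have hd : DiffContOnCl ℂ riemannZeta (Metric.ball s (η / 2)) := by
    refine DifferentiableOn.diffContOnCl_ball (U := {z | z ≠ 1})
      (fun z hz ↦ (differentiableAt_riemannZeta hz).differentiableWithinAt) fun z hz h ↦ ?_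
    have := him0 z hz
    rw [h] at this
    simp at this
    linarith
  have h2 := norm_deriv_le_of_forall_mem_sphere_norm_le (show 0 < η / 2 by linarith) hd h1
  rw [Real.mul_rpow (by norm_num) (by positivity)] at h2
  refine h2.trans (le_of_eq ?_)
  ring

end LowerBounds

end Vinogradov

namespace Vinogradov

open Complex MeasureTheory Set Asymptotics Topology

/-! ### Logarithmic derivatives near the line `re s = 1` -/

section ZeroFree

lemma one_le_of_norm_LFunction_sq_le {q : ℕ} [NeZero q] (χ : DirichletCharacter ℂ q) {t R x : ℝ}
    (hx : 0 < x) (hx1 : x ≤ 1)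
    (h : ‖DirichletCharacter.LFunction (χ ^ 2) (1 + x + 2 * I * t)‖ ≤ R) :
    1 ≤ (3 / x) ^ 3 * ‖DirichletCharacter.LFunction χ (1 + x + I * t)‖ ^ 4 * R := by
  have h1 := DirichletCharacter.norm_LFunction_product_ge_one χ hx t
  rw [norm_mul, norm_mul, norm_pow, norm_pow] at h1
  refine h1.le.trans ?_
  have h2 : ‖DirichletCharacter.LFunctionTrivChar q (1 + x)‖ ≤ 3 / x := by
    have hre : (1 + (x : ℂ)).re = 1 + x := by simp
    rw [DirichletCharacter.LFunctionTrivChar, DirichletCharacter.LFunction_eq_LSeries 1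
      (by rw [hre]; linarith)]
    have := norm_LSeries_le (a := fun n : ℕ ↦ (1 : DirichletCharacter ℂ q) n)
      (fun n ↦ DirichletCharacter.norm_le_one _ _) (s := 1 + x) (by rw [hre]; linarith)
      (by rw [hre]; linarith)
    rwa [hre, add_sub_cancel_left] at this
  gcongr

lemma rpow_natCast_mul' {x : ℝ} (hx : 0 ≤ x) (η : ℝ) (n : ℕ) : x ^ (n * η) = (x ^ η) ^ n := by
  rw [mul_comm, Real.rpow_mul_natCast hx]

lemma norm_LFunctionTrivChar_le {q : ℕ} [NeZero q] {s : ℂ} (hs : 1 ≤ s.re) (hs1 : s ≠ 1) :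
    ‖DirichletCharacter.LFunctionTrivChar q s‖ ≤ (2 * Real.log q + 1) * ‖riemannZeta s‖ := by
  rw [DirichletCharacter.LFunctionTrivChar_eq_mul_riemannZeta hs1, norm_mul, norm_prod]
  gcongr
  refine le_trans (Finset.prod_le_prod (fun _ _ ↦ norm_nonneg _) fun p hp ↦ ?_)
    (prod_one_add_inv_le (NeZero.ne q))
  have hp0 := (Nat.prime_of_mem_primeFactors hp).pos
  refine (norm_sub_le _ _).trans ?_
  rw [norm_one, norm_natCast_cpow_of_pos hp0, neg_re, Real.rpow_neg (Nat.cast_nonneg _)]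
  gcongr
  have h1 : (1 : ℝ) ≤ p := by exact_mod_cast hp0
  simpa using Real.rpow_le_rpow_of_exponent_le h1 hs

set_option maxHeartbeats 800000 in
lemma exists_le_norm_LFunction_aux {η : ℝ} (hη : 0 < η) (hη' : η ≤ 1 / 2) : ∃ c : ℝ, 0 < c ∧
    ∀ (q : ℕ) [NeZero q] (χ : DirichletCharacter ℂ q), χ ≠ 1 → ∀ s : ℂ,
      1 - c * (q * (|s.im| + 2)) ^ (-(14 * η)) ≤ s.re → s.re ≤ 2 →
      c * (q * (|s.im| + 2)) ^ (-(14 * η)) ≤ ‖DirichletCharacter.LFunction χ s‖ := by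
  obtain ⟨C₁, hC₁, hder⟩ := exists_norm_deriv_LFunction_le hη hη'
  obtain ⟨C₂, hC₂, hL⟩ := exists_norm_LFunction_le hη hη'
  obtain ⟨C₅, hC₅, hZ⟩ := exists_norm_riemannZeta_le hη hη'
  obtain ⟨c', hc', hS⟩ := exists_le_norm_LFunction_one hη
  set c₀ := min c' 1 with hc₀
  have hc₀0 : 0 < c₀ := by positivity
  set c₁ := min (c₀ / (4 * C₁)) (η / 2) with hc₁
  have hc₁0 : 0 < c₁ := by positivity
  set C₄ := 1 + 2 * C₂ + (2 / η + 1) * (2 * C₅ * (1 + 1 / c₁)) with hC₄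
  have hC₄1 : 1 ≤ C₄ := by
    have : 0 ≤ 2 * C₂ + (2 / η + 1) * (2 * C₅ * (1 + 1 / c₁)) := by positivity
    linarith
  set c₃ := min (1 / (6912 * C₁ ^ 4 * C₄)) (η / 2) with hc₃
  have hc₃0 : 0 < c₃ := by positivity
  refine ⟨min c₁ c₃ / 3, by positivity, fun q _ χ hχ s hs hs' ↦ ?_⟩
  set t := s.im with ht
  set Q : ℝ := q * (|t| + 2) with hQ
  have hq : (1 : ℝ) ≤ q := by exact_mod_cast NeZero.one_le
  have hQ1 : 1 ≤ Q := by rw [hQ]; nlinarith [abs_nonneg t]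
  have hqQ : (q : ℝ) ≤ Q := by rw [hQ]; nlinarith [abs_nonneg t]
  have htQ : 2 * |t| + 2 ≤ 2 * Q := by rw [hQ]; nlinarith [abs_nonneg t]
  have hQ0 : 0 ≤ Q := by linarith
  set P := Q ^ η with hP
  have hP1 : 1 ≤ P := Real.one_le_rpow hQ1 hη.le
  have hP0 : 0 < P := by linarith
  have e14 : Q ^ (-(14 * η)) = (P ^ 14)⁻¹ := by
    rw [Real.rpow_neg hQ0, hP, ← rpow_natCast_mul' hQ0]; norm_num
  have e2 : Q ^ (2 * η) = P ^ 2 := by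
    rw [hP, ← rpow_natCast_mul' hQ0]; norm_num
  have e22 : (2 * Q) ^ (2 * η) ≤ 2 * P ^ 2 := by
    rw [Real.mul_rpow (by norm_num) hQ0, e2]
    gcongr
    calc (2 : ℝ) ^ (2 * η) ≤ 2 ^ (1 : ℝ) := by gcongr <;> linarith
      _ = 2 := Real.rpow_one _
  have epow : ∀ m n : ℕ, m ≤ n → P ^ m ≤ P ^ n := fun m n h ↦ pow_le_pow_right₀ hP1 h
  have einv : ∀ m n : ℕ, m ≤ n → (P ^ n)⁻¹ ≤ (P ^ m)⁻¹ := fun m n h ↦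
    inv_anti₀ (by positivity) (epow m n h)
  have einv1 : ∀ n : ℕ, (P ^ n)⁻¹ ≤ 1 := fun n ↦ inv_le_one_of_one_le₀ (one_le_pow₀ hP1)
  rw [e14] at hs ⊢
  set τ := c₁ * (P ^ 3)⁻¹ with hτ
  have hτ0 : 0 < τ := by positivity
  have hτη : τ ≤ η / 2 := by
    calc τ ≤ c₁ * 1 := by rw [hτ]; gcongr; exact einv1 3
      _ ≤ η / 2 := by rw [mul_one]; exact min_le_right _ _
  have hcτ : min c₁ c₃ / 3 * (P ^ 14)⁻¹ ≤ τ / 3 := by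
    rw [div_mul_eq_mul_div]
    have : min c₁ c₃ * (P ^ 14)⁻¹ ≤ τ := by
      rw [hτ]; gcongr
      · exact min_le_left _ _
      · norm_num
    linarith
  by_cases hcase : χ ^ 2 = 1 ∧ |t| ≤ τ
  · obtain ⟨hχ2, htτ⟩ := hcase
    refine hcτ.trans ?_
    rcases lt_or_ge (1 + τ) s.re with h | h
    · have := le_norm_LFunction_of_one_lt_re χ (s := s) (by linarith) hs'
      linarith
    have h1 : c₀ * P⁻¹ ≤ ‖DirichletCharacter.LFunction χ 1‖ := by
      refine le_trans ?_ (hS q χ hχ hχ2)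
      rw [Real.rpow_neg (by linarith)]
      gcongr
      · exact min_le_left _ _
      · rw [hP]; gcongr
    set S₀ : Set ℂ := ({z : ℂ | -|t| ≤ z.im} ∩ {z : ℂ | z.im ≤ |t|}) ∩
      ({z : ℂ | 1 - η / 2 ≤ z.re} ∩ {z : ℂ | z.re ≤ 2}) with hS₀
    have hconv : Convex ℝ S₀ := ((convex_halfSpace_im_ge _).inter (convex_halfSpace_im_le _)).inter
      ((convex_halfSpace_re_ge _).inter (convex_halfSpace_re_le _))
    have h4 := hconv.norm_image_sub_le_of_norm_deriv_le (f := DirichletCharacter.LFunction χ)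
      (C := C₁ * P ^ 2) (fun z _ ↦ DirichletCharacter.differentiable_LFunction hχ z) (fun z hz ↦ by
        refine (hder q χ hχ z hz.2.1 (hz.2.2.trans (by norm_num))).trans ?_
        rw [← e2, hQ]
        have : |z.im| ≤ |t| := abs_le.2 hz.1
        gcongr)
      (x := 1) (y := s) ⟨⟨by simp, by simp⟩, by simp; linarith, by simp⟩
      ⟨⟨neg_abs_le t, le_abs_self t⟩, (by linarith : 1 - η / 2 ≤ s.re), hs'⟩
    have h5 : ‖s - 1‖ ≤ 2 * τ := by
      refine (norm_le_abs_re_add_abs_im _).trans ?_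
      have : |(s - 1).re| ≤ τ := by
        rw [sub_re, one_re, abs_le]; constructor <;> linarith
      have : |(s - 1).im| ≤ τ := by
        rw [sub_im, one_im, sub_zero]; exact htτ
      linarith
    have h6 := norm_sub_norm_le (DirichletCharacter.LFunction χ 1) (DirichletCharacter.LFunction χ s)
    rw [norm_sub_rev] at h6
    have h7 : C₁ * P ^ 2 * ‖s - 1‖ ≤ c₀ * P⁻¹ / 2 := by
      calc C₁ * P ^ 2 * ‖s - 1‖ ≤ C₁ * P ^ 2 * (2 * τ) := by gcongr
        _ = c₁ * (2 * C₁ * P⁻¹) := by rw [hτ]; field_simp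
        _ ≤ c₀ / (4 * C₁) * (2 * C₁ * P⁻¹) := by gcongr; exact min_le_left _ _
        _ = c₀ * P⁻¹ / 2 := by field_simp; ring
    have h8 : τ ≤ c₀ * P⁻¹ := by
      calc τ ≤ c₀ / (4 * C₁) * (P ^ 1)⁻¹ := by
            rw [hτ]; gcongr
            · exact min_le_left _ _
            · norm_num
        _ ≤ c₀ * P⁻¹ := by
            rw [pow_one]; gcongr
            exact div_le_self hc₀0.le (by linarith)
    linarith
  set x := c₃ * (P ^ 14)⁻¹ with hx
  have hx0 : 0 < x := by positivity
  have hxη : x ≤ η / 2 := by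
    calc x ≤ c₃ * 1 := by rw [hx]; gcongr; exact einv1 14
      _ ≤ η / 2 := by rw [mul_one]; exact min_le_right _ _
  have hcx : min c₁ c₃ / 3 * (P ^ 14)⁻¹ ≤ x / 3 := by
    rw [div_mul_eq_mul_div]
    have : min c₁ c₃ * (P ^ 14)⁻¹ ≤ x := by
      rw [hx]; gcongr
      exact min_le_right _ _
    linarith
  refine hcx.trans ?_
  refine le_norm_of_product_ge_one (t := t) (M := C₁ * P ^ 2) (R := C₄ * P ^ 6) ?_ ?_ hx0 ?_
    (fun z _ _ _ ↦ DirichletCharacter.differentiable_LFunction hχ z) (fun z hz hz1 hz2 ↦ ?_)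
    (fun y hy hy1 ↦ one_le_of_norm_LFunction_sq_le χ hy hy1 ?_)
    (fun z _ hz1 hz2 ↦ le_norm_LFunction_of_one_lt_re χ hz1 hz2) rfl ?_ hs'
  · exact one_le_mul_of_one_le_of_one_le hC₁ (one_le_pow₀ hP1)
  · exact one_le_mul_of_one_le_of_one_le hC₄1 (one_le_pow₀ hP1)
  · calc x * (6912 * (C₁ * P ^ 2) ^ 4 * (C₄ * P ^ 6)) = c₃ * (6912 * C₁ ^ 4 * C₄) := by
          rw [hx]; field_simp
      _ ≤ 1 / (6912 * C₁ ^ 4 * C₄) * (6912 * C₁ ^ 4 * C₄) := by gcongr; exact min_le_left _ _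
      _ = 1 := by field_simp
  · refine (hder q χ hχ z (by linarith) (by linarith)).trans ?_
    rw [hz, ← hQ, e2]
  · set w : ℂ := 1 + y + 2 * I * t with hw
    have hwre : w.re = 1 + y := by simp [hw]
    have hwim : w.im = 2 * t := by simp [hw]
    have hwim' : |w.im| = 2 * |t| := by rw [hwim, abs_mul, abs_two]
    by_cases hχ2 : χ ^ 2 = 1
    · have htτ : τ < |t| := by
        by_contra! h
        exact hcase ⟨hχ2, h⟩
      have hw1 : τ ≤ ‖w - 1‖ := by
        have := abs_im_le_norm (w - 1)
        rw [sub_im, one_im, sub_zero, hwim'] at this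
        linarith
      have hwne : w ≠ 1 := fun h ↦ by
        rw [h, sub_self, norm_zero] at hw1; linarith
      rw [hχ2]
      have b1 := norm_LFunctionTrivChar_le (q := q) (s := w) (by rw [hwre]; linarith) hwne
      have b2 := two_mul_log_add_one_le hη hq
      have b3 := hZ w hwne (by rw [hwre]; linarith) (by rw [hwre]; linarith)
      rw [hwim'] at b3
      have b4 : 1 + 1 / ‖w - 1‖ ≤ (1 + 1 / c₁) * P ^ 3 := by
        have : 1 / ‖w - 1‖ ≤ 1 / τ := by gcongr
        have h9 : 1 / τ = 1 / c₁ * P ^ 3 := by rw [hτ]; field_simp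
        have : 1 ≤ P ^ 3 := one_le_pow₀ hP1
        linarith
      have b5 : (2 * |t| + 2) ^ (2 * η) ≤ 2 * P ^ 2 := le_trans (by gcongr) e22
      have b6 : (q : ℝ) ^ η ≤ P := by rw [hP]; gcongr
      refine b1.trans ?_
      calc (2 * Real.log q + 1) * ‖riemannZeta w‖ ≤
          ((2 / η + 1) * P) * (C₅ * (2 * P ^ 2) * ((1 + 1 / c₁) * P ^ 3)) := by
            gcongr
            · exact b2.trans (by gcongr)
            · exact b3.trans (by gcongr)
        _ = (2 / η + 1) * (2 * C₅ * (1 + 1 / c₁)) * P ^ 6 := by ring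
        _ ≤ C₄ * P ^ 6 := by gcongr; rw [hC₄]; linarith
    · refine (hL q _ hχ2 w (by rw [hwre]; linarith) (by rw [hwre]; linarith)).trans ?_
      rw [hwim']
      have b5 : (q * (2 * |t| + 2)) ^ (2 * η) ≤ 2 * P ^ 2 := by
        refine le_trans ?_ e22
        have : (q : ℝ) * (2 * |t| + 2) ≤ 2 * Q := by
          calc (q : ℝ) * (2 * |t| + 2) ≤ q * (2 * |t| + 4) := by gcongr; norm_num
            _ = 2 * Q := by rw [hQ]; ring
        gcongr
      calc C₂ * (q * (2 * |t| + 2)) ^ (2 * η) ≤ C₂ * (2 * P ^ 2) := by gcongr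
        _ = 2 * C₂ * P ^ 2 := by ring
        _ ≤ C₄ * P ^ 6 := by
          have h9 : 0 ≤ (2 / η + 1) * (2 * C₅ * (1 + 1 / c₁)) := by positivity
          have := epow 2 6 (by norm_num)
          gcongr
          rw [hC₄]; linarith
  · have : min c₁ c₃ / 3 * (P ^ 14)⁻¹ ≤ x := by linarith
    linarith

lemma exists_le_norm_riemannZeta_aux {η : ℝ} (hη : 0 < η) (hη' : η ≤ 1 / 2) : ∃ c : ℝ, 0 < c ∧
    ∀ s : ℂ, 1 ≤ |s.im| → 1 - c * (|s.im| + 2) ^ (-(14 * η)) ≤ s.re → s.re ≤ 2 →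
      c * (|s.im| + 2) ^ (-(14 * η)) ≤ ‖riemannZeta s‖ := by
  obtain ⟨C₁, hC₁, hder⟩ := exists_norm_deriv_riemannZeta_le hη hη'
  obtain ⟨C₅, hC₅, hZ⟩ := exists_norm_riemannZeta_le hη hη'
  set C₄ := 1 + 4 * C₅ with hC₄
  have hC₄1 : 1 ≤ C₄ := by linarith
  set c₃ := min (1 / (6912 * C₁ ^ 4 * C₄)) (η / 2) with hc₃
  have hc₃0 : 0 < c₃ := by positivity
  refine ⟨c₃ / 3, by positivity, fun s hst hs hs' ↦ ?_⟩
  set t := s.im with ht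
  set Q : ℝ := |t| + 2 with hQ
  have hQ1 : 1 ≤ Q := by rw [hQ]; linarith
  have htQ : 2 * |t| + 2 ≤ 2 * Q := by rw [hQ]; linarith
  have hQ0 : 0 ≤ Q := by linarith
  set P := Q ^ η with hP
  have hP1 : 1 ≤ P := Real.one_le_rpow hQ1 hη.le
  have hP0 : 0 < P := by linarith
  have e14 : Q ^ (-(14 * η)) = (P ^ 14)⁻¹ := by
    rw [Real.rpow_neg hQ0, hP, ← rpow_natCast_mul' hQ0]; norm_num
  have e2 : Q ^ (2 * η) = P ^ 2 := by
    rw [hP, ← rpow_natCast_mul' hQ0]; norm_num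
  have e22 : (2 * Q) ^ (2 * η) ≤ 2 * P ^ 2 := by
    rw [Real.mul_rpow (by norm_num) hQ0, e2]
    gcongr
    calc (2 : ℝ) ^ (2 * η) ≤ 2 ^ (1 : ℝ) := by gcongr <;> linarith
      _ = 2 := Real.rpow_one _
  rw [e14] at hs ⊢
  set x := c₃ * (P ^ 14)⁻¹ with hx
  have hx0 : 0 < x := by positivity
  have hxη : x ≤ η / 2 := by
    calc x ≤ c₃ * 1 := by rw [hx]; gcongr; exact inv_le_one_of_one_le₀ (one_le_pow₀ hP1)
      _ ≤ η / 2 := by rw [mul_one]; exact min_le_right _ _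
  have hcx : c₃ / 3 * (P ^ 14)⁻¹ = x / 3 := by rw [hx]; ring
  rw [hcx] at hs ⊢
  have h0 : ∀ z : ℂ, z.im = t → z ≠ 1 := by
    rintro z hz rfl
    rw [← hz] at hst
    simp at hst
    linarith
  have hL1 : ∀ χ : DirichletCharacter ℂ 1, DirichletCharacter.LFunction χ = riemannZeta :=
    fun χ ↦ DirichletCharacter.LFunction_modOne_eq
  refine le_norm_of_product_ge_one (t := t) (M := C₁ * P ^ 2) (R := C₄ * P ^ 6) ?_ ?_ hx0 ?_
    (fun z hz _ _ ↦ differentiableAt_riemannZeta (h0 z hz)) (fun z hz hz1 hz2 ↦ ?_)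
    (fun y hy hy1 ↦ ?_) (fun z _ hz1 hz2 ↦ ?_) rfl (by linarith) hs'
  · exact one_le_mul_of_one_le_of_one_le hC₁ (one_le_pow₀ hP1)
  · exact one_le_mul_of_one_le_of_one_le hC₄1 (one_le_pow₀ hP1)
  · calc x * (6912 * (C₁ * P ^ 2) ^ 4 * (C₄ * P ^ 6)) = c₃ * (6912 * C₁ ^ 4 * C₄) := by
          rw [hx]; field_simp
      _ ≤ 1 / (6912 * C₁ ^ 4 * C₄) * (6912 * C₁ ^ 4 * C₄) := by gcongr; exact min_le_left _ _
      _ = 1 := by field_simp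
  · refine (hder z (by rwa [hz]) (by linarith) (by linarith)).trans ?_
    rw [hz, ← hQ, e2]
  · have h1 := one_le_of_norm_LFunction_sq_le (1 : DirichletCharacter ℂ 1) (t := t)
      (R := C₄ * P ^ 6) hy hy1
    rw [hL1, hL1] at h1
    refine h1 ?_
    set w : ℂ := 1 + y + 2 * I * t with hw
    have hwre : w.re = 1 + y := by simp [hw]
    have hwim : w.im = 2 * t := by simp [hw]
    have hwim' : |w.im| = 2 * |t| := by rw [hwim, abs_mul, abs_two]
    have hw1 : 1 ≤ ‖w - 1‖ := by
      have := abs_im_le_norm (w - 1)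
      rw [sub_im, one_im, sub_zero, hwim'] at this
      linarith
    have hwne : w ≠ 1 := fun h ↦ by
      rw [h, sub_self, norm_zero] at hw1; linarith
    have b3 := hZ w hwne (by rw [hwre]; linarith) (by rw [hwre]; linarith)
    rw [hwim'] at b3
    have b4 : 1 + 1 / ‖w - 1‖ ≤ 2 := by
      have : 1 / ‖w - 1‖ ≤ 1 := by rw [div_le_one (by linarith)]; exact hw1
      linarith
    have b5 : (2 * |t| + 2) ^ (2 * η) ≤ 2 * P ^ 2 := le_trans (by gcongr) e22
    calc ‖riemannZeta w‖ ≤ C₅ * (2 * P ^ 2) * 2 := b3.trans (by gcongr)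
      _ = 4 * C₅ * P ^ 2 := by ring
      _ ≤ C₄ * P ^ 6 := by
        have : P ^ 2 ≤ P ^ 6 := pow_le_pow_right₀ hP1 (by norm_num)
        gcongr
        linarith
  · have := le_norm_LFunction_of_one_lt_re (1 : DirichletCharacter ℂ 1) hz1 hz2
    rwa [hL1] at this

/-- A zero-free region for nonprincipal Dirichlet `L`-functions, including Siegel's bound for
exceptional zeros, together with a bound for the logarithmic derivative there. -/
theorem exists_norm_logDeriv_LFunction_le {κ : ℝ} (hκ : 0 < κ) : ∃ C : ℝ, 1 ≤ C ∧
    ∀ (q : ℕ) [NeZero q] (χ : DirichletCharacter ℂ q), χ ≠ 1 → ∀ s : ℂ,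
      1 - C⁻¹ * (q * (|s.im| + 2)) ^ (-κ) ≤ s.re → s.re ≤ 2 →
      DirichletCharacter.LFunction χ s ≠ 0 ∧
      ‖logDeriv (DirichletCharacter.LFunction χ) s‖ ≤ C * (q * (|s.im| + 2)) ^ κ := by
  set η := min (κ / 16) (1 / 2) with hη
  have hη0 : 0 < η := by positivity
  have hηκ : η ≤ κ / 16 := min_le_left _ _
  have hη' : η ≤ 1 / 2 := min_le_right _ _
  obtain ⟨c, hc, h1⟩ := exists_le_norm_LFunction_aux hη0 hη'
  obtain ⟨D, hD, h2⟩ := exists_norm_deriv_LFunction_le hη0 hη'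
  set C := D / c + (1 / c + 2 / η) + 1 with hC
  have hD' : 0 ≤ D / c := by positivity
  have hc' : 0 ≤ 1 / c := by positivity
  have hη2 : 0 ≤ 2 / η := by positivity
  have hC1 : 1 ≤ C := by rw [hC]; linarith
  have hCc : C⁻¹ ≤ c := by
    rw [inv_le_comm₀ (by linarith) hc, ← one_div]; rw [hC]; linarith
  have hCη : C⁻¹ ≤ η / 2 := by
    rw [inv_le_comm₀ (by linarith) (by linarith), inv_div]; rw [hC]; linarith
  refine ⟨C, hC1, fun q _ χ hχ s hs hs' ↦ ?_⟩
  set Q : ℝ := q * (|s.im| + 2) with hQ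
  have hq : (1 : ℝ) ≤ q := by exact_mod_cast NeZero.one_le
  have hQ1 : 1 ≤ Q := by rw [hQ]; nlinarith [abs_nonneg s.im]
  have hQ0 : 0 < Q := by linarith
  have hC0 : 0 < C⁻¹ := by positivity
  have h3 : C⁻¹ * Q ^ (-κ) ≤ c * Q ^ (-(14 * η)) := by
    gcongr
    · linarith
  have h4 : C⁻¹ * Q ^ (-κ) ≤ η / 2 := by
    calc _ ≤ η / 2 * 1 := by
          gcongr
          exact Real.rpow_le_one_of_one_le_of_nonpos hQ1 (by linarith)
      _ = _ := mul_one _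
  have h5 := h1 q χ hχ s (by rw [← hQ]; linarith) hs'
  rw [← hQ] at h5
  have h6 : 0 < c * Q ^ (-(14 * η)) := by positivity
  refine ⟨norm_pos_iff.1 (h6.trans_le h5), ?_⟩
  have h7 := h2 q χ hχ s (by linarith) (by linarith)
  rw [← hQ] at h7
  rw [logDeriv_apply, norm_div]
  calc _ ≤ D * Q ^ (2 * η) / (c * Q ^ (-(14 * η))) := by gcongr
    _ = D / c * Q ^ (16 * η) := by
      rw [Real.rpow_neg hQ0.le, show 16 * η = 2 * η + 14 * η by ring, Real.rpow_add hQ0]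
      field_simp
    _ ≤ C * Q ^ κ := by
      gcongr
      · rw [hC]; linarith
      · linarith

/-- A zero-free region for the Riemann zeta function away from the pole, together with a bound for
the logarithmic derivative there. -/
theorem exists_norm_logDeriv_riemannZeta_le {κ : ℝ} (hκ : 0 < κ) : ∃ C : ℝ, 1 ≤ C ∧
    ∀ s : ℂ, 1 ≤ |s.im| → 1 - C⁻¹ * (|s.im| + 2) ^ (-κ) ≤ s.re → s.re ≤ 2 →
      riemannZeta s ≠ 0 ∧ ‖logDeriv riemannZeta s‖ ≤ C * (|s.im| + 2) ^ κ := by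
  set η := min (κ / 16) (1 / 2) with hη
  have hη0 : 0 < η := by positivity
  have hηκ : η ≤ κ / 16 := min_le_left _ _
  have hη' : η ≤ 1 / 2 := min_le_right _ _
  obtain ⟨c, hc, h1⟩ := exists_le_norm_riemannZeta_aux hη0 hη'
  obtain ⟨D, hD, h2⟩ := exists_norm_deriv_riemannZeta_le hη0 hη'
  set C := D / c + (1 / c + 2 / η) + 1 with hC
  have hD' : 0 ≤ D / c := by positivity
  have hc' : 0 ≤ 1 / c := by positivity
  have hη2 : 0 ≤ 2 / η := by positivity
  have hC1 : 1 ≤ C := by rw [hC]; linarith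
  have hCc : C⁻¹ ≤ c := by
    rw [inv_le_comm₀ (by linarith) hc, ← one_div]; rw [hC]; linarith
  have hCη : C⁻¹ ≤ η / 2 := by
    rw [inv_le_comm₀ (by linarith) (by linarith), inv_div]; rw [hC]; linarith
  refine ⟨C, hC1, fun s hst hs hs' ↦ ?_⟩
  set Q : ℝ := |s.im| + 2 with hQ
  have hQ1 : 1 ≤ Q := by linarith
  have hQ0 : 0 < Q := by linarith
  have hC0 : 0 < C⁻¹ := by positivity
  have h3 : C⁻¹ * Q ^ (-κ) ≤ c * Q ^ (-(14 * η)) := by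
    gcongr
    · linarith
  have h4 : C⁻¹ * Q ^ (-κ) ≤ η / 2 := by
    calc _ ≤ η / 2 * 1 := by
          gcongr
          exact Real.rpow_le_one_of_one_le_of_nonpos hQ1 (by linarith)
      _ = _ := mul_one _
  have h5 := h1 s hst (by rw [← hQ]; linarith) hs'
  rw [← hQ] at h5
  have h6 : 0 < c * Q ^ (-(14 * η)) := by positivity
  refine ⟨norm_pos_iff.1 (h6.trans_le h5), ?_⟩
  have h7 := h2 s hst (by linarith) (by linarith)
  rw [← hQ] at h7
  rw [logDeriv_apply, norm_div]
  calc _ ≤ D * Q ^ (2 * η) / (c * Q ^ (-(14 * η))) := by gcongr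
    _ = D / c * Q ^ (16 * η) := by
      rw [Real.rpow_neg hQ0.le, show 16 * η = 2 * η + 14 * η by ring, Real.rpow_add hQ0]
      field_simp
    _ ≤ C * Q ^ κ := by
      gcongr
      · rw [hC]; linarith
      · linarith

end ZeroFree

end Vinogradov

namespace Vinogradov

open Complex MeasureTheory Set Asymptotics Topology

/-! ### A smoothed Perron formula -/

section Perron

lemma norm_one_div_mul_add_one_le {s : ℂ} (hs : 1 ≤ s.re) :
    ‖1 / (s * (s + 1))‖ ≤ (1 + s.im ^ 2)⁻¹ := by
  rw [norm_div, norm_one, norm_mul, one_div]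
  have h1 : ‖s‖ ≤ ‖s + 1‖ := by
    rw [← sq_le_sq₀ (norm_nonneg _) (norm_nonneg _), Complex.sq_norm, Complex.sq_norm, normSq_apply,
      normSq_apply, add_re, add_im, one_re, one_im]
    nlinarith
  have h2 : ‖s‖ ^ 2 = s.re ^ 2 + s.im ^ 2 := by
    rw [Complex.sq_norm, normSq_apply]; ring
  refine inv_anti₀ (by positivity) ?_
  nlinarith [norm_nonneg s]

lemma integrable_one_div_mul_add_one {σ : ℝ} (hσ : 1 ≤ σ) :
    Integrable fun t : ℝ ↦ 1 / (((σ : ℂ) + t * I) * (σ + t * I + 1)) := by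
  refine integrable_inv_one_add_sq.mono' ?_ (ae_of_all _ fun t ↦ ?_)
  · refine Continuous.aestronglyMeasurable (Continuous.div₀ continuous_const (by fun_prop) fun t ↦ ?_)
    refine mul_ne_zero (fun h ↦ ?_) (fun h ↦ ?_)
    · have := congrArg re h
      simp at this; linarith
    · have := congrArg re h
      simp at this; linarith
  · simpa using norm_one_div_mul_add_one_le (s := (σ : ℂ) + t * I) (by simpa using hσ)

lemma integral_cpow_div_eq {σ y : ℝ} (hσ : 1 ≤ σ) (hy : 0 < y) :
    ∫ t : ℝ, (y : ℂ) ^ (-((σ : ℂ) + t * I)) * (1 / (((σ : ℂ) + t * I) * (σ + t * I + 1))) =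
      2 * Real.pi * (max (1 - y) 0 : ℝ) := by
  set f : ℝ → ℂ := fun t ↦ (Ioc (0 : ℝ) 1).indicator (fun _ ↦ 1) t -
    (Ioc (0 : ℝ) 1).indicator (fun t ↦ (t : ℂ) ^ (1 : ℂ)) t with hf
  have hM : ∀ s : ℂ, 0 < s.re → HasMellin f s (1 / (s * (s + 1))) := by
    intro s hs
    have h1 := hasMellin_one_Ioc hs
    have h2 := hasMellin_cpow_Ioc 1 (s := s) (by rw [one_re]; linarith)
    have h3 := hasMellin_sub h1.1 h2.1
    rw [h1.2, h2.2] at h3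
    have hs0 : s ≠ 0 := by rintro rfl; simp at hs
    have hs1 : s + 1 ≠ 0 := by
      intro h; have := congrArg re h; simp at this; linarith
    have h4 : 1 / s - 1 / (s + 1) = 1 / (s * (s + 1)) := by field_simp; ring
    rwa [h4] at h3
  have hfy : ∀ y : ℝ, 0 < y → f y = (max (1 - y) 0 : ℝ) := by
    intro y hy
    by_cases h : y ≤ 1
    · simp only [hf, indicator, mem_Ioc, hy, h, and_self, if_true, cpow_one]
      rw [max_eq_left (by linarith)]; push_cast; ring
    · simp only [hf, indicator, mem_Ioc, hy, h, and_false, if_false]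
      rw [max_eq_right (by linarith)]; simp
  have hcont : ContinuousAt f y := by
    have : ContinuousAt (fun y : ℝ ↦ ((max (1 - y) 0 : ℝ) : ℂ)) y := by
      have : Continuous (fun y : ℝ ↦ ((max (1 - y) 0 : ℝ) : ℂ)) := by fun_prop
      exact this.continuousAt
    refine this.congr ?_
    filter_upwards [lt_mem_nhds hy] with z hz using (hfy z hz).symm
  have hre : ∀ t : ℝ, ((σ : ℂ) + t * I).re = σ := fun t ↦ by simp
  have hV : Complex.VerticalIntegrable (mellin f) σ := by
    refine (integrable_one_div_mul_add_one hσ).congr (ae_of_all _ fun t ↦ ?_)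
    exact (hM _ (by rw [hre]; linarith)).2.symm
  have h := mellinInv_mellin_eq σ f hy (hM σ (by simp; linarith)).1 hV hcont
  rw [hfy y hy, mellinInv] at h
  rw [← h, Complex.real_smul]
  have hpi : (Real.pi : ℂ) ≠ 0 := by exact_mod_cast Real.pi_ne_zero
  push_cast
  rw [← mul_assoc, mul_one_div_cancel (by simp), one_mul]
  refine integral_congr_ae (ae_of_all _ fun t ↦ ?_)
  simp only [smul_eq_mul]
  rw [(hM _ (by rw [hre]; linarith)).2]

/-- A smoothed Perron formula. -/
lemma integral_LSeries_mul_eq {a : ℕ → ℂ} {σ x : ℝ} {M : ℕ} (hσ : 1 ≤ σ) (hx : 0 < x)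
    (hM : x ≤ M) (ha : LSeriesSummable a σ) :
    ∫ t : ℝ, LSeries a ((σ : ℂ) + t * I) * ((x : ℂ) ^ ((σ : ℂ) + t * I) *
      (1 / (((σ : ℂ) + t * I) * (σ + t * I + 1)))) =
      2 * Real.pi * ∑ n ∈ Finset.Icc 1 M, a n * (max (1 - n / x) 0 : ℝ) := by
  set k : ℝ → ℂ := fun t ↦ 1 / (((σ : ℂ) + t * I) * (σ + t * I + 1)) with hk
  set F : ℕ → ℝ → ℂ := fun n t ↦
    LSeries.term a ((σ : ℂ) + t * I) n * ((x : ℂ) ^ ((σ : ℂ) + t * I) * k t) with hF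
  have hre : ∀ t : ℝ, ((σ : ℂ) + t * I).re = σ := fun t ↦ by simp
  have hxn : ∀ t : ℝ, ‖(x : ℂ) ^ ((σ : ℂ) + t * I)‖ = x ^ σ := fun t ↦ by
    rw [norm_cpow_eq_rpow_re_of_pos hx, hre]
  have hkint : Integrable k := integrable_one_div_mul_add_one hσ
  have hFn : ∀ n t, F n t = if n = 0 then 0 else
      a n * ((((n : ℝ) / x : ℝ) : ℂ) ^ (-((σ : ℂ) + t * I)) * k t) := by
    intro n t
    split_ifs with h
    · simp [hF, h]
    · have hn : (0 : ℝ) < n := by exact_mod_cast Nat.pos_of_ne_zero h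
      simp only [hF]
      rw [LSeries.term_of_ne_zero h, ofReal_div, Complex.cpow_neg, div_cpow_ofReal_nonneg hn.le hx.le,
        ofReal_natCast]
      have h1 : (x : ℂ) ^ ((σ : ℂ) + t * I) ≠ 0 := by
        rw [Ne, cpow_eq_zero_iff]; simp [hx.ne']
      have h2 : (n : ℂ) ^ ((σ : ℂ) + t * I) ≠ 0 := by
        rw [Ne, cpow_eq_zero_iff]; simp [h]
      field_simp
  have hnorm : ∀ n t, ‖F n t‖ = ‖LSeries.term a σ n‖ * (x ^ σ * ‖k t‖) := by
    intro n t
    simp only [hF]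
    rw [norm_mul, norm_mul, hxn, LSeries.norm_term_eq, LSeries.norm_term_eq, hre, ofReal_re]
  have hFint : ∀ n, Integrable (F n) := by
    intro n
    by_cases h : n = 0
    · have : F n = fun _ ↦ 0 := funext fun t ↦ by rw [hFn, if_pos h]
      rw [this]; exact integrable_zero ℝ ℂ volume
    have hn : (0 : ℝ) < n := by exact_mod_cast Nat.pos_of_ne_zero h
    have : F n = fun t : ℝ ↦ a n * ((((n : ℝ) / x : ℝ) : ℂ) ^ (-((σ : ℂ) + t * I)) * k t) :=
      funext fun t ↦ by rw [hFn, if_neg h]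
    rw [this]
    refine Integrable.const_mul ?_ _
    refine hkint.bdd_mul (c := (n / x) ^ (-σ)) ?_ (ae_of_all _ fun t ↦ ?_)
    · refine Continuous.aestronglyMeasurable ?_
      refine Continuous.const_cpow (by fun_prop) (Or.inl ?_)
      exact_mod_cast (div_pos hn hx).ne'
    · rw [norm_cpow_eq_rpow_re_of_pos (div_pos hn hx), neg_re, hre]
  have hsum : Summable fun n ↦ ∫ t, ‖F n t‖ := by
    simp only [hnorm]
    simp_rw [integral_const_mul]
    exact ha.norm.mul_right _
  have h1 := hasSum_integral_of_summable_integral_norm hFint hsum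
  have h2 : ∀ t, ∑' n, F n t = LSeries a ((σ : ℂ) + t * I) * ((x : ℂ) ^ ((σ : ℂ) + t * I) * k t) := by
    intro t
    simp only [hF]
    rw [tsum_mul_right, LSeries]
  simp only [h2] at h1
  have h3 : ∀ n, ∫ t, F n t = if n = 0 then 0 else
      2 * Real.pi * (a n * (max (1 - n / x) 0 : ℝ)) := by
    intro n
    simp only [hFn]
    split_ifs with h
    · simp
    · have hn : (0 : ℝ) < n := by exact_mod_cast Nat.pos_of_ne_zero h
      rw [integral_const_mul, integral_cpow_div_eq hσ (div_pos hn hx)]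
      ring
  simp only [h3] at h1
  refine h1.unique ?_
  rw [Finset.mul_sum]
  have h4 : ∀ n ∉ Finset.Icc 1 M, (if n = 0 then (0 : ℂ) else
      2 * Real.pi * (a n * (max (1 - n / x) 0 : ℝ))) = 0 := by
    intro n hn
    split_ifs with h
    · rfl
    · have : M < n := by
        by_contra! h'
        exact hn (Finset.mem_Icc.2 ⟨Nat.pos_of_ne_zero h, h'⟩)
      have hMn : (M : ℝ) < n := by exact_mod_cast this
      rw [max_eq_right]
      · simp
      · rw [sub_nonpos, le_div_iff₀ hx]; linarith
  have h5 : ∑ n ∈ Finset.Icc 1 M, 2 * (Real.pi : ℂ) * (a n * (max (1 - n / x) 0 : ℝ)) =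
      ∑ n ∈ Finset.Icc 1 M, if n = 0 then (0 : ℂ) else
        2 * Real.pi * (a n * (max (1 - n / x) 0 : ℝ)) := by
    refine Finset.sum_congr rfl fun n hn ↦ ?_
    have : n ≠ 0 := by have := (Finset.mem_Icc.1 hn).1; omega
    rw [if_neg this]
  rw [h5]
  exact hasSum_sum_of_ne_finset_zero h4

end Perron

end Vinogradov

namespace Vinogradov

open Complex MeasureTheory Set Asymptotics Topology

/-! ### Shifting the contour -/

section Contour

lemma norm_LSeries_le_of_norm_le_log {a : ℕ → ℂ} (ha : ∀ n, n ≠ 0 → ‖a n‖ ≤ Real.log n + 1) {δ : ℝ}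
    (hδ : 0 < δ) (hδ1 : δ ≤ 1) {s : ℂ} (hs : s.re = 1 + δ) :
    LSeriesSummable a s ∧ ‖LSeries a s‖ ≤ 30 / δ ^ 2 := by
  set D := 4 / δ + 1 with hD
  have hD0 : 0 < D := by positivity
  have hb : ∀ n : ℕ, n ≠ 0 → ‖a n‖ ≤ D * (n : ℝ) ^ (δ / 2) := by
    intro n hn
    have h1 : (1 : ℝ) ≤ n := by exact_mod_cast Nat.one_le_iff_ne_zero.2 hn
    have h2 := two_mul_log_add_one_le (κ := δ / 2) (by positivity) h1
    have h3 := Real.log_nonneg h1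
    have h4 : 2 / (δ / 2) + 1 = D := by rw [hD]; field_simp; ring
    rw [h4] at h2
    linarith [ha n hn]
  refine ⟨LSeriesSummable_of_le_const_mul_rpow (x := 1 + δ / 2) (by rw [hs]; linarith)
    ⟨D, fun n hn ↦ by simpa using hb n hn⟩, ?_⟩
  set a' : ℕ → ℂ := fun n ↦ if n = 0 then 0 else a n * (n : ℂ) ^ (-(δ / 2 : ℂ)) / D with ha'
  have hnn : ∀ n : ℕ, n ≠ 0 → ‖(n : ℂ) ^ (-(δ / 2 : ℂ))‖ = ((n : ℝ) ^ (δ / 2))⁻¹ := by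
    intro n hn
    rw [norm_natCast_cpow_of_pos (Nat.pos_of_ne_zero hn), ← Real.rpow_neg (Nat.cast_nonneg _)]
    congr 1
    rw [neg_re]; norm_cast
  have h1 : ∀ n, ‖a' n‖ ≤ 1 := by
    intro n
    simp only [ha']
    split_ifs with h
    · simp
    · have hn : (0 : ℝ) < n := by exact_mod_cast Nat.pos_of_ne_zero h
      rw [norm_div, norm_mul, hnn n h, Complex.norm_real, Real.norm_of_nonneg hD0.le,
        div_le_one hD0, ← div_eq_mul_inv, div_le_iff₀ (by positivity)]
      exact hb n h
  have hre : (s - δ / 2).re = 1 + δ / 2 := by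
    rw [sub_re, hs, show ((δ : ℂ) / 2) = ((δ / 2 : ℝ) : ℂ) by push_cast; ring, ofReal_re]; ring
  have h2 := norm_LSeries_le h1 (s := s - δ / 2) (by rw [hre]; linarith) (by rw [hre]; linarith)
  have h3 : LSeries a s = D * LSeries a' (s - δ / 2) := by
    rw [LSeries, LSeries, ← tsum_mul_left]
    refine tsum_congr fun n ↦ ?_
    by_cases h : n = 0
    · simp [h]
    have hn : (n : ℂ) ≠ 0 := by exact_mod_cast h
    have hDc : (D : ℂ) ≠ 0 := by exact_mod_cast hD0.ne'
    rw [LSeries.term_of_ne_zero h, LSeries.term_of_ne_zero h]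
    simp only [ha', h, if_false]
    rw [Complex.cpow_sub _ _ hn, Complex.cpow_neg]
    have : (n : ℂ) ^ (δ / 2 : ℂ) ≠ 0 := by rw [Ne, cpow_eq_zero_iff]; simp [h]
    have : (n : ℂ) ^ s ≠ 0 := by rw [Ne, cpow_eq_zero_iff]; simp [h]
    field_simp
  rw [h3, norm_mul, Complex.norm_real, Real.norm_of_nonneg hD0.le]
  calc D * ‖LSeries a' (s - δ / 2)‖ ≤ (5 / δ) * (3 / (δ / 2)) := by
        gcongr
        · rw [hD, div_add_one hδ.ne']; gcongr; linarith
        · refine h2.trans (le_of_eq ?_)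
          rw [hre]; congr 1; ring
    _ = 30 / δ ^ 2 := by field_simp; ring

lemma arctan_le_self {x : ℝ} (hx : 0 ≤ x) : Real.arctan x ≤ x := by
  have h := Real.le_tan (Real.arctan_nonneg.2 hx) (Real.arctan_lt_pi_div_two x)
  rwa [Real.tan_arctan] at h

lemma norm_setIntegral_Ioi_le {f : ℝ → ℂ} {B T : ℝ} (hT : 0 < T) (hB : 0 ≤ B)
    (hf : ∀ t, ‖f t‖ ≤ B * (1 + t ^ 2)⁻¹) : ‖∫ t in Ioi T, f t‖ ≤ B / T := by
  calc ‖∫ t in Ioi T, f t‖ ≤ ∫ t in Ioi T, B * (1 + t ^ 2)⁻¹ :=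
        norm_integral_le_of_norm_le (integrable_inv_one_add_sq.const_mul B).integrableOn
          (ae_of_all _ hf)
    _ = B * Real.arctan T⁻¹ := by
        rw [integral_const_mul, integral_Ioi_inv_one_add_sq, Real.arctan_inv_of_pos hT]
    _ ≤ B * T⁻¹ := by gcongr; exact arctan_le_self (by positivity)
    _ = B / T := by rw [div_eq_mul_inv]

lemma norm_setIntegral_Iic_le {f : ℝ → ℂ} {B T : ℝ} (hT : 0 < T) (hB : 0 ≤ B)
    (hf : ∀ t, ‖f t‖ ≤ B * (1 + t ^ 2)⁻¹) : ‖∫ t in Iic (-T), f t‖ ≤ B / T := by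
  calc ‖∫ t in Iic (-T), f t‖ ≤ ∫ t in Iic (-T), B * (1 + t ^ 2)⁻¹ :=
        norm_integral_le_of_norm_le (integrable_inv_one_add_sq.const_mul B).integrableOn
          (ae_of_all _ hf)
    _ = B * Real.arctan T⁻¹ := by
        rw [integral_const_mul, integral_Iic_inv_one_add_sq, Real.arctan_inv_of_pos hT,
          Real.arctan_neg]; ring
    _ ≤ B * T⁻¹ := by gcongr; exact arctan_le_self (by positivity)
    _ = B / T := by rw [div_eq_mul_inv]

/-- Shifting the contour in the smoothed Perron formula. -/
lemma norm_sum_mul_max_le {a : ℕ → ℂ} (ha : ∀ n, n ≠ 0 → ‖a n‖ ≤ Real.log n + 1) {G : ℂ → ℂ}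
    {x r T K : ℝ} {M : ℕ} (hx : Real.exp 1 ≤ x) (hM : x ≤ M) (hr0 : 0 < r) (hr : r ≤ 1 / 2)
    (hT : 1 ≤ T) (hK : 0 ≤ K)
    (hd : ∀ s : ℂ, 1 - r ≤ s.re → s.re ≤ 2 → |s.im| ≤ T → DifferentiableAt ℂ G s)
    (hb : ∀ s : ℂ, 1 - r ≤ s.re → s.re ≤ 2 → |s.im| ≤ T → ‖G s‖ ≤ K)
    (hG : ∀ s : ℂ, 1 < s.re → G s = LSeries a s) :
    ‖∑ n ∈ Finset.Icc 1 M, a n * (max (1 - n / x) 0 : ℝ)‖ ≤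
      100 * (x * Real.log x ^ 2 / T + T * K * x ^ (1 - r) + K * x / T ^ 2) := by
  have hx0 : 0 < x := (Real.exp_pos 1).trans_le hx
  have hx1 : 1 ≤ x := (Real.one_le_exp (by norm_num)).trans hx
  have hL : 1 ≤ Real.log x := (Real.le_log_iff_exp_le hx0).2 hx
  have hT0 : 0 < T := by linarith
  set L := Real.log x with hLdef
  set δ := 1 / L with hδ
  have hδ0 : 0 < δ := by positivity
  have hδ1 : δ ≤ 1 := by rw [hδ, div_le_one (by linarith)]; exact hL
  set σ := 1 + δ with hσ
  have hxσ : x ^ σ ≤ 3 * x := by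
    rw [hσ, Real.rpow_add hx0, Real.rpow_one, mul_comm]
    gcongr
    rw [Real.rpow_def_of_pos hx0, ← hLdef, hδ, mul_one_div_cancel (by linarith)]
    exact Real.exp_one_lt_d9.le.trans (by norm_num)
  set H : ℂ → ℂ := fun s ↦ G s * ((x : ℂ) ^ s * (1 / (s * (s + 1)))) with hH
  have hre : ∀ t : ℝ, ((σ : ℂ) + t * I).re = σ := fun t ↦ by simp
  have hP := integral_LSeries_mul_eq (a := a) (σ := σ) (by linarith) hx0 hM
    (norm_LSeries_le_of_norm_le_log ha hδ0 hδ1 (by simp [hσ])).1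
  have hP' : ∫ t : ℝ, H (σ + t * I) = 
      2 * Real.pi * ∑ n ∈ Finset.Icc 1 M, a n * (max (1 - n / x) 0 : ℝ) := by
    rw [← hP]
    refine integral_congr_ae (ae_of_all _ fun t ↦ ?_)
    simp only [hH]
    rw [hG _ (by rw [hre]; linarith)]
  set B := 90 * x * L ^ 2 with hB
  have hB0 : 0 ≤ B := by positivity
  have hHb : ∀ t : ℝ, ‖H (σ + t * I)‖ ≤ B * (1 + t ^ 2)⁻¹ := by
    intro t
    simp only [hH]
    rw [hG _ (by rw [hre]; linarith), norm_mul, norm_mul, norm_cpow_eq_rpow_re_of_pos hx0, hre]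
    have h1 := (norm_LSeries_le_of_norm_le_log ha hδ0 hδ1 (hre t)).2
    have h2 := norm_one_div_mul_add_one_le (s := σ + t * I) (by rw [hre]; linarith)
    have h3 : ((σ : ℂ) + t * I).im = t := by simp
    rw [h3] at h2
    calc _ ≤ 30 / δ ^ 2 * (3 * x * (1 + t ^ 2)⁻¹) := by gcongr
      _ = B * (1 + t ^ 2)⁻¹ := by rw [hB, hδ]; field_simp; ring
  have hHd : ∀ s : ℂ, 1 - r ≤ s.re → s.re ≤ 2 → |s.im| ≤ T → DifferentiableAt ℂ H s := by
    intro s h1 h2 h3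
    have hs0 : s ≠ 0 := by rintro rfl; simp at h1; linarith
    have hs1 : s + 1 ≠ 0 := by
      intro h; have := congrArg re h; simp at this; linarith
    have hxc : (x : ℂ) ≠ 0 := by exact_mod_cast hx0.ne'
    refine (hd s h1 h2 h3).mul (DifferentiableAt.mul ?_ ?_)
    · exact differentiableAt_id.const_cpow (Or.inl hxc)
    · exact (differentiableAt_const _).div (by fun_prop) (mul_ne_zero hs0 hs1)
  have hHi : Integrable fun t : ℝ ↦ H (σ + t * I) := by
    refine (integrable_inv_one_add_sq.const_mul B).mono' ?_ (ae_of_all _ hHb)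
    have hab : LSeries.abscissaOfAbsConv a ≤ 1 := by
      refine LSeries.abscissaOfAbsConv_le_of_forall_lt_LSeriesSummable (x := 1) fun y hy ↦ ?_
      have hm : 0 < min (y - 1) 1 := lt_min (by linarith) one_pos
      refine ((norm_LSeries_le_of_norm_le_log ha hm (min_le_right _ _)
        (s := ((1 + min (y - 1) 1 : ℝ) : ℂ)) (ofReal_re _)).1).of_re_le_re ?_
      rw [ofReal_re, ofReal_re]
      linarith [min_le_left (y - 1) 1]
    refine Continuous.aestronglyMeasurable (continuous_iff_continuousAt.2 fun t ↦ ?_)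
    have hs1 : 1 < ((σ : ℂ) + t * I).re := by rw [hre]; linarith
    have hmem : {s : ℂ | LSeries.abscissaOfAbsConv a < s.re} ∈ 𝓝 ((σ : ℂ) + t * I) :=
      (isOpen_re_gt_EReal _).mem_nhds (lt_of_le_of_lt hab (by exact_mod_cast hs1))
    have hL' := ((LSeries_differentiableOn a).differentiableAt hmem).continuousAt
    have hG' : ContinuousAt G ((σ : ℂ) + t * I) := by
      refine hL'.congr ?_
      filter_upwards [(isOpen_lt continuous_const continuous_re).mem_nhds hs1] with z hz
      exact (hG z hz).symm
    have hsn : ((σ : ℂ) + t * I) * (σ + t * I + 1) ≠ 0 := by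
      refine mul_ne_zero (fun h ↦ ?_) (fun h ↦ ?_)
      · have := congrArg re h
        simp at this; linarith
      · have := congrArg re h
        simp at this; linarith
    have hxc : (x : ℂ) ≠ 0 := by exact_mod_cast hx0.ne'
    have hH' : ContinuousAt H ((σ : ℂ) + t * I) := by
      refine hG'.mul (ContinuousAt.mul ?_ ?_)
      · exact (differentiableAt_id.const_cpow (Or.inl hxc)).continuousAt
      · exact continuousAt_const.div (by fun_prop) hsn
    exact ContinuousAt.comp (f := fun t : ℝ ↦ (σ : ℂ) + t * I) hH' (by fun_prop)
  have hsplit : ∫ t : ℝ, H (σ + t * I) = (∫ t in Iic (-T), H (σ + t * I)) +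
      (∫ t in (-T)..T, H (σ + t * I)) + ∫ t in Ioi T, H (σ + t * I) := by
    rw [intervalIntegral.integral_of_le (by linarith), ← setIntegral_union _ measurableSet_Ioc
      hHi.integrableOn hHi.integrableOn, Iic_union_Ioc_eq_Iic (by linarith),
      ← setIntegral_union _ measurableSet_Ioi hHi.integrableOn hHi.integrableOn, Iic_union_Ioi,
      setIntegral_univ]
    · exact Set.disjoint_left.2 fun t h1 h2 ↦ absurd (mem_Ioi.1 h2) (not_lt.2 (mem_Iic.1 h1))
    · exact Set.disjoint_left.2 fun t h1 h2 ↦ absurd h2.1 (not_lt.2 (mem_Iic.1 h1))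
  have hrect := integral_boundary_rect_eq_zero_of_differentiableOn H
    (((1 - r : ℝ) : ℂ) + ((-T : ℝ) : ℂ) * I) ((σ : ℂ) + (T : ℂ) * I) (fun s hs ↦ by
      have e1 : (((1 - r : ℝ) : ℂ) + ((-T : ℝ) : ℂ) * I).re = 1 - r := by simp
      have e2 : (((1 - r : ℝ) : ℂ) + ((-T : ℝ) : ℂ) * I).im = -T := by simp
      have e3 : ((σ : ℂ) + (T : ℂ) * I).im = T := by simp
      rw [e1, e2, e3, hre, uIcc_of_le (by linarith), uIcc_of_le (by linarith)] at hs
      exact (hHd s hs.1.1 (hs.1.2.trans (by linarith)) (abs_le.2 hs.2)).differentiableWithinAt)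
  have e1 : (((1 - r : ℝ) : ℂ) + ((-T : ℝ) : ℂ) * I).re = 1 - r := by simp
  have e2 : (((1 - r : ℝ) : ℂ) + ((-T : ℝ) : ℂ) * I).im = -T := by simp
  have e3 : ((σ : ℂ) + (T : ℂ) * I).im = T := by simp
  rw [e1, e2, e3, hre] at hrect
  have hh : ∀ τ : ℝ, |τ| = T → ‖∫ y in (1 - r)..σ, H (y + τ * I)‖ ≤ 6 * (K * x / T ^ 2) := by
    intro τ hτ
    have hc : ∀ y ∈ uIoc (1 - r) σ, ‖H (y + τ * I)‖ ≤ 3 * (K * x / T ^ 2) := by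
      intro y hy
      rw [uIoc_of_le (by linarith)] at hy
      have f1 : ((y : ℂ) + τ * I).re = y := by simp
      have f2 : ((y : ℂ) + τ * I).im = τ := by simp
      simp only [hH]
      rw [norm_mul, norm_mul, norm_cpow_eq_rpow_re_of_pos hx0, f1]
      have h1 := hb (y + τ * I) (by rw [f1]; exact hy.1.le) (by rw [f1]; linarith [hy.2])
        (by rw [f2, hτ])
      have h2 : x ^ y ≤ 3 * x := le_trans (Real.rpow_le_rpow_of_exponent_le hx1 hy.2) hxσ
      have h3 : ‖1 / (((y : ℂ) + τ * I) * (y + τ * I + 1))‖ ≤ 1 / T ^ 2 := by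
        rw [norm_div, norm_one, norm_mul, sq]
        have g1 := abs_im_le_norm ((y : ℂ) + τ * I)
        have g2 := abs_im_le_norm ((y : ℂ) + τ * I + 1)
        rw [f2, hτ] at g1
        rw [add_im, f2, one_im, add_zero, hτ] at g2
        gcongr
      calc _ ≤ K * (3 * x * (1 / T ^ 2)) := by gcongr
        _ = 3 * (K * x / T ^ 2) := by ring
    refine (intervalIntegral.norm_integral_le_of_norm_le_const hc).trans ?_
    rw [abs_of_nonneg (by linarith)]
    calc 3 * (K * x / T ^ 2) * (σ - (1 - r)) ≤ 3 * (K * x / T ^ 2) * 2 := by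
          gcongr; linarith
      _ = _ := by ring
  have hl : ‖∫ y in (-T)..T, H ((1 - r : ℝ) + y * I)‖ ≤ 4 * (T * K * x ^ (1 - r)) := by
    have hc : ∀ y ∈ uIoc (-T) T, ‖H ((1 - r : ℝ) + y * I)‖ ≤ 2 * (K * x ^ (1 - r)) := by
      intro y hy
      rw [uIoc_of_le (by linarith)] at hy
      have f1 : (((1 - r : ℝ) : ℂ) + y * I).re = 1 - r := by simp
      have f2 : (((1 - r : ℝ) : ℂ) + y * I).im = y := by simp
      simp only [hH]
      rw [norm_mul, norm_mul, norm_cpow_eq_rpow_re_of_pos hx0, f1]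
      have h1 := hb ((1 - r : ℝ) + y * I) (by rw [f1]) (by rw [f1]; linarith)
        (by rw [f2]; exact abs_le.2 ⟨hy.1.le, hy.2⟩)
      have h3 : ‖1 / ((((1 - r : ℝ) : ℂ) + y * I) * ((1 - r : ℝ) + y * I + 1))‖ ≤ 2 := by
        rw [norm_div, norm_one, norm_mul]
        have g1 := (le_abs_self _).trans (abs_re_le_norm (((1 - r : ℝ) : ℂ) + y * I))
        have g2 := (le_abs_self _).trans (abs_re_le_norm (((1 - r : ℝ) : ℂ) + y * I + 1))
        rw [f1] at g1
        rw [add_re, f1, one_re] at g2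
        calc _ ≤ 1 / ((1 / 2 : ℝ) * 1) := by gcongr <;> linarith
          _ = 2 := by norm_num
      calc _ ≤ K * (x ^ (1 - r) * 2) := by gcongr
        _ = _ := by ring
    refine (intervalIntegral.norm_integral_le_of_norm_le_const hc).trans (le_of_eq ?_)
    rw [abs_of_nonneg (by linarith)]
    ring
  have hmid : ‖∫ t in (-T)..T, H (σ + t * I)‖ ≤
      4 * (T * K * x ^ (1 - r)) + 12 * (K * x / T ^ 2) := by
    have g1 := hh (-T) (by rw [abs_neg, abs_of_pos hT0])
    have g2 := hh T (abs_of_pos hT0)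
    have : I • ∫ t in (-T)..T, H (σ + t * I) = I • (∫ y in (-T)..T, H ((1 - r : ℝ) + y * I)) +
        (∫ y in (1 - r)..σ, H (y + T * I)) - ∫ y in (1 - r)..σ, H (y + (-T : ℝ) * I) := by
      linear_combination hrect
    have h5 := congrArg norm this
    rw [norm_smul, norm_I, one_mul] at h5
    rw [h5]
    refine (norm_sub_le _ _).trans ?_
    have h6 := norm_add_le (I • (∫ y in (-T)..T, H ((1 - r : ℝ) + y * I)))
      (∫ y in (1 - r)..σ, H (y + T * I))
    rw [norm_smul, norm_I, one_mul] at h6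
    linarith
  have t1 := norm_setIntegral_Iic_le hT0 hB0 hHb
  have t2 := norm_setIntegral_Ioi_le hT0 hB0 hHb
  have hfin : ‖∫ t : ℝ, H (σ + t * I)‖ ≤ 2 * (B / T) + 4 * (T * K * x ^ (1 - r)) +
      12 * (K * x / T ^ 2) := by
    rw [hsplit]
    refine (norm_add₃_le).trans ?_
    linarith
  rw [hP', norm_mul, norm_mul, Complex.norm_real, Real.norm_of_nonneg Real.pi_pos.le] at hfin
  have hpi := Real.pi_gt_three
  have n2 : ‖(2 : ℂ)‖ = 2 := by norm_num
  rw [n2] at hfin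
  set Y := ‖∑ n ∈ Finset.Icc 1 M, a n * (max (1 - n / x) 0 : ℝ)‖ with hY
  have hY0 : 0 ≤ Y := norm_nonneg _
  have h6 : 6 * Y ≤ 2 * Real.pi * Y := by gcongr; linarith
  have hBT : B / T = 90 * (x * L ^ 2 / T) := by rw [hB]; ring
  rw [hBT] at hfin
  have z1 : 0 ≤ x * L ^ 2 / T := by positivity
  have z2 : 0 ≤ T * K * x ^ (1 - r) := by positivity
  have z3 : 0 ≤ K * x / T ^ 2 := by positivity
  linarith

end Contour

end Vinogradov

namespace Vinogradov

open Complex MeasureTheory Set Asymptotics Topology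

/-! ### Removing the smoothing -/

section SiegelWalfisz

lemma pow_mul_exp_neg_le {c y : ℝ} (hc : 0 < c) (hy : 0 ≤ y) (m : ℕ) :
    y ^ m * Real.exp (-(c * y)) ≤ m.factorial / c ^ m := by
  have h := Real.pow_div_factorial_le_exp (c * y) (by positivity) m
  rw [div_le_iff₀ (by positivity), mul_pow] at h
  rw [Real.exp_neg, ← div_eq_mul_inv, div_le_div_iff₀ (Real.exp_pos _) (by positivity)]
  linarith

/-- The smoothed sum bound coming from a region of the shape `1 - c / √(log x)`. -/
lemma exists_norm_sum_mul_max_le_of_region (A : ℕ) {C₀ : ℝ} (hC₀ : 2 ≤ C₀) : ∃ C : ℝ, 0 < C ∧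
    ∀ (a : ℕ → ℂ) (G : ℂ → ℂ), (∀ n, n ≠ 0 → ‖a n‖ ≤ Real.log n + 1) →
    (∀ s : ℂ, 1 < s.re → G s = LSeries a s) → ∀ (x : ℝ) (M : ℕ), Real.exp 1 ≤ x → x ≤ M →
    (∀ s : ℂ, 1 - C₀⁻¹ * (√(Real.log x))⁻¹ ≤ s.re → s.re ≤ 2 → |s.im| ≤ Real.log x ^ (A + 2) →
      DifferentiableAt ℂ G s ∧ ‖G s‖ ≤ C₀ * Real.log x) →
    ‖∑ n ∈ Finset.Icc 1 M, a n * (max (1 - n / x) 0 : ℝ)‖ ≤ C * x / Real.log x ^ A := by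
  set D : ℝ := (4 * A + 6).factorial / C₀⁻¹ ^ (4 * A + 6) with hD
  have hD0 : 0 < D := by positivity
  refine ⟨100 * (1 + C₀ * D + C₀), by positivity, fun a G ha hG x M hx hM h ↦ ?_⟩
  have hx0 : 0 < x := (Real.exp_pos 1).trans_le hx
  have hL : 1 ≤ Real.log x := (Real.le_log_iff_exp_le hx0).2 hx
  set L := Real.log x with hLdef
  have hL0 : 0 < L := by linarith
  have hy1 : 1 ≤ √L := Real.one_le_sqrt.2 hL
  have hyy : √L ^ 2 = L := Real.sq_sqrt hL0.le
  set y := √L with hy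
  have hr : C₀⁻¹ * y⁻¹ ≤ 1 / 2 := by
    calc C₀⁻¹ * y⁻¹ ≤ 2⁻¹ * 1 := by gcongr; exact inv_le_one_of_one_le₀ hy1
      _ = 1 / 2 := by norm_num
  have h1 := norm_sum_mul_max_le ha (G := G) (r := C₀⁻¹ * y⁻¹) (T := L ^ (A + 2)) (K := C₀ * L)
    hx hM (by positivity) hr (one_le_pow₀ hL) (by positivity) (fun s a b c ↦ (h s a b c).1)
    (fun s a b c ↦ (h s a b c).2) hG
  refine h1.trans ?_
  rw [← hLdef]
  have t1 : x * L ^ 2 / L ^ (A + 2) = x / L ^ A := by field_simp; ring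
  have t2 : L ^ (A + 2) * (C₀ * L) * x ^ (1 - C₀⁻¹ * y⁻¹) ≤ C₀ * D * (x / L ^ A) := by
    have e1 : x ^ (1 - C₀⁻¹ * y⁻¹) = x * Real.exp (-(C₀⁻¹ * y)) := by
      rw [sub_eq_add_neg, Real.rpow_add hx0, Real.rpow_one, Real.rpow_def_of_pos hx0, ← hLdef, ← hyy]
      congr 2
      field_simp
    have e2 := pow_mul_exp_neg_le (c := C₀⁻¹) (by positivity) (y := y) (by positivity) (4 * A + 6)
    rw [← hD] at e2
    have e3 : L ^ (A + 2) * L * L ^ A = y ^ (4 * A + 6) := by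
      rw [← hyy]; ring
    rw [e1, mul_div_assoc', le_div_iff₀ (by positivity)]
    calc _ = C₀ * x * (y ^ (4 * A + 6) * Real.exp (-(C₀⁻¹ * y))) := by rw [← e3]; ring
      _ ≤ C₀ * x * D := by gcongr
      _ = _ := by ring
  have t3 : C₀ * L * x / (L ^ (A + 2)) ^ 2 ≤ C₀ * (x / L ^ A) := by
    rw [mul_div_assoc', div_le_div_iff₀ (by positivity) (by positivity)]
    calc C₀ * L * x * L ^ A = C₀ * x * L ^ (A + 1) := by ring
      _ ≤ C₀ * x * L ^ (2 * A + 4) := by gcongr <;> first | exact hL | omega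
      _ = _ := by ring
  calc _ ≤ 100 * (x / L ^ A + C₀ * D * (x / L ^ A) + C₀ * (x / L ^ A)) := by rw [t1]; gcongr
    _ = _ := by ring

lemma max_one_sub_div_mul {x : ℝ} (hx : 0 < x) (y : ℝ) :
    x * max (1 - y / x) 0 = max (x - y) 0 := by
  rw [mul_max_of_nonneg _ _ hx.le, mul_zero, mul_sub, mul_one, mul_div_cancel₀ _ hx.ne']

/-- Removing the smooth weight by differencing. -/
lemma norm_mul_sum_le_of_smooth {a : ℕ → ℂ} (ha : ∀ n, n ≠ 0 → ‖a n‖ ≤ Real.log n + 1) {N h : ℕ}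
    (hN : 0 < N) {E₁ E₂ : ℝ}
    (h₁ : ‖∑ n ∈ Finset.Icc 1 (N + h), a n * (max (1 - n / (N : ℝ)) 0 : ℝ)‖ ≤ E₁)
    (h₂ : ‖∑ n ∈ Finset.Icc 1 (N + h), a n * (max (1 - n / ((N + h : ℕ) : ℝ)) 0 : ℝ)‖ ≤ E₂) :
    h * ‖∑ n ∈ Finset.Icc 1 N, a n‖ ≤
      (N + h) * E₂ + N * E₁ + h ^ 2 * (Real.log (N + h) + 1) := by
  have hN0 : (0 : ℝ) < N := by exact_mod_cast hN
  have hNh0 : (0 : ℝ) < (N + h : ℕ) := by exact_mod_cast Nat.add_pos_left hN h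
  set S₁ := ∑ n ∈ Finset.Icc 1 (N + h), a n * (max (1 - n / (N : ℝ)) 0 : ℝ) with hS₁
  set S₂ := ∑ n ∈ Finset.Icc 1 (N + h), a n * (max (1 - n / ((N + h : ℕ) : ℝ)) 0 : ℝ) with hS₂
  have hNhN : (N : ℝ) ≤ ((N + h : ℕ) : ℝ) := by exact_mod_cast Nat.le_add_right N h
  have hdis : Finset.Icc 1 (N + h) = Finset.Icc 1 N ∪ Finset.Ioc N (N + h) := by
    ext n; simp only [Finset.mem_union, Finset.mem_Icc, Finset.mem_Ioc]; omega
  have hdisj : Disjoint (Finset.Icc 1 N) (Finset.Ioc N (N + h)) := by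
    rw [Finset.disjoint_left]; intro n h1 h2
    rw [Finset.mem_Icc] at h1; rw [Finset.mem_Ioc] at h2; omega
  have key : ((N + h : ℕ) : ℂ) * S₂ - N * S₁ = h * ∑ n ∈ Finset.Icc 1 N, a n +
      ∑ n ∈ Finset.Ioc N (N + h), a n * ((N + h : ℝ) - n : ℝ) := by
    rw [hS₁, hS₂, Finset.mul_sum, Finset.mul_sum, ← Finset.sum_sub_distrib, hdis,
      Finset.sum_union hdisj, Finset.mul_sum]
    have e1 : ∀ (n : ℕ) (z : ℝ), 0 < z → (z : ℂ) * (a n * (max (1 - n / z) 0 : ℝ)) =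
        a n * (max (z - n) 0 : ℝ) := by
      intro n z hz
      rw [← max_one_sub_div_mul hz]; push_cast; ring
    congr 1
    · refine Finset.sum_congr rfl fun n hn ↦ ?_
      have hn' : (n : ℝ) ≤ N := by exact_mod_cast (Finset.mem_Icc.1 hn).2
      have q1 := e1 n N hN0
      have q2 := e1 n (N + h : ℕ) hNh0
      rw [ofReal_natCast] at q1 q2
      rw [max_eq_left (by linarith : (0 : ℝ) ≤ (N : ℝ) - n)] at q1
      rw [max_eq_left (by linarith : (0 : ℝ) ≤ ((N + h : ℕ) : ℝ) - n)] at q2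
      rw [q1, q2]
      push_cast; ring
    · refine Finset.sum_congr rfl fun n hn ↦ ?_
      have hn' : (N : ℝ) ≤ n := by exact_mod_cast (Finset.mem_Ioc.1 hn).1.le
      have hn'' : (n : ℝ) ≤ (N + h : ℕ) := by exact_mod_cast (Finset.mem_Ioc.1 hn).2
      have q1 := e1 n N hN0
      have q2 := e1 n (N + h : ℕ) hNh0
      rw [ofReal_natCast] at q1 q2
      rw [max_eq_right (by linarith : (N : ℝ) - n ≤ 0)] at q1
      rw [max_eq_left (by linarith : (0 : ℝ) ≤ ((N + h : ℕ) : ℝ) - n)] at q2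
      rw [q1, q2]
      push_cast; ring
  have hrest : ‖∑ n ∈ Finset.Ioc N (N + h), a n * ((N + h : ℝ) - n : ℝ)‖ ≤
      h ^ 2 * (Real.log (N + h) + 1) := by
    refine (norm_sum_le_of_le (n := fun _ ↦ ((Real.log (N + h) + 1) * h : ℝ)) _ fun n hn ↦ ?_).trans
      (le_of_eq ?_)
    · have hn' : (N : ℝ) ≤ n := by exact_mod_cast (Finset.mem_Ioc.1 hn).1.le
      have hn'' : (n : ℝ) ≤ N + h := by exact_mod_cast (Finset.mem_Ioc.1 hn).2
      have hn0 : n ≠ 0 := by have := (Finset.mem_Ioc.1 hn).1; omega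
      rw [norm_mul, Complex.norm_real, Real.norm_of_nonneg (by linarith)]
      have : Real.log n ≤ Real.log (N + h) := Real.log_le_log (by linarith) hn''
      have hl : 0 ≤ Real.log n := Real.log_natCast_nonneg n
      exact mul_le_mul ((ha n hn0).trans (by linarith)) (by linarith) (by linarith) (by linarith)
    · rw [Finset.sum_const, Nat.card_Ioc, Nat.add_sub_cancel_left, nsmul_eq_mul]; ring
  have h3 : (h : ℂ) * ∑ n ∈ Finset.Icc 1 N, a n = ((N + h : ℕ) : ℂ) * S₂ - N * S₁ -
      ∑ n ∈ Finset.Ioc N (N + h), a n * ((N + h : ℝ) - n : ℝ) := by rw [key]; ring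
  have h4 := congrArg norm h3
  rw [norm_mul, Complex.norm_natCast] at h4
  rw [h4]
  refine (norm_sub_le _ _).trans ?_
  have h5 := norm_sub_le (((N + h : ℕ) : ℂ) * S₂) (N * S₁)
  rw [norm_mul, norm_mul, Complex.norm_natCast, Complex.norm_natCast] at h5
  have h6 : ((N + h : ℕ) : ℝ) * ‖S₂‖ ≤ (N + h) * E₂ := by push_cast; gcongr
  have h7 : (N : ℝ) * ‖S₁‖ ≤ N * E₁ := by gcongr
  linarith

lemma pow_log_le {x : ℝ} (hx : 1 ≤ x) (m : ℕ) : Real.log x ^ m ≤ m.factorial * x := by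
  have h := Real.pow_div_factorial_le_exp (Real.log x) (Real.log_nonneg hx) m
  rw [Real.exp_log (by linarith), div_le_iff₀ (by positivity)] at h
  linarith

lemma norm_sum_le_of_smooth {a : ℕ → ℂ} (ha : ∀ n, n ≠ 0 → ‖a n‖ ≤ Real.log n + 1) (A : ℕ) {N : ℕ}
    (hN : 3 ≤ N) {C : ℝ} (hC : 0 ≤ C)
    (hS : ∀ (x : ℝ) (M : ℕ), (N : ℝ) ≤ x → x ≤ M →
      ‖∑ n ∈ Finset.Icc 1 M, a n * (max (1 - n / x) 0 : ℝ)‖ ≤ C * x / Real.log x ^ (2 * A + 1)) :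
    ‖∑ n ∈ Finset.Icc 1 N, a n‖ ≤ (5 * C + 3 + 3 * (A + 1).factorial) * N / Real.log N ^ A := by
  have hN3 : (3 : ℝ) ≤ N := by exact_mod_cast hN
  have hN0 : (0 : ℝ) < N := by linarith
  have hL : 1 ≤ Real.log N := by
    rw [Real.le_log_iff_exp_le hN0]
    exact Real.exp_one_lt_d9.le.trans (by linarith)
  set L := Real.log N with hLdef
  have hL0 : 0 < L := by linarith
  set h := ⌈(N : ℝ) / L ^ (A + 1)⌉₊ with hh
  have hh1 : (N : ℝ) / L ^ (A + 1) ≤ h := Nat.le_ceil _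
  have hh0 : (0 : ℝ) < h := lt_of_lt_of_le (by positivity) hh1
  have hh2 : (h : ℝ) ≤ N / L ^ (A + 1) + 1 := (Nat.ceil_lt_add_one (by positivity)).le
  have hhN : h ≤ N := Nat.ceil_le.2 (div_le_self hN0.le (one_le_pow₀ hL))
  have hhN' : (h : ℝ) ≤ N := by exact_mod_cast hhN
  have hlog : Real.log (N + h) + 1 ≤ 3 * L := by
    have : Real.log (N + h) ≤ Real.log (2 * N) := Real.log_le_log (by positivity) (by linarith)
    rw [Real.log_mul (by norm_num) (by positivity)] at this
    have := Real.log_two_lt_d9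
    linarith
  have hE₂ : C * ((N + h : ℕ) : ℝ) / Real.log ((N + h : ℕ) : ℝ) ^ (2 * A + 1) ≤
      C * (2 * N) / L ^ (2 * A + 1) := by
    have : L ≤ Real.log ((N + h : ℕ) : ℝ) := Real.log_le_log hN0 (by push_cast; linarith)
    gcongr
    push_cast; linarith
  have h1 := norm_mul_sum_le_of_smooth ha (h := h) (by omega : 0 < N)
    (hS N (N + h) le_rfl (by push_cast; linarith))
    ((hS (N + h : ℕ) (N + h) (by push_cast; linarith) le_rfl).trans hE₂)
  set Y := ‖∑ n ∈ Finset.Icc 1 N, a n‖ with hY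
  have h2 : h * Y ≤ 5 * C * N ^ 2 / L ^ (2 * A + 1) + h ^ 2 * (3 * L) := by
    refine h1.trans ?_
    calc _ ≤ (N + N) * (C * (2 * N) / L ^ (2 * A + 1)) + N * (C * N / L ^ (2 * A + 1)) +
          h ^ 2 * (3 * L) := by gcongr
      _ = _ := by ring
  have h3 : 5 * C * N ^ 2 / L ^ (2 * A + 1) ≤ h * (5 * C * N / L ^ A) := by
    calc 5 * C * N ^ 2 / L ^ (2 * A + 1) = N / L ^ (A + 1) * (5 * C * N / L ^ A) := by
          field_simp; ring
      _ ≤ _ := by gcongr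
  have h4 : (h : ℝ) * (3 * L) ≤ (3 + 3 * (A + 1).factorial) * N / L ^ A := by
    have h5 := pow_log_le (by linarith : (1 : ℝ) ≤ N) (A + 1)
    rw [← hLdef] at h5
    rw [le_div_iff₀ (by positivity)]
    calc h * (3 * L) * L ^ A ≤ (N / L ^ (A + 1) + 1) * (3 * L) * L ^ A := by gcongr
      _ = 3 * N + 3 * L ^ (A + 1) := by field_simp; ring
      _ ≤ _ := by linarith
  have h6 : h * Y ≤ h * (5 * C * N / L ^ A + (3 + 3 * (A + 1).factorial) * N / L ^ A) := by
    refine h2.trans ?_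
    rw [mul_add]
    have : (h : ℝ) ^ 2 * (3 * L) = h * (h * (3 * L)) := by ring
    rw [this]
    gcongr
  refine (le_of_mul_le_mul_left h6 hh0).trans (le_of_eq ?_)
  ring

end SiegelWalfisz

end Vinogradov

namespace Vinogradov

open Complex MeasureTheory Set Asymptotics Topology

/-! ### The Siegel-Walfisz theorem -/

section SiegelWalfiszTheorem

open ArithmeticFunction

lemma rpow_le_three_mul_sqrt {m : ℕ} (hm : m ≠ 0) {L Q : ℝ} (hL : 1 ≤ L) (hQ : 0 ≤ Q)
    (h : Q ≤ 3 * L ^ m) : Q ^ (1 / (2 * m) : ℝ) ≤ 3 * √L := by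
  have hm' : (1 : ℝ) ≤ m := by exact_mod_cast Nat.one_le_iff_ne_zero.2 hm
  have hL0 : (0 : ℝ) ≤ L := by linarith
  calc Q ^ (1 / (2 * m) : ℝ) ≤ (3 * L ^ m) ^ (1 / (2 * m) : ℝ) :=
        Real.rpow_le_rpow hQ h (by positivity)
    _ = 3 ^ (1 / (2 * m) : ℝ) * √L := by
        rw [Real.mul_rpow (by norm_num) (by positivity), ← Real.rpow_natCast, ← Real.rpow_mul hL0,
          Real.sqrt_eq_rpow]
        congr 2
        field_simp
    _ ≤ 3 ^ (1 : ℝ) * √L := by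
        gcongr
        · norm_num
        · rw [div_le_one (by positivity)]; linarith
    _ = _ := by rw [Real.rpow_one]

lemma sqrt_le_self_of_one_le {L : ℝ} (hL : 1 ≤ L) : √L ≤ L := by
  rw [Real.sqrt_le_left (by linarith)]
  exact le_self_pow₀ hL (by norm_num)

lemma exp_one_le_of_three_le {x : ℝ} (hx : 3 ≤ x) : Real.exp 1 ≤ x :=
  Real.exp_one_lt_d9.le.trans (by linarith)

lemma one_le_log_of_three_le {x : ℝ} (hx : 3 ≤ x) : 1 ≤ Real.log x :=
  (Real.le_log_iff_exp_le (by linarith)).2 (exp_one_le_of_three_le hx)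

/-- The Siegel–Walfisz theorem for non-principal characters. -/
theorem exists_norm_sum_vonMangoldt_char_le (A B : ℕ) : ∃ C : ℝ, 0 < C ∧ ∀ N : ℕ, 3 ≤ N →
    ∀ (q : ℕ) [NeZero q], (q : ℝ) ≤ Real.log N ^ B → ∀ χ : DirichletCharacter ℂ q, χ ≠ 1 →
      ‖∑ n ∈ Finset.Icc 1 N, χ n * (Λ n : ℂ)‖ ≤ C * N / Real.log N ^ A := by
  set m := (2 * A + 1) + B + 2 with hm
  have hm0 : m ≠ 0 := by omega
  have hκ : (0 : ℝ) < 1 / (2 * m) := by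
    have : (0 : ℝ) < m := by exact_mod_cast Nat.pos_of_ne_zero hm0
    positivity
  obtain ⟨C₁, hC₁, hb⟩ := exists_norm_logDeriv_LFunction_le hκ
  obtain ⟨C₂, hC₂, hr⟩ := exists_norm_sum_mul_max_le_of_region (2 * A + 1)
    (C₀ := 3 * C₁) (by linarith)
  refine ⟨5 * C₂ + 3 + 3 * (A + 1).factorial, by positivity, fun N hN q _ hq χ hχ ↦ ?_⟩
  have hN3 : (3 : ℝ) ≤ N := by exact_mod_cast hN
  have ha : ∀ n : ℕ, n ≠ 0 → ‖χ n * (Λ n : ℂ)‖ ≤ Real.log n + 1 := by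
    intro n _
    rw [norm_mul, Complex.norm_real, Real.norm_of_nonneg vonMangoldt_nonneg]
    have h1 := χ.norm_le_one n
    have h2 : Λ n ≤ Real.log n := vonMangoldt_le_log
    have h3 : 0 ≤ Λ n := vonMangoldt_nonneg
    nlinarith [norm_nonneg (χ n)]
  refine norm_sum_le_of_smooth ha A hN hC₂.le fun x M hx hM ↦ ?_
  have hx3 : 3 ≤ x := hN3.trans hx
  have hL := one_le_log_of_three_le hx3
  refine hr (fun n ↦ χ n * (Λ n : ℂ)) (fun s ↦ -logDeriv (DirichletCharacter.LFunction χ) s) ha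
    (fun s hs ↦ ?_) x M (exp_one_le_of_three_le hx3) hM fun s hs1 hs2 hs3 ↦ ?_
  · have h := DirichletCharacter.LSeries_twist_vonMangoldt_eq χ hs
    rw [logDeriv_apply, DirichletCharacter.deriv_LFunction_eq_deriv_LSeries _ hs,
      DirichletCharacter.LFunction_eq_LSeries _ hs, ← neg_div, ← h]
    rfl
  · set L := Real.log x with hLdef
    have hq0 : (1 : ℝ) ≤ q := by exact_mod_cast NeZero.one_le
    have hQ : q * (|s.im| + 2) ≤ 3 * L ^ m := by
      have h1 : (q : ℝ) ≤ L ^ B := hq.trans (by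
        have := Real.log_nonneg (by linarith : (1 : ℝ) ≤ N)
        gcongr
        exact Real.log_le_log (by linarith) hx)
      have h2 : |s.im| + 2 ≤ 3 * L ^ (2 * A + 1 + 2) := by
        linarith [one_le_pow₀ hL (n := 2 * A + 1 + 2)]
      calc q * (|s.im| + 2) ≤ L ^ B * (3 * L ^ (2 * A + 1 + 2)) := by gcongr
        _ = _ := by rw [hm]; ring
    have hQ0 : 0 < q * (|s.im| + 2) := by positivity
    have hQκ := rpow_le_three_mul_sqrt hm0 hL hQ0.le hQ
    obtain ⟨h1, h2⟩ := hb q χ hχ s (by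
      refine le_trans ?_ hs1
      rw [Real.rpow_neg hQ0.le]
      have : (3 * √L)⁻¹ ≤ ((q * (|s.im| + 2)) ^ (1 / (2 * m) : ℝ))⁻¹ :=
        inv_anti₀ (Real.rpow_pos_of_pos hQ0 _) hQκ
      have h3 : C₁⁻¹ * (3 * √L)⁻¹ ≤ C₁⁻¹ * ((q * (|s.im| + 2)) ^ (1 / (2 * m) : ℝ))⁻¹ := by
        gcongr
      have h4 : (3 * C₁)⁻¹ * (√L)⁻¹ = C₁⁻¹ * (3 * √L)⁻¹ := by
        rw [mul_inv, mul_inv]; ring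
      linarith) hs2
    have hd := DirichletCharacter.differentiable_LFunction hχ
    refine ⟨?_, ?_⟩
    · have : DifferentiableAt ℂ (deriv (DirichletCharacter.LFunction χ)) s :=
        (hd.analyticAt s).deriv.differentiableAt
      exact (this.div (hd s) h1).neg
    · rw [norm_neg]
      calc _ ≤ C₁ * (q * (|s.im| + 2)) ^ (1 / (2 * m) : ℝ) := h2
        _ ≤ C₁ * (3 * √L) := by gcongr
        _ ≤ C₁ * (3 * L) := by gcongr; exact sqrt_le_self_of_one_le hL
        _ = _ := by ring

/-- The entire function `(s - 1) ζ(s)`. -/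
noncomputable abbrev zetaMulSubOne : ℂ → ℂ := DirichletCharacter.LFunctionTrivChar₁ 1

lemma zetaMulSubOne_of_ne {s : ℂ} (hs : s ≠ 1) : zetaMulSubOne s = (s - 1) * riemannZeta s := by
  rw [zetaMulSubOne, DirichletCharacter.LFunctionTrivChar₁, Function.update_of_ne hs,
    DirichletCharacter.LFunctionTrivChar, DirichletCharacter.LFunction_modOne_eq]

lemma zetaMulSubOne_one : zetaMulSubOne 1 = 1 := by
  simp [zetaMulSubOne, DirichletCharacter.LFunctionTrivChar₁]

/-- The regular function `-ζ'/ζ - ζ`, the pole at `1` being removed. -/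
noncomputable def zetaRegular (s : ℂ) : ℂ := -logDeriv zetaMulSubOne s - dslope zetaMulSubOne 1 s

lemma zetaRegular_of_ne {s : ℂ} (hs : s ≠ 1) (h0 : riemannZeta s ≠ 0) :
    zetaRegular s = -logDeriv riemannZeta s - riemannZeta s := by
  have hs' : s - 1 ≠ 0 := sub_ne_zero.2 hs
  have h1 : logDeriv zetaMulSubOne s = 1 / (s - 1) + logDeriv riemannZeta s := by
    have e1 : zetaMulSubOne =ᶠ[𝓝 s] fun z ↦ (z - 1) * riemannZeta z := by
      filter_upwards [isOpen_ne.mem_nhds hs] with z hz using zetaMulSubOne_of_ne hz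
    rw [(logDeriv_congr_nhds e1).eq_of_nhds, logDeriv_mul (f := fun z ↦ z - 1) s hs' h0 (by fun_prop)
      (differentiableAt_riemannZeta hs)]
    congr 1
    rw [logDeriv_apply]; simp
  rw [zetaRegular, h1, dslope_of_ne _ hs, slope_def_field, zetaMulSubOne_of_ne hs,
    zetaMulSubOne_one]
  field_simp
  ring

lemma differentiableAt_zetaRegular {s : ℂ} (h0 : zetaMulSubOne s ≠ 0) :
    DifferentiableAt ℂ zetaRegular s := by
  have hd : Differentiable ℂ zetaMulSubOne := DirichletCharacter.differentiable_LFunctionTrivChar₁ 1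
  have h1 : DifferentiableAt ℂ (deriv zetaMulSubOne) s := (hd.analyticAt s).deriv.differentiableAt
  have h2 : Differentiable ℂ (dslope zetaMulSubOne 1) := by
    rw [← differentiableOn_univ, Complex.differentiableOn_dslope univ_mem]
    exact hd.differentiableOn
  exact ((h1.div (hd s) h0).neg).sub (h2 s)

lemma zetaMulSubOne_ne_zero {s : ℂ} (hs : 1 ≤ s.re) : zetaMulSubOne s ≠ 0 := by
  rcases eq_or_ne s 1 with rfl | h
  · rw [zetaMulSubOne_one]; exact one_ne_zero
  · rw [zetaMulSubOne_of_ne h]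
    exact mul_ne_zero (sub_ne_zero.2 h) (riemannZeta_ne_zero_of_one_le_re hs)

lemma exists_zetaRegular_bound_of_abs_im_le_one : ∃ r : ℝ, 0 < r ∧ ∃ K : ℝ, ∀ s : ℂ, 1 - r ≤ s.re →
    s.re ≤ 2 → |s.im| ≤ 1 → zetaMulSubOne s ≠ 0 ∧ ‖zetaRegular s‖ ≤ K := by
  have hd : Differentiable ℂ zetaMulSubOne := DirichletCharacter.differentiable_LFunctionTrivChar₁ 1
  have hK : IsCompact (Icc (1 : ℝ) 2 ×ℂ Icc (-1 : ℝ) 1) := isCompact_Icc.reProdIm isCompact_Icc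
  have hU : IsOpen {s : ℂ | zetaMulSubOne s ≠ 0} := isOpen_ne_fun hd.continuous continuous_const
  obtain ⟨r, hr, hsub⟩ := hK.exists_cthickening_subset_open hU fun s hs ↦ by
    rw [mem_reProdIm] at hs
    exact zetaMulSubOne_ne_zero hs.1.1
  obtain ⟨K, hKb⟩ := hK.cthickening (r := r) |>.exists_bound_of_continuousOn (f := zetaRegular)
    fun s hs ↦ (differentiableAt_zetaRegular (hsub hs)).continuousAt.continuousWithinAt
  refine ⟨r, hr, K, fun s h1 h2 h3 ↦ ?_⟩
  have hs : s ∈ Metric.cthickening r (Icc (1 : ℝ) 2 ×ℂ Icc (-1 : ℝ) 1) := by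
    refine Metric.mem_cthickening_of_dist_le s (⟨max s.re 1, s.im⟩ : ℂ) r _ ?_ ?_
    · rw [mem_reProdIm]
      exact ⟨⟨le_max_right _ _, max_le h2 (by norm_num)⟩, abs_le.1 h3⟩
    · rw [Complex.dist_eq]
      have : s - ⟨max s.re 1, s.im⟩ = ((s.re - max s.re 1 : ℝ) : ℂ) := by
        apply Complex.ext <;> simp
      rw [this, Complex.norm_real, Real.norm_eq_abs, abs_le]
      rcases le_total s.re 1 with h | h
      · rw [max_eq_right h]; constructor <;> linarith
      · rw [max_eq_left h]; constructor <;> linarith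
  exact ⟨hsub hs, hKb s hs⟩

/-- The prime number theorem with an error term saving an arbitrary power of `log N`. -/
theorem exists_abs_sum_vonMangoldt_sub_le (A : ℕ) : ∃ C : ℝ, 0 < C ∧ ∀ N : ℕ, 3 ≤ N →
      |∑ n ∈ Finset.Icc 1 N, Λ n - N| ≤ C * N / Real.log N ^ A := by
  set m := (2 * A + 1) + 2 with hm
  have hm0 : m ≠ 0 := by omega
  have hm1 : (1 : ℝ) ≤ m := by exact_mod_cast Nat.pos_of_ne_zero hm0
  set κ : ℝ := 1 / (2 * m) with hκdef
  have hκ : 0 < κ := by positivity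
  have hκ' : κ ≤ 1 / 2 := by
    rw [hκdef]
    exact one_div_le_one_div_of_le (by norm_num) (by linarith)
  obtain ⟨C₁, hC₁, hb⟩ := exists_norm_logDeriv_riemannZeta_le hκ
  obtain ⟨C₃, hC₃, hz⟩ := exists_norm_riemannZeta_le (η := κ / 2) (by positivity) (by linarith)
  obtain ⟨r, hr, K, hK⟩ := exists_zetaRegular_bound_of_abs_im_le_one
  set C₀ := 3 * C₁ + 6 * C₃ + r⁻¹ + |K| + 2 / κ with hC₀
  have hr0 : 0 < r⁻¹ := by positivity
  have hκ0 : 0 < 2 / κ := by positivity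
  have hK0 := abs_nonneg K
  have hC₀r : C₀⁻¹ ≤ r := inv_le_of_inv_le₀ hr (by linarith)
  have hC₀κ : C₀⁻¹ ≤ κ / 2 := inv_le_of_inv_le₀ (by positivity) (by rw [inv_div]; linarith)
  have hC₀C : C₀⁻¹ ≤ (3 * C₁)⁻¹ := inv_anti₀ (by positivity) (by linarith)
  have hC₀0 : 0 < C₀ := by linarith
  obtain ⟨C₂, hC₂, hreg⟩ := exists_norm_sum_mul_max_le_of_region (2 * A + 1)
    (C₀ := C₀) (by linarith)
  refine ⟨5 * C₂ + 3 + 3 * (A + 1).factorial, by positivity, fun N hN ↦ ?_⟩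
  have hN3 : (3 : ℝ) ≤ N := by exact_mod_cast hN
  have ha : ∀ n : ℕ, n ≠ 0 → ‖(Λ n : ℂ) - 1‖ ≤ Real.log n + 1 := by
    intro n _
    refine (norm_sub_le _ _).trans ?_
    rw [Complex.norm_real, Real.norm_of_nonneg vonMangoldt_nonneg, norm_one]
    linarith [vonMangoldt_le_log (n := n)]
  have hfin : ‖∑ n ∈ Finset.Icc 1 N, ((Λ n : ℂ) - 1)‖ ≤
      (5 * C₂ + 3 + 3 * (A + 1).factorial) * N / Real.log N ^ A := by
    refine norm_sum_le_of_smooth ha A hN hC₂.le fun x M hx hM ↦ ?_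
    have hx3 : 3 ≤ x := hN3.trans hx
    have hL := one_le_log_of_three_le hx3
    refine hreg (fun n ↦ (Λ n : ℂ) - 1) zetaRegular ha (fun s hs ↦ ?_) x M
      (exp_one_le_of_three_le hx3) hM fun s hs1 hs2 hs3 ↦ ?_
    · have hs1 : s ≠ 1 := by rintro rfl; simp at hs
      have h := LSeries_sub (LSeriesSummable_vonMangoldt hs) (LSeriesSummable_one_iff.2 hs)
      rw [LSeries_vonMangoldt_eq_deriv_riemannZeta_div hs, LSeries_one_eq_riemannZeta hs] at h
      rw [zetaRegular_of_ne hs1 (riemannZeta_ne_zero_of_one_le_re hs.le), logDeriv_apply, ← neg_div,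
        ← h]
      rfl
    · set L := Real.log x with hLdef
      have hy : (√L)⁻¹ ≤ 1 := inv_le_one_of_one_le₀ (Real.one_le_sqrt.2 hL)
      have hy0 : 0 < (√L)⁻¹ := by positivity
      have hle : C₀⁻¹ * (√L)⁻¹ ≤ C₀⁻¹ := mul_le_of_le_one_right (by positivity) hy
      rcases le_total (|s.im|) 1 with ht | ht
      · obtain ⟨h1, h2⟩ := hK s (by linarith) hs2 ht
        refine ⟨differentiableAt_zetaRegular h1, h2.trans ?_⟩
        calc K ≤ C₀ * 1 := by linarith [le_abs_self K]
          _ ≤ C₀ * L := by gcongr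
      · have hs1' : s ≠ 1 := by rintro rfl; simp at ht; linarith
        have hQ0 : 0 < |s.im| + 2 := by positivity
        have hQ : |s.im| + 2 ≤ 3 * L ^ m := by
          linarith [one_le_pow₀ hL (n := 2 * A + 1 + 2)]
        have hQκ : (|s.im| + 2) ^ κ ≤ 3 * √L := rpow_le_three_mul_sqrt hm0 hL hQ0.le hQ
        obtain ⟨h1, h2⟩ := hb s ht (by
          refine le_trans ?_ hs1
          rw [Real.rpow_neg hQ0.le]
          have : (3 * √L)⁻¹ ≤ ((|s.im| + 2) ^ κ)⁻¹ := inv_anti₀ (Real.rpow_pos_of_pos hQ0 _) hQκ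
          have h3 : C₁⁻¹ * (3 * √L)⁻¹ ≤ C₁⁻¹ * ((|s.im| + 2) ^ κ)⁻¹ := by gcongr
          have h4 : (3 * C₁)⁻¹ * (√L)⁻¹ = C₁⁻¹ * (3 * √L)⁻¹ := by
            rw [mul_inv, mul_inv]; ring
          have h5 : C₀⁻¹ * (√L)⁻¹ ≤ (3 * C₁)⁻¹ * (√L)⁻¹ := by gcongr
          linarith) hs2
        have h3 := hz s hs1' (by linarith) (by linarith)
        refine ⟨differentiableAt_zetaRegular ?_, ?_⟩
        · rw [zetaMulSubOne_of_ne hs1']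
          exact mul_ne_zero (sub_ne_zero.2 hs1') h1
        · rw [zetaRegular_of_ne hs1' h1]
          have h4 : 1 / ‖s - 1‖ ≤ 1 := by
            have : |(s - 1).im| ≤ ‖s - 1‖ := Complex.abs_im_le_norm _
            rw [div_le_one (by rw [norm_pos_iff]; exact sub_ne_zero.2 hs1')]
            simp only [sub_im, one_im, sub_zero] at this
            linarith
          have h5 : ‖riemannZeta s‖ ≤ C₃ * (3 * √L) * 2 := by
            refine h3.trans ?_
            rw [mul_div_cancel₀ κ (two_ne_zero)]
            gcongr
            linarith
          have h6 : √L ≤ L := sqrt_le_self_of_one_le hL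
          calc _ ≤ ‖logDeriv riemannZeta s‖ + ‖riemannZeta s‖ := by
                refine (norm_sub_le _ _).trans ?_
                rw [norm_neg]
            _ ≤ C₁ * (3 * √L) + C₃ * (3 * √L) * 2 := by
                refine add_le_add (h2.trans ?_) h5
                gcongr
            _ = (3 * C₁ + 6 * C₃) * √L := by ring
            _ ≤ C₀ * L := by
                gcongr
                linarith
  have hcast : ∑ n ∈ Finset.Icc 1 N, ((Λ n : ℂ) - 1) =
      ((∑ n ∈ Finset.Icc 1 N, Λ n - N : ℝ) : ℂ) := by
    rw [Finset.sum_sub_distrib]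
    simp
  rw [hcast, Complex.norm_real, Real.norm_eq_abs] at hfin
  exact hfin

end SiegelWalfiszTheorem

end Vinogradov

namespace Vinogradov

open Complex MeasureTheory Set Asymptotics Topology

/-! ### Geometric exponential sums -/

section ExponentialSums

/-- The additive character `x ↦ exp (2 pi i x)`. -/
noncomputable def ee (x : ℝ) : ℂ := exp (2 * Real.pi * x * I)

lemma ee_add (x y : ℝ) : ee (x + y) = ee x * ee y := by
  rw [ee, ee, ee, ← Complex.exp_add]; push_cast; ring_nf

@[simp] lemma ee_zero : ee 0 = 1 := by simp [ee]

@[simp] lemma norm_ee (x : ℝ) : ‖ee x‖ = 1 := by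
  rw [ee, show (2 * Real.pi * x * I : ℂ) = ((2 * Real.pi * x : ℝ) : ℂ) * I by push_cast; ring]
  exact Complex.norm_exp_ofReal_mul_I _

lemma ee_intCast (n : ℤ) : ee n = 1 := by
  rw [ee, Complex.exp_eq_one_iff]
  exact ⟨n, by push_cast; ring⟩

lemma ee_add_intCast (x : ℝ) (n : ℤ) : ee (x + n) = ee x := by rw [ee_add, ee_intCast, mul_one]

lemma ee_neg (x : ℝ) : ee (-x) = (starRingEnd ℂ) (ee x) := by
  rw [ee, ee, ← Complex.exp_conj]
  simp [Complex.conj_ofNat]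

lemma ee_natCast_mul (n : ℕ) (x : ℝ) : ee (n * x) = ee x ^ n := by
  rw [ee, ee, ← Complex.exp_nat_mul]; push_cast; ring_nf

/-- The distance to the nearest integer. -/
noncomputable def dn (x : ℝ) : ℝ := |x - round x|

lemma dn_nonneg (x : ℝ) : 0 ≤ dn x := abs_nonneg _

lemma dn_le (x : ℝ) (n : ℤ) : dn x ≤ |x - n| := round_le x n

lemma dn_add_intCast (x : ℝ) (n : ℤ) : dn (x + n) = dn x := by
  rw [dn, dn, round_add_intCast]; push_cast; ring_nf

lemma dn_le_add_abs (x y : ℝ) : dn x ≤ dn y + |x - y| := by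
  refine (dn_le x (round y)).trans ?_
  rw [show x - round y = (y - round y) + (x - y) by ring]
  exact abs_add_le _ _

lemma four_mul_dn_le (x : ℝ) : 4 * dn x ≤ ‖ee x - 1‖ := by
  have h1 : ee x = ee (x - round x) := by
    conv_lhs => rw [show x = (x - round x) + (round x : ℤ) by ring, ee_add_intCast]
  have h2 := abs_sub_round x
  rw [h1, dn]
  set y := x - round x with hy
  rw [ee, show (2 * Real.pi * y * I : ℂ) = I * ((2 * Real.pi * y : ℝ) : ℂ) by push_cast; ring,
    Complex.norm_exp_I_mul_ofReal_sub_one, show 2 * Real.pi * y / 2 = Real.pi * y by ring, norm_mul,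
    Real.norm_eq_abs, Real.norm_eq_abs, abs_of_pos (by norm_num : (0 : ℝ) < 2)]
  have h3 : |Real.sin (Real.pi * y)| = Real.sin (Real.pi * |y|) := by
    rcases le_total 0 y with h | h
    · rw [abs_of_nonneg h] at h2 ⊢
      exact abs_of_nonneg (Real.sin_nonneg_of_nonneg_of_le_pi (by positivity)
        (by nlinarith [Real.pi_pos]))
    · rw [abs_of_nonpos h] at h2 ⊢
      rw [mul_neg, Real.sin_neg]
      apply abs_of_nonpos
      apply Real.sin_nonpos_of_nonpos_of_neg_pi_le
      · nlinarith [Real.pi_pos]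
      · nlinarith [Real.pi_pos]
  rw [h3]
  have h4 := Real.mul_le_sin (x := Real.pi * |y|) (by positivity) (by nlinarith [Real.pi_pos])
  have h5 : 2 / Real.pi * (Real.pi * |y|) = 2 * |y| := by
    have := Real.pi_pos.ne'
    field_simp
  linarith

/-- A regularised version of `min U (1 / ‖x‖)`, with `‖x‖` the distance to the nearest integer. -/
noncomputable def kern (U x : ℝ) : ℝ := U / (1 + U * dn x)

lemma kern_nonneg {U : ℝ} (hU : 0 ≤ U) (x : ℝ) : 0 ≤ kern U x :=
  div_nonneg hU (by have := dn_nonneg x; positivity)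

lemma kern_le_left {U : ℝ} (hU : 0 ≤ U) (x : ℝ) : kern U x ≤ U :=
  div_le_self hU (by have := mul_nonneg hU (dn_nonneg x); linarith)

lemma kern_le_of_le_dn {U x d : ℝ} (hU : 0 ≤ U) (hd : 0 < d) (h : d ≤ dn x) : kern U x ≤ 1 / d := by
  have := dn_nonneg x
  rw [kern, div_le_div_iff₀ (by positivity) hd]
  nlinarith

lemma kern_mono {U V : ℝ} (hU : 0 ≤ U) (h : U ≤ V) (x : ℝ) : kern U x ≤ kern V x := by
  have := dn_nonneg x
  have hV : 0 ≤ V := hU.trans h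
  rw [kern, kern, div_le_div_iff₀ (by positivity) (by positivity)]
  nlinarith

/-- The bound for the sum of a geometric progression. -/
lemma norm_sum_ee_le {A B : ℕ} {U : ℝ} (hU : 0 < U) (hAB : (B : ℝ) - A ≤ U) (x : ℝ) :
    ‖∑ n ∈ Finset.Ioc A B, ee (n * x)‖ ≤ 2 * kern U x := by
  have h1 : ‖∑ n ∈ Finset.Ioc A B, ee (n * x)‖ ≤ U := by
    refine (norm_sum_le _ _).trans ?_
    simp only [norm_ee, Finset.sum_const, Nat.card_Ioc, nsmul_eq_mul, mul_one]
    rcases le_total A B with h | h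
    · rw [Nat.cast_sub h]; exact hAB
    · rw [Nat.sub_eq_zero_of_le h]; simpa using hU.le
  have h2 : ‖∑ n ∈ Finset.Ioc A B, ee (n * x)‖ * (4 * dn x) ≤ 2 := by
    have key : (∑ n ∈ Finset.Ioc A B, ee (n * x)) * (ee x - 1) =
        if A ≤ B then ee ((B + 1 : ℕ) * x) - ee ((A + 1 : ℕ) * x) else 0 := by
      split_ifs with h
      · clear h1 hAB
        induction B, h using Nat.le_induction with
        | base => simp
        | succ B hB ih =>
          rw [Finset.sum_Ioc_succ_top (by omega), add_mul, ih, ee_natCast_mul, ee_natCast_mul,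
            ee_natCast_mul]
          ring
      · rw [Finset.Ioc_eq_empty (by omega)]; simp
    calc _ ≤ ‖∑ n ∈ Finset.Ioc A B, ee (n * x)‖ * ‖ee x - 1‖ := by gcongr; exact four_mul_dn_le x
      _ = ‖(∑ n ∈ Finset.Ioc A B, ee (n * x)) * (ee x - 1)‖ := (norm_mul _ _).symm
      _ ≤ 2 := by
        rw [key]
        split_ifs
        · refine (norm_sub_le _ _).trans ?_
          rw [norm_ee, norm_ee]; norm_num
        · simp
  have := dn_nonneg x
  rw [kern, mul_div_assoc', le_div_iff₀ (by positivity)]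
  nlinarith

lemma min_div_le_dn {q i : ℕ} (hi : i < q) : min (i : ℝ) (q - i) / q ≤ dn (i / q) := by
  have hq : (0 : ℝ) < q := by exact_mod_cast (Nat.zero_le i).trans_lt hi
  have hi' : (i : ℝ) < q := by exact_mod_cast hi
  have hi0 : (0 : ℝ) ≤ i := Nat.cast_nonneg i
  rw [dn, div_le_iff₀ hq]
  have h : |(i : ℝ) / q - round ((i : ℝ) / q)| * q = |(i : ℝ) - round ((i : ℝ) / q) * q| := by
    rw [← abs_of_pos hq, ← abs_mul, abs_of_pos hq, sub_mul, div_mul_cancel₀ _ hq.ne']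
  rw [h]
  set r := round ((i : ℝ) / q)
  rcases le_or_gt r 0 with hr | hr
  · refine (min_le_left _ _).trans (le_trans ?_ (le_abs_self _))
    have : (r : ℝ) ≤ 0 := by exact_mod_cast hr
    nlinarith
  · refine (min_le_right _ _).trans (le_trans ?_ (neg_le_abs _))
    have : (1 : ℝ) ≤ r := by exact_mod_cast hr
    nlinarith

lemma sum_range_inv_add_one_le (q : ℕ) :
    ∑ i ∈ Finset.range q, (1 : ℝ) / (i + 1) ≤ 1 + Real.log q := by
  have h := harmonic_le_one_add_log q
  rw [harmonic] at h
  push_cast at h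
  simpa [one_div] using h

/-- The sum of the kernel over a full period of a rational approximation. -/
lemma sum_range_kern_le {q : ℕ} {a : ℤ} (hq : q ≠ 0) (hcop : IsCoprime a q) {α : ℝ}
    (hα : |α - a / q| ≤ 1 / q ^ 2) {U : ℝ} (hU : 0 ≤ U) (β : ℝ) :
    ∑ j ∈ Finset.range q, kern U (β + j * α) ≤ 5 * U + 8 * q * (1 + Real.log q) := by
  have : NeZero q := ⟨hq⟩
  have hq0 : (0 : ℝ) < q := by exact_mod_cast Nat.pos_of_ne_zero hq
  set m := ⌊q * β⌋ with hm
  set F : ℕ → ℝ := fun i ↦ (if i ≤ 2 then U else 0) + (if q - 1 - i ≤ 1 then U else 0) +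
    4 * q * (1 / (i + 1)) + 4 * q * (1 / ((q - 1 - i : ℕ) + 1)) with hF
  have hpt : ∀ j ∈ Finset.range q, kern U (β + j * α) ≤ F ((m + j * a : ℤ) : ZMod q).val := by
    intro j hj
    have hj' : (j : ℝ) ≤ q := by exact_mod_cast (Finset.mem_range.1 hj).le
    set z := ((m + j * a : ℤ) : ZMod q) with hz
    set i := z.val with hi
    have hiq : i < q := ZMod.val_lt z
    obtain ⟨k, hk⟩ : ∃ k : ℤ, m + j * a = i + k * q := by
      have : ((m + j * a : ℤ) : ZMod q) = ((i : ℤ) : ZMod q) := by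
        rw [← hz, hi]; simp
      rw [ZMod.intCast_eq_intCast_iff_dvd_sub] at this
      obtain ⟨k, hk⟩ := this
      exact ⟨-k, by linarith⟩
    have hkR : (m : ℝ) + j * a = i + k * q := by exact_mod_cast hk
    have hdist : |(β + j * α) - (i / q + k)| ≤ 2 / q := by
      have e1 : (β + j * α) - (i / q + k) = (q * β - m) / q + j * (α - a / q) := by
        field_simp
        linear_combination hkR
      rw [e1]
      refine (abs_add_le _ _).trans ?_
      have e2 : |(q * β - m) / q| ≤ 1 / q := by
        rw [abs_div, abs_of_pos hq0, abs_of_nonneg (sub_nonneg.2 (Int.floor_le _))]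
        gcongr
        linarith [Int.lt_floor_add_one (q * β)]
      have e3 : |(j : ℝ) * (α - a / q)| ≤ 1 / q := by
        rw [abs_mul, abs_of_nonneg (Nat.cast_nonneg j)]
        calc _ ≤ (q : ℝ) * (1 / q ^ 2) := by gcongr
          _ = 1 / q := by field_simp
      calc _ ≤ 1 / q + 1 / (q : ℝ) := add_le_add e2 e3
        _ = _ := by ring
    have hdn : dn (i / q) - 2 / q ≤ dn (β + j * α) := by
      have h1 := dn_le_add_abs (i / q + k) (β + j * α)
      rw [dn_add_intCast, abs_sub_comm] at h1
      linarith
    have hmin := min_div_le_dn hiq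
    have hcast : ((q - 1 - i : ℕ) : ℝ) + 1 = q - i := by
      rw [Nat.sub_sub, Nat.cast_sub (by omega)]; push_cast; ring
    have hi0 : (0 : ℝ) ≤ i := Nat.cast_nonneg i
    have hiq' : (i : ℝ) < q := by exact_mod_cast hiq
    have p1 : (0 : ℝ) ≤ 4 * q * (1 / (i + 1)) := by positivity
    have p2 : (0 : ℝ) ≤ 4 * q * (1 / ((q - 1 - i : ℕ) + 1)) := by positivity
    by_cases c1 : i ≤ 2
    · have p3 : (0 : ℝ) ≤ if q - 1 - i ≤ 1 then U else 0 := by split_ifs <;> simp [hU]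
      have := kern_le_left hU (β + j * α)
      simp only [hF, if_pos c1]
      linarith
    by_cases c2 : q - 1 - i ≤ 1
    · have := kern_le_left hU (β + j * α)
      simp only [hF, if_pos c2, if_neg c1]
      linarith
    · simp only [hF, if_neg c1, if_neg c2]
      have c1' : (3 : ℝ) ≤ i := by exact_mod_cast (by omega : 3 ≤ i)
      have c2' : (3 : ℝ) ≤ q - i := by
        rw [← hcast]; exact_mod_cast (by omega : 3 ≤ q - 1 - i + 1)
      rw [hcast]
      set μ := min (i : ℝ) (q - i) with hμ
      have hμ3 : 3 ≤ μ := le_min c1' c2'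
      have hd : μ / (3 * q) ≤ dn (β + j * α) := by
        refine le_trans ?_ hdn
        refine le_trans ?_ (sub_le_sub_right hmin _)
        rw [← sub_div, div_le_div_iff₀ (by positivity) hq0]
        nlinarith
      have := kern_le_of_le_dn hU (by positivity) hd
      refine this.trans ?_
      rw [one_div_div]
      have p2' : (0 : ℝ) ≤ 4 * q * (1 / (q - i)) := by
        have : (0 : ℝ) < q - i := by linarith
        positivity
      rcases min_choice (i : ℝ) (q - i) with h | h
      · rw [hμ, h]
        have : 3 * (q : ℝ) / i ≤ 4 * q * (1 / (i + 1)) := by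
          rw [mul_one_div, div_le_div_iff₀ (by linarith) (by linarith)]
          nlinarith
        linarith
      · rw [hμ, h]
        have : 3 * (q : ℝ) / (q - i) ≤ 4 * q * (1 / (q - i)) := by
          rw [mul_one_div]
          gcongr
          norm_num
        linarith
  refine (Finset.sum_le_sum hpt).trans ?_
  have hsum1 : ∑ j ∈ Finset.range q, F ((m + j * a : ℤ) : ZMod q).val =
      ∑ i ∈ Finset.range q, F i := by
    have hbij : Function.Bijective fun z : ZMod q ↦ (m : ZMod q) + z * a := by
      have hu : IsUnit (a : ZMod q) := by
        obtain ⟨x, y, hxy⟩ := hcop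
        refine IsUnit.of_mul_eq_one (x : ZMod q) ?_
        have := congrArg (Int.cast : ℤ → ZMod q) hxy
        push_cast at this
        simpa [mul_comm] using this
      obtain ⟨w, hw⟩ := hu
      rw [← hw]
      exact ((Equiv.addLeft (m : ZMod q)).bijective).comp (Units.mulRight_bijective w)
    have hrange : ∀ H : ZMod q → ℝ, ∑ j ∈ Finset.range q, H (j : ZMod q) = ∑ z, H z := by
      intro H
      refine Finset.sum_bij' (fun j _ ↦ (j : ZMod q)) (fun z _ ↦ z.val) (fun _ _ ↦ Finset.mem_univ _)
        (fun z _ ↦ Finset.mem_range.2 (ZMod.val_lt z)) (fun j hj ↦ ?_) (fun z _ ↦ by simp)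
        (fun _ _ ↦ rfl)
      exact ZMod.val_cast_of_lt (Finset.mem_range.1 hj)
    have h1 := hrange fun z ↦ F ((m : ZMod q) + z * a).val
    have h2 := hrange fun z ↦ F z.val
    have h3 := hbij.sum_comp fun z ↦ F z.val
    push_cast
    rw [h1, h3, ← h2]
    exact Finset.sum_congr rfl fun j hj ↦ by rw [ZMod.val_cast_of_lt (Finset.mem_range.1 hj)]
  rw [hsum1]
  have hH := sum_range_inv_add_one_le q
  have s1 : ∑ i ∈ Finset.range q, (if i ≤ 2 then U else 0) ≤ 3 * U := by
    rw [← Finset.sum_filter, Finset.sum_const, nsmul_eq_mul]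
    gcongr
    have : ((Finset.range q).filter (· ≤ 2)).card ≤ (Finset.range 3).card :=
      Finset.card_le_card fun i hi ↦ by
        rw [Finset.mem_filter] at hi; rw [Finset.mem_range]; omega
    exact_mod_cast this
  have s2 : ∑ i ∈ Finset.range q, (if q - 1 - i ≤ 1 then U else 0) ≤ 2 * U := by
    rw [Finset.sum_range_reflect (fun i ↦ if i ≤ 1 then U else 0) q, ← Finset.sum_filter,
      Finset.sum_const, nsmul_eq_mul]
    gcongr
    have : ((Finset.range q).filter (· ≤ 1)).card ≤ (Finset.range 2).card :=
      Finset.card_le_card fun i hi ↦ by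
        rw [Finset.mem_filter] at hi; rw [Finset.mem_range]; omega
    exact_mod_cast this
  have s3 : ∑ i ∈ Finset.range q, 4 * (q : ℝ) * (1 / ((q - 1 - i : ℕ) + 1)) =
      ∑ i ∈ Finset.range q, 4 * (q : ℝ) * (1 / (i + 1)) :=
    Finset.sum_range_reflect (fun i ↦ 4 * (q : ℝ) * (1 / ((i : ℝ) + 1))) q
  simp only [hF, Finset.sum_add_distrib]
  rw [s3, ← Finset.mul_sum]
  have s4 : 4 * (q : ℝ) * ∑ i ∈ Finset.range q, 1 / ((i : ℝ) + 1) ≤ 4 * q * (1 + Real.log q) := by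
    gcongr
  linarith

/-- The sum of the kernel over an arbitrary progression. -/
lemma sum_Ioc_kern_le {q : ℕ} {a : ℤ} (hq : q ≠ 0) (hcop : IsCoprime a q) {α : ℝ}
    (hα : |α - a / q| ≤ 1 / q ^ 2) {U : ℝ} (hU : 0 ≤ U) (β : ℝ) (A B : ℕ) {D : ℝ} (hD : 0 ≤ D)
    (hAB : (B : ℝ) - A ≤ D) :
    ∑ j ∈ Finset.Ioc A B, kern U (β + j * α) ≤
      (D / q + 1) * (5 * U + 8 * q * (1 + Real.log q)) := by
  have hq0 : (0 : ℝ) < q := by exact_mod_cast Nat.pos_of_ne_zero hq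
  have hq1 : (1 : ℝ) ≤ q := by exact_mod_cast Nat.one_le_iff_ne_zero.2 hq
  set J := ⌊D / q⌋₊ + 1 with hJ
  have hJD : (J : ℝ) ≤ D / q + 1 := by
    rw [hJ]; push_cast; linarith [Nat.floor_le (by positivity : 0 ≤ D / q)]
  have hDJ : D ≤ J * q := by
    have := Nat.lt_floor_add_one (D / q)
    rw [div_lt_iff₀ hq0] at this
    rw [hJ]; push_cast; linarith
  have hBJ : B ≤ A + J * q := by
    have : (B : ℝ) ≤ ((A + J * q : ℕ) : ℝ) := by push_cast; linarith
    exact_mod_cast this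
  have hblock : ∀ J : ℕ, ∑ j ∈ Finset.Ioc A (A + J * q), kern U (β + j * α) ≤
      J * (5 * U + 8 * q * (1 + Real.log q)) := by
    intro J
    induction J with
    | zero => simp
    | succ J ih =>
      have h1 : A + J * q ≤ A + (J + 1) * q := by nlinarith
      rw [← Finset.sum_Ioc_consecutive _ (by omega : A ≤ A + J * q) h1]
      have h2 : ∑ j ∈ Finset.Ioc (A + J * q) (A + (J + 1) * q), kern U (β + j * α) =
          ∑ j ∈ Finset.range q, kern U ((β + (A + J * q + 1 : ℕ) * α) + j * α) := by
        rw [← Finset.Ico_add_one_add_one_eq_Ioc, Finset.sum_Ico_eq_sum_range,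
          show A + (J + 1) * q + 1 - (A + J * q + 1) = q by
            rw [add_mul, one_mul]; omega]
        refine Finset.sum_congr rfl fun j _ ↦ ?_
        congr 1
        push_cast
        ring
      rw [h2]
      have h3 := sum_range_kern_le hq hcop hα hU (β + (A + J * q + 1 : ℕ) * α)
      push_cast at h3 ih ⊢
      linarith
  have hlog : 0 ≤ Real.log q := Real.log_nonneg hq1
  calc _ ≤ ∑ j ∈ Finset.Ioc A (A + J * q), kern U (β + j * α) :=
        Finset.sum_le_sum_of_subset_of_nonneg (Finset.Ioc_subset_Ioc_right hBJ)
          fun _ _ _ ↦ kern_nonneg hU _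
    _ ≤ J * (5 * U + 8 * q * (1 + Real.log q)) := hblock J
    _ ≤ _ := by gcongr

end ExponentialSums

end Vinogradov

namespace Vinogradov

open Complex MeasureTheory Set Asymptotics Topology

/-! ### Bilinear exponential sums -/

section BilinearSums

/-- Summation over the region under a hyperbola. -/
lemma sum_Ioc_sum_divisorsAntidiagonal {R : Type*} [AddCommMonoid R] (F : ℕ → ℕ → R) (N : ℕ) :
    ∑ n ∈ Finset.Ioc 0 N, ∑ x ∈ n.divisorsAntidiagonal, F x.1 x.2 =
      ∑ d ∈ Finset.Ioc 0 N, ∑ k ∈ Finset.Ioc 0 (N / d), F d k := by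
  have h1 : ∀ n ∈ Finset.Ioc 0 N, ∑ x ∈ n.divisorsAntidiagonal, F x.1 x.2 =
      ∑ d ∈ Finset.Ioc 0 N, ∑ k ∈ Finset.Ioc 0 N, if d * k = n then F d k else 0 := by
    intro n hn
    rw [Finset.mem_Ioc] at hn
    rw [Nat.divisorsAntidiagonal_eq_prod_filter_of_le hn.1.ne' hn.2, Finset.sum_filter,
      Finset.sum_product]
  rw [Finset.sum_congr rfl h1, Finset.sum_comm]
  refine Finset.sum_congr rfl fun d hd ↦ ?_
  rw [Finset.mem_Ioc] at hd
  rw [Finset.sum_comm]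
  have h2 : ∀ k ∈ Finset.Ioc 0 N, (∑ n ∈ Finset.Ioc 0 N, if d * k = n then F d k else 0) =
      if k ≤ N / d then F d k else 0 := by
    intro k hk
    rw [Finset.mem_Ioc] at hk
    rw [Finset.sum_ite_eq]
    congr 1
    rw [Finset.mem_Ioc, Nat.le_div_iff_mul_le hd.1, mul_comm k d, eq_iff_iff]
    have : 0 < d * k := Nat.mul_pos hd.1 hk.1
    tauto
  rw [Finset.sum_congr rfl h2, ← Finset.sum_filter]
  refine Finset.sum_congr ?_ fun _ _ ↦ rfl
  ext k
  simp only [Finset.mem_filter, Finset.mem_Ioc]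
  have := Nat.div_le_self N d
  omega

lemma sum_Ioc_one_div_le (K : ℕ) : ∑ k ∈ Finset.Ioc 0 K, (1 : ℝ) / k ≤ 1 + Real.log K := by
  refine le_trans (le_of_eq ?_) (sum_range_inv_add_one_le K)
  rw [← Finset.Ico_add_one_add_one_eq_Ioc, Finset.sum_Ico_eq_sum_range]
  refine Finset.sum_congr (by simp) fun i _ ↦ ?_
  push_cast; ring

lemma card_divisors_mul_le (m n : ℕ) :
    (m * n).divisors.card ≤ m.divisors.card * n.divisors.card := by
  rw [Nat.divisors_mul]; exact Finset.card_mul_le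

lemma one_add_log_natCast_pos (K : ℕ) : 0 < 1 + Real.log K := by
  linarith [Real.log_natCast_nonneg K]

lemma card_divisorsAntidiagonal (n : ℕ) : n.divisorsAntidiagonal.card = n.divisors.card := by
  rw [← Nat.map_div_right_divisors, Finset.card_map]

lemma sum_card_divisors_le (K : ℕ) :
    ∑ k ∈ Finset.Ioc 0 K, (k.divisors.card : ℝ) ≤ K * (1 + Real.log K) := by
  have h := sum_Ioc_sum_divisorsAntidiagonal (fun _ _ ↦ (1 : ℝ)) K
  simp only [Finset.sum_const, nsmul_eq_mul, mul_one, Nat.card_Ioc, Nat.sub_zero,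
    card_divisorsAntidiagonal] at h
  rw [h]
  calc ∑ d ∈ Finset.Ioc 0 K, ((K / d : ℕ) : ℝ) ≤ ∑ d ∈ Finset.Ioc 0 K, (K : ℝ) * (1 / d) := by
        refine Finset.sum_le_sum fun d _ ↦ ?_
        rw [mul_one_div]
        exact Nat.cast_div_le
    _ ≤ _ := by
        rw [← Finset.mul_sum]
        exact mul_le_mul_of_nonneg_left (sum_Ioc_one_div_le K) (Nat.cast_nonneg K)

lemma sum_card_divisors_div_le (K : ℕ) :
    ∑ k ∈ Finset.Ioc 0 K, (k.divisors.card : ℝ) / k ≤ (1 + Real.log K) ^ 2 := by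
  have h := sum_Ioc_sum_divisorsAntidiagonal (fun x y ↦ (1 : ℝ) / x * (1 / y)) K
  have h1 : ∀ n ∈ Finset.Ioc 0 K, ∑ x ∈ n.divisorsAntidiagonal, (1 : ℝ) / x.1 * (1 / x.2) =
      (n.divisors.card : ℝ) / n := by
    intro n _
    rw [← card_divisorsAntidiagonal, div_eq_mul_one_div, ← nsmul_eq_mul, ← Finset.sum_const]
    refine Finset.sum_congr rfl fun x hx ↦ ?_
    rw [← (Nat.mem_divisorsAntidiagonal.1 hx).1]
    push_cast
    rw [one_div_mul_one_div]
  rw [Finset.sum_congr rfl h1] at h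
  rw [h]
  calc _ ≤ ∑ d ∈ Finset.Ioc 0 K, (1 : ℝ) / d * (1 + Real.log K) := by
        refine Finset.sum_le_sum fun d _ ↦ ?_
        rw [← Finset.mul_sum]
        refine mul_le_mul_of_nonneg_left ?_ (by positivity)
        refine le_trans ?_ (sum_Ioc_one_div_le K)
        exact Finset.sum_le_sum_of_subset_of_nonneg
          (Finset.Ioc_subset_Ioc_right (Nat.div_le_self K d)) fun _ _ _ ↦ by positivity
    _ = (∑ d ∈ Finset.Ioc 0 K, (1 : ℝ) / d) * (1 + Real.log K) := by rw [Finset.sum_mul]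
    _ ≤ (1 + Real.log K) * (1 + Real.log K) :=
        mul_le_mul_of_nonneg_right (sum_Ioc_one_div_le K) (one_add_log_natCast_pos K).le
    _ = _ := by ring

/-- The second moment of the divisor function. -/
lemma sum_card_divisors_sq_le (K : ℕ) :
    ∑ k ∈ Finset.Ioc 0 K, (k.divisors.card : ℝ) ^ 2 ≤ K * (1 + Real.log K) ^ 3 := by
  have hL := one_add_log_natCast_pos K
  have h := sum_Ioc_sum_divisorsAntidiagonal
    (fun x y ↦ (x.divisors.card : ℝ) * y.divisors.card) K
  calc _ ≤ ∑ n ∈ Finset.Ioc 0 K, ∑ x ∈ n.divisorsAntidiagonal,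
        (x.1.divisors.card : ℝ) * x.2.divisors.card := by
        refine Finset.sum_le_sum fun n _ ↦ ?_
        rw [sq, ← card_divisorsAntidiagonal, ← nsmul_eq_mul, ← Finset.sum_const]
        refine Finset.sum_le_sum fun x hx ↦ ?_
        rw [card_divisorsAntidiagonal, ← (Nat.mem_divisorsAntidiagonal.1 hx).1]
        exact_mod_cast card_divisors_mul_le _ _
    _ = _ := h
    _ ≤ ∑ d ∈ Finset.Ioc 0 K, K * (1 + Real.log K) * ((d.divisors.card : ℝ) / d) := by
        refine Finset.sum_le_sum fun d hd ↦ ?_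
        have hd0 : 0 < d := (Finset.mem_Ioc.1 hd).1
        rw [← Finset.mul_sum]
        have h1 : ∑ y ∈ Finset.Ioc 0 (K / d), (y.divisors.card : ℝ) ≤
            K / d * (1 + Real.log K) := by
          refine (sum_card_divisors_le (K / d)).trans ?_
          rcases Nat.eq_zero_or_pos (K / d) with h0 | h0
          · rw [h0]; simp only [Nat.cast_zero, zero_mul]; positivity
          · refine mul_le_mul Nat.cast_div_le ?_ (one_add_log_natCast_pos _).le (by positivity)
            gcongr
            exact_mod_cast Nat.div_le_self K d
        calc _ ≤ (d.divisors.card : ℝ) * (K / d * (1 + Real.log K)) := by gcongr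
          _ = _ := by ring
    _ ≤ K * (1 + Real.log K) * (1 + Real.log K) ^ 2 := by
        rw [← Finset.mul_sum]
        exact mul_le_mul_of_nonneg_left (sum_card_divisors_div_le K) (by positivity)
    _ = _ := by ring

lemma dn_neg (x : ℝ) : dn (-x) = dn x := by
  apply le_antisymm
  · refine (dn_le (-x) (-round x)).trans (le_of_eq ?_)
    rw [dn, ← abs_neg]; push_cast; ring_nf
  · have := dn_le x (-round (-x))
    refine this.trans (le_of_eq ?_)
    rw [dn, ← abs_neg]; push_cast; ring_nf

lemma kern_neg (U x : ℝ) : kern U (-x) = kern U x := by rw [kern, kern, dn_neg]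

/-- The mean square of the inner sums in a bilinear form. -/
lemma sum_norm_sq_inner_le {q : ℕ} {a : ℤ} (hq : q ≠ 0) (hcop : IsCoprime a q) {α : ℝ}
    (hα : |α - a / q| ≤ 1 / q ^ 2) (g : ℕ → ℂ) {M : ℕ} (hM : 0 < M) (V X : ℕ) :
    ∑ m ∈ Finset.Ioc M (2 * M), ‖∑ k ∈ Finset.Ioc V (X / m), g k * ee (m * k * α)‖ ^ 2 ≤
      2 * (((X / M : ℕ) : ℝ) / q + 1) * (5 * M + 8 * q * (1 + Real.log q)) *
        ∑ k ∈ Finset.Ioc V (X / M), ‖g k‖ ^ 2 := by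
  set K := X / M with hK
  have hM0 : (0 : ℝ) < M := by exact_mod_cast hM
  set c : ℕ → ℕ → ℂ := fun m k ↦ if k ≤ X / m then g k * ee (m * k * α) else 0 with hc
  have hT : ∀ m ∈ Finset.Ioc M (2 * M), ∑ k ∈ Finset.Ioc V (X / m), g k * ee (m * k * α) =
      ∑ k ∈ Finset.Ioc V K, c m k := by
    intro m hm
    rw [Finset.mem_Ioc] at hm
    have hle : X / m ≤ K := Nat.div_le_div_left hm.1.le hM
    rw [hc, ← Finset.sum_filter]
    refine Finset.sum_congr ?_ fun _ _ ↦ rfl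
    ext k
    simp only [Finset.mem_filter, Finset.mem_Ioc]
    omega
  have hsq : ∀ z : ℂ, ((‖z‖ ^ 2 : ℝ) : ℂ) = z * (starRingEnd ℂ) z := by
    intro z; rw [Complex.mul_conj, Complex.normSq_eq_norm_sq]
  have hsum : ((∑ m ∈ Finset.Ioc M (2 * M), ‖∑ k ∈ Finset.Ioc V (X / m), g k * ee (m * k * α)‖ ^ 2
      : ℝ) : ℂ) = ∑ k ∈ Finset.Ioc V K, ∑ l ∈ Finset.Ioc V K,
        g k * (starRingEnd ℂ) (g l) *
          ∑ m ∈ Finset.Ioc M (min (2 * M) (min (X / k) (X / l))), ee (m * ((k - l : ℝ) * α)) := by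
    push_cast
    have h1 : ∀ m ∈ Finset.Ioc M (2 * M),
        ((‖∑ k ∈ Finset.Ioc V (X / m), g k * ee (m * k * α)‖ : ℂ)) ^ 2 =
        ∑ k ∈ Finset.Ioc V K, ∑ l ∈ Finset.Ioc V K, c m k * (starRingEnd ℂ) (c m l) := by
      intro m hm
      have := hsq (∑ k ∈ Finset.Ioc V (X / m), g k * ee (m * k * α))
      push_cast at this
      rw [this, hT m hm, map_sum, Finset.sum_mul_sum]
    rw [Finset.sum_congr rfl h1, Finset.sum_comm]
    refine Finset.sum_congr rfl fun k hk ↦ ?_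
    rw [Finset.sum_comm]
    refine Finset.sum_congr rfl fun l hl ↦ ?_
    rw [Finset.mem_Ioc] at hk hl
    have h2 : Finset.Ioc M (min (2 * M) (min (X / k) (X / l))) =
        (Finset.Ioc M (2 * M)).filter (fun m ↦ k ≤ X / m ∧ l ≤ X / m) := by
      ext m
      simp only [Finset.mem_filter, Finset.mem_Ioc, le_min_iff]
      by_cases hm : M < m
      · have hm0 : 0 < m := by omega
        rw [Nat.le_div_iff_mul_le (by omega), Nat.le_div_iff_mul_le (by omega),
          Nat.le_div_iff_mul_le hm0, Nat.le_div_iff_mul_le hm0, mul_comm k m, mul_comm l m]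
        tauto
      · tauto
    rw [h2, Finset.sum_filter, Finset.mul_sum]
    refine Finset.sum_congr rfl fun m _ ↦ ?_
    simp only [hc]
    by_cases hk' : k ≤ X / m
    · by_cases hl' : l ≤ X / m
      · rw [if_pos hk', if_pos hl', if_pos ⟨hk', hl'⟩, map_mul, ← ee_neg,
          show m * ((k - l : ℝ) * α) = m * k * α + -(m * l * α) by ring, ee_add]
        ring
      · simp [hl']
    · simp [hk']
  set G := ∑ k ∈ Finset.Ioc V K, ‖g k‖ ^ 2 with hG
  set P := ((K : ℝ) / q + 1) * (5 * M + 8 * q * (1 + Real.log q)) with hP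
  have hkern : ∀ k : ℕ, ∑ l ∈ Finset.Ioc V K, kern M ((k - l : ℝ) * α) ≤ P := by
    intro k
    have h := sum_Ioc_kern_le hq hcop hα hM0.le (-(k * α)) V K (D := K) (by positivity)
      (by linarith [Nat.cast_nonneg (α := ℝ) V])
    refine le_trans (le_of_eq (Finset.sum_congr rfl fun l _ ↦ ?_)) h
    rw [← kern_neg]; congr 1; ring
  have hreal : ∑ m ∈ Finset.Ioc M (2 * M),
      ‖∑ k ∈ Finset.Ioc V (X / m), g k * ee (m * k * α)‖ ^ 2 ≤
      ∑ k ∈ Finset.Ioc V K, ∑ l ∈ Finset.Ioc V K,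
        (‖g k‖ ^ 2 + ‖g l‖ ^ 2) * kern M ((k - l : ℝ) * α) := by
    have h1 := congrArg norm hsum
    rw [Complex.norm_real, Real.norm_of_nonneg (Finset.sum_nonneg fun _ _ ↦ by positivity)] at h1
    rw [h1]
    refine norm_sum_le_of_le _ fun k _ ↦ norm_sum_le_of_le _ fun l _ ↦ ?_
    rw [norm_mul, norm_mul, RCLike.norm_conj]
    have h2 : ‖∑ m ∈ Finset.Ioc M (min (2 * M) (min (X / k) (X / l))),
        ee (m * ((k - l : ℝ) * α))‖ ≤ 2 * kern M ((k - l : ℝ) * α) := by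
      refine norm_sum_ee_le hM0 ?_ _
      have : ((min (2 * M) (min (X / k) (X / l)) : ℕ) : ℝ) ≤ ((2 * M : ℕ) : ℝ) := by
        exact_mod_cast min_le_left _ _
      push_cast at this ⊢
      linarith
    calc _ ≤ ‖g k‖ * ‖g l‖ * (2 * kern M ((k - l : ℝ) * α)) := by gcongr
      _ = (2 * ‖g k‖ * ‖g l‖) * kern M ((k - l : ℝ) * α) := by ring
      _ ≤ _ := mul_le_mul_of_nonneg_right (two_mul_le_add_sq _ _) (kern_nonneg hM0.le _)
  refine hreal.trans ?_
  simp only [add_mul, Finset.sum_add_distrib]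
  have h3 : ∑ k ∈ Finset.Ioc V K, ∑ l ∈ Finset.Ioc V K, ‖g k‖ ^ 2 * kern M ((k - l : ℝ) * α) ≤
      G * P := by
    rw [hG, Finset.sum_mul]
    refine Finset.sum_le_sum fun k _ ↦ ?_
    rw [← Finset.mul_sum]
    exact mul_le_mul_of_nonneg_left (hkern k) (by positivity)
  have h4 : ∑ k ∈ Finset.Ioc V K, ∑ l ∈ Finset.Ioc V K, ‖g l‖ ^ 2 * kern M ((k - l : ℝ) * α) =
      ∑ k ∈ Finset.Ioc V K, ∑ l ∈ Finset.Ioc V K, ‖g k‖ ^ 2 * kern M ((k - l : ℝ) * α) := by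
    rw [Finset.sum_comm]
    refine Finset.sum_congr rfl fun k _ ↦ Finset.sum_congr rfl fun l _ ↦ ?_
    rw [← kern_neg]; congr 2; ring
  rw [h4]
  calc _ ≤ G * P + G * P := add_le_add h3 h3
    _ = _ := by rw [hP]; ring

/-- Splitting a long sum into dyadic blocks. -/
lemma norm_sum_Ioc_le_of_dyadic {E : Type*} [SeminormedAddCommGroup E] (F : ℕ → E) (U : ℕ) {B : ℝ}
    (J : ℕ) (h : ∀ j < J, ‖∑ m ∈ Finset.Ioc (2 ^ j * U) (2 * (2 ^ j * U)), F m‖ ≤ B) :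
    ‖∑ m ∈ Finset.Ioc U (2 ^ J * U), F m‖ ≤ J * B := by
  induction J with
  | zero => simp
  | succ J ih =>
    have h1 : U ≤ 2 ^ J * U := Nat.le_mul_of_pos_left U (by positivity)
    have h2 : 2 ^ (J + 1) * U = 2 * (2 ^ J * U) := by ring
    rw [h2, ← Finset.sum_Ioc_consecutive _ h1 (by omega)]
    refine (norm_add_le _ _).trans ?_
    have := ih fun j hj ↦ h j (by omega)
    have h3 := h J (by omega)
    push_cast
    linarith

lemma log_two_add_one_mul_le {X : ℕ} (hX : 3 ≤ X) : ((Nat.log 2 X + 1 : ℕ) : ℝ) ≤ 3 * Real.log X := by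
  have h := Nat.pow_log_le_self 2 (by omega : X ≠ 0)
  have h' : ((2 : ℝ)) ^ Nat.log 2 X ≤ X := by exact_mod_cast h
  have h1 := Real.log_le_log (by positivity) h'
  rw [Real.log_pow] at h1
  have h2 := Real.log_two_gt_d9
  have h3 := one_le_log_of_three_le (by exact_mod_cast hX : (3 : ℝ) ≤ X)
  push_cast
  nlinarith

end BilinearSums

end Vinogradov

namespace Vinogradov

open Complex MeasureTheory Set Asymptotics Topology

open ArithmeticFunction

/-! ### Sums of type I -/

section TypeOneSums

/-- Multiples of `α` by nonzero integers up to half of the denominator are not too close to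
integers. -/
lemma one_div_le_dn_mul {q : ℕ} {a : ℤ} (hcop : IsCoprime a q) {α : ℝ}
    (hα : |α - a / q| ≤ 1 / q ^ 2) {t : ℕ} (ht : 0 < t) (htq : 2 * t ≤ q) :
    1 / (2 * q : ℝ) ≤ dn (t * α) := by
  have hq : 0 < q := by omega
  have hq' : (0 : ℝ) < q := by exact_mod_cast hq
  have htq' : 2 * (t : ℝ) ≤ q := by exact_mod_cast htq
  rw [dn]
  set r := round (t * α)
  have hne : (t : ℤ) * a - r * q ≠ 0 := by
    intro h
    have h1 : (q : ℤ) ∣ t * a := ⟨r, by linarith⟩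
    have h2 : (q : ℤ) ∣ t := hcop.symm.dvd_of_dvd_mul_right h1
    have := Nat.le_of_dvd ht (Int.natCast_dvd_natCast.1 h2)
    omega
  have h1 : (1 : ℝ) ≤ |(t : ℝ) * a - r * q| := by exact_mod_cast Int.one_le_abs hne
  have h2 : (1 : ℝ) / q ≤ |(t : ℝ) * (a / q) - r| := by
    rw [show (t : ℝ) * (a / q) - r = (t * a - r * q) / q by field_simp, abs_div, abs_of_pos hq']
    gcongr
  have h3 : |(t : ℝ) * (α - a / q)| ≤ 1 / (2 * q) := by
    rw [abs_mul, abs_of_nonneg (Nat.cast_nonneg t)]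
    calc (t : ℝ) * |α - a / q| ≤ q / 2 * (1 / q ^ 2) := by gcongr; linarith
      _ = _ := by field_simp
  have h4 : |(t : ℝ) * (a / q) - r| ≤ |t * α - r| + |(t : ℝ) * (α - a / q)| := by
    rw [show (t : ℝ) * (a / q) - r = (t * α - r) - t * (α - a / q) by ring]
    exact abs_sub _ _
  have h5 : (1 : ℝ) / q = 1 / (2 * q) + 1 / (2 * q) := by field_simp; norm_num
  linarith

/-- The sum of the bounds for the geometric sums with frequencies `t α`, over one period. -/
lemma sum_Ioc_kern_div_le_of_period {q : ℕ} {a : ℤ} (hq : q ≠ 0) (hcop : IsCoprime a q) {α : ℝ}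
    (hα : |α - a / q| ≤ 1 / q ^ 2) {X : ℝ} (hX : 0 ≤ X) :
    ∑ t ∈ Finset.Ioc 0 q, kern (X / t) (t * α) ≤ 88 * q * (1 + Real.log q) + 20 * (X / q) := by
  have hq0 : (0 : ℝ) < q := by exact_mod_cast Nat.pos_of_ne_zero hq
  have hpt : ∀ t ∈ Finset.Ioc 0 q,
      kern (X / t) (t * α) ≤ 2 * kern (2 * q) (0 + t * α) + kern (2 * X / q) (0 + t * α) := by
    intro t ht
    rw [Finset.mem_Ioc] at ht
    have ht0 : (0 : ℝ) < t := by exact_mod_cast ht.1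
    rw [zero_add]
    rcases le_or_gt (2 * t) q with h | h
    · have hd := one_div_le_dn_mul hcop hα ht.1 h
      have hd0 : 0 < dn (t * α) := lt_of_lt_of_le (by positivity) hd
      have h1 : kern (X / t) (t * α) ≤ 1 / dn (t * α) :=
        kern_le_of_le_dn (by positivity) hd0 le_rfl
      have h2 : 1 / dn (t * α) ≤ 2 * kern (2 * q) (t * α) := by
        rw [kern, mul_div_assoc', div_le_div_iff₀ hd0 (by positivity)]
        rw [div_le_iff₀ (by positivity)] at hd
        nlinarith
      have h3 := kern_nonneg (U := 2 * X / q) (by positivity) (t * α)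
      linarith
    · have h1 : kern (X / t) (t * α) ≤ kern (2 * X / q) (t * α) := by
        refine kern_mono (by positivity) ?_ _
        rw [div_le_div_iff₀ ht0 hq0]
        have : (q : ℝ) ≤ 2 * t := by exact_mod_cast h.le
        nlinarith
      have h3 := kern_nonneg (U := 2 * q) (by positivity) (t * α)
      linarith
  refine (Finset.sum_le_sum hpt).trans ?_
  rw [Finset.sum_add_distrib, ← Finset.mul_sum]
  have h1 := sum_Ioc_kern_le hq hcop hα (U := 2 * q) (by positivity) 0 0 q (D := q) hq0.le (by simp)
  have h2 := sum_Ioc_kern_le hq hcop hα (U := 2 * X / q) (by positivity) 0 0 q (D := q) hq0.le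
    (by simp)
  rw [div_self hq0.ne'] at h1 h2
  have h3 : 0 ≤ Real.log q := Real.log_natCast_nonneg q
  have h4 : 2 * X / q = 2 * (X / q) := by ring
  rw [h4] at h2 ⊢
  nlinarith

lemma sum_Ioc_kern_div_le_of_mul {q : ℕ} {a : ℤ} (hq : q ≠ 0) (hcop : IsCoprime a q) {α : ℝ}
    (hα : |α - a / q| ≤ 1 / q ^ 2) {X : ℝ} (hX : 0 ≤ X) (J : ℕ) :
    ∑ t ∈ Finset.Ioc 0 ((J + 1) * q), kern (X / t) (t * α) ≤
      88 * q * (1 + Real.log q) + 20 * (X / q) +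
        ∑ j ∈ Finset.Ioc 0 J, (10 * (X / q) * (1 / j) + 16 * q * (1 + Real.log q)) := by
  have hq0 : (0 : ℝ) < q := by exact_mod_cast Nat.pos_of_ne_zero hq
  induction J with
  | zero => simpa using sum_Ioc_kern_div_le_of_period hq hcop hα hX
  | succ J ih =>
    rw [← Finset.sum_Ioc_consecutive _ (Nat.zero_le ((J + 1) * q))
      (Nat.mul_le_mul_right q (by omega : J + 1 ≤ J + 1 + 1)),
      ← Finset.sum_Ioc_consecutive _ (Nat.zero_le J) (Nat.le_succ J)]
    simp only [Nat.Ioc_succ_singleton,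
      Finset.sum_singleton]
    have h1 := sum_Ioc_kern_le hq hcop hα (U := X / ((J + 1 : ℕ) * q)) (by positivity) 0
      ((J + 1) * q) ((J + 1 + 1) * q) (D := q) hq0.le (by push_cast; linarith)
    rw [div_self hq0.ne'] at h1
    have h2 : ∑ t ∈ Finset.Ioc ((J + 1) * q) ((J + 1 + 1) * q), kern (X / t) (t * α) ≤
        ∑ t ∈ Finset.Ioc ((J + 1) * q) ((J + 1 + 1) * q),
          kern (X / ((J + 1 : ℕ) * q)) (0 + t * α) := by
      refine Finset.sum_le_sum fun t ht ↦ ?_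
      rw [zero_add]
      rw [Finset.mem_Ioc] at ht
      refine kern_mono (by positivity) ?_ _
      refine div_le_div_of_nonneg_left hX (by positivity) ?_
      exact_mod_cast ht.1.le
    have h4 : X / ((J + 1 : ℕ) * q) = (X / q) * (1 / (J + 1 : ℕ)) := by
      field_simp
    rw [h4] at h1 h2
    linarith

/-- The sum of the bounds for the geometric sums with frequencies `t α`. -/
lemma sum_Ioc_kern_div_le {q : ℕ} {a : ℤ} (hq : q ≠ 0) (hcop : IsCoprime a q) {α : ℝ}
    (hα : |α - a / q| ≤ 1 / q ^ 2) {X T : ℕ} (hqX : q ≤ X) (hT : T ≤ X) :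
    ∑ t ∈ Finset.Ioc 0 T, kern (X / t) (t * α) ≤
      (1 + Real.log X) * (88 * q + 30 * (X / q) + 16 * T) := by
  have hq0 : (0 : ℝ) < q := by exact_mod_cast Nat.pos_of_ne_zero hq
  have hlogq : Real.log q ≤ Real.log X := Real.log_le_log hq0 (by exact_mod_cast hqX)
  have hlogq0 : 0 ≤ Real.log q := Real.log_natCast_nonneg q
  set J := T / q with hJ
  have hlogJ : ∑ j ∈ Finset.Ioc 0 J, (1 : ℝ) / j ≤ 1 + Real.log X := by
    refine (Finset.sum_le_sum_of_subset_of_nonneg (Finset.Ioc_subset_Ioc_right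
      ((Nat.div_le_self T q).trans hT)) fun _ _ _ ↦ by positivity).trans (sum_Ioc_one_div_le X)
  have hJT : (J : ℝ) * q ≤ T := by exact_mod_cast Nat.div_mul_le_self T q
  have hsub : T ≤ (J + 1) * q := by
    have := Nat.lt_div_mul_add (Nat.pos_of_ne_zero hq) (a := T)
    rw [add_mul, one_mul]; exact this.le
  have h1 : ∑ t ∈ Finset.Ioc 0 T, kern (X / t) (t * α) ≤
      ∑ t ∈ Finset.Ioc 0 ((J + 1) * q), kern (X / t) (t * α) :=
    Finset.sum_le_sum_of_subset_of_nonneg (Finset.Ioc_subset_Ioc_right hsub) fun t _ _ ↦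
      kern_nonneg (by positivity) _
  refine h1.trans ((sum_Ioc_kern_div_le_of_mul hq hcop hα (Nat.cast_nonneg X) J).trans ?_)
  rw [Finset.sum_add_distrib, ← Finset.mul_sum, Finset.sum_const, Nat.card_Ioc, Nat.sub_zero,
    nsmul_eq_mul]
  have hXq : 0 ≤ (X : ℝ) / q := by positivity
  have h2 : 10 * ((X : ℝ) / q) * ∑ j ∈ Finset.Ioc 0 J, (1 : ℝ) / j ≤
      10 * (X / q) * (1 + Real.log X) := by gcongr
  have h3 : (J : ℝ) * (16 * q * (1 + Real.log q)) ≤ 16 * T * (1 + Real.log X) := by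
    calc (J : ℝ) * (16 * q * (1 + Real.log q)) = 16 * (J * q) * (1 + Real.log q) := by ring
      _ ≤ _ := by gcongr
  have h4 : 88 * q * (1 + Real.log q) ≤ 88 * q * (1 + Real.log X) := by gcongr
  have h5 : 20 * ((X : ℝ) / q) ≤ 20 * (X / q) * (1 + Real.log X) :=
    le_mul_of_one_le_right (by positivity) (by linarith)
  linarith

/-- A geometric sum with logarithmic weights. -/
lemma norm_sum_log_mul_ee_le {Y : ℕ} {U : ℝ} (hU : 0 < U) (hY : (Y : ℝ) ≤ U) (x : ℝ) :
    ‖∑ k ∈ Finset.Ioc 0 Y, (Real.log k : ℂ) * ee (k * x)‖ ≤ Real.log Y * (2 * kern U x) := by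
  have hlog : ∀ k : ℕ, Real.log k =
      ∑ j ∈ Finset.Ico 1 k, (Real.log ((j + 1 : ℕ) : ℝ) - Real.log j) := by
    intro k
    rcases Nat.eq_zero_or_pos k with h | h
    · simp [h]
    · rw [Finset.sum_Ico_sub (fun j ↦ Real.log (j : ℝ)) h]; simp
  have h1 : ∑ k ∈ Finset.Ioc 0 Y, (Real.log k : ℂ) * ee (k * x) =
      ∑ j ∈ Finset.Ico 1 Y, ((Real.log ((j + 1 : ℕ) : ℝ) - Real.log j : ℝ) : ℂ) *
        ∑ k ∈ Finset.Ioc j Y, ee (k * x) := by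
    have h2 : ∀ k ∈ Finset.Ioc 0 Y, (Real.log k : ℂ) * ee (k * x) =
        ∑ j ∈ Finset.Ico 1 k,
          ((Real.log ((j + 1 : ℕ) : ℝ) - Real.log j : ℝ) : ℂ) * ee (k * x) := by
      intro k _
      rw [hlog k, Complex.ofReal_sum, Finset.sum_mul]
    rw [Finset.sum_congr rfl h2]
    simp_rw [Finset.mul_sum]
    apply Finset.sum_comm'
    intro k j
    simp only [Finset.mem_Ioc, Finset.mem_Ico]
    omega
  rw [h1]
  have h3 : ∀ j ∈ Finset.Ico 1 Y, ‖((Real.log ((j + 1 : ℕ) : ℝ) - Real.log j : ℝ) : ℂ) *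
        ∑ k ∈ Finset.Ioc j Y, ee (k * x)‖ ≤
      (Real.log ((j + 1 : ℕ) : ℝ) - Real.log j) * (2 * kern U x) := by
    intro j hj
    rw [Finset.mem_Ico] at hj
    have hj0 : (0 : ℝ) < j := by exact_mod_cast hj.1
    have : Real.log j ≤ Real.log ((j + 1 : ℕ) : ℝ) :=
      Real.log_le_log hj0 (by push_cast; linarith)
    rw [norm_mul, Complex.norm_real, Real.norm_of_nonneg (by linarith)]
    refine mul_le_mul_of_nonneg_left (norm_sum_ee_le hU (by linarith) x) (by linarith)
  refine (norm_sum_le_of_le _ h3).trans (le_of_eq ?_)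
  rw [← Finset.sum_mul, ← hlog]

end TypeOneSums

end Vinogradov

namespace Vinogradov

open Complex MeasureTheory Set Asymptotics Topology

open ArithmeticFunction

/-! ### The Vaughan identity and the minor arcs -/

section Vaughan

open scoped ArithmeticFunction.Moebius ArithmeticFunction.zeta

/-- Truncation of an arithmetic function to arguments at most `U`. -/
def trunc (U : ℕ) (f : ArithmeticFunction ℝ) : ArithmeticFunction ℝ :=
  ⟨fun n ↦ if n ≤ U then f n else 0, by simp⟩

@[simp] lemma trunc_apply (U : ℕ) (f : ArithmeticFunction ℝ) (n : ℕ) :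
    trunc U f n = if n ≤ U then f n else 0 := rfl

lemma arithmeticFunction_sub_apply (f g : ArithmeticFunction ℝ) (n : ℕ) :
    (f - g) n = f n - g n := by
  rw [sub_eq_add_neg, ArithmeticFunction.add_apply, ArithmeticFunction.neg_apply, sub_eq_add_neg]

/-- The Möbius function with real values. -/
noncomputable def mobius : ArithmeticFunction ℝ := ((μ : ArithmeticFunction ℤ) : ArithmeticFunction ℝ)

/-- The constant function with real values. -/
noncomputable def zetaFun : ArithmeticFunction ℝ := ((ζ : ArithmeticFunction ℕ) : ArithmeticFunction ℝ)

/-- The function `∑_{d ∣ k, d > U} μ(d)`. -/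
noncomputable def vaughanCoeff (U : ℕ) : ArithmeticFunction ℝ := (mobius - trunc U mobius) * zetaFun

lemma mobius_mul_zetaFun : mobius * zetaFun = 1 := coe_moebius_mul_coe_zeta

/-- Vaughan's identity. -/
lemma vonMangoldt_eq_vaughan (U : ℕ) : Λ = trunc U Λ + trunc U mobius * ArithmeticFunction.log -
    trunc U Λ * trunc U mobius * zetaFun + (Λ - trunc U Λ) * vaughanCoeff U := by
  have h : Λ * zetaFun = ArithmeticFunction.log := vonMangoldt_mul_zeta
  rw [vaughanCoeff, sub_mul mobius, mobius_mul_zetaFun, ← h]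
  ring

lemma abs_mobius_le (n : ℕ) : |mobius n| ≤ 1 := by
  rw [mobius, intCoe_apply]
  exact_mod_cast abs_moebius_le_one

lemma abs_trunc_mobius_le (U n : ℕ) : |trunc U mobius n| ≤ 1 := by
  rw [trunc_apply]
  split_ifs
  · exact abs_mobius_le n
  · simp

lemma vaughanCoeff_apply (U k : ℕ) :
    vaughanCoeff U k = ∑ d ∈ k.divisors, (if d ≤ U then 0 else mobius d) := by
  rw [vaughanCoeff, zetaFun, coe_mul_zeta_apply]
  refine Finset.sum_congr rfl fun d _ ↦ ?_
  rw [arithmeticFunction_sub_apply, trunc_apply]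
  split_ifs <;> simp

lemma vaughanCoeff_eq_zero {U k : ℕ} (h : k ≤ U) : vaughanCoeff U k = 0 := by
  rw [vaughanCoeff_apply]
  refine Finset.sum_eq_zero fun d hd ↦ if_pos ((Nat.divisor_le hd).trans h)

lemma abs_vaughanCoeff_le (U k : ℕ) : |vaughanCoeff U k| ≤ k.divisors.card := by
  rw [vaughanCoeff_apply]
  refine (Finset.abs_sum_le_sum_abs _ _).trans ?_
  rw [Finset.card_eq_sum_ones, Nat.cast_sum]
  refine Finset.sum_le_sum fun d _ ↦ ?_
  split_ifs
  · simp
  · simpa using abs_mobius_le d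

lemma abs_trunc_mul_trunc_le (U n : ℕ) : |(trunc U Λ * trunc U mobius) n| ≤ Real.log n := by
  rw [mul_apply]
  refine (Finset.abs_sum_le_sum_abs _ _).trans ?_
  rw [← vonMangoldt_sum, ← Nat.sum_divisorsAntidiagonal (fun d _ ↦ Λ d)]
  refine Finset.sum_le_sum fun x _ ↦ ?_
  rw [abs_mul]
  have h1 : |trunc U Λ x.1| ≤ Λ x.1 := by
    rw [trunc_apply]
    split_ifs
    · exact (abs_of_nonneg vonMangoldt_nonneg).le
    · simp [vonMangoldt_nonneg]
  calc _ ≤ Λ x.1 * 1 := mul_le_mul h1 (abs_trunc_mobius_le U x.2) (abs_nonneg _) vonMangoldt_nonneg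
    _ = _ := mul_one _

lemma trunc_mul_trunc_eq_zero {U n : ℕ} (h : U ^ 2 < n) : (trunc U Λ * trunc U mobius) n = 0 := by
  rw [mul_apply]
  refine Finset.sum_eq_zero fun x hx ↦ ?_
  have hx' := (Nat.mem_divisorsAntidiagonal.1 hx).1
  by_cases h1 : x.1 ≤ U
  · by_cases h2 : x.2 ≤ U
    · have := Nat.mul_le_mul h1 h2
      rw [hx'] at this
      exfalso; nlinarith
    · simp [h2]
  · simp [h1]

/-- The exponential sum attached to a Dirichlet convolution. -/
lemma sum_Ioc_mul_apply_mul_ee (f g : ArithmeticFunction ℝ) (X : ℕ) (α : ℝ) :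
    ∑ n ∈ Finset.Ioc 0 X, (((f * g) n : ℝ) : ℂ) * ee (n * α) =
      ∑ d ∈ Finset.Ioc 0 X, (f d : ℂ) *
        ∑ k ∈ Finset.Ioc 0 (X / d), (g k : ℂ) * ee (d * k * α) := by
  have h := sum_Ioc_sum_divisorsAntidiagonal
    (fun d k ↦ ((f d : ℂ) * ((g k : ℂ) * ee (d * k * α)))) X
  simp_rw [Finset.mul_sum]
  rw [← h]
  refine Finset.sum_congr rfl fun n _ ↦ ?_
  rw [mul_apply, Complex.ofReal_sum, Finset.sum_mul]
  refine Finset.sum_congr rfl fun x hx ↦ ?_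
  rw [← (Nat.mem_divisorsAntidiagonal.1 hx).1]
  push_cast
  ring

section

variable {q : ℕ} {a : ℤ} {α : ℝ} {X U : ℕ}

/-- Sums of type I with a smooth variable. -/
lemma norm_sum_mul_zeta_le (hq : q ≠ 0) (hcop : IsCoprime a q)
    (hα : |α - a / q| ≤ 1 / q ^ 2) (hqX : q ≤ X) {T : ℕ} (hT : T ≤ X) (f : ArithmeticFunction ℝ)
    (hf : ∀ n, |f n| ≤ Real.log n) (hf0 : ∀ n, T < n → f n = 0) :
    ‖∑ n ∈ Finset.Ioc 0 X, (((f * zetaFun) n : ℝ) : ℂ) * ee (n * α)‖ ≤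
      2 * (1 + Real.log X) ^ 2 * (88 * q + 30 * (X / q) + 16 * T) := by
  have hX0 : 0 < X := (Nat.pos_of_ne_zero hq).trans_le hqX
  rw [sum_Ioc_mul_apply_mul_ee, ← Finset.sum_subset (Finset.Ioc_subset_Ioc_right hT)
    fun d _ hd' ↦ ?_]
  swap
  · rw [Finset.mem_Ioc] at *
    rw [hf0 d (by omega)]; simp
  have h1 : ∀ d ∈ Finset.Ioc 0 T,
      ‖(f d : ℂ) * ∑ k ∈ Finset.Ioc 0 (X / d), (zetaFun k : ℂ) * ee (d * k * α)‖ ≤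
        (1 + Real.log X) * 2 * kern (X / d) (d * α) := by
    intro d hd
    rw [Finset.mem_Ioc] at hd
    have hd0 : (0 : ℝ) < d := by exact_mod_cast hd.1
    have hX0' : (0 : ℝ) < X := by exact_mod_cast hX0
    have h2 : ∑ k ∈ Finset.Ioc 0 (X / d), (zetaFun k : ℂ) * ee (d * k * α) =
        ∑ k ∈ Finset.Ioc 0 (X / d), ee (k * (d * α)) := by
      refine Finset.sum_congr rfl fun k hk ↦ ?_
      rw [Finset.mem_Ioc] at hk
      rw [zetaFun, natCoe_apply, zeta_apply_ne hk.1.ne']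
      rw [show (d : ℝ) * k * α = k * (d * α) by ring]; simp
    rw [h2, norm_mul, Complex.norm_real, Real.norm_eq_abs, mul_assoc]
    have h3 : Real.log d ≤ Real.log X :=
      Real.log_le_log hd0 (by exact_mod_cast hd.2.trans hT)
    refine mul_le_mul ((hf d).trans (by linarith)) (norm_sum_ee_le (by positivity) ?_ _)
      (norm_nonneg _) (one_add_log_natCast_pos X).le
    simpa using Nat.cast_div_le (α := ℝ) (m := X) (n := d)
  refine (norm_sum_le_of_le _ h1).trans ?_
  rw [← Finset.mul_sum]
  have := sum_Ioc_kern_div_le hq hcop hα hqX hT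
  have hL := one_add_log_natCast_pos X
  calc _ ≤ (1 + Real.log X) * 2 * ((1 + Real.log X) * (88 * q + 30 * (X / q) + 16 * T)) := by
        gcongr
    _ = _ := by ring

/-- Sums of type I with a logarithmic variable. -/
lemma norm_sum_mul_log_le (hq : q ≠ 0) (hcop : IsCoprime a q)
    (hα : |α - a / q| ≤ 1 / q ^ 2) (hqX : q ≤ X) {T : ℕ} (hT : T ≤ X) (f : ArithmeticFunction ℝ)
    (hf : ∀ n, |f n| ≤ 1) (hf0 : ∀ n, T < n → f n = 0) :
    ‖∑ n ∈ Finset.Ioc 0 X, (((f * ArithmeticFunction.log) n : ℝ) : ℂ) * ee (n * α)‖ ≤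
      2 * (1 + Real.log X) ^ 2 * (88 * q + 30 * (X / q) + 16 * T) := by
  have hX0 : 0 < X := (Nat.pos_of_ne_zero hq).trans_le hqX
  rw [sum_Ioc_mul_apply_mul_ee, ← Finset.sum_subset (Finset.Ioc_subset_Ioc_right hT)
    fun d _ hd' ↦ ?_]
  swap
  · rw [Finset.mem_Ioc] at *
    rw [hf0 d (by omega)]; simp
  have h1 : ∀ d ∈ Finset.Ioc 0 T,
      ‖(f d : ℂ) * ∑ k ∈ Finset.Ioc 0 (X / d), ((ArithmeticFunction.log k : ℝ) : ℂ) * ee (d * k * α)‖ ≤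
        (1 + Real.log X) * 2 * kern (X / d) (d * α) := by
    intro d hd
    rw [Finset.mem_Ioc] at hd
    have hd0 : (0 : ℝ) < d := by exact_mod_cast hd.1
    have hX0' : (0 : ℝ) < X := by exact_mod_cast hX0
    have h2 : ∑ k ∈ Finset.Ioc 0 (X / d), ((ArithmeticFunction.log k : ℝ) : ℂ) * ee (d * k * α) =
        ∑ k ∈ Finset.Ioc 0 (X / d), (Real.log k : ℂ) * ee (k * (d * α)) := by
      refine Finset.sum_congr rfl fun k _ ↦ ?_
      rw [ArithmeticFunction.log_apply, show (d : ℝ) * k * α = k * (d * α) by ring]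
    rw [h2, norm_mul, Complex.norm_real, Real.norm_eq_abs]
    have h3 : Real.log ((X / d : ℕ) : ℝ) ≤ 1 + Real.log X := by
      rcases Nat.eq_zero_or_pos (X / d) with h0 | h0
      · rw [h0]; simpa using (one_add_log_natCast_pos X).le
      · have := Real.log_le_log (by exact_mod_cast h0 : (0 : ℝ) < (X / d : ℕ))
          (by exact_mod_cast Nat.div_le_self X d : ((X / d : ℕ) : ℝ) ≤ X)
        linarith
    have h4 := norm_sum_log_mul_ee_le (Y := X / d) (U := X / d) (by positivity)
      Nat.cast_div_le (d * α)
    have h5 := kern_nonneg (U := X / d) (by positivity) (d * α)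
    calc _ ≤ 1 * (Real.log ((X / d : ℕ) : ℝ) * (2 * kern (X / d) (d * α))) :=
          mul_le_mul (hf d) h4 (norm_nonneg _) zero_le_one
      _ ≤ 1 * ((1 + Real.log X) * (2 * kern (X / d) (d * α))) := by gcongr
      _ = _ := by ring
  refine (norm_sum_le_of_le _ h1).trans ?_
  rw [← Finset.mul_sum]
  have := sum_Ioc_kern_div_le hq hcop hα hqX hT
  have hL := one_add_log_natCast_pos X
  calc _ ≤ (1 + Real.log X) * 2 * ((1 + Real.log X) * (88 * q + 30 * (X / q) + 16 * T)) := by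
        gcongr
    _ = _ := by ring

/-- A dyadic block of the sum of type II. -/
lemma norm_sum_block_le (hq : q ≠ 0) (hcop : IsCoprime a q)
    (hα : |α - a / q| ≤ 1 / q ^ 2) (hqX : q ≤ X) (hU : 0 < U) {M : ℕ} (hUM : U ≤ M) :
    ‖∑ m ∈ Finset.Ioc M (2 * M), (Λ m : ℂ) *
      ∑ k ∈ Finset.Ioc U (X / m), (vaughanCoeff U k : ℂ) * ee (m * k * α)‖ ≤
      4 * (1 + Real.log X) ^ 3 * √(X * (X / q + 2 * (X / U) + q)) := by
  have hX0 : 0 < X := (Nat.pos_of_ne_zero hq).trans_le hqX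
  have hX0' : (0 : ℝ) < X := by exact_mod_cast hX0
  have hq0 : (0 : ℝ) < q := by exact_mod_cast Nat.pos_of_ne_zero hq
  have hM : 0 < M := hU.trans_le hUM
  have hM0 : (0 : ℝ) < M := by exact_mod_cast hM
  have hU0 : (0 : ℝ) < U := by exact_mod_cast hU
  have hL := one_add_log_natCast_pos X
  rcases le_or_gt (M * U) X with hMX | hMX
  swap
  · rw [Finset.sum_eq_zero, norm_zero]
    · positivity
    · intro m hm
      rw [Finset.mem_Ioc] at hm
      rw [Finset.Ioc_eq_empty, Finset.sum_empty, mul_zero]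
      rw [not_lt]
      refine Nat.le_of_lt_succ ((Nat.div_lt_iff_lt_mul (by omega)).2 ?_)
      calc X < M * U := hMX
        _ ≤ m * (U + 1) := Nat.mul_le_mul hm.1.le (Nat.le_succ U)
        _ = _ := mul_comm _ _
  have hMX' : (M : ℝ) * U ≤ X := by exact_mod_cast hMX
  set E := (X : ℝ) / q + 2 * (X / U) + q with hE
  have hE0 : 0 ≤ E := by positivity
  set L := 1 + Real.log X with hLdef
  have hMleX : M ≤ X := (Nat.le_mul_of_pos_right M hU).trans hMX
  have hΛ : ∀ m ∈ Finset.Ioc M (2 * M), ‖(Λ m : ℂ)‖ ^ 2 ≤ L ^ 2 := by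
    intro m hm
    rw [Finset.mem_Ioc] at hm
    rw [Complex.norm_real, Real.norm_of_nonneg vonMangoldt_nonneg]
    have h1 : Real.log m ≤ Real.log (2 * X) := by
      refine Real.log_le_log (by exact_mod_cast (by omega : 0 < m)) ?_
      exact_mod_cast (by omega : m ≤ 2 * X)
    rw [Real.log_mul (by norm_num) hX0'.ne'] at h1
    have h2 := Real.log_two_lt_d9
    have h3 : Λ m ≤ L := vonMangoldt_le_log.trans (by rw [hLdef]; linarith)
    exact pow_le_pow_left₀ vonMangoldt_nonneg h3 2
  have hΛsum : ∑ m ∈ Finset.Ioc M (2 * M), ‖(Λ m : ℂ)‖ ^ 2 ≤ M * L ^ 2 := by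
    refine (Finset.sum_le_sum hΛ).trans (le_of_eq ?_)
    rw [Finset.sum_const, Nat.card_Ioc, nsmul_eq_mul, show 2 * M - M = M by omega]
  have hinner := sum_norm_sq_inner_le hq hcop hα (fun k ↦ (vaughanCoeff U k : ℂ)) hM U X
  have hlogXM : 1 + Real.log ((X / M : ℕ) : ℝ) ≤ L := by
    rw [hLdef]
    have h0 : 0 < X / M := Nat.div_pos hMleX hM
    have := Real.log_le_log (by exact_mod_cast h0 : (0 : ℝ) < (X / M : ℕ))
      (by exact_mod_cast Nat.div_le_self X M : ((X / M : ℕ) : ℝ) ≤ X)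
    linarith
  have hb : ∑ k ∈ Finset.Ioc U (X / M), ‖(vaughanCoeff U k : ℂ)‖ ^ 2 ≤ X / M * L ^ 3 := by
    calc _ ≤ ∑ k ∈ Finset.Ioc U (X / M), (k.divisors.card : ℝ) ^ 2 := by
          refine Finset.sum_le_sum fun k _ ↦ ?_
          rw [Complex.norm_real, Real.norm_eq_abs]
          exact pow_le_pow_left₀ (abs_nonneg _) (abs_vaughanCoeff_le U k) 2
      _ ≤ ∑ k ∈ Finset.Ioc 0 (X / M), (k.divisors.card : ℝ) ^ 2 :=
          Finset.sum_le_sum_of_subset_of_nonneg (Finset.Ioc_subset_Ioc_left (Nat.zero_le U))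
            fun _ _ _ ↦ by positivity
      _ ≤ ((X / M : ℕ) : ℝ) * (1 + Real.log ((X / M : ℕ) : ℝ)) ^ 3 := sum_card_divisors_sq_le _
      _ ≤ _ := by
          have := one_add_log_natCast_pos (X / M)
          refine mul_le_mul Nat.cast_div_le ?_ (by positivity) (by positivity)
          exact pow_le_pow_left₀ this.le hlogXM 3
  have hL1 : 1 ≤ L := by rw [hLdef]; linarith [Real.log_natCast_nonneg X]
  have hlogq : 1 + Real.log q ≤ L := by
    rw [hLdef]; linarith [Real.log_le_log hq0 (by exact_mod_cast hqX : (q : ℝ) ≤ X)]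
  have hlogq0 := one_add_log_natCast_pos q
  have hsq : ‖∑ m ∈ Finset.Ioc M (2 * M), (Λ m : ℂ) *
      ∑ k ∈ Finset.Ioc U (X / m), (vaughanCoeff U k : ℂ) * ee (m * k * α)‖ ^ 2 ≤
      16 * L ^ 6 * (X * E) := by
    calc _ ≤ (∑ m ∈ Finset.Ioc M (2 * M), ‖(Λ m : ℂ)‖ *
          ‖∑ k ∈ Finset.Ioc U (X / m), (vaughanCoeff U k : ℂ) * ee (m * k * α)‖) ^ 2 := by
          refine pow_le_pow_left₀ (norm_nonneg _) (norm_sum_le_of_le _ fun m _ ↦ ?_) 2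
          exact (norm_mul _ _).le
      _ ≤ _ := Finset.sum_mul_sq_le_sq_mul_sq _ _ _
      _ ≤ (M * L ^ 2) * (2 * (((X / M : ℕ) : ℝ) / q + 1) * (5 * M + 8 * q * (1 + Real.log q)) *
          (X / M * L ^ 3)) := by
          refine mul_le_mul hΛsum (hinner.trans ?_) (Finset.sum_nonneg fun _ _ ↦ by positivity)
            (by positivity)
          exact mul_le_mul_of_nonneg_left hb (by positivity)
      _ ≤ (M * L ^ 2) * (2 * ((X / M) / q + 1) * (5 * M * L + 8 * q * L) * (X / M * L ^ 3)) := by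
          have h1 : ((X / M : ℕ) : ℝ) ≤ X / M := Nat.cast_div_le
          have h2 : 5 * (M : ℝ) ≤ 5 * M * L := le_mul_of_one_le_right (by positivity) hL1
          have h3 : 8 * (q : ℝ) * (1 + Real.log q) ≤ 8 * q * L := by gcongr
          refine mul_le_mul_of_nonneg_left ?_ (by positivity)
          refine mul_le_mul_of_nonneg_right ?_ (by positivity)
          refine mul_le_mul ?_ (add_le_add h2 h3) (by positivity) (by positivity)
          gcongr
      _ = 2 * L ^ 6 * (X * (5 * (X / q) + 8 * (X / M) + 5 * M + 8 * q)) := by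
          field_simp
          ring
      _ ≤ _ := by
          have h1 : (X : ℝ) / M ≤ X / U := by
            refine div_le_div_of_nonneg_left hX0'.le hU0 (by exact_mod_cast hUM)
          have h2 : (M : ℝ) ≤ X / U := by rwa [le_div_iff₀ hU0]
          have h3 : 0 ≤ (X : ℝ) / q := by positivity
          have h4 : 5 * ((X : ℝ) / q) + 8 * (X / M) + 5 * M + 8 * q ≤ 8 * E := by
            rw [hE]; linarith
          calc _ ≤ 2 * L ^ 6 * (X * (8 * E)) := by gcongr
            _ = _ := by ring
  have h5 := Real.sqrt_le_sqrt hsq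
  rw [Real.sqrt_sq (norm_nonneg _)] at h5
  refine h5.trans (le_of_eq ?_)
  rw [Real.sqrt_mul (by positivity), show 16 * L ^ 6 = (4 * L ^ 3) ^ 2 by ring,
    Real.sqrt_sq (by positivity)]

/-- The sum of type II in Vaughan's identity. -/
lemma norm_sum_typeTwo_le (hq : q ≠ 0) (hcop : IsCoprime a q)
    (hα : |α - a / q| ≤ 1 / q ^ 2) (hqX : q ≤ X) (hX : 3 ≤ X) (hU : 0 < U) :
    ‖∑ n ∈ Finset.Ioc 0 X, ((((Λ - trunc U Λ) * vaughanCoeff U) n : ℝ) : ℂ) * ee (n * α)‖ ≤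
      12 * (1 + Real.log X) ^ 4 * √(X * (X / q + 2 * (X / U) + q)) := by
  rw [sum_Ioc_mul_apply_mul_ee]
  set F : ℕ → ℂ := fun m ↦ (Λ m : ℂ) *
    ∑ k ∈ Finset.Ioc U (X / m), (vaughanCoeff U k : ℂ) * ee (m * k * α) with hF
  set J := Nat.log 2 X + 1 with hJ
  have hXJ : X < 2 ^ J := Nat.lt_pow_succ_log_self (by norm_num) X
  have hXJ' : X ≤ 2 ^ J * U := hXJ.le.trans (Nat.le_mul_of_pos_right _ hU)
  have hinner : ∀ m : ℕ, ∑ k ∈ Finset.Ioc 0 (X / m), (vaughanCoeff U k : ℂ) * ee (m * k * α) =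
      ∑ k ∈ Finset.Ioc U (X / m), (vaughanCoeff U k : ℂ) * ee (m * k * α) := by
    intro m
    symm
    refine Finset.sum_subset (Finset.Ioc_subset_Ioc_left (Nat.zero_le U)) fun k hk hk' ↦ ?_
    rw [Finset.mem_Ioc] at hk hk'
    rw [vaughanCoeff_eq_zero (by omega)]; simp
  have heq : ∑ d ∈ Finset.Ioc 0 X, (((Λ - trunc U Λ) d : ℝ) : ℂ) *
      ∑ k ∈ Finset.Ioc 0 (X / d), (vaughanCoeff U k : ℂ) * ee (d * k * α) =
      ∑ m ∈ Finset.Ioc U (2 ^ J * U), F m := by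
    have h1 : ∀ d, (((Λ - trunc U Λ) d : ℝ) : ℂ) *
      ∑ k ∈ Finset.Ioc 0 (X / d), (vaughanCoeff U k : ℂ) * ee (d * k * α) =
        if d ≤ U then 0 else F d := by
      intro d
      rw [hinner, arithmeticFunction_sub_apply, trunc_apply]
      split_ifs <;> simp [hF]
    rw [Finset.sum_congr rfl fun d _ ↦ h1 d]
    have h2 : ∀ d ∈ Finset.Ioc U (2 ^ J * U), F d = if d ≤ U then 0 else F d := by
      intro d hd
      rw [Finset.mem_Ioc] at hd
      rw [if_neg (by omega)]
    rw [Finset.sum_congr rfl h2]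
    have h3 : ∀ d, X < d → F d = 0 := by
      intro d hd
      simp [hF, Nat.div_eq_of_lt hd]
    rw [Finset.sum_subset (Finset.Ioc_subset_Ioc_right hXJ'),
      Finset.sum_subset (s₁ := Finset.Ioc U (2 ^ J * U))
        (Finset.Ioc_subset_Ioc_left (Nat.zero_le U))]
    · intro d hd hd'
      rw [Finset.mem_Ioc] at hd hd'
      rw [if_pos (by omega)]
    · intro d hd hd'
      rw [Finset.mem_Ioc] at hd hd'
      rw [h3 d (by omega), ite_self]
  rw [heq]
  have h := norm_sum_Ioc_le_of_dyadic F U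
    (B := 4 * (1 + Real.log X) ^ 3 * √(X * (X / q + 2 * (X / U) + q))) J fun j _ ↦
      norm_sum_block_le hq hcop hα hqX hU (Nat.le_mul_of_pos_left U (by positivity))
  refine h.trans ?_
  have h1 := log_two_add_one_mul_le hX
  have hL := one_add_log_natCast_pos X
  calc _ ≤ (3 * (1 + Real.log X)) *
        (4 * (1 + Real.log X) ^ 3 * √(X * (X / q + 2 * (X / U) + q))) := by
        gcongr
        rw [hJ]; linarith
    _ = _ := by ring

/-- **Vinogradov's estimate** for exponential sums over primes. -/
theorem norm_sum_vonMangoldt_mul_ee_le (hq : q ≠ 0) (hcop : IsCoprime a q)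
    (hα : |α - a / q| ≤ 1 / q ^ 2) (hqX : q ≤ X) (hX : 3 ≤ X) (hU : 0 < U) (hUX : U ^ 2 ≤ X) :
    ‖∑ n ∈ Finset.Ioc 0 X, (Λ n : ℂ) * ee (n * α)‖ ≤
      500 * (1 + Real.log X) ^ 4 * (√(X * (X / q + 2 * (X / U) + q)) + U ^ 2) := by
  have hX0 : (0 : ℝ) < X := by exact_mod_cast (by omega : 0 < X)
  have hq0 : (0 : ℝ) < q := by exact_mod_cast Nat.pos_of_ne_zero hq
  have hq1 : (1 : ℝ) ≤ q := by exact_mod_cast Nat.one_le_iff_ne_zero.2 hq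
  have hU1 : (1 : ℝ) ≤ U := by exact_mod_cast hU
  have hqX' : (q : ℝ) ≤ X := by exact_mod_cast hqX
  have hUleX : U ≤ X := (Nat.le_self_pow (by norm_num) U).trans hUX
  set L := 1 + Real.log X with hLdef
  have hL1 : 1 ≤ L := by rw [hLdef]; linarith [Real.log_natCast_nonneg X]
  set E := √(X * (X / q + 2 * (X / U) + q)) with hE
  have hE0 : 0 ≤ E := Real.sqrt_nonneg _
  have hqE : (q : ℝ) ≤ E := by
    apply Real.le_sqrt_of_sq_le
    calc (q : ℝ) ^ 2 = q * q := sq _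
      _ ≤ X * (X / q + 2 * (X / U) + q) := by
        refine mul_le_mul hqX' ?_ hq0.le hX0.le
        linarith [show 0 ≤ (X : ℝ) / q + 2 * (X / U) by positivity]
  have hXqE : (X : ℝ) / q ≤ E := by
    apply Real.le_sqrt_of_sq_le
    have h1 : (X : ℝ) / q ≤ X := div_le_self hX0.le hq1
    calc ((X : ℝ) / q) ^ 2 = (X / q) * (X / q) := sq _
      _ ≤ X * (X / q + 2 * (X / U) + q) := by
        refine mul_le_mul h1 ?_ (by positivity) hX0.le
        linarith [show 0 ≤ 2 * ((X : ℝ) / U) + q by positivity]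
  have hsplit : ∑ n ∈ Finset.Ioc 0 X, (Λ n : ℂ) * ee (n * α) =
      ∑ n ∈ Finset.Ioc 0 X, (trunc U Λ n : ℂ) * ee (n * α) +
      ∑ n ∈ Finset.Ioc 0 X, (((trunc U mobius * ArithmeticFunction.log) n : ℝ) : ℂ) * ee (n * α) -
      ∑ n ∈ Finset.Ioc 0 X, (((trunc U Λ * trunc U mobius * zetaFun) n : ℝ) : ℂ) * ee (n * α) +
      ∑ n ∈ Finset.Ioc 0 X, ((((Λ - trunc U Λ) * vaughanCoeff U) n : ℝ) : ℂ) * ee (n * α) := by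
    rw [← Finset.sum_add_distrib, ← Finset.sum_sub_distrib, ← Finset.sum_add_distrib]
    refine Finset.sum_congr rfl fun n _ ↦ ?_
    have h := congrArg (fun f : ArithmeticFunction ℝ ↦ (f n : ℂ)) (vonMangoldt_eq_vaughan U)
    simp only [ArithmeticFunction.add_apply, arithmeticFunction_sub_apply] at h
    rw [h]
    push_cast
    ring
  have h1 : ‖∑ n ∈ Finset.Ioc 0 X, (trunc U Λ n : ℂ) * ee (n * α)‖ ≤ U * L := by
    rw [← Finset.sum_subset (Finset.Ioc_subset_Ioc_right hUleX)]
    · have h2 : ∀ n ∈ Finset.Ioc 0 U, ‖(trunc U Λ n : ℂ) * ee (n * α)‖ ≤ L := by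
        intro n hn
        rw [Finset.mem_Ioc] at hn
        rw [norm_mul, norm_ee, mul_one, trunc_apply, if_pos hn.2, Complex.norm_real,
          Real.norm_of_nonneg vonMangoldt_nonneg]
        have h3 : Real.log n ≤ Real.log X :=
          Real.log_le_log (by exact_mod_cast hn.1) (by exact_mod_cast hn.2.trans hUleX)
        exact vonMangoldt_le_log.trans (by rw [hLdef]; linarith)
      refine (norm_sum_le_of_le _ h2).trans (le_of_eq ?_)
      simp
    · intro n hn hn'
      rw [Finset.mem_Ioc] at hn hn'
      rw [trunc_apply, if_neg (by omega)]; simp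
  have h2 := norm_sum_mul_log_le hq hcop hα hqX hUleX (trunc U mobius) (abs_trunc_mobius_le U)
    fun n hn ↦ by rw [trunc_apply, if_neg (by omega)]
  have h3 := norm_sum_mul_zeta_le hq hcop hα hqX hUX (trunc U Λ * trunc U mobius)
    (abs_trunc_mul_trunc_le U) fun n hn ↦ trunc_mul_trunc_eq_zero hn
  have h4 := norm_sum_typeTwo_le hq hcop hα hqX hX hU
  rw [hsplit]
  have hU2 : (U : ℝ) ≤ U ^ 2 := by nlinarith
  have hL2 : L ^ 2 ≤ L ^ 4 := pow_le_pow_right₀ hL1 (by norm_num)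
  have hL3 : L ≤ L ^ 4 := le_self_pow₀ hL1 (by norm_num)
  push_cast at h3
  have h5 : 2 * L ^ 2 * (88 * q + 30 * (X / q) + 16 * U) ≤
      2 * L ^ 4 * (88 * E + 30 * E + 16 * U ^ 2) := by gcongr
  have h6 : 2 * L ^ 2 * (88 * q + 30 * (X / q) + 16 * (U : ℝ) ^ 2) ≤
      2 * L ^ 4 * (88 * E + 30 * E + 16 * U ^ 2) := by gcongr
  have h7 : U * L ≤ L ^ 4 * U ^ 2 := by
    rw [mul_comm]; gcongr
  have h8 : 0 ≤ L ^ 4 * E := by positivity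
  have h9 : 0 ≤ L ^ 4 * (U : ℝ) ^ 2 := by positivity
  refine (norm_add_le _ _).trans ?_
  refine (add_le_add_left ((norm_sub_le _ _).trans (add_le_add_left (norm_add_le _ _) _)) _).trans ?_
  linarith

end

end Vaughan

end Vinogradov

namespace Vinogradov

open Complex MeasureTheory Set Asymptotics Topology

open ArithmeticFunction

/-! ### Ramanujan sums -/

section RamanujanSums

open scoped ArithmeticFunction.Moebius ArithmeticFunction.zeta

lemma ee_div_eq_one {m : ℕ} (hm : m ≠ 0) {n : ℤ} (h : ee (n / m) = 1) : (m : ℤ) ∣ n := by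
  have h1 := four_mul_dn_le (n / m)
  rw [h, sub_self, norm_zero] at h1
  have h2 : dn (n / m) = 0 := le_antisymm (by linarith) (dn_nonneg _)
  rw [dn, abs_eq_zero, sub_eq_zero] at h2
  have hm' : (m : ℝ) ≠ 0 := by exact_mod_cast hm
  rw [div_eq_iff hm'] at h2
  exact ⟨round ((n : ℝ) / m), by rw [mul_comm]; exact_mod_cast h2⟩

/-- Orthogonality of additive characters. -/
lemma sum_range_ee (m : ℕ) (n : ℤ) :
    ∑ b ∈ Finset.range m, ee (b * (n / m)) = if (m : ℤ) ∣ n then (m : ℂ) else 0 := by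
  rcases eq_or_ne m 0 with rfl | hm
  · simp
  have hm' : (m : ℝ) ≠ 0 := by exact_mod_cast hm
  split_ifs with h
  · obtain ⟨k, rfl⟩ := h
    have h1 : ∀ b ∈ Finset.range m, ee (b * (((m * k : ℤ) : ℝ) / m)) = 1 := by
      intro b _
      have : (b : ℝ) * (((m * k : ℤ) : ℝ) / m) = ((b * k : ℤ) : ℝ) := by
        push_cast; field_simp
      rw [this, ee_intCast]
    rw [Finset.sum_congr rfl h1]; simp
  · have hne : ee (n / m) ≠ 1 := fun h' ↦ h (ee_div_eq_one hm h')
    simp_rw [ee_natCast_mul]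
    rw [geom_sum_eq hne, ← ee_natCast_mul, mul_div_cancel₀ _ hm', ee_intCast, sub_self, zero_div]

/-- The function `d ↦ if d ∣ n then d else 0`. -/
noncomputable def divIndicator (n : ℤ) : ArithmeticFunction ℝ :=
  ⟨fun d ↦ if (d : ℤ) ∣ n then (d : ℝ) else 0, by simp⟩

lemma divIndicator_apply (n : ℤ) (d : ℕ) :
    divIndicator n d = if (d : ℤ) ∣ n then (d : ℝ) else 0 := rfl

lemma isMultiplicative_divIndicator (n : ℤ) : (divIndicator n).IsMultiplicative := by
  refine ⟨by simp [divIndicator_apply], fun {a b} hab ↦ ?_⟩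
  simp only [divIndicator_apply]
  have h : ((a * b : ℕ) : ℤ) ∣ n ↔ (a : ℤ) ∣ n ∧ (b : ℤ) ∣ n := by
    push_cast
    exact ⟨fun h ↦ ⟨dvd_of_mul_right_dvd h, dvd_of_mul_left_dvd h⟩,
      fun h ↦ (Nat.isCoprime_iff_coprime.2 hab).mul_dvd h.1 h.2⟩
  rw [if_congr h rfl rfl]
  by_cases ha : (a : ℤ) ∣ n <;> by_cases hb : (b : ℤ) ∣ n <;> simp [ha, hb]

/-- Ramanujan's sum, as an arithmetic function of the modulus. -/
noncomputable def ramanujan (n : ℤ) : ArithmeticFunction ℝ := mobius * divIndicator n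

lemma isMultiplicative_mobius : mobius.IsMultiplicative := isMultiplicative_moebius.intCast

lemma isMultiplicative_ramanujan (n : ℤ) : (ramanujan n).IsMultiplicative :=
  isMultiplicative_mobius.mul (isMultiplicative_divIndicator n)

lemma sum_divisors_mobius {m : ℕ} : ∑ d ∈ m.divisors, mobius d = if m = 1 then 1 else 0 := by
  rw [← coe_mul_zeta_apply, ← one_apply (R := ℝ)]
  exact congrArg (fun f : ArithmeticFunction ℝ ↦ f m) mobius_mul_zetaFun

lemma ramanujan_prime {p : ℕ} (hp : p.Prime) (n : ℤ) :
    ramanujan n p = (if (p : ℤ) ∣ n then (p : ℝ) else 0) - 1 := by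
  rw [ramanujan, mul_apply, Nat.sum_divisorsAntidiagonal (fun x y ↦ mobius x * divIndicator n y),
    hp.divisors, Finset.sum_pair hp.one_lt.ne, Nat.div_one, Nat.div_self hp.pos,
    divIndicator_apply, divIndicator_apply]
  simp [mobius, moebius_apply_prime hp]
  ring

lemma ramanujan_of_coprime {q : ℕ} (hq : q ≠ 0) {n : ℤ} (h : IsCoprime n q) :
    ramanujan n q = mobius q := by
  rw [ramanujan, mul_apply, Nat.sum_divisorsAntidiagonal (fun x y ↦ mobius x * divIndicator n y),
    Finset.sum_eq_single q]
  · rw [Nat.div_self (Nat.pos_of_ne_zero hq), divIndicator_apply]; simp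
  · intro d hd hdq
    have hd' := Nat.dvd_of_mem_divisors hd
    rw [divIndicator_apply, if_neg, mul_zero]
    intro hn
    have h1 : ((q / d : ℕ) : ℤ) ∣ q := Int.natCast_dvd_natCast.2 (Nat.div_dvd_of_dvd hd')
    have h2 := h.isUnit_of_dvd' hn h1
    rw [Int.ofNat_isUnit, Nat.isUnit_iff] at h2
    exact hdq (Nat.eq_of_dvd_of_div_eq_one hd' h2)
  · intro h'
    exact absurd (Nat.mem_divisors_self q hq) h'

/-- The evaluation of Ramanujan's sum. -/
lemma sum_coprime_ee {q : ℕ} (hq : q ≠ 0) (n : ℤ) :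
    ∑ b ∈ (Finset.range q).filter q.Coprime, ee (b * (n / q)) = (ramanujan n q : ℂ) := by
  have hind : ∀ b ∈ Finset.range q, (if q.Coprime b then ee (b * (n / q)) else 0) =
      ∑ d ∈ q.divisors, if d ∣ b then (mobius d : ℂ) * ee (b * (n / q)) else 0 := by
    intro b _
    have h1 : q.divisors.filter (· ∣ b) = (Nat.gcd q b).divisors := by
      ext d
      simp only [Finset.mem_filter, Nat.mem_divisors, Nat.dvd_gcd_iff]
      have : Nat.gcd q b ≠ 0 := Nat.gcd_ne_zero_left hq
      tauto
    rw [← Finset.sum_filter, h1, ← Finset.sum_mul, ← Complex.ofReal_sum, sum_divisors_mobius]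
    unfold Nat.Coprime
    split_ifs <;> simp
  rw [Finset.sum_filter, Finset.sum_congr rfl hind, Finset.sum_comm, ramanujan, mul_apply,
    Nat.sum_divisorsAntidiagonal (fun x y ↦ mobius x * divIndicator n y), Complex.ofReal_sum]
  refine Finset.sum_congr rfl fun d hd ↦ ?_
  obtain ⟨m, rfl⟩ := Nat.dvd_of_mem_divisors hd
  have hd0 : d ≠ 0 := by rintro rfl; simp at hq
  have hd0' : 0 < d := Nat.pos_of_ne_zero hd0
  rw [Nat.mul_div_cancel_left m hd0', divIndicator_apply]
  push_cast
  rw [← Finset.sum_filter, ← Finset.mul_sum]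
  congr 1
  have h2 := sum_range_ee m n
  rw [show ((if (m : ℤ) ∣ n then (m : ℝ) else 0 : ℝ) : ℂ) = if (m : ℤ) ∣ n then (m : ℂ) else 0 by
    split_ifs <;> simp, ← h2]
  symm
  refine Finset.sum_nbij (fun b ↦ d * b) ?_ ?_ ?_ ?_
  · intro b hb
    simp only [Finset.mem_range, Finset.mem_filter] at hb ⊢
    exact ⟨(Nat.mul_lt_mul_left hd0').2 hb, dvd_mul_right d b⟩
  · intro b _ c _ hbc
    exact Nat.eq_of_mul_eq_mul_left hd0' hbc
  · intro b hb
    simp only [Finset.coe_filter, Finset.mem_range, Set.mem_ofPred_eq] at hb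
    obtain ⟨hb1, c, rfl⟩ := hb
    exact ⟨c, by simpa using (Nat.mul_lt_mul_left hd0').1 hb1, rfl⟩
  · intro b _
    congr 1
    have : (d : ℝ) ≠ 0 := by exact_mod_cast hd0
    push_cast
    field_simp

end RamanujanSums

section PrimeWeights

/-- The weight `log p` on primes `p`. -/
noncomputable def lw (n : ℕ) : ℝ := if n.Prime then Real.log n else 0

lemma lw_nonneg (n : ℕ) : 0 ≤ lw n := by
  rw [lw]; split_ifs
  · exact Real.log_natCast_nonneg n
  · exact le_rfl

lemma lw_le_log (n : ℕ) : lw n ≤ Real.log n := by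
  rw [lw]; split_ifs
  · exact le_rfl
  · exact Real.log_natCast_nonneg n

lemma lw_le_vonMangoldt (n : ℕ) : lw n ≤ Λ n := by
  rw [lw]; split_ifs with h
  · rw [vonMangoldt_apply_prime h]
  · exact vonMangoldt_nonneg

lemma sum_lw_eq_theta (X : ℕ) : ∑ n ∈ Finset.Ioc 0 X, lw n = Chebyshev.theta X := by
  rw [Chebyshev.theta, Nat.floor_natCast, Finset.sum_filter]; rfl

lemma sum_lw_le (X : ℕ) : ∑ n ∈ Finset.Ioc 0 X, lw n ≤ 2 * X := by
  rw [sum_lw_eq_theta]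
  refine (Chebyshev.theta_le_log4_mul_x (Nat.cast_nonneg X)).trans ?_
  have : Real.log 4 = 2 * Real.log 2 := by
    rw [show (4 : ℝ) = 2 ^ 2 by norm_num, Real.log_pow]; norm_num
  have h2 := Real.log_two_lt_d9
  gcongr
  linarith

/-- Replacing the von Mangoldt function by the weight supported on primes. -/
lemma norm_sum_vonMangoldt_sub_sum_lw_le {X : ℕ} (hX : 1 ≤ X) (g : ℕ → ℂ) (hg : ∀ n, ‖g n‖ ≤ 1) :
    ‖∑ n ∈ Finset.Ioc 0 X, g n * (Λ n : ℂ) - ∑ n ∈ Finset.Ioc 0 X, g n * (lw n : ℂ)‖ ≤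
      2 * √X * Real.log X := by
  have h := Chebyshev.abs_psi_sub_theta_le_sqrt_mul_log (x := X) (by exact_mod_cast hX)
  rw [← sum_lw_eq_theta, Chebyshev.psi, Nat.floor_natCast, ← Finset.sum_sub_distrib] at h
  rw [← Finset.sum_sub_distrib]
  refine le_trans ?_ ((le_abs_self _).trans h)
  refine norm_sum_le_of_le _ fun n _ ↦ ?_
  rw [← mul_sub, norm_mul, ← Complex.ofReal_sub, Complex.norm_real,
    Real.norm_of_nonneg (by linarith [lw_le_vonMangoldt n])]
  exact mul_le_of_le_one_left (by linarith [lw_le_vonMangoldt n]) (hg n)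

end PrimeWeights

section ResidueClasses

/-- Expansion of a function on the units modulo `q` into characters. -/
lemma sum_char_mul_sum_units {q : ℕ} [NeZero q] (f : ZMod q → ℂ) {y : ZMod q} (hy : IsUnit y) :
    ∑ χ : DirichletCharacter ℂ q, (∑ b : (ZMod q)ˣ, f b * χ ((b : ZMod q)⁻¹)) * χ y =
      q.totient * f y := by
  simp_rw [Finset.sum_mul, mul_assoc]
  rw [Finset.sum_comm]
  have h1 : ∀ b : (ZMod q)ˣ, ∑ χ : DirichletCharacter ℂ q, f b * (χ ((b : ZMod q)⁻¹) * χ y) =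
      if (b : ZMod q) = y then f y * q.totient else 0 := by
    intro b
    rw [← Finset.mul_sum, DirichletCharacter.sum_char_inv_mul_char_eq ℂ b.isUnit y]
    split_ifs with h
    · rw [h]
    · simp
  rw [Finset.sum_congr rfl fun b _ ↦ h1 b, Finset.sum_eq_single hy.unit]
  · simp [mul_comm]
  · intro b _ hb
    rw [if_neg]
    intro h
    exact hb (Units.ext h)
  · simp

lemma sum_units_eq {q : ℕ} [NeZero q] (f : ℕ → ℂ) :
    ∑ b : (ZMod q)ˣ, f (b : ZMod q).val = ∑ b ∈ (Finset.range q).filter q.Coprime, f b := by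
  refine Finset.sum_bij (fun b _ ↦ (b : ZMod q).val) ?_ ?_ ?_ ?_
  · intro b _
    rw [Finset.mem_filter, Finset.mem_range]
    exact ⟨ZMod.val_lt _, (ZMod.val_coe_unit_coprime b).symm⟩
  · intro b _ c _ h
    exact Units.ext (ZMod.val_injective q h)
  · intro b hb
    rw [Finset.mem_filter, Finset.mem_range] at hb
    refine ⟨ZMod.unitOfCoprime b hb.2.symm, Finset.mem_univ _, ?_⟩
    rw [ZMod.coe_unitOfCoprime, ZMod.val_natCast, Nat.mod_eq_of_lt hb.1]
  · intro b _; rfl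

lemma ee_val_mul_div {q : ℕ} (hq : q ≠ 0) (a : ℤ) (n : ℕ) :
    ee (((n : ZMod q).val : ℝ) * (a / q)) = ee (n * (a / q)) := by
  have hq' : (q : ℝ) ≠ 0 := by exact_mod_cast hq
  obtain ⟨k, hk⟩ : ∃ k, q * k + n % q = n := ⟨n / q, Nat.div_add_mod n q⟩
  have h : (n : ℝ) * (a / q) = ((n : ZMod q).val : ℝ) * (a / q) + ((k * a : ℤ) : ℝ) := by
    have h1 : (n : ℝ) = q * k + (n % q : ℕ) := by exact_mod_cast hk.symm
    rw [ZMod.val_natCast]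
    nth_rw 1 [h1]
    push_cast
    field_simp
    ring
  rw [h, ee_add_intCast]

/-- The sum over primes dividing `q` is small. -/
lemma sum_lw_not_coprime_le {q : ℕ} (hq : q ≠ 0) (X : ℕ) :
    ∑ n ∈ (Finset.Ioc 0 X).filter (fun n ↦ ¬ n.Coprime q), lw n ≤ (q : ℝ) ^ 2 := by
  have hq0 : (0 : ℝ) < q := by exact_mod_cast Nat.pos_of_ne_zero hq
  have h1 : ∑ n ∈ (Finset.Ioc 0 X).filter (fun n ↦ ¬ n.Coprime q), lw n ≤ ∑ n ∈ q.divisors, lw n := by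
    rw [← Finset.sum_filter_add_sum_filter_not ((Finset.Ioc 0 X).filter (fun n ↦ ¬ n.Coprime q))
      Nat.Prime]
    rw [Finset.sum_eq_zero (s := ((Finset.Ioc 0 X).filter (fun n ↦ ¬ n.Coprime q)).filter
      (fun n ↦ ¬ n.Prime)) (f := lw), add_zero]
    · refine Finset.sum_le_sum_of_subset_of_nonneg ?_ fun n _ _ ↦ lw_nonneg n
      intro n hn
      simp only [Finset.mem_filter] at hn
      rw [Nat.mem_divisors]
      exact ⟨by_contra fun h ↦ hn.1.2 ((Nat.Prime.coprime_iff_not_dvd hn.2).2 h), hq⟩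
    · intro n hn
      simp only [Finset.mem_filter] at hn
      rw [lw, if_neg hn.2]
  refine h1.trans ?_
  have h2 : ∀ n ∈ q.divisors, lw n ≤ (q : ℝ) := by
    intro n hn
    refine (lw_le_log n).trans ?_
    have h3 : (n : ℝ) ≤ q := by exact_mod_cast Nat.divisor_le hn
    exact (Real.log_le_self (Nat.cast_nonneg n)).trans h3
  refine (Finset.sum_le_sum h2).trans ?_
  rw [Finset.sum_const, nsmul_eq_mul, sq]
  have : (q.divisors.card : ℝ) ≤ q := by exact_mod_cast Nat.card_divisors_le_self q
  gcongr

/-- Exponential sums over primes at rational points, in terms of character sums. -/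
lemma norm_sum_lw_mul_ee_div_sub_le {q : ℕ} [NeZero q] {a : ℤ} (ha : IsCoprime a q) {X : ℕ}
    {D₀ D₁ : ℝ} (h0 : |∑ n ∈ Finset.Ioc 0 X, lw n - X| ≤ D₀)
    (h1 : ∀ χ : DirichletCharacter ℂ q, χ ≠ 1 →
      ‖∑ n ∈ Finset.Ioc 0 X, χ n * (lw n : ℂ)‖ ≤ D₁) (hD₁ : 0 ≤ D₁) :
    ‖∑ n ∈ Finset.Ioc 0 X, (lw n : ℂ) * ee (n * (a / q)) - (mobius q / q.totient : ℝ) * X‖ ≤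
      q * D₁ + D₀ + 2 * q ^ 2 := by
  have hq : q ≠ 0 := NeZero.ne q
  have hφ : 0 < q.totient := Nat.totient_pos.2 (Nat.pos_of_ne_zero hq)
  have hφ' : (0 : ℝ) < q.totient := by exact_mod_cast hφ
  have hφ1 : (1 : ℝ) ≤ q.totient := by exact_mod_cast hφ
  have hφc : (q.totient : ℂ) ≠ 0 := by exact_mod_cast hφ.ne'
  set f : ZMod q → ℂ := fun y ↦ ee ((y.val : ℝ) * (a / q)) with hf
  set τ : DirichletCharacter ℂ q → ℂ := fun χ ↦ ∑ b : (ZMod q)ˣ, f b * χ ((b : ZMod q)⁻¹) with hτ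
  set E := ∑ n ∈ (Finset.Ioc 0 X).filter (fun n ↦ ¬ n.Coprime q), lw n with hE
  have hEq : E ≤ (q : ℝ) ^ 2 := sum_lw_not_coprime_le hq X
  have hE0 : 0 ≤ E := Finset.sum_nonneg fun n _ ↦ lw_nonneg n
  have hτ1 : τ 1 = (mobius q : ℂ) := by
    rw [← ramanujan_of_coprime hq ha, ← sum_coprime_ee hq, ← sum_units_eq fun b ↦ ee (b * (a / q))]
    refine Finset.sum_congr rfl fun b _ ↦ ?_
    rw [MulChar.one_apply, mul_one]
    rw [ZMod.inv_coe_unit]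
    exact (b⁻¹).isUnit
  have hτle : ∀ χ, ‖τ χ‖ ≤ q.totient := by
    intro χ
    refine (norm_sum_le_of_le (n := fun _ ↦ (1 : ℝ)) _ fun b _ ↦ ?_).trans ?_
    · rw [norm_mul, hf, norm_ee, one_mul]
      exact DirichletCharacter.norm_le_one χ _
    · rw [Finset.sum_const, Finset.card_univ, ZMod.card_units_eq_totient]; simp
  have hmain : ∑ n ∈ (Finset.Ioc 0 X).filter (fun n ↦ n.Coprime q), (lw n : ℂ) * ee (n * (a / q)) =
      (q.totient : ℂ)⁻¹ * ∑ χ : DirichletCharacter ℂ q, τ χ *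
        ∑ n ∈ Finset.Ioc 0 X, χ n * (lw n : ℂ) := by
    rw [eq_inv_mul_iff_mul_eq₀ hφc]
    simp_rw [Finset.mul_sum]
    rw [Finset.sum_comm, Finset.sum_filter]
    refine Finset.sum_congr rfl fun n _ ↦ ?_
    split_ifs with hn
    · have h2 := sum_char_mul_sum_units f ((ZMod.isUnit_iff_coprime n q).2 hn)
      rw [hf] at h2
      simp only [ee_val_mul_div hq] at h2
      rw [mul_left_comm, ← h2, Finset.mul_sum]
      refine Finset.sum_congr rfl fun χ _ ↦ ?_
      simp only [hτ, hf]
      ring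
    · symm
      refine Finset.sum_eq_zero fun χ _ ↦ ?_
      rw [χ.map_nonunit (fun h ↦ hn ((ZMod.isUnit_iff_coprime n q).1 h))]
      simp
  have hone : ‖∑ n ∈ Finset.Ioc 0 X, (1 : DirichletCharacter ℂ q) n * (lw n : ℂ) - X‖ ≤ D₀ + E := by
    have h2 : ∑ n ∈ Finset.Ioc 0 X, (1 : DirichletCharacter ℂ q) n * (lw n : ℂ) =
        ((∑ n ∈ Finset.Ioc 0 X, lw n - E : ℝ) : ℂ) := by
      rw [hE, Finset.sum_filter, ← Finset.sum_sub_distrib, Complex.ofReal_sum]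
      refine Finset.sum_congr rfl fun n _ ↦ ?_
      by_cases hn : n.Coprime q
      · rw [MulChar.one_apply ((ZMod.isUnit_iff_coprime n q).2 hn)]; simp [hn]
      · rw [MulChar.map_nonunit _ (fun h ↦ hn ((ZMod.isUnit_iff_coprime n q).1 h))]; simp [hn]
    rw [h2, ← Complex.ofReal_natCast, ← Complex.ofReal_sub, Complex.norm_real, Real.norm_eq_abs,
      show ∑ n ∈ Finset.Ioc 0 X, lw n - E - (X : ℝ) = (∑ n ∈ Finset.Ioc 0 X, lw n - X) - E by ring]
    refine (abs_sub _ _).trans ?_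
    rw [abs_of_nonneg hE0]
    linarith
  rw [← Finset.sum_filter_add_sum_filter_not (Finset.Ioc 0 X) (fun n ↦ n.Coprime q), hmain,
    ← Finset.add_sum_erase _ _ (Finset.mem_univ (1 : DirichletCharacter ℂ q)), hτ1]
  set T := ∑ χ ∈ Finset.univ.erase (1 : DirichletCharacter ℂ q), τ χ *
        ∑ n ∈ Finset.Ioc 0 X, χ n * (lw n : ℂ) with hT
  have hTle : ‖T‖ ≤ q.totient * (q.totient * D₁) := by
    have h3 : ∀ χ ∈ Finset.univ.erase (1 : DirichletCharacter ℂ q),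
        ‖τ χ * ∑ n ∈ Finset.Ioc 0 X, χ n * (lw n : ℂ)‖ ≤ q.totient * D₁ := by
      intro χ hχ
      rw [norm_mul]
      exact mul_le_mul (hτle χ) (h1 χ (Finset.ne_of_mem_erase hχ)) (norm_nonneg _) hφ'.le
    refine (norm_sum_le_of_le _ h3).trans ?_
    rw [Finset.sum_const, nsmul_eq_mul]
    have hcard : ((Finset.univ.erase (1 : DirichletCharacter ℂ q)).card : ℝ) ≤ q.totient := by
      have := DirichletCharacter.card_eq_totient_of_hasEnoughRootsOfUnity ℂ q
      rw [Nat.card_eq_fintype_card] at this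
      rw [← this, ← Finset.card_univ]
      exact_mod_cast Finset.card_erase_le
    gcongr
  have hEle : ‖∑ n ∈ (Finset.Ioc 0 X).filter (fun n ↦ ¬ n.Coprime q),
      (lw n : ℂ) * ee (n * (a / q))‖ ≤ E := by
    refine norm_sum_le_of_le _ fun n _ ↦ ?_
    rw [norm_mul, norm_ee, mul_one, Complex.norm_real, Real.norm_of_nonneg (lw_nonneg n)]
  set S1 := ∑ n ∈ Finset.Ioc 0 X, (1 : DirichletCharacter ℂ q) n * (lw n : ℂ) with hS1
  set S2 := ∑ n ∈ (Finset.Ioc 0 X).filter (fun n ↦ ¬ n.Coprime q),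
      (lw n : ℂ) * ee (n * (a / q)) with hS2
  have hrw : (q.totient : ℂ)⁻¹ * ((mobius q : ℂ) * S1 + T) + S2 -
      ((mobius q / q.totient : ℝ) : ℂ) * X =
      (q.totient : ℂ)⁻¹ * (mobius q : ℂ) * (S1 - X) + (q.totient : ℂ)⁻¹ * T + S2 := by
    push_cast; ring
  rw [hrw]
  refine (norm_add₃_le).trans ?_
  rw [norm_mul, norm_mul, norm_mul, norm_inv, Complex.norm_natCast, Complex.norm_real,
    Real.norm_eq_abs]
  have hφq : (q.totient : ℝ) ≤ q := by exact_mod_cast Nat.totient_le q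
  have h4 : (q.totient : ℝ)⁻¹ * |mobius q| * ‖S1 - X‖ ≤ 1 * 1 * (D₀ + E) := by
    have := inv_le_one_of_one_le₀ hφ1
    have := abs_mobius_le q
    gcongr
  have h5 : (q.totient : ℝ)⁻¹ * ‖T‖ ≤ q * D₁ := by
    calc _ ≤ (q.totient : ℝ)⁻¹ * (q.totient * (q.totient * D₁)) := by gcongr
      _ = q.totient * D₁ := by field_simp
      _ ≤ _ := by gcongr
  linarith

end ResidueClasses

end Vinogradov

namespace Vinogradov

open Complex MeasureTheory Set Asymptotics Topology

open ArithmeticFunction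

/-! ### Prime exponential sums on the major arcs -/

section MajorArcs

lemma eventually_mul_log_pow_le_sqrt (K : ℝ) (A : ℕ) :
    ∀ᶠ N : ℕ in atTop, K * Real.log N ^ A ≤ √N := by
  have h := (Real.isLittleO_pow_log_id_atTop (n := 2 * A)).bound
    (show 0 < ((|K| + 1) ^ 2)⁻¹ by positivity)
  have h' := tendsto_natCast_atTop_atTop (R := ℝ) |>.eventually h
  filter_upwards [h'] with N hN
  have hlog := Real.log_natCast_nonneg N
  rw [id, Real.norm_of_nonneg (by positivity), Real.norm_of_nonneg (Nat.cast_nonneg N),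
    inv_mul_eq_div, le_div_iff₀ (by positivity)] at hN
  calc K * Real.log N ^ A ≤ (|K| + 1) * Real.log N ^ A := by
        gcongr; linarith [le_abs_self K]
    _ ≤ √N := by
        apply Real.le_sqrt_of_sq_le
        calc _ = Real.log N ^ (2 * A) * (|K| + 1) ^ 2 := by ring
          _ ≤ _ := hN

lemma eventually_le_log (K : ℝ) : ∀ᶠ N : ℕ in atTop, K ≤ Real.log N :=
  (Real.tendsto_log_atTop.comp tendsto_natCast_atTop_atTop).eventually_ge_atTop K

lemma sum_Ioc_eq_sum_Icc {M : Type*} [AddCommMonoid M] (f : ℕ → M) (N : ℕ) :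
    ∑ n ∈ Finset.Ioc 0 N, f n = ∑ n ∈ Finset.Icc 1 N, f n := rfl

/-- The exponential sum over primes near a rational point with small denominator. -/
theorem eventually_norm_sum_lw_mul_ee_div_sub_le (A B : ℕ) : ∀ᶠ N : ℕ in atTop,
    ∀ q : ℕ, q ≠ 0 → (q : ℝ) ≤ Real.log N ^ B → ∀ a : ℤ, IsCoprime a q → ∀ X ≤ N,
      ‖∑ n ∈ Finset.Ioc 0 X, (lw n : ℂ) * ee (n * (a / q)) -
        (mobius q / q.totient : ℝ) * X‖ ≤ N / Real.log N ^ A := by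
  obtain ⟨C₁, hC₁, hχ⟩ := exists_norm_sum_vonMangoldt_char_le (A + B + 1) (B + 1)
  obtain ⟨C₂, hC₂, hζ⟩ := exists_abs_sum_vonMangoldt_sub_le (A + B + 1)
  set C := max C₁ C₂ with hC
  have hC0 : 0 < C := lt_max_of_lt_left hC₁
  filter_upwards [eventually_mul_log_pow_le_sqrt 3 A, eventually_mul_log_pow_le_sqrt 12 (A + B + 1),
    eventually_mul_log_pow_le_sqrt 6 (A + 2 * B), eventually_le_log 1,
    eventually_le_log (2 ^ (B + 1)), eventually_le_log (6 * C * 2 ^ (A + B + 1)),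
    eventually_ge_atTop 9] with N h1 h2 h3 h4 h5 h6 h7 q hq hqL a ha X hX
  set L := Real.log N with hL
  have hN0 : (0 : ℝ) < N := by exact_mod_cast (by omega : 0 < N)
  have hL0 : 0 < L := by linarith
  have hXN : (X : ℝ) ≤ N := by exact_mod_cast hX
  have hN1 : (1 : ℝ) ≤ N := by exact_mod_cast (by omega : 1 ≤ N)
  have hsqrt : √N * √N = (N : ℝ) := Real.mul_self_sqrt hN0.le
  have hsq0 : 0 < √(N : ℝ) := Real.sqrt_pos.2 hN0
  have hφ : (1 : ℝ) ≤ q.totient := by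
    exact_mod_cast Nat.totient_pos.2 (Nat.pos_of_ne_zero hq)
  rcases le_or_gt ((X : ℝ) ^ 2) N with hXs | hXs
  · have hX' : (X : ℝ) ≤ √N := Real.le_sqrt_of_sq_le hXs
    have h8 : ‖∑ n ∈ Finset.Ioc 0 X, (lw n : ℂ) * ee (n * (a / q))‖ ≤ 2 * X := by
      refine (norm_sum_le_of_le (n := lw) _ fun n _ ↦ ?_).trans (sum_lw_le X)
      rw [norm_mul, norm_ee, mul_one, Complex.norm_real, Real.norm_of_nonneg (lw_nonneg n)]
    have h9 : ‖((mobius q / q.totient : ℝ) : ℂ) * X‖ ≤ X := by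
      rw [norm_mul, Complex.norm_real, Complex.norm_natCast, norm_div, Real.norm_eq_abs,
        Real.norm_natCast]
      refine mul_le_of_le_one_left (Nat.cast_nonneg X) ?_
      rw [div_le_one (by linarith)]
      exact (abs_mobius_le q).trans hφ
    refine (norm_sub_le _ _).trans ((add_le_add h8 h9).trans ?_)
    rw [le_div_iff₀ (by positivity)]
    calc (2 * (X : ℝ) + X) * L ^ A = X * (3 * L ^ A) := by ring
      _ ≤ √N * √N := by gcongr
      _ = N := hsqrt
  have hX3 : 3 ≤ X := by
    by_contra h
    have h8 : (X : ℝ) ≤ 3 := by exact_mod_cast (by omega : X ≤ 3)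
    have h9 : (9 : ℝ) ≤ N := by exact_mod_cast h7
    nlinarith
  have hX0 : (0 : ℝ) < X := by exact_mod_cast (by omega : 0 < X)
  have hlogX : L ≤ 2 * Real.log X := by
    have := Real.log_le_log hN0 hXs.le
    rwa [Real.log_pow, Nat.cast_ofNat] at this
  have hlogX0 : 0 < Real.log X := by linarith
  have hlogXL : Real.log X ≤ L := Real.log_le_log hX0 hXN
  have hqX : (q : ℝ) ≤ Real.log X ^ (B + 1) := by
    calc (q : ℝ) ≤ L ^ B := hqL
      _ ≤ (2 * Real.log X) ^ B := by gcongr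
      _ = 2 ^ B * Real.log X ^ B := mul_pow _ _ _
      _ ≤ Real.log X * Real.log X ^ B := by
          gcongr
          rw [pow_succ] at h5
          linarith
      _ = _ := by ring
  have : NeZero q := ⟨hq⟩
  set D := C * 2 ^ (A + B + 1) * N / L ^ (A + B + 1) + 2 * √N * L with hD
  have hmainD : ∀ c, c ≤ C → c * X / Real.log X ^ (A + B + 1) + 2 * √X * Real.log X ≤ D := by
    intro c hc
    refine add_le_add ?_ (by gcongr)
    rw [div_le_div_iff₀ (by positivity) (by positivity)]
    calc c * X * L ^ (A + B + 1) ≤ C * N * (2 * Real.log X) ^ (A + B + 1) := by gcongr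
      _ = _ := by ring
  have hbig := norm_sum_lw_mul_ee_div_sub_le ha (X := X) (D₀ := D) (D₁ := D) ?_ ?_ (by positivity)
  · refine hbig.trans ?_
    have e1 : (q : ℝ) * D + D ≤ 2 * L ^ B * D := by
      have : (1 : ℝ) ≤ L ^ B := one_le_pow₀ h4
      have hD0 : 0 ≤ D := by positivity
      nlinarith
    have e2 : 2 * (q : ℝ) ^ 2 ≤ 2 * L ^ (2 * B) := by
      rw [mul_comm 2 B, pow_mul]; gcongr
    have e3 : 2 * L ^ B * D = 2 * C * 2 ^ (A + B + 1) / L * (N / L ^ A) + 4 * L ^ (B + 1) * √N := by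
      rw [hD]; field_simp; ring
    have e4 : 2 * C * 2 ^ (A + B + 1) / L * (N / L ^ A) ≤ 1 / 3 * (N / L ^ A) := by
      refine mul_le_mul_of_nonneg_right ?_ (by positivity)
      rw [div_le_div_iff₀ hL0 (by norm_num)]
      linarith
    have e5 : 4 * L ^ (B + 1) * √N ≤ 1 / 3 * (N / L ^ A) := by
      rw [mul_div_assoc', le_div_iff₀ (by positivity)]
      calc 4 * L ^ (B + 1) * √N * L ^ A = 1 / 3 * (12 * L ^ (A + B + 1) * √N) := by ring
        _ ≤ 1 / 3 * (√N * √N) := by gcongr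
        _ = _ := by rw [hsqrt]
    have e6 : 2 * L ^ (2 * B) ≤ 1 / 3 * (N / L ^ A) := by
      rw [mul_div_assoc', le_div_iff₀ (by positivity)]
      calc 2 * L ^ (2 * B) * L ^ A = 1 / 3 * (6 * L ^ (A + 2 * B)) := by ring
        _ ≤ 1 / 3 * √N := by gcongr
        _ ≤ 1 / 3 * N := by
            gcongr
            exact sqrt_le_self_of_one_le hN1
    linarith
  · have h8 := hζ X hX3
    have h9 := norm_sum_vonMangoldt_sub_sum_lw_le (by omega : 1 ≤ X) (fun _ ↦ 1) (by simp)
    simp only [one_mul, ← Complex.ofReal_sum, ← Complex.ofReal_sub, Complex.norm_real,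
      Real.norm_eq_abs] at h9
    rw [sum_Ioc_eq_sum_Icc (fun n ↦ Λ n)] at h9
    have h10 := hmainD C₂ (le_max_right _ _)
    rw [abs_le] at h8 h9 ⊢
    constructor <;> linarith
  · intro χ hχ1
    have h8 := hχ X hX3 q hqX χ hχ1
    have h9 := norm_sum_vonMangoldt_sub_sum_lw_le (by omega : 1 ≤ X) (fun n ↦ χ n)
      (fun n ↦ DirichletCharacter.norm_le_one χ _)
    rw [sum_Ioc_eq_sum_Icc (fun n ↦ χ n * (Λ n : ℂ))] at h9
    have h10 := hmainD C₁ (le_max_left _ _)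
    rw [norm_sub_rev] at h9
    have h11 := norm_le_norm_add_norm_sub' (∑ n ∈ Finset.Ioc 0 X, χ n * (lw n : ℂ))
      (∑ n ∈ Finset.Icc 1 X, χ n * (Λ n : ℂ))
    linarith

lemma norm_ee_sub_ee_le (x y : ℝ) : ‖ee x - ee y‖ ≤ 2 * Real.pi * |x - y| := by
  have h : ee x - ee y = ee y * (ee (x - y) - 1) := by
    rw [mul_sub, ← ee_add]; ring_nf
  rw [h, norm_mul, norm_ee, one_mul, ee]
  have h2 := Real.norm_exp_I_mul_ofReal_sub_one_le (x := 2 * Real.pi * (x - y))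
  rw [show (2 * Real.pi * ((x - y : ℝ) : ℂ) * I) = I * ((2 * Real.pi * (x - y) : ℝ) : ℂ) by
    push_cast; ring]
  refine h2.trans (le_of_eq ?_)
  rw [Real.norm_eq_abs, abs_mul, abs_of_pos (by positivity)]

/-- Partial summation against an additive character. -/
lemma norm_sum_mul_ee_le_of_partial_sums {c : ℕ → ℂ} {N : ℕ} {E : ℝ}
    (h : ∀ X ≤ N, ‖∑ n ∈ Finset.Ioc 0 X, c n‖ ≤ E) (β : ℝ) {X : ℕ} (hX : X ≤ N) :
    ‖∑ n ∈ Finset.Ioc 0 X, c n * ee (n * β)‖ ≤ E * (1 + X * (2 * Real.pi * |β|)) := by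
  have key : ∀ Y ≤ N, ‖∑ n ∈ Finset.Ioc 0 Y, c n * ee (n * β) -
      (∑ n ∈ Finset.Ioc 0 Y, c n) * ee (Y * β)‖ ≤ Y * (E * (2 * Real.pi * |β|)) := by
    intro Y
    induction Y with
    | zero => simp
    | succ Y ih =>
      intro hY
      rw [← Finset.sum_Ioc_consecutive _ (Nat.zero_le Y) (Nat.le_succ Y),
        ← Finset.sum_Ioc_consecutive c (Nat.zero_le Y) (Nat.le_succ Y)]
      simp only [Nat.Ioc_succ_singleton, Finset.sum_singleton]
      set T := ∑ n ∈ Finset.Ioc 0 Y, c n with hT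
      set F := ∑ n ∈ Finset.Ioc 0 Y, c n * ee (n * β) with hF
      have h1 : F + c (Y + 1) * ee ((Y + 1 : ℕ) * β) - (T + c (Y + 1)) * ee ((Y + 1 : ℕ) * β) =
          (F - T * ee (Y * β)) + T * (ee (Y * β) - ee ((Y + 1 : ℕ) * β)) := by ring
      rw [h1]
      refine (norm_add_le _ _).trans ?_
      have h2 : ‖T * (ee (Y * β) - ee ((Y + 1 : ℕ) * β))‖ ≤ E * (2 * Real.pi * |β|) := by
        rw [norm_mul]
        refine mul_le_mul (h Y (by omega)) ((norm_ee_sub_ee_le _ _).trans (le_of_eq ?_))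
          (norm_nonneg _) ((norm_nonneg _).trans (h Y (by omega)))
        rw [show (Y : ℝ) * β - (Y + 1 : ℕ) * β = -β by push_cast; ring, abs_neg]
      have h3 := ih (by omega)
      calc _ ≤ (Y : ℝ) * (E * (2 * Real.pi * |β|)) + E * (2 * Real.pi * |β|) := add_le_add h3 h2
        _ = _ := by push_cast; ring
  have h1 := key X hX
  have h2 : ‖(∑ n ∈ Finset.Ioc 0 X, c n) * ee (X * β)‖ ≤ E := by
    rw [norm_mul, norm_ee, mul_one]; exact h X hX
  have h3 := norm_le_norm_add_norm_sub' (∑ n ∈ Finset.Ioc 0 X, c n * ee (n * β))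
    ((∑ n ∈ Finset.Ioc 0 X, c n) * ee (X * β))
  linarith

/-- The exponential sum over primes on the major arcs. -/
theorem eventually_norm_sum_lw_mul_ee_sub_le (A B : ℕ) : ∀ᶠ N : ℕ in atTop,
    ∀ q : ℕ, q ≠ 0 → (q : ℝ) ≤ Real.log N ^ B → ∀ a : ℤ, IsCoprime a q → ∀ α : ℝ,
      |α - a / q| ≤ Real.log N ^ B / N → ∀ X ≤ N,
      ‖∑ n ∈ Finset.Ioc 0 X, (lw n : ℂ) * ee (n * α) -
        (mobius q / q.totient : ℝ) * ∑ n ∈ Finset.Ioc 0 X, ee (n * (α - a / q))‖ ≤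
        N / Real.log N ^ A := by
  filter_upwards [eventually_norm_sum_lw_mul_ee_div_sub_le (A + B + 1) B, eventually_le_log 8,
    eventually_gt_atTop 0] with N hN hL hN0 q hq hqL a ha α hα X hX
  set β := α - a / q with hβ
  set L := Real.log N with hLdef
  have hN0' : (0 : ℝ) < N := by exact_mod_cast hN0
  have hL0 : 0 < L := by linarith
  have h := norm_sum_mul_ee_le_of_partial_sums (N := N) (E := N / L ^ (A + B + 1))
    (c := fun n ↦ (lw n : ℂ) * ee (n * (a / q)) - (mobius q / q.totient : ℝ)) ?_ β hX
  · have h1 : ∑ n ∈ Finset.Ioc 0 X, ((lw n : ℂ) * ee (n * (a / q)) -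
        ((mobius q / q.totient : ℝ) : ℂ)) * ee (n * β) =
        ∑ n ∈ Finset.Ioc 0 X, (lw n : ℂ) * ee (n * α) -
        (mobius q / q.totient : ℝ) * ∑ n ∈ Finset.Ioc 0 X, ee (n * β) := by
      rw [Finset.mul_sum, ← Finset.sum_sub_distrib]
      refine Finset.sum_congr rfl fun n _ ↦ ?_
      rw [sub_mul, mul_assoc, ← ee_add, ← mul_add, hβ]
      congr 4
      ring
    rw [h1] at h
    refine h.trans ?_
    have hXN : (X : ℝ) ≤ N := by exact_mod_cast hX
    have hpi : 2 * Real.pi ≤ 7 := by linarith [Real.pi_lt_d2]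
    have hLB : (1 : ℝ) ≤ L ^ B := one_le_pow₀ (by linarith)
    have h2 : (X : ℝ) * (2 * Real.pi * |β|) ≤ 7 * L ^ B := by
      calc (X : ℝ) * (2 * Real.pi * |β|) ≤ N * (7 * (L ^ B / N)) := by gcongr
        _ = _ := by field_simp
    calc _ ≤ N / L ^ (A + B + 1) * (8 * L ^ B) := by gcongr; linarith
      _ ≤ N / L ^ (A + B + 1) * (L * L ^ B) := by gcongr
      _ = _ := by field_simp; ring
  · intro Y hY
    have h1 := hN q hq hqL a ha Y hY
    rw [Finset.sum_sub_distrib, Finset.sum_const, Nat.card_Ioc, Nat.sub_zero, nsmul_eq_mul,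
      mul_comm (Y : ℂ)]
    exact h1

end MajorArcs

end Vinogradov

namespace Vinogradov

open Complex MeasureTheory Set Asymptotics Topology

/-! ### Ternary sums and Fourier transforms -/

section Fourier

/-- The exponential sum of `f` over the finite set `s`. -/
noncomputable def fourierSum (s : Finset ℕ) (f : ℕ → ℂ) (α : ℝ) : ℂ :=
  ∑ n ∈ s, f n * ee (n * α)

/-- The weighted count of ternary representations of `N` by elements of `s`. -/
noncomputable def triSum (s : Finset ℕ) (N : ℕ) (f g h : ℕ → ℂ) : ℂ :=
  ∑ a ∈ s, ∑ b ∈ s, ∑ c ∈ s, if a + b + c = N then f a * g b * h c else 0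

lemma fourierSum_sub (s : Finset ℕ) (f g : ℕ → ℂ) (α : ℝ) :
    fourierSum s (f - g) α = fourierSum s f α - fourierSum s g α := by
  simp [fourierSum, sub_mul, Finset.sum_sub_distrib]

variable {s : Finset ℕ} {N : ℕ}

lemma mul_triSum (hs : ∀ n ∈ s, n ≤ N) (f g h : ℕ → ℂ) :
    ((3 * N + 1 : ℕ) : ℂ) * triSum s N f g h =
      ∑ k ∈ Finset.range (3 * N + 1), fourierSum s f (k / (3 * N + 1 : ℕ)) *
        fourierSum s g (k / (3 * N + 1 : ℕ)) * fourierSum s h (k / (3 * N + 1 : ℕ)) *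
        ee (-(N * (k / (3 * N + 1 : ℕ)))) := by
  set m := 3 * N + 1 with hm
  have hterm : ∀ k ∈ Finset.range m, fourierSum s f (k / m) * fourierSum s g (k / m) *
      fourierSum s h (k / m) * ee (-(N * (k / m))) =
      ∑ a ∈ s, ∑ b ∈ s, ∑ c ∈ s, f a * g b * h c *
        ee (k * (((a + b + c - N : ℤ) : ℝ) / m)) := by
    intro k _
    simp only [fourierSum]
    rw [Finset.sum_mul_sum, Finset.sum_mul, Finset.sum_mul]
    refine Finset.sum_congr rfl fun a _ ↦ ?_
    rw [Finset.sum_mul, Finset.sum_mul]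
    refine Finset.sum_congr rfl fun b _ ↦ ?_
    rw [Finset.mul_sum, Finset.sum_mul]
    refine Finset.sum_congr rfl fun c _ ↦ ?_
    have : ((k : ℝ) * (((a + b + c - N : ℤ) : ℝ) / m)) =
        a * (k / m) + b * (k / m) + c * (k / m) + -(N * (k / m)) := by
      push_cast; ring
    rw [this, ee_add, ee_add, ee_add]
    ring
  rw [Finset.sum_congr rfl hterm, Finset.sum_comm, triSum, Finset.mul_sum]
  refine Finset.sum_congr rfl fun a ha ↦ ?_
  rw [Finset.mul_sum]
  conv_rhs => rw [Finset.sum_comm]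
  refine Finset.sum_congr rfl fun b hb ↦ ?_
  rw [Finset.mul_sum]
  conv_rhs => rw [Finset.sum_comm]
  refine Finset.sum_congr rfl fun c hc ↦ ?_
  rw [← Finset.mul_sum, sum_range_ee]
  have h1 := hs a ha
  have h2 := hs b hb
  have h3 := hs c hc
  by_cases hN : a + b + c = N
  · have h0 : (a + b + c - N : ℤ) = 0 := by omega
    rw [if_pos hN, h0, if_pos (dvd_zero _), mul_comm]
  · rw [if_neg hN, if_neg, mul_zero, mul_zero]
    rintro ⟨t, ht⟩
    have hm' : (m : ℤ) = 3 * N + 1 := by simp [hm]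
    have ht0 : t ≠ 0 := by rintro rfl; omega
    rcases lt_or_gt_of_ne ht0 with h | h <;> nlinarith

lemma sum_norm_sq_fourierSum (hs : ∀ n ∈ s, n ≤ N) (f : ℕ → ℂ) :
    ∑ k ∈ Finset.range (3 * N + 1), ‖fourierSum s f (k / (3 * N + 1 : ℕ))‖ ^ 2 =
      (3 * N + 1 : ℕ) * ∑ n ∈ s, ‖f n‖ ^ 2 := by
  set m := 3 * N + 1 with hm
  have hterm : ∀ k ∈ Finset.range m, ((‖fourierSum s f (k / m)‖ ^ 2 : ℝ) : ℂ) =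
      ∑ a ∈ s, ∑ b ∈ s, f a * starRingEnd ℂ (f b) *
        ee (k * (((a - b : ℤ) : ℝ) / m)) := by
    intro k _
    rw [← Complex.normSq_eq_norm_sq, ← Complex.mul_conj]
    simp only [fourierSum]
    rw [map_sum, Finset.sum_mul_sum]
    refine Finset.sum_congr rfl fun a _ ↦ Finset.sum_congr rfl fun b _ ↦ ?_
    have : ((k : ℝ) * (((a - b : ℤ) : ℝ) / m)) = a * (k / m) + -(b * (k / m)) := by
      push_cast; ring
    rw [this, ee_add, ee_neg, map_mul]
    ring
  have : ((∑ k ∈ Finset.range m, ‖fourierSum s f (k / m)‖ ^ 2 : ℝ) : ℂ) =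
      ((m * ∑ n ∈ s, ‖f n‖ ^ 2 : ℝ) : ℂ) := by
    rw [Complex.ofReal_sum, Finset.sum_congr rfl hterm, Finset.sum_comm, Complex.ofReal_mul,
      Complex.ofReal_sum, Finset.mul_sum]
    refine Finset.sum_congr rfl fun a ha ↦ ?_
    rw [Finset.sum_comm, Finset.sum_eq_single_of_mem a ha]
    · rw [← Finset.mul_sum, sum_range_ee, sub_self, if_pos (dvd_zero _), Complex.mul_conj,
        Complex.normSq_eq_norm_sq, mul_comm, Complex.ofReal_natCast]
    · intro b hb hba
      rw [← Finset.mul_sum, sum_range_ee, if_neg, mul_zero]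
      rintro ⟨t, ht⟩
      have h1 := hs a ha
      have h2 := hs b hb
      have hm' : (m : ℤ) = 3 * N + 1 := by simp [hm]
      have ht0 : t ≠ 0 := by rintro rfl; omega
      rcases lt_or_gt_of_ne ht0 with h | h <;> nlinarith
  exact_mod_cast this

lemma norm_triSum_le_of_mul_triSum {D F G : ℝ} {d f g : ℕ → ℂ} (hs : ∀ n ∈ s, n ≤ N)
    (hd : ∀ α, ‖fourierSum s d α‖ ≤ D) (hf : ∑ n ∈ s, ‖f n‖ ^ 2 ≤ F)
    (hg : ∑ n ∈ s, ‖g n‖ ^ 2 ≤ G) {T : ℂ}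
    (hT : ((3 * N + 1 : ℕ) : ℂ) * T =
      ∑ k ∈ Finset.range (3 * N + 1), fourierSum s d (k / (3 * N + 1 : ℕ)) *
        fourierSum s f (k / (3 * N + 1 : ℕ)) * fourierSum s g (k / (3 * N + 1 : ℕ)) *
        ee (-(N * (k / (3 * N + 1 : ℕ))))) :
    ‖T‖ ≤ D * ((F + G) / 2) := by
  have hD : 0 ≤ D := (norm_nonneg _).trans (hd 0)
  have hF := sum_norm_sq_fourierSum hs f
  have hG := sum_norm_sq_fourierSum hs g
  set m := 3 * N + 1 with hm
  have hm0 : (0 : ℝ) < m := by positivity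
  have h1 : (m : ℝ) * ‖T‖ ≤ m * (D * ((F + G) / 2)) := by
    rw [← Complex.norm_natCast, ← norm_mul, hT, Complex.norm_natCast]
    calc _ ≤ ∑ k ∈ Finset.range m, D * ((‖fourierSum s f (k / m)‖ ^ 2 +
          ‖fourierSum s g (k / m)‖ ^ 2) / 2) := by
          refine norm_sum_le_of_le _ fun k _ ↦ ?_
          rw [norm_mul, norm_ee, mul_one, norm_mul, norm_mul, mul_assoc]
          refine mul_le_mul (hd _) ?_ (by positivity) hD
          nlinarith [sq_nonneg (‖fourierSum s f (k / m)‖ - ‖fourierSum s g (k / m)‖)]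
      _ = D * ((m * ∑ n ∈ s, ‖f n‖ ^ 2 + m * ∑ n ∈ s, ‖g n‖ ^ 2) / 2) := by
          rw [← Finset.mul_sum, ← Finset.sum_div, Finset.sum_add_distrib, hF, hG]
      _ ≤ D * ((m * F + m * G) / 2) := by gcongr
      _ = _ := by ring
  exact le_of_mul_le_mul_left h1 hm0

/-- Stability of the ternary count under perturbations with small exponential sum. -/
theorem norm_triSum_sub_triSum_le {D F G : ℝ} {f g : ℕ → ℂ} (hs : ∀ n ∈ s, n ≤ N)
    (hd : ∀ α, ‖fourierSum s f α - fourierSum s g α‖ ≤ D) (hf : ∑ n ∈ s, ‖f n‖ ^ 2 ≤ F)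
    (hg : ∑ n ∈ s, ‖g n‖ ^ 2 ≤ G) :
    ‖triSum s N f f f - triSum s N g g g‖ ≤ D * (3 / 2 * (F + G)) := by
  simp only [← fourierSum_sub] at hd
  have h1 : ‖triSum s N (f - g) f f‖ ≤ D * ((F + F) / 2) :=
    norm_triSum_le_of_mul_triSum hs hd hf hf (mul_triSum hs _ _ _)
  have h2 : ‖triSum s N g (f - g) f‖ ≤ D * ((G + F) / 2) :=
    norm_triSum_le_of_mul_triSum hs hd hg hf <| (mul_triSum hs _ _ _).trans <|
      Finset.sum_congr rfl fun k _ ↦ by ring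
  have h3 : ‖triSum s N g g (f - g)‖ ≤ D * ((G + G) / 2) :=
    norm_triSum_le_of_mul_triSum hs hd hg hg <| (mul_triSum hs _ _ _).trans <|
      Finset.sum_congr rfl fun k _ ↦ by ring
  have h4 : triSum s N f f f - triSum s N g g g = triSum s N (f - g) f f +
      triSum s N g (f - g) f + triSum s N g g (f - g) := by
    simp only [triSum, ← Finset.sum_add_distrib, ← Finset.sum_sub_distrib]
    refine Finset.sum_congr rfl fun a _ ↦ Finset.sum_congr rfl fun b _ ↦
      Finset.sum_congr rfl fun c _ ↦ ?_
    split_ifs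
    · simp only [Pi.sub_apply]; ring
    · ring
  rw [h4]
  calc _ ≤ D * ((F + F) / 2) + D * ((G + F) / 2) + D * ((G + G) / 2) :=
        norm_add_le_of_le (norm_add_le_of_le h1 h2) h3
    _ = _ := by ring

end Fourier

end Vinogradov

namespace Vinogradov

open Complex MeasureTheory Set Asymptotics Topology

/-! ### A model for the primes -/

section Model

/-- The reduced fractions in `[0, 1)` with denominator at most `Q`. -/
def fracs (Q : ℕ) : Finset (Σ _ : ℕ, ℕ) :=
  (Finset.Icc 1 Q).sigma fun q ↦ (Finset.range q).filter q.Coprime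

lemma mem_fracs {Q : ℕ} {p : Σ _ : ℕ, ℕ} :
    p ∈ fracs Q ↔ (1 ≤ p.1 ∧ p.1 ≤ Q) ∧ p.2 < p.1 ∧ p.1.Coprime p.2 := by
  simp [fracs]

/-- The value of a fraction. -/
noncomputable def fracVal (p : Σ _ : ℕ, ℕ) : ℝ := p.2 / p.1

/-- The size of the exponential sum over primes near a fraction with denominator `q`. -/
noncomputable def wt (q : ℕ) : ℝ := mobius q / q.totient

/-- The model for the weighted indicator function of the primes. -/
noncomputable def model (Q : ℕ) (n : ℕ) : ℂ :=
  ∑ p ∈ fracs Q, (wt p.1 : ℂ) * ee (-(n * fracVal p))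

lemma abs_wt_le (q : ℕ) : |wt q| ≤ 1 / q.totient := by
  rw [wt, abs_div, Nat.abs_cast]
  exact div_le_div_of_nonneg_right (abs_mobius_le q) (Nat.cast_nonneg _)

lemma sum_fracs_const {M : Type*} [AddCommMonoid M] (Q : ℕ) (f : ℕ → M) :
    ∑ p ∈ fracs Q, f p.1 = ∑ q ∈ Finset.Icc 1 Q, q.totient • f q := by
  rw [fracs, Finset.sum_sigma]
  refine Finset.sum_congr rfl fun q _ ↦ ?_
  simp only [Finset.sum_const]
  rfl

lemma sum_fracs_abs_wt_le (Q : ℕ) : ∑ p ∈ fracs Q, |wt p.1| ≤ Q := by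
  rw [sum_fracs_const Q (fun q ↦ |wt q|)]
  calc _ ≤ ∑ q ∈ Finset.Icc 1 Q, (1 : ℝ) := by
        refine Finset.sum_le_sum fun q hq ↦ ?_
        rw [nsmul_eq_mul]
        have h : (0 : ℝ) < q.totient := by
          exact_mod_cast Nat.totient_pos.2 (Finset.mem_Icc.1 hq).1
        calc (q.totient : ℝ) * |wt q| ≤ q.totient * (1 / q.totient) := by
              gcongr; exact abs_wt_le q
          _ = 1 := by field_simp
    _ = Q := by simp

/-- Distinct reduced fractions are well separated modulo one. -/
lemma one_div_le_dn_fracVal_sub {p p' : Σ _ : ℕ, ℕ} (hp : p.2 < p.1) (hp' : p'.2 < p'.1)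
    (hc : p.1.Coprime p.2) (hc' : p'.1.Coprime p'.2) (hne : p ≠ p') :
    1 / ((p.1 : ℝ) * p'.1) ≤ dn (fracVal p - fracVal p') := by
  obtain ⟨q, b⟩ := p
  obtain ⟨q', b'⟩ := p'
  simp only at hp hp' hc hc'
  have hq : (0 : ℝ) < q := by exact_mod_cast (Nat.zero_le b).trans_lt hp
  have hq' : (0 : ℝ) < q' := by exact_mod_cast (Nat.zero_le b').trans_lt hp'
  rw [dn]
  simp only [fracVal]
  set r := round ((b : ℝ) / q - b' / q')
  have hz : (b * q' - b' * q - r * (q * q') : ℤ) ≠ 0 := by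
    intro h
    have h1 : (q : ℤ) ∣ b * q' := ⟨b' + r * q', by linarith⟩
    have h2 : (q' : ℤ) ∣ b' * q := ⟨b - r * q, by linarith⟩
    have h3 : q ∣ q' := hc.dvd_of_dvd_mul_left (by exact_mod_cast h1)
    have h4 : q' ∣ q := hc'.dvd_of_dvd_mul_left (by exact_mod_cast h2)
    obtain rfl := Nat.dvd_antisymm h3 h4
    have h5 : (q : ℤ) * (b - b' - r * q) = 0 := by linarith
    have hq0 : (q : ℤ) ≠ 0 := by exact_mod_cast hq.ne'
    have h6 : (b - b' - r * q : ℤ) = 0 := (mul_eq_zero.1 h5).resolve_left hq0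
    have h7 : b = b' := by
      refine Nat.ModEq.eq_of_lt_of_lt ?_ hp hp'
      rw [← Int.natCast_modEq_iff]
      exact (Int.modEq_iff_dvd.2 ⟨-r, by linarith⟩)
    exact hne (by rw [h7])
  have h1 : (b : ℝ) / q - b' / q' - r =
      ((b * q' - b' * q - r * (q * q') : ℤ) : ℝ) / (q * q') := by
    push_cast; field_simp
  rw [h1, abs_div, abs_of_pos (mul_pos hq hq')]
  refine div_le_div_of_nonneg_right ?_ (by positivity)
  exact_mod_cast Int.one_le_abs hz

lemma norm_sum_ee_le_of_le_dn (A B : ℕ) {d x : ℝ} (hd : 0 < d) (h : d ≤ dn x) :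
    ‖∑ n ∈ Finset.Ioc A B, ee (n * x)‖ ≤ 2 / d := by
  have hB : (0 : ℝ) ≤ B := Nat.cast_nonneg B
  have hA : (0 : ℝ) ≤ A := Nat.cast_nonneg A
  have hB1 : (0 : ℝ) < B + 1 := by linarith
  calc _ ≤ 2 * kern (B + 1) x := norm_sum_ee_le hB1 (by linarith) x
    _ ≤ 2 * (1 / d) := by
        gcongr
        exact kern_le_of_le_dn hB1.le hd h
    _ = _ := by ring

lemma norm_sum_wt_mul_sum_ee_le {Q : ℕ} {s : Finset (Σ _ : ℕ, ℕ)} (hs : s ⊆ fracs Q) {d α : ℝ}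
    (hd : 0 < d) (h : ∀ p ∈ s, d ≤ dn (α - fracVal p)) (A B : ℕ) :
    ‖∑ p ∈ s, (wt p.1 : ℂ) * ∑ n ∈ Finset.Ioc A B, ee (n * (α - fracVal p))‖ ≤ 2 * Q / d := by
  calc _ ≤ ∑ p ∈ s, |wt p.1| * (2 / d) := by
        refine norm_sum_le_of_le _ fun p hp ↦ ?_
        rw [norm_mul, Complex.norm_real, Real.norm_eq_abs]
        gcongr
        exact norm_sum_ee_le_of_le_dn A B hd (h p hp)
    _ ≤ ∑ p ∈ fracs Q, |wt p.1| * (2 / d) :=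
        Finset.sum_le_sum_of_subset_of_nonneg hs fun p _ _ ↦ by positivity
    _ ≤ Q * (2 / d) := by
        rw [← Finset.sum_mul]
        gcongr
        exact sum_fracs_abs_wt_le Q
    _ = _ := by ring

lemma fourierSum_model (Q A B : ℕ) (α : ℝ) : fourierSum (Finset.Ioc A B) (model Q) α =
    ∑ p ∈ fracs Q, (wt p.1 : ℂ) * ∑ n ∈ Finset.Ioc A B, ee (n * (α - fracVal p)) := by
  simp only [fourierSum, model, Finset.mul_sum, Finset.sum_mul]
  rw [Finset.sum_comm]
  refine Finset.sum_congr rfl fun p _ ↦ Finset.sum_congr rfl fun n _ ↦ ?_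
  rw [mul_assoc, ← ee_add]
  ring_nf

lemma fourierSum_sub_intCast (s : Finset ℕ) (f : ℕ → ℂ) (α : ℝ) (k : ℤ) :
    fourierSum s f (α - k) = fourierSum s f α := by
  refine Finset.sum_congr rfl fun n _ ↦ ?_
  rw [show (n : ℝ) * (α - k) = n * α + ((-(n * k) : ℤ) : ℝ) by push_cast; ring, ee_add_intCast]

/-- Dirichlet approximation by a fraction in `[0, 1)`, up to an integer translation. -/
lemma exists_abs_sub_fracVal_le (α : ℝ) {R : ℕ} (hR : 0 < R) :
    ∃ (k : ℤ) (p : Σ _ : ℕ, ℕ), (1 ≤ p.1 ∧ p.1 ≤ R) ∧ (p.2 < p.1 ∧ p.1.Coprime p.2) ∧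
      |α - k - fracVal p| ≤ 1 / ((R + 1) * p.1) := by
  obtain ⟨r, h1, h2⟩ := Real.exists_rat_abs_sub_le_and_den_le α hR
  have hd : (0 : ℤ) < r.den := by exact_mod_cast r.den_pos
  have hd' : (0 : ℝ) < r.den := by exact_mod_cast r.den_pos
  have h3 := Int.emod_nonneg r.num hd.ne'
  have h4 := Int.emod_lt_of_pos r.num hd
  have h5 : (((r.num % r.den).toNat : ℕ) : ℤ) = r.num % r.den := Int.toNat_of_nonneg h3
  refine ⟨r.num / r.den, ⟨r.den, (r.num % r.den).toNat⟩, ⟨r.den_pos, h2⟩,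
    ⟨by simp only; omega, ?_⟩, ?_⟩
  · simp only
    rw [← Nat.isCoprime_iff_coprime, h5, Int.emod_def, sub_eq_add_neg, ← mul_neg,
      IsCoprime.add_mul_left_right_iff]
    exact (Rat.isCoprime_num_den r).symm
  · have h6 : ((((r.num % r.den).toNat : ℕ) : ℤ) : ℝ) = ((r.num % r.den : ℤ) : ℝ) := by rw [h5]
    rw [Int.cast_natCast] at h6
    have h7 : (r : ℝ) = (r.num / r.den : ℤ) + ((r.num % r.den : ℤ) : ℝ) / r.den := by
      have h8 : ((r.den : ℤ) : ℝ) * (r.num / r.den : ℤ) + ((r.num % r.den : ℤ) : ℝ) = r.num := by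
        exact_mod_cast Int.mul_ediv_add_emod r.num r.den
      rw [Rat.cast_def, ← h8, Int.cast_natCast]
      field_simp
    simp only [fracVal]
    rw [h6, sub_sub, ← h7]
    exact h1

end Model

end Vinogradov

namespace Vinogradov

open Complex MeasureTheory Set Asymptotics Topology

/-! ### Approximating the primes by the model -/

section Approximation

/-- The exponential sum over primes on the minor arcs. -/
theorem eventually_norm_sum_lw_mul_ee_le : ∀ᶠ N : ℕ in atTop, ∀ q : ℕ, q ≠ 0 →
    Real.log N ^ 16 ≤ q → (q : ℝ) ≤ N / Real.log N ^ 64 → ∀ a : ℤ, IsCoprime a q → ∀ α : ℝ,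
      |α - a / q| ≤ 1 / q ^ 2 → ∀ X ≤ N,
      ‖∑ n ∈ Finset.Ioc 0 X, (lw n : ℂ) * ee (n * α)‖ ≤ N / Real.log N ^ 3 := by
  filter_upwards [eventually_mul_log_pow_le_sqrt 2 3, eventually_mul_log_pow_le_sqrt 1 32,
    eventually_mul_log_pow_le_sqrt 24000 39, eventually_mul_log_pow_le_sqrt 6 4,
    eventually_le_log 72000, eventually_ge_atTop 9] with N h1 h2 h3 h4 h5 h6 q hq hqL hqN a ha α hα
    X hX
  set L := Real.log N with hL
  have hN0 : (0 : ℝ) < N := by exact_mod_cast (by omega : 0 < N)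
  have hN1 : (1 : ℝ) ≤ N := by exact_mod_cast (by omega : 1 ≤ N)
  have hL0 : 0 < L := by linarith
  have hL1 : 1 ≤ L := by linarith
  have hXN : (X : ℝ) ≤ N := by exact_mod_cast hX
  have hsqrt : √N * √N = (N : ℝ) := Real.mul_self_sqrt hN0.le
  have hsN : √N ≤ (N : ℝ) := sqrt_le_self_of_one_le hN1
  have hq0 : (0 : ℝ) < q := by exact_mod_cast Nat.pos_of_ne_zero hq
  have htriv : ‖∑ n ∈ Finset.Ioc 0 X, (lw n : ℂ) * ee (n * α)‖ ≤ 2 * X := by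
    refine (norm_sum_le_of_le (n := lw) _ fun n _ ↦ ?_).trans (sum_lw_le X)
    rw [norm_mul, norm_ee, mul_one, Complex.norm_real, Real.norm_of_nonneg (lw_nonneg n)]
  rcases le_or_gt ((X : ℝ) ^ 2) N with hXs | hXs
  · have hX' : (X : ℝ) ≤ √N := Real.le_sqrt_of_sq_le hXs
    refine htriv.trans ?_
    rw [le_div_iff₀ (by positivity)]
    calc 2 * (X : ℝ) * L ^ 3 = X * (2 * L ^ 3) := by ring
      _ ≤ √N * √N := by gcongr
      _ = N := hsqrt
  rcases lt_or_ge X q with hXq | hXq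
  · have hX' : (X : ℝ) ≤ N / L ^ 64 := (Nat.cast_le.2 hXq.le).trans hqN
    refine htriv.trans ?_
    rw [le_div_iff₀ (by positivity)]
    calc 2 * (X : ℝ) * L ^ 3 ≤ L * (N / L ^ 64) * L ^ 3 := by gcongr; linarith
      _ = N / L ^ 60 := by field_simp
      _ ≤ N := div_le_self hN0.le (one_le_pow₀ hL1)
  have hX3 : 3 ≤ X := by
    by_contra h
    have h8 : (X : ℝ) ≤ 3 := by exact_mod_cast (by omega : X ≤ 3)
    have h9 : (9 : ℝ) ≤ N := by exact_mod_cast h6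
    nlinarith
  have hX0 : (0 : ℝ) < X := by exact_mod_cast (by omega : 0 < X)
  have hsX : √N ≤ X := (Real.sqrt_le_left hX0.le).2 hXs.le
  have hlogXL : Real.log X ≤ L := Real.log_le_log hX0 hXN
  have hlogX0 : 0 ≤ Real.log X := Real.log_natCast_nonneg X
  have hL16 : (1 : ℝ) ≤ L ^ 16 := one_le_pow₀ hL1
  set U := ⌊L ^ 16⌋₊ with hU
  have hU0 : 0 < U := Nat.floor_pos.2 hL16
  have hUle : (U : ℝ) ≤ L ^ 16 := Nat.floor_le (by positivity)
  have hU1 : (1 : ℝ) ≤ U := by exact_mod_cast hU0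
  have hUge : L ^ 16 ≤ 2 * U := by
    have := Nat.lt_floor_add_one (L ^ 16)
    linarith
  have hU2 : (U : ℝ) ^ 2 ≤ (L ^ 16) ^ 2 := by gcongr
  have hv := norm_sum_vonMangoldt_mul_ee_le (U := U) hq ha hα hXq hX3 hU0
    (by
      have : ((U ^ 2 : ℕ) : ℝ) ≤ X := by
        rw [Nat.cast_pow]
        calc (U : ℝ) ^ 2 ≤ (L ^ 16) ^ 2 := hU2
          _ = 1 * L ^ 32 := by ring
          _ ≤ X := h2.trans hsX
      exact_mod_cast this)
  have hw := norm_sum_vonMangoldt_sub_sum_lw_le (by omega : 1 ≤ X) (fun n ↦ ee (n * α))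
    (fun n ↦ (norm_ee _).le)
  have hroot : √(X * (X / q + 2 * (X / U) + q)) ≤ 3 * N / L ^ 8 := by
    rw [Real.sqrt_le_left (by positivity)]
    have e1 : (X : ℝ) / q ≤ N / L ^ 16 := by gcongr
    have e2 : (X : ℝ) / U ≤ 2 * (N / L ^ 16) := by
      rw [mul_div_assoc', div_le_div_iff₀ (by linarith) (by positivity)]
      calc (X : ℝ) * L ^ 16 ≤ N * (2 * U) := by gcongr
        _ = _ := by ring
    have e3 : (N : ℝ) / L ^ 64 ≤ N / L ^ 16 := by gcongr; norm_num
    calc (X : ℝ) * (X / q + 2 * (X / U) + q) ≤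
          N * (N / L ^ 16 + 2 * (2 * (N / L ^ 16)) + 4 * (N / L ^ 16)) := by
            gcongr
            have : 0 ≤ N / L ^ 16 := by positivity
            linarith
      _ = _ := by field_simp; ring
  have hb1 : 500 * (1 + Real.log X) ^ 4 * (√(X * (X / q + 2 * (X / U) + q)) + (U : ℝ) ^ 2) ≤
      500 * (2 * L) ^ 4 * (3 * N / L ^ 8 + (L ^ 16) ^ 2) := by
    gcongr; linarith
  have hb2 : 500 * (2 * L) ^ 4 * (3 * N / L ^ 8 + (L ^ 16) ^ 2) =
      24000 / L * (N / L ^ 3) + 8000 * L ^ 36 := by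
    field_simp; ring
  have hb3 : 24000 / L * (N / L ^ 3) ≤ 1 / 3 * (N / L ^ 3) := by
    refine mul_le_mul_of_nonneg_right ?_ (by positivity)
    rw [div_le_div_iff₀ hL0 (by norm_num)]
    linarith
  have hb4 : 8000 * L ^ 36 ≤ 1 / 3 * (N / L ^ 3) := by
    rw [mul_div_assoc', le_div_iff₀ (by positivity)]
    calc 8000 * L ^ 36 * L ^ 3 = 1 / 3 * (24000 * L ^ 39) := by ring
      _ ≤ 1 / 3 * (N : ℝ) := by gcongr; linarith
  have hb5 : 2 * √X * Real.log X ≤ 1 / 3 * (N / L ^ 3) := by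
    rw [mul_div_assoc', le_div_iff₀ (by positivity)]
    calc 2 * √X * Real.log X * L ^ 3 ≤ 2 * √N * L * L ^ 3 := by gcongr
      _ = 1 / 3 * (√N * (6 * L ^ 4)) := by ring
      _ ≤ 1 / 3 * (√N * √N) := by gcongr
      _ = _ := by rw [hsqrt]
  have h11 := norm_le_norm_add_norm_sub' (∑ n ∈ Finset.Ioc 0 X, (lw n : ℂ) * ee (n * α))
    (∑ n ∈ Finset.Ioc 0 X, (ArithmeticFunction.vonMangoldt n : ℂ) * ee (n * α))
  simp only [mul_comm (ee _)] at hw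
  rw [norm_sub_rev] at hw
  linarith

lemma fourierSum_Ioc {A B : ℕ} (hAB : A ≤ B) (f : ℕ → ℂ) (α : ℝ) :
    fourierSum (Finset.Ioc A B) f α =
      fourierSum (Finset.Ioc 0 B) f α - fourierSum (Finset.Ioc 0 A) f α := by
  rw [fourierSum, fourierSum, fourierSum, ← Finset.sum_Ioc_consecutive _ (Nat.zero_le A) hAB,
    add_sub_cancel_left]

/-- The exponential sum over primes is uniformly close to that of the model. -/
theorem eventually_norm_fourierSum_lw_sub_model_le : ∀ᶠ N : ℕ in atTop, ∀ A B : ℕ, A ≤ B → B ≤ N →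
    ∀ α : ℝ, ‖fourierSum (Finset.Ioc A B) (fun n ↦ (lw n : ℂ)) α -
      fourierSum (Finset.Ioc A B) (model ⌊Real.log N ^ 16⌋₊) α‖ ≤ 3 * (N / Real.log N ^ 3) := by
  filter_upwards [eventually_norm_sum_lw_mul_ee_le, eventually_norm_sum_lw_mul_ee_sub_le 3 64,
    eventually_mul_log_pow_le_sqrt 2 80, eventually_le_log 4, eventually_ge_atTop 1] with N hminor
    hmajor h1 h2 h3 A B hAB hBN α
  set L := Real.log N with hL
  have hN1 : (1 : ℝ) ≤ N := by exact_mod_cast h3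
  have hN0 : (0 : ℝ) < N := by linarith
  have hL0 : 0 < L := by linarith
  have hL1 : 1 ≤ L := by linarith
  have hLN : 2 * L ^ 80 ≤ N := h1.trans (sqrt_le_self_of_one_le hN1)
  set Q := ⌊L ^ 16⌋₊ with hQ
  set R := ⌊(N : ℝ) / L ^ 64⌋₊ with hR
  have hQle : (Q : ℝ) ≤ L ^ 16 := Nat.floor_le (by positivity)
  have hRle : (R : ℝ) ≤ N / L ^ 64 := Nat.floor_le (by positivity)
  have hRlt : (N : ℝ) / L ^ 64 < R + 1 := Nat.lt_floor_add_one _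
  have hNR : 2 * L ^ 16 ≤ N / L ^ 64 := by
    rw [le_div_iff₀ (by positivity)]
    calc 2 * L ^ 16 * L ^ 64 = 2 * L ^ 80 := by ring
      _ ≤ (N : ℝ) := hLN
  have hL16 : 1 ≤ L ^ 16 := one_le_pow₀ hL1
  have hR0 : 0 < R := Nat.floor_pos.2 (by linarith)
  have hQ0 : 0 < Q := Nat.floor_pos.2 hL16
  have hR0' : (0 : ℝ) < R := by exact_mod_cast hR0
  have hQ0' : (0 : ℝ) < Q := by exact_mod_cast hQ0
  obtain ⟨k, p, ⟨hp1, hpR⟩, ⟨hp2, hpc⟩, happrox⟩ := exists_abs_sub_fracVal_le α hR0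
  rw [← fourierSum_sub_intCast _ _ α k, ← fourierSum_sub_intCast _ _ α k]
  set β := α - k with hβ
  have hq0 : (0 : ℝ) < p.1 := by exact_mod_cast hp1
  have hpR' : (p.1 : ℝ) ≤ R := by exact_mod_cast hpR
  have hcop : IsCoprime ((p.2 : ℕ) : ℤ) (p.1 : ℤ) := Nat.isCoprime_iff_coprime.2 hpc.symm
  have hfv : fracVal p = ((p.2 : ℤ) : ℝ) / p.1 := by simp [fracVal]
  have hsep : ∀ p' ∈ fracs Q, p' ≠ p → 1 / (2 * (R * Q) : ℝ) ≤ dn (β - fracVal p') := by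
    intro p' hp' hne
    obtain ⟨⟨hp1', hpQ'⟩, hp2', hpc'⟩ := mem_fracs.1 hp'
    have hq0' : (0 : ℝ) < p'.1 := by exact_mod_cast hp1'
    have hpQ'' : (p'.1 : ℝ) ≤ Q := by exact_mod_cast hpQ'
    have e1 := one_div_le_dn_fracVal_sub hp2 hp2' hpc hpc' hne.symm
    have e2 := dn_le_add_abs (fracVal p - fracVal p') (β - fracVal p')
    rw [show fracVal p - fracVal p' - (β - fracVal p') = -(β - fracVal p) by ring, abs_neg] at e2
    have e3 : 1 / ((R + 1) * p.1 : ℝ) ≤ 1 / (2 * (p.1 * p'.1)) := by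
      apply one_div_le_one_div_of_le (by positivity)
      have : 2 * (p'.1 : ℝ) ≤ R + 1 := by linarith
      nlinarith
    have e4 : 1 / (2 * (R * Q) : ℝ) ≤ 1 / (2 * (p.1 * p'.1)) := by
      apply one_div_le_one_div_of_le (by positivity)
      gcongr
    have e5 : 1 / ((p.1 : ℝ) * p'.1) = 1 / (2 * (p.1 * p'.1)) + 1 / (2 * (p.1 * p'.1)) := by
      field_simp; norm_num
    linarith
  have hd : (0 : ℝ) < 1 / (2 * (R * Q)) := by positivity
  have hother := norm_sum_wt_mul_sum_ee_le (Q := Q) (Finset.erase_subset p (fracs Q)) hd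
    (fun p' hp' ↦ hsep p' (Finset.mem_of_mem_erase hp') (Finset.ne_of_mem_erase hp')) A B
  have hother' : 2 * (Q : ℝ) / (1 / (2 * (R * Q))) ≤ N / L ^ 3 := by
    calc 2 * (Q : ℝ) / (1 / (2 * (R * Q))) = 4 * R * Q ^ 2 := by field_simp; norm_num
      _ ≤ L * (N / L ^ 64) * (L ^ 16) ^ 2 := by gcongr
      _ = N / L ^ 31 := by field_simp
      _ ≤ N / L ^ 3 := by gcongr; norm_num
  rw [fourierSum_Ioc hAB (fun n ↦ (lw n : ℂ)), fourierSum_model]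
  rcases le_or_gt p.1 Q with hpQ | hpQ
  · have hpQ' : (p.1 : ℝ) ≤ L ^ 64 := by
      have : (p.1 : ℝ) ≤ Q := by exact_mod_cast hpQ
      exact this.trans (hQle.trans (pow_le_pow_right₀ hL1 (by norm_num)))
    have happ : |β - ((p.2 : ℤ) : ℝ) / p.1| ≤ L ^ 64 / N := by
      rw [← hfv]
      refine happrox.trans ?_
      rw [div_le_div_iff₀ (by positivity) hN0]
      have e1 : (N : ℝ) ≤ L ^ 64 * (R + 1) := by
        rw [div_lt_iff₀ (by positivity)] at hRlt; linarith
      have e2 : (1 : ℝ) ≤ p.1 := by exact_mod_cast hp1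
      calc 1 * (N : ℝ) ≤ L ^ 64 * (R + 1) * 1 := by linarith
        _ ≤ L ^ 64 * (R + 1) * p.1 := by gcongr
        _ = _ := by ring
    have hm := fun X hX ↦ hmajor p.1 (by omega) hpQ' p.2 hcop β happ X hX
    rw [← hfv] at hm
    have hmB := hm B hBN
    have hmA := hm A (hAB.trans hBN)
    rw [← Finset.add_sum_erase _ _ (mem_fracs.2 ⟨⟨hp1, hpQ⟩, hp2, hpc⟩)]
    have hsplit : ∑ n ∈ Finset.Ioc A B, ee (n * (β - fracVal p)) =
        ∑ n ∈ Finset.Ioc 0 B, ee (n * (β - fracVal p)) -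
        ∑ n ∈ Finset.Ioc 0 A, ee (n * (β - fracVal p)) := by
      rw [← Finset.sum_Ioc_consecutive _ (Nat.zero_le A) hAB, add_sub_cancel_left]
    rw [hsplit]
    simp only [fourierSum, wt] at hmA hmB hother ⊢
    set M := ∑ x ∈ (fracs Q).erase p, ((mobius x.1 / x.1.totient : ℝ) : ℂ) *
      ∑ n ∈ Finset.Ioc A B, ee (n * (β - fracVal x))
    rw [show ∀ a b c d w : ℂ, a - b - (w * (c - d) + M) = (a - w * c) - (b - w * d) - M by
      intros; ring]
    refine (norm_sub_le _ _).trans ?_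
    have := norm_sub_le_of_le hmB hmA
    linarith
  · have hpL : L ^ 16 ≤ p.1 := (Nat.lt_of_floor_lt hpQ).le
    have happ : |β - ((p.2 : ℤ) : ℝ) / p.1| ≤ 1 / (p.1 : ℝ) ^ 2 := by
      rw [← hfv]
      refine happrox.trans (one_div_le_one_div_of_le (by positivity) ?_)
      rw [sq]
      gcongr
      linarith
    have hm := fun X hX ↦ hminor p.1 (by omega) hpL (hpR'.trans hRle) p.2 hcop β happ X hX
    have hmB := hm B hBN
    have hmA := hm A (hAB.trans hBN)
    rw [Finset.erase_eq_of_notMem (fun h ↦ by have := (mem_fracs.1 h).1.2; omega)] at hother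
    have := norm_sub_le_of_le (norm_sub_le_of_le hmB hmA) (hother.trans hother')
    simp only [fourierSum] at this ⊢
    linarith

end Approximation

end Vinogradov

namespace Vinogradov

open Complex MeasureTheory Set Asymptotics Topology

/-! ### Moments of the model -/

section ModelMoments

lemma one_div_sq_le_dn_fracVal_sub {Q : ℕ} {p p' : Σ _ : ℕ, ℕ} (hp : p ∈ fracs Q)
    (hp' : p' ∈ fracs Q) (hne : p ≠ p') : 1 / (Q : ℝ) ^ 2 ≤ dn (fracVal p - fracVal p') := by
  obtain ⟨⟨h1, h2⟩, h3, h4⟩ := mem_fracs.1 hp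
  obtain ⟨⟨h1', h2'⟩, h3', h4'⟩ := mem_fracs.1 hp'
  have h5 : (0 : ℝ) < p.1 := by exact_mod_cast h1
  have h5' : (0 : ℝ) < p'.1 := by exact_mod_cast h1'
  refine le_trans ?_ (one_div_le_dn_fracVal_sub h3 h3' h4 h4' hne)
  rw [sq]
  gcongr

lemma sum_one_div_totient_le (Q : ℕ) :
    ∑ q ∈ Finset.Icc 1 Q, (1 : ℝ) / q.totient ≤ (2 * Real.log Q + 1) * (1 + Real.log Q) := by
  calc _ ≤ ∑ q ∈ Finset.Ioc 0 Q, (2 * Real.log Q + 1) * ((1 : ℝ) / q) := by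
        refine Finset.sum_le_sum fun q hq ↦ ?_
        have hq1 := (Finset.mem_Icc.1 hq).1
        have hq0 : (0 : ℝ) < q := by exact_mod_cast hq1
        have hφ : (0 : ℝ) < q.totient := by exact_mod_cast Nat.totient_pos.2 hq1
        have h1 := le_totient_mul_log (n := q) (by omega)
        have h2 : Real.log q ≤ Real.log Q :=
          Real.log_le_log hq0 (by exact_mod_cast (Finset.mem_Icc.1 hq).2)
        rw [mul_one_div, div_le_div_iff₀ hφ hq0]
        nlinarith
    _ ≤ _ := by
        rw [← Finset.mul_sum]
        have := Real.log_natCast_nonneg Q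
        gcongr
        exact sum_Ioc_one_div_le Q

lemma sum_fracs_wt_sq_le (Q : ℕ) :
    ∑ p ∈ fracs Q, wt p.1 ^ 2 ≤ (2 * Real.log Q + 1) * (1 + Real.log Q) := by
  rw [sum_fracs_const Q (fun q ↦ wt q ^ 2)]
  refine le_trans (Finset.sum_le_sum fun q hq ↦ ?_) (sum_one_div_totient_le Q)
  have hφ : (0 : ℝ) < q.totient := by
    exact_mod_cast Nat.totient_pos.2 (Finset.mem_Icc.1 hq).1
  rw [nsmul_eq_mul, ← sq_abs]
  calc (q.totient : ℝ) * |wt q| ^ 2 ≤ q.totient * (1 / q.totient) ^ 2 := by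
        gcongr; exact abs_wt_le q
    _ = _ := by field_simp

/-- The second moment of the model. -/
theorem sum_norm_sq_model_le (Q A B : ℕ) : ∑ n ∈ Finset.Ioc A B, ‖model Q n‖ ^ 2 ≤
    B * ((2 * Real.log Q + 1) * (1 + Real.log Q)) + 2 * Q ^ 4 := by
  have h1 : ((∑ n ∈ Finset.Ioc A B, ‖model Q n‖ ^ 2 : ℝ) : ℂ) =
      ∑ p ∈ fracs Q, (wt p.1 : ℂ) * ∑ p' ∈ fracs Q, (wt p'.1 : ℂ) *
        ∑ n ∈ Finset.Ioc A B, ee (n * (fracVal p - fracVal p')) := by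
    rw [Complex.ofReal_sum]
    simp only [Finset.mul_sum]
    rw [Finset.sum_congr rfl fun p _ ↦ Finset.sum_comm, Finset.sum_comm]
    refine Finset.sum_congr rfl fun n _ ↦ ?_
    rw [← Complex.normSq_eq_norm_sq, ← Complex.mul_conj, mul_comm]
    simp only [model]
    rw [map_sum, Finset.sum_mul_sum]
    refine Finset.sum_congr rfl fun p _ ↦ Finset.sum_congr rfl fun p' _ ↦ ?_
    rw [map_mul, Complex.conj_ofReal, ee_neg, Complex.conj_conj,
      show (n : ℝ) * (fracVal p - fracVal p') = n * fracVal p + -(n * fracVal p') by ring, ee_add]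
    ring
  have h2 : ∀ p ∈ fracs Q, ‖∑ p' ∈ fracs Q, (wt p'.1 : ℂ) *
      ∑ n ∈ Finset.Ioc A B, ee (n * (fracVal p - fracVal p'))‖ ≤ |wt p.1| * B + 2 * Q ^ 3 := by
    intro p hp
    have hQ : (0 : ℝ) < Q := by
      have := (mem_fracs.1 hp).1
      exact_mod_cast (by omega : 0 < Q)
    rw [← Finset.add_sum_erase _ _ hp]
    refine norm_add_le_of_le ?_ ?_
    · simp only [sub_self, mul_zero, ee_zero, Finset.sum_const, Nat.card_Ioc, nsmul_eq_mul, mul_one]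
      rw [norm_mul, Complex.norm_real, Complex.norm_natCast, Real.norm_eq_abs]
      gcongr
      exact_mod_cast Nat.sub_le B A
    · refine (norm_sum_wt_mul_sum_ee_le (Finset.erase_subset p _)
        (show (0 : ℝ) < 1 / Q ^ 2 by positivity) (fun p' hp' ↦ ?_) A B).trans (le_of_eq ?_)
      · exact one_div_sq_le_dn_fracVal_sub hp (Finset.mem_of_mem_erase hp')
          (Finset.ne_of_mem_erase hp').symm
      · field_simp
  have h3 : ∑ n ∈ Finset.Ioc A B, ‖model Q n‖ ^ 2 ≤
      ∑ p ∈ fracs Q, |wt p.1| * (|wt p.1| * B + 2 * Q ^ 3) := by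
    rw [← Real.norm_of_nonneg (Finset.sum_nonneg fun n _ ↦ by positivity :
      0 ≤ ∑ n ∈ Finset.Ioc A B, ‖model Q n‖ ^ 2), ← Complex.norm_real, h1]
    refine norm_sum_le_of_le _ fun p hp ↦ ?_
    rw [norm_mul, Complex.norm_real, Real.norm_eq_abs]
    gcongr
    exact h2 p hp
  refine h3.trans ?_
  calc _ = B * ∑ p ∈ fracs Q, wt p.1 ^ 2 + (∑ p ∈ fracs Q, |wt p.1|) * (2 * Q ^ 3) := by
        rw [Finset.mul_sum, Finset.sum_mul, ← Finset.sum_add_distrib]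
        refine Finset.sum_congr rfl fun p _ ↦ ?_
        rw [← sq_abs]; ring
    _ ≤ B * ((2 * Real.log Q + 1) * (1 + Real.log Q)) + Q * (2 * Q ^ 3) := by
        gcongr
        · exact sum_fracs_wt_sq_le Q
        · exact sum_fracs_abs_wt_le Q
    _ = _ := by ring

variable {s : Finset ℕ} {N : ℕ}

lemma triSum_swap (f g h : ℕ → ℂ) : triSum s N f g h = triSum s N g f h := by
  rw [triSum, Finset.sum_comm]
  refine Finset.sum_congr rfl fun a _ ↦ Finset.sum_congr rfl fun b _ ↦
    Finset.sum_congr rfl fun c _ ↦ ?_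
  rw [add_comm b a, mul_comm (f b)]

lemma triSum_rotate (f g h : ℕ → ℂ) : triSum s N f g h = triSum s N g h f := by
  rw [triSum, triSum, Finset.sum_comm]
  refine Finset.sum_congr rfl fun a _ ↦ ?_
  rw [Finset.sum_comm]
  refine Finset.sum_congr rfl fun b _ ↦ Finset.sum_congr rfl fun c _ ↦ ?_
  rw [show c + a + b = a + b + c by ring, show f c * g a * h b = g a * h b * f c by ring]

lemma triSum_sum_left {ι : Type*} (t : Finset ι) (w : ι → ℂ) (F : ι → ℕ → ℂ) (g h : ℕ → ℂ) :
    triSum s N (fun n ↦ ∑ i ∈ t, w i * F i n) g h = ∑ i ∈ t, w i * triSum s N (F i) g h := by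
  simp only [triSum, Finset.mul_sum]
  conv_rhs => rw [Finset.sum_comm]
  refine Finset.sum_congr rfl fun a _ ↦ ?_
  conv_rhs => rw [Finset.sum_comm]
  refine Finset.sum_congr rfl fun b _ ↦ ?_
  conv_rhs => rw [Finset.sum_comm]
  refine Finset.sum_congr rfl fun c _ ↦ ?_
  split_ifs
  · rw [Finset.sum_mul, Finset.sum_mul]
    exact Finset.sum_congr rfl fun i _ ↦ by ring
  · simp

lemma triSum_sum {ι : Type*} (t : Finset ι) (w : ι → ℂ) (F : ι → ℕ → ℂ) :
    triSum s N (fun n ↦ ∑ i ∈ t, w i * F i n) (fun n ↦ ∑ i ∈ t, w i * F i n)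
      (fun n ↦ ∑ i ∈ t, w i * F i n) =
    ∑ i ∈ t, ∑ j ∈ t, ∑ k ∈ t, w i * w j * w k * triSum s N (F k) (F i) (F j) := by
  rw [triSum_sum_left]
  refine Finset.sum_congr rfl fun i _ ↦ ?_
  rw [triSum_rotate, triSum_sum_left, Finset.mul_sum]
  refine Finset.sum_congr rfl fun j _ ↦ ?_
  rw [triSum_rotate, triSum_sum_left, Finset.mul_sum, Finset.mul_sum]
  exact Finset.sum_congr rfl fun k _ ↦ by ring

lemma norm_pair_sum_le (A B M : ℕ) {d x z : ℝ} (hd : 0 < d) (h : d ≤ dn (x - z)) :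
    ‖∑ a ∈ Finset.Ioc A B, ∑ c ∈ Finset.Ioc A B,
      if a + c = M then ee (a * x) * ee (c * z) else 0‖ ≤ 2 / d := by
  have h1 : ∑ a ∈ Finset.Ioc A B, ∑ c ∈ Finset.Ioc A B,
      (if a + c = M then ee (a * x) * ee (c * z) else 0) =
      ee (M * z) * ∑ a ∈ Finset.Ioc (max A (M - B - 1)) (min B (M - A - 1)),
        ee (a * (x - z)) := by
    have h2 : Finset.Ioc (max A (M - B - 1)) (min B (M - A - 1)) =
        (Finset.Ioc A B).filter fun a ↦ A < M - a ∧ M - a ≤ B ∧ a ≤ M := by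
      ext a
      simp only [Finset.mem_Ioc, Finset.mem_filter]
      omega
    rw [h2, Finset.sum_filter, Finset.mul_sum]
    refine Finset.sum_congr rfl fun a ha ↦ ?_
    split_ifs with hM
    · rw [Finset.sum_eq_single_of_mem (M - a) (Finset.mem_Ioc.2 ⟨hM.1, hM.2.1⟩), if_pos (by omega),
        Nat.cast_sub hM.2.2, ← ee_add, ← ee_add]
      · ring_nf
      · intro c _ hc
        rw [if_neg (by omega)]
    · rw [mul_zero]
      refine Finset.sum_eq_zero fun c hc ↦ ?_
      rw [Finset.mem_Ioc] at hc
      rw [if_neg (by omega)]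
  rw [h1, norm_mul, norm_ee, one_mul]
  exact norm_sum_ee_le_of_le_dn _ _ hd h

lemma norm_triSum_ee_le {A B : ℕ} (hB : B ≤ N) {d x y z : ℝ} (hd : 0 < d) (h : d ≤ dn (x - z)) :
    ‖triSum (Finset.Ioc A B) N (fun n ↦ ee (n * x)) (fun n ↦ ee (n * y))
      (fun n ↦ ee (n * z))‖ ≤ N * (2 / d) := by
  rw [triSum_swap, triSum]
  calc _ ≤ ∑ b ∈ Finset.Ioc A B, 2 / d := by
        refine norm_sum_le_of_le _ fun b hb ↦ ?_
        have h1 : ∀ a ∈ Finset.Ioc A B, (∑ c ∈ Finset.Ioc A B,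
            if b + a + c = N then ee (b * y) * ee (a * x) * ee (c * z) else 0) =
            ee (b * y) * ∑ c ∈ Finset.Ioc A B,
              if a + c = N - b then ee (a * x) * ee (c * z) else 0 := by
          intro a _
          rw [Finset.mul_sum]
          refine Finset.sum_congr rfl fun c _ ↦ ?_
          have hbB := (Finset.mem_Ioc.1 hb).2
          by_cases hN : b + a + c = N
          · rw [if_pos hN, if_pos (by omega), mul_assoc]
          · rw [if_neg hN, if_neg (by omega), mul_zero]
        rw [Finset.sum_congr rfl h1, ← Finset.mul_sum, norm_mul, norm_ee, one_mul]
        exact norm_pair_sum_le A B _ hd h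
    _ = ((B - A : ℕ) : ℝ) * (2 / d) := by
        rw [Finset.sum_const, Nat.card_Ioc, nsmul_eq_mul]
    _ ≤ _ := by
        gcongr
        exact (Nat.sub_le B A).trans hB

/-- The number of ternary representations of `N` by elements of `s`. -/
def triCount (s : Finset ℕ) (N : ℕ) : ℕ :=
  ∑ a ∈ s, ∑ b ∈ s, ∑ c ∈ s, if a + b + c = N then 1 else 0

lemma triSum_ee_self (s : Finset ℕ) (N : ℕ) (x : ℝ) :
    triSum s N (fun n ↦ ee (n * x)) (fun n ↦ ee (n * x)) (fun n ↦ ee (n * x)) =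
      triCount s N * ee (N * x) := by
  rw [triSum, triCount]
  push_cast
  simp only [Finset.sum_mul]
  refine Finset.sum_congr rfl fun a _ ↦ Finset.sum_congr rfl fun b _ ↦
    Finset.sum_congr rfl fun c _ ↦ ?_
  split_ifs with h
  · rw [← h, ← ee_add, ← ee_add, one_mul]
    push_cast
    ring_nf
  · rw [zero_mul]

/-- The ternary count of the model. -/
theorem norm_triSum_model_sub_le (Q : ℕ) {A B : ℕ} (hB : B ≤ N) :
    ‖triSum (Finset.Ioc A B) N (model Q) (model Q) (model Q) -
      triCount (Finset.Ioc A B) N *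
        ((∑ q ∈ Finset.Icc 1 Q, wt q ^ 3 * ramanujan (-N) q : ℝ) : ℂ)‖ ≤ 2 * N * Q ^ 5 := by
  set I := Finset.Ioc A B with hI
  set F : (Σ _ : ℕ, ℕ) → ℕ → ℂ := fun p n ↦ ee (n * -fracVal p) with hF
  have hM : model Q = fun n ↦ ∑ p ∈ fracs Q, (wt p.1 : ℂ) * F p n := by
    funext n
    simp only [model, hF, mul_neg]
  rw [hM, triSum_sum]
  have hdiag : (triCount I N : ℂ) *
      ((∑ q ∈ Finset.Icc 1 Q, wt q ^ 3 * ramanujan (-N) q : ℝ) : ℂ) =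
      ∑ i ∈ fracs Q, ∑ j ∈ fracs Q, ∑ k ∈ fracs Q, if j = i ∧ k = i then
        (wt i.1 : ℂ) * wt i.1 * wt i.1 * triSum I N (F i) (F i) (F i) else 0 := by
    have h1 : ∀ i ∈ fracs Q, (∑ j ∈ fracs Q, ∑ k ∈ fracs Q, if j = i ∧ k = i then
        (wt i.1 : ℂ) * wt i.1 * wt i.1 * triSum I N (F i) (F i) (F i) else 0) =
        triCount I N * ((wt i.1 : ℂ) ^ 3 * ee ((-N : ℤ) * fracVal i)) := by
      intro i hi
      rw [Finset.sum_eq_single_of_mem i hi, Finset.sum_eq_single_of_mem i hi, if_pos ⟨rfl, rfl⟩,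
        triSum_ee_self]
      · push_cast
        rw [mul_neg, ← neg_mul]
        ring
      · intro k _ hk
        rw [if_neg (fun h ↦ hk h.2)]
      · intro j _ hj
        exact Finset.sum_eq_zero fun k _ ↦ if_neg fun h ↦ hj h.1
    rw [Finset.sum_congr rfl h1, ← Finset.mul_sum, fracs, Finset.sum_sigma, Complex.ofReal_sum]
    congr 1
    refine Finset.sum_congr rfl fun q hq ↦ ?_
    rw [Complex.ofReal_mul, Complex.ofReal_pow,
      ← sum_coprime_ee (by have := (Finset.mem_Icc.1 hq).1; omega), Finset.mul_sum]
    refine Finset.sum_congr rfl fun b _ ↦ ?_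
    simp only [fracVal]
    ring_nf
  rw [hdiag]
  simp only [← Finset.sum_sub_distrib]
  calc _ ≤ ∑ i ∈ fracs Q, ∑ j ∈ fracs Q, ∑ k ∈ fracs Q,
        |wt i.1| * |wt j.1| * |wt k.1| * (2 * N * Q ^ 2) := by
        refine norm_sum_le_of_le _ fun i hi ↦ norm_sum_le_of_le _ fun j hj ↦
          norm_sum_le_of_le _ fun k hk ↦ ?_
        have hQ : (0 : ℝ) < Q := by
          have := (mem_fracs.1 hi).1
          exact_mod_cast (by omega : 0 < Q)
        have hd : (0 : ℝ) < 1 / Q ^ 2 := by positivity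
        have hbd : (N : ℝ) * (2 / (1 / Q ^ 2)) = 2 * N * Q ^ 2 := by field_simp
        split_ifs with hijk
        · obtain ⟨rfl, rfl⟩ := hijk
          rw [sub_self, norm_zero]
          positivity
        · rw [sub_zero, norm_mul, norm_mul, norm_mul, Complex.norm_real, Complex.norm_real,
            Complex.norm_real, Real.norm_eq_abs, Real.norm_eq_abs, Real.norm_eq_abs]
          gcongr
          rw [← hbd]
          by_cases hkj : j = k
          · have hij : j ≠ i := fun h ↦ hijk ⟨h, by rw [← hkj, h]⟩
            rw [triSum_swap]
            refine norm_triSum_ee_le hB hd ?_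
            rw [neg_sub_neg]
            exact one_div_sq_le_dn_fracVal_sub hj hi hij
          · refine norm_triSum_ee_le hB hd ?_
            rw [neg_sub_neg]
            exact one_div_sq_le_dn_fracVal_sub hj hk hkj
    _ = (∑ i ∈ fracs Q, |wt i.1|) ^ 3 * (2 * N * Q ^ 2) := by
        simp only [← Finset.sum_mul, ← Finset.mul_sum]
        ring
    _ ≤ (Q : ℝ) ^ 3 * (2 * N * Q ^ 2) := by
        gcongr
        exact sum_fracs_abs_wt_le Q
    _ = _ := by ring

end ModelMoments

end Vinogradov

namespace Vinogradov

open Complex MeasureTheory Set Asymptotics Topology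

/-! ### The singular series -/

section SingularSeries

lemma abs_ramanujan_le (n : ℤ) (q : ℕ) : |ramanujan n q| ≤ q.totient := by
  rcases eq_or_ne q 0 with rfl | hq
  · simp
  · rw [← Real.norm_eq_abs, ← Complex.norm_real, ← sum_coprime_ee hq]
    refine (norm_sum_le_of_le (n := fun _ ↦ 1) _ fun b _ ↦ (norm_ee _).le).trans (le_of_eq ?_)
    simp only [Finset.sum_const, nsmul_eq_mul, mul_one]
    rfl

/-- The summand of the singular series of the ternary problem. -/
noncomputable def singularTerm (n : ℤ) (q : ℕ) : ℝ := wt q ^ 3 * ramanujan n q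

lemma abs_singularTerm_le (n : ℤ) (q : ℕ) : |singularTerm n q| ≤ 1 / (q.totient : ℝ) ^ 2 := by
  rcases Nat.eq_zero_or_pos q.totient with h | h
  · rw [Nat.totient_eq_zero] at h
    subst h
    simp [singularTerm]
  · have h' : (0 : ℝ) < q.totient := by exact_mod_cast h
    rw [singularTerm, abs_mul, abs_pow]
    calc |wt q| ^ 3 * |ramanujan n q| ≤ (1 / q.totient) ^ 3 * q.totient := by
          gcongr
          · exact abs_wt_le q
          · exact abs_ramanujan_le n q
      _ = _ := by field_simp

lemma summable_one_div_totient_sq : Summable fun q : ℕ ↦ 1 / (q.totient : ℝ) ^ 2 := by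
  have h : Summable fun q : ℕ ↦ 81 * (1 / (q : ℝ) ^ (3 / 2 : ℝ)) :=
    (Real.summable_one_div_nat_rpow.2 (by norm_num)).mul_left 81
  refine h.of_nonneg_of_le (fun q ↦ by positivity) fun q ↦ ?_
  rcases eq_or_ne q 0 with rfl | hq
  · simp
  · have hq1 : (1 : ℝ) ≤ q := by exact_mod_cast Nat.one_le_iff_ne_zero.2 hq
    have hq0 : (0 : ℝ) < q := by linarith
    have hφ : (0 : ℝ) < q.totient := by
      exact_mod_cast Nat.totient_pos.2 (Nat.pos_of_ne_zero hq)
    have h1 := le_totient_mul_log hq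
    have h2 := two_mul_log_add_one_le (κ := 1 / 4) (by norm_num) hq1
    have h3 : (q : ℝ) ≤ q.totient * (9 * (q : ℝ) ^ (1 / 4 : ℝ)) := by
      refine h1.trans ?_
      gcongr
      refine h2.trans (le_of_eq ?_)
      norm_num
    have h4 : (q : ℝ) ^ 2 ≤ 81 * (q.totient : ℝ) ^ 2 * (q : ℝ) ^ (1 / 2 : ℝ) := by
      calc (q : ℝ) ^ 2 ≤ (q.totient * (9 * (q : ℝ) ^ (1 / 4 : ℝ))) ^ 2 := by gcongr
        _ = 81 * (q.totient : ℝ) ^ 2 * ((q : ℝ) ^ (1 / 4 : ℝ)) ^ 2 := by ring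
        _ = _ := by
          rw [← Real.rpow_natCast ((q : ℝ) ^ (1 / 4 : ℝ)), ← Real.rpow_mul hq0.le]
          norm_num
    have h5 : (q : ℝ) ^ 2 = (q : ℝ) ^ (3 / 2 : ℝ) * (q : ℝ) ^ (1 / 2 : ℝ) := by
      rw [← Real.rpow_add hq0, ← Real.rpow_natCast]
      norm_num
    rw [h5] at h4
    have h6 : (0 : ℝ) < (q : ℝ) ^ (1 / 2 : ℝ) := by positivity
    have h7 := le_of_mul_le_mul_right h4 h6
    rw [mul_one_div, div_le_div_iff₀ (by positivity) (by positivity), one_mul]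
    exact h7

lemma summable_norm_singularTerm (n : ℤ) : Summable fun q ↦ ‖singularTerm n q‖ :=
  summable_one_div_totient_sq.of_nonneg_of_le (fun _ ↦ norm_nonneg _) (abs_singularTerm_le n)

lemma singularTerm_one (n : ℤ) : singularTerm n 1 = 1 := by
  rw [singularTerm, wt, isMultiplicative_mobius.map_one, (isMultiplicative_ramanujan n).map_one]
  simp

lemma singularTerm_mul (n : ℤ) {a b : ℕ} (h : a.Coprime b) :
    singularTerm n (a * b) = singularTerm n a * singularTerm n b := by
  rw [singularTerm, singularTerm, singularTerm, wt, wt, wt,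
    isMultiplicative_mobius.map_mul_of_coprime h,
    (isMultiplicative_ramanujan n).map_mul_of_coprime h, Nat.totient_mul h]
  push_cast
  rw [mul_div_mul_comm]
  ring

lemma tsum_singularTerm_prime_pow (n : ℤ) {p : ℕ} (hp : p.Prime) :
    ∑' k, singularTerm n (p ^ k) = 1 + singularTerm n p := by
  rw [tsum_eq_sum (s := Finset.range 2)]
  · rw [Finset.sum_range_succ, Finset.sum_range_one, pow_zero, pow_one, singularTerm_one]
  · intro k hk
    rw [Finset.mem_range, not_lt] at hk
    have h : mobius (p ^ k) = 0 := by
      rw [mobius, ArithmeticFunction.intCoe_apply,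
        ArithmeticFunction.moebius_apply_prime_pow hp (by omega), if_neg (by omega), Int.cast_zero]
    rw [singularTerm, wt, h]
    simp

lemma prod_primesBelow_ge {f : ℕ → ℝ} (h2 : 1 ≤ f 2)
    (hf : ∀ p : ℕ, p.Prime → 3 ≤ p → 1 - 1 / ((p : ℝ) - 1) ^ 2 ≤ f p) {m : ℕ} (hm : 3 ≤ m) :
    ((m : ℝ) - 1) / (2 * (m - 2)) ≤ ∏ p ∈ m.primesBelow, f p := by
  induction m, hm using Nat.le_induction with
  | base =>
    have : Nat.primesBelow 3 = {2} := by decide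
    rw [this, Finset.prod_singleton]
    norm_num
    exact h2
  | succ m hm ih =>
    have hm' : (3 : ℝ) ≤ m := by exact_mod_cast hm
    have h0 : (0 : ℝ) < m - 2 := by linarith
    have h1 : (0 : ℝ) < m - 1 := by linarith
    have hpos : (0 : ℝ) ≤ ((m : ℝ) - 1) / (2 * (m - 2)) := by positivity
    have e : (((m + 1 : ℕ) : ℝ) - 1) / (2 * ((m + 1 : ℕ) - 2)) =
        (1 - 1 / ((m : ℝ) - 1) ^ 2) * (((m : ℝ) - 1) / (2 * (m - 2))) := by
      push_cast
      rw [show (m : ℝ) + 1 - 1 = m by ring, show (m : ℝ) + 1 - 2 = m - 1 by ring]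
      field_simp
      ring
    rw [Nat.primesBelow_succ]
    split_ifs with hp
    · rw [Finset.prod_insert (Nat.notMem_primesBelow m), e]
      have h3 : (0 : ℝ) ≤ 1 - 1 / ((m : ℝ) - 1) ^ 2 := by
        rw [sub_nonneg, div_le_one (by positivity)]
        nlinarith
      exact mul_le_mul (hf m hp hm) ih hpos (h3.trans (hf m hp hm))
    · refine le_trans ?_ ih
      rw [e]
      refine mul_le_of_le_one_left hpos ?_
      have : (0 : ℝ) ≤ 1 / ((m : ℝ) - 1) ^ 2 := by positivity
      linarith

/-- The singular series is bounded below at odd integers. -/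
theorem one_half_le_tsum_singularTerm {n : ℤ} (hn : Odd n) :
    1 / 2 ≤ ∑' q, singularTerm n q := by
  have h := EulerProduct.eulerProduct (singularTerm_one n) (singularTerm_mul n)
    (summable_norm_singularTerm n) (by simp [singularTerm])
  refine ge_of_tendsto h ?_
  filter_upwards [eventually_ge_atTop 3] with m hm
  have hm' : (3 : ℝ) ≤ m := by exact_mod_cast hm
  have h2 : 1 ≤ ∑' k, singularTerm n (2 ^ k) := by
    rw [tsum_singularTerm_prime_pow n Nat.prime_two, singularTerm, ramanujan_prime Nat.prime_two,
      if_neg, wt, mobius, ArithmeticFunction.intCoe_apply,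
      ArithmeticFunction.moebius_apply_prime Nat.prime_two]
    · norm_num
    · exact fun h ↦ (Int.not_even_iff_odd.2 hn) (even_iff_two_dvd.2 (by exact_mod_cast h))
  refine le_trans ?_ (prod_primesBelow_ge (f := fun p ↦ ∑' k, singularTerm n (p ^ k)) h2 ?_ hm)
  · rw [div_le_div_iff₀ (by norm_num) (by linarith)]
    linarith
  · intro p hp _
    rw [tsum_singularTerm_prime_pow n hp]
    have h3 := neg_le_of_abs_le (abs_singularTerm_le n p)
    rw [Nat.totient_prime hp, Nat.cast_sub hp.one_le, Nat.cast_one] at h3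
    linarith

lemma eventually_one_fourth_le_sum_singularTerm : ∀ᶠ Q : ℕ in atTop, ∀ n : ℤ, Odd n →
    1 / 4 ≤ ∑ q ∈ Finset.Icc 1 Q, singularTerm n q := by
  have h := (tendsto_sum_nat_add fun q : ℕ ↦ 1 / (q.totient : ℝ) ^ 2).comp (tendsto_add_atTop_nat 1)
  filter_upwards [h.eventually_le_const (show (0 : ℝ) < 1 / 4 by norm_num)] with Q hQ n hn
  have hs := (summable_norm_singularTerm n).of_norm
  have h1 := hs.sum_add_tsum_nat_add (Q + 1)
  have h2 := one_half_le_tsum_singularTerm hn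
  have h3 : ‖∑' i, singularTerm n (i + (Q + 1))‖ ≤ 1 / 4 :=
    (tsum_of_norm_bounded ((summable_nat_add_iff (Q + 1)).2 summable_one_div_totient_sq).hasSum
      fun i ↦ abs_singularTerm_le n _).trans hQ
  have h4 : ∑ q ∈ Finset.range (Q + 1), singularTerm n q =
      ∑ q ∈ Finset.Icc 1 Q, singularTerm n q := by
    rw [Finset.range_eq_Ico, Finset.sum_eq_sum_Ico_succ_bot (by omega)]
    rw [show singularTerm n 0 = 0 by simp [singularTerm], zero_add]
    rfl
  rw [h4] at h1
  have h5 := le_of_abs_le h3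
  linarith

end SingularSeries

end Vinogradov

namespace Vinogradov

open Complex MeasureTheory Set Asymptotics Topology

/-! ### Sums of three primes -/

section TernaryProblem

lemma sq_le_triCount {A B N m : ℕ} (hA : A + m ≤ N / 3) (hB : N / 3 + 2 * m ≤ B) :
    m ^ 2 ≤ triCount (Finset.Ioc A B) N := by
  have hsub : Finset.Ioc (N / 3 - m) (N / 3) ⊆ Finset.Ioc A B :=
    Finset.Ioc_subset_Ioc (by omega) (by omega)
  have hcard : (Finset.Ioc (N / 3 - m) (N / 3)).card = m := by
    rw [Nat.card_Ioc]
    omega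
  calc m ^ 2 = ∑ _a ∈ Finset.Ioc (N / 3 - m) (N / 3),
        ∑ _b ∈ Finset.Ioc (N / 3 - m) (N / 3), 1 := by
        simp only [Finset.sum_const, hcard, smul_eq_mul, mul_one, sq]
    _ ≤ ∑ a ∈ Finset.Ioc (N / 3 - m) (N / 3), ∑ b ∈ Finset.Ioc (N / 3 - m) (N / 3),
        ∑ c ∈ Finset.Ioc A B, if a + b + c = N then 1 else 0 := by
        refine Finset.sum_le_sum fun a ha ↦ Finset.sum_le_sum fun b hb ↦ ?_
        rw [Finset.mem_Ioc] at ha hb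
        have hc : N - a - b ∈ Finset.Ioc A B := by
          rw [Finset.mem_Ioc]
          omega
        refine le_trans (le_of_eq ?_) (Finset.single_le_sum (fun _ _ ↦ Nat.zero_le _) hc)
        rw [if_pos (by omega)]
    _ ≤ ∑ a ∈ Finset.Ioc (N / 3 - m) (N / 3), ∑ b ∈ Finset.Ioc A B,
        ∑ c ∈ Finset.Ioc A B, if a + b + c = N then 1 else 0 :=
        Finset.sum_le_sum fun a _ ↦ Finset.sum_le_sum_of_subset hsub
    _ ≤ _ := Finset.sum_le_sum_of_subset hsub

lemma sum_norm_sq_lw_le {A B N : ℕ} (hB : B ≤ N) :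
    ∑ n ∈ Finset.Ioc A B, ‖(lw n : ℂ)‖ ^ 2 ≤ 2 * N * Real.log N := by
  have hL : 0 ≤ Real.log N := Real.log_natCast_nonneg N
  calc ∑ n ∈ Finset.Ioc A B, ‖(lw n : ℂ)‖ ^ 2 ≤ ∑ n ∈ Finset.Ioc A B, lw n * Real.log N := by
        refine Finset.sum_le_sum fun n hn ↦ ?_
        rw [Finset.mem_Ioc] at hn
        rw [Complex.norm_real, Real.norm_eq_abs, sq_abs, sq]
        refine mul_le_mul_of_nonneg_left ((lw_le_log n).trans ?_) (lw_nonneg n)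
        exact Real.log_le_log (by exact_mod_cast (by omega : 0 < n))
          (by exact_mod_cast hn.2.trans hB)
    _ ≤ (∑ n ∈ Finset.Ioc 0 N, lw n) * Real.log N := by
        rw [← Finset.sum_mul]
        refine mul_le_mul_of_nonneg_right ?_ hL
        exact Finset.sum_le_sum_of_subset_of_nonneg
          (Finset.Ioc_subset_Ioc (Nat.zero_le A) hB) fun n _ _ ↦ lw_nonneg n
    _ ≤ _ := mul_le_mul_of_nonneg_right (sum_lw_le N) hL

lemma exists_primes_of_triSum_ne_zero {s : Finset ℕ} {N : ℕ}
    (h : triSum s N (fun n ↦ (lw n : ℂ)) (fun n ↦ (lw n : ℂ)) (fun n ↦ (lw n : ℂ)) ≠ 0) :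
    ∃ a ∈ s, ∃ b ∈ s, ∃ c ∈ s, a.Prime ∧ b.Prime ∧ c.Prime ∧ N = a + b + c := by
  obtain ⟨a, ha, h⟩ := Finset.exists_ne_zero_of_sum_ne_zero h
  obtain ⟨b, hb, h⟩ := Finset.exists_ne_zero_of_sum_ne_zero h
  obtain ⟨c, hc, h⟩ := Finset.exists_ne_zero_of_sum_ne_zero h
  have hp : ∀ n : ℕ, (lw n : ℂ) ≠ 0 → n.Prime := fun n hn ↦ by
    by_contra hn'
    exact hn (by rw [lw, if_neg hn', Complex.ofReal_zero])
  by_cases hN : a + b + c = N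
  · rw [if_pos hN] at h
    exact ⟨a, ha, b, hb, c, hc, hp a (left_ne_zero_of_mul (left_ne_zero_of_mul h)),
      hp b (right_ne_zero_of_mul (left_ne_zero_of_mul h)), hp c (right_ne_zero_of_mul h), hN.symm⟩
  · rw [if_neg hN] at h
    exact absurd rfl h

/-- A large odd `N` is a sum of three primes from any interval containing a positive proportion of
its ternary representations. -/
theorem eventually_exists_primes {c : ℝ} (hc : 0 < c) : ∀ᶠ N : ℕ in atTop, ∀ A B : ℕ, A ≤ B →
    B ≤ N → c * N ^ 2 ≤ triCount (Finset.Ioc A B) N → Odd N →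
    ∃ a ∈ Finset.Ioc A B, ∃ b ∈ Finset.Ioc A B, ∃ c ∈ Finset.Ioc A B,
      a.Prime ∧ b.Prime ∧ c.Prime ∧ N = a + b + c := by
  have hlog : Tendsto (fun N : ℕ ↦ Real.log N) atTop atTop :=
    Real.tendsto_log_atTop.comp tendsto_natCast_atTop_atTop
  have hQ : Tendsto (fun N : ℕ ↦ ⌊Real.log N ^ 16⌋₊) atTop atTop :=
    tendsto_nat_floor_atTop.comp ((tendsto_pow_atTop (by norm_num)).comp hlog)
  filter_upwards [hQ.eventually eventually_one_fourth_le_sum_singularTerm,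
    eventually_norm_fourierSum_lw_sub_model_le, eventually_le_log 1, eventually_le_log (400 / c),
    eventually_mul_log_pow_le_sqrt 2 64, eventually_mul_log_pow_le_sqrt (20 / c) 80,
    eventually_ge_atTop 1] with N hS hF hL1 hLc h64 h80 hN1 A B hAB hBN hcount hodd
  have hN1' : (1 : ℝ) ≤ N := by exact_mod_cast hN1
  have hN0 : (0 : ℝ) < N := by linarith
  have hsqrt : √(N : ℝ) ≤ N := sqrt_le_self_of_one_le hN1'
  set L := Real.log N with hLdef
  have hL0 : 0 < L := by linarith
  set Q := ⌊L ^ 16⌋₊ with hQdef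
  have hQL : (Q : ℝ) ≤ L ^ 16 := Nat.floor_le (by positivity)
  have hQ1 : 1 ≤ Q := Nat.le_floor (by rw [Nat.cast_one]; exact one_le_pow₀ hL1)
  have hQ0 : (0 : ℝ) < Q := by exact_mod_cast hQ1
  have hlogQ : Real.log Q ≤ L := by
    refine Real.log_le_log hQ0 (hQL.trans ?_)
    have h1 : L ^ 16 ≤ L ^ 64 := pow_le_pow_right₀ hL1 (by norm_num)
    have h2 : 0 ≤ L ^ 64 := by positivity
    linarith
  have hlogQ0 : 0 ≤ Real.log Q := Real.log_natCast_nonneg Q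
  have hG : ∑ n ∈ Finset.Ioc A B, ‖model Q n‖ ^ 2 ≤ 7 * N * L ^ 2 := by
    refine (sum_norm_sq_model_le Q A B).trans ?_
    have hBN' : (B : ℝ) ≤ N := by exact_mod_cast hBN
    have h1 : (B : ℝ) * ((2 * Real.log Q + 1) * (1 + Real.log Q)) ≤
        N * ((2 * L + L) * (L + L)) := by gcongr
    have h2 : 2 * (Q : ℝ) ^ 4 ≤ N := by
      calc 2 * (Q : ℝ) ^ 4 ≤ 2 * (L ^ 16) ^ 4 := by gcongr
        _ = 2 * L ^ 64 := by ring
        _ ≤ _ := h64.trans hsqrt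
    have h3 : (N : ℝ) ≤ N * L ^ 2 := le_mul_of_one_le_right hN0.le (one_le_pow₀ hL1)
    linarith
  have hdiff := norm_triSum_sub_triSum_le (f := fun n ↦ (lw n : ℂ)) (g := model Q)
    (fun n hn ↦ (Finset.mem_Ioc.1 hn).2.trans hBN) (hF A B hAB hBN)
    (sum_norm_sq_lw_le hBN) hG
  have hdiff' : 3 * (N / L ^ 3) * (3 / 2 * (2 * N * L + 7 * N * L ^ 2)) ≤ c * N ^ 2 / 8 := by
    have h1 : 2 * N * L ≤ 2 * N * L ^ 2 := by
      gcongr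
      exact le_self_pow₀ hL1 (by norm_num)
    calc 3 * (N / L ^ 3) * (3 / 2 * (2 * N * L + 7 * N * L ^ 2))
        ≤ 3 * (N / L ^ 3) * (3 / 2 * (2 * N * L ^ 2 + 7 * N * L ^ 2)) := by gcongr
      _ = 81 / 2 * (N : ℝ) ^ 2 / L := by field_simp; ring
      _ ≤ _ := by
        rw [div_le_div_iff₀ hL0 (by norm_num)]
        rw [div_le_iff₀ hc] at hLc
        have h2 : (0 : ℝ) ≤ (N : ℝ) ^ 2 := by positivity
        nlinarith
  have hmodel := norm_triSum_model_sub_le Q (A := A) hBN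
  have hmodel' : 2 * N * (Q : ℝ) ^ 5 ≤ c * N ^ 2 / 10 := by
    have h1 : 20 / c * (Q : ℝ) ^ 5 ≤ N := by
      calc 20 / c * (Q : ℝ) ^ 5 ≤ 20 / c * (L ^ 16) ^ 5 := by gcongr
        _ = 20 / c * L ^ 80 := by ring
        _ ≤ _ := h80.trans hsqrt
    rw [div_mul_eq_mul_div, div_le_iff₀ hc] at h1
    nlinarith
  have hser := hS (-N) (by simpa using hodd)
  refine exists_primes_of_triSum_ne_zero fun h0 ↦ ?_
  rw [h0, zero_sub, norm_neg] at hdiff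
  set T := triSum (Finset.Ioc A B) N (model Q) (model Q) (model Q)
  have hmain : ‖(triCount (Finset.Ioc A B) N : ℂ) *
      ((∑ q ∈ Finset.Icc 1 Q, wt q ^ 3 * ramanujan (-N) q : ℝ) : ℂ)‖ =
      triCount (Finset.Ioc A B) N * ∑ q ∈ Finset.Icc 1 Q, singularTerm (-N) q := by
    rw [norm_mul, Complex.norm_natCast, Complex.norm_real, Real.norm_of_nonneg]
    · rfl
    · exact le_trans (by norm_num) hser
  have h1 := norm_sub_norm_le ((triCount (Finset.Ioc A B) N : ℂ) *
      ((∑ q ∈ Finset.Icc 1 Q, wt q ^ 3 * ramanujan (-N) q : ℝ) : ℂ)) T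
  rw [norm_sub_rev, hmain] at h1
  have h2 : c * N ^ 2 * (1 / 4) ≤
      triCount (Finset.Ioc A B) N * ∑ q ∈ Finset.Icc 1 Q, singularTerm (-N) q := by
    gcongr
  have h3 : 0 < c * N ^ 2 := by positivity
  linarith

end TernaryProblem

end Vinogradov

theorem vinogradov_with_restriction (ε : ℝ) (hε : 0 < ε) :
    ∃ N₀ : ℕ, ∀ N : ℕ, N₀ ≤ N → Odd N →
    ∃ q₁ q₂ q₃ : ℕ, q₁.Prime ∧ q₂.Prime ∧ q₃.Prime ∧ N = q₁ + q₂ + q₃ ∧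
      (N : ℝ) / (3 + ε) < q₁ ∧ (q₁ : ℝ) < (3 + 2 * ε) / (9 + 3 * ε) * N ∧
      (N : ℝ) / (3 + ε) < q₂ ∧ (q₂ : ℝ) < (3 + 2 * ε) / (9 + 3 * ε) * N ∧
      (N : ℝ) / (3 + ε) < q₃ ∧ (q₃ : ℝ) < (3 + 2 * ε) / (9 + 3 * ε) * N := by
  obtain ⟨η, hη⟩ : ∃ η, η = ε / (9 + 3 * ε) := ⟨_, rfl⟩
  have hη0 : 0 < η := by rw [hη]; positivity
  have hη1 : η ≤ 1 / 3 := by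
    rw [hη, div_le_div_iff₀ (by positivity) (by norm_num)]
    linarith
  have hlow (N : ℝ) : N / (3 + ε) = N / 3 - η * N := by
    rw [hη]
    field_simp
    ring
  have hupp : (3 + 2 * ε) / (9 + 3 * ε) = 1 / 3 + η := by
    rw [hη]
    field_simp
    ring
  have hev := Vinogradov.eventually_exists_primes (c := η ^ 2 / 64) (by positivity)
  obtain ⟨N₀, hN₀⟩ := eventually_atTop.1
    (hev.and (eventually_ge_atTop ⌈8 / η⌉₊))
  refine ⟨N₀, fun N hN hodd ↦ ?_⟩
  obtain ⟨hrep, hNη⟩ := hN₀ N hN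
  have hηN : 8 ≤ η * N := by
    have := Nat.ceil_le.1 hNη
    rwa [div_le_iff₀' hη0] at this
  have hN0 : (0 : ℝ) ≤ N := Nat.cast_nonneg N
  have hηN' : η * N ≤ 1 / 3 * N := by gcongr
  rw [hupp, hlow]
  set l : ℝ := N / 3 - η * N with hl
  set r : ℝ := (1 / 3 + η) * N with hr
  have hl0 : 0 ≤ l := by linarith
  set A := ⌊l⌋₊
  set B := ⌈r⌉₊ - 1
  set m := ⌊η * N / 4⌋₊
  have hA : (A : ℝ) ≤ l := Nat.floor_le hl0
  have hm : (m : ℝ) ≤ η * N / 4 := Nat.floor_le (by linarith)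
  have hm' : η * N / 4 < m + 1 := Nat.lt_floor_add_one _
  have hr1 : 1 ≤ ⌈r⌉₊ := Nat.one_le_ceil_iff.2 (by linarith)
  have hN3 : ((N / 3 : ℕ) : ℝ) ≤ N / 3 := Nat.cast_div_le
  have hAm : A + m ≤ N / 3 := by
    rw [Nat.le_div_iff_mul_le (by norm_num)]
    have : ((A + m : ℕ) : ℝ) * 3 ≤ N := by push_cast; linarith
    exact_mod_cast this
  have hBm : N / 3 + 2 * m ≤ B := by
    refine Nat.le_sub_one_of_lt (Nat.lt_ceil.2 ?_)
    push_cast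
    linarith
  have hBN : B ≤ N := by
    refine (Nat.sub_le _ _).trans (Nat.ceil_le.2 ?_)
    linarith
  have hcount : η ^ 2 / 64 * (N : ℝ) ^ 2 ≤ Vinogradov.triCount (Finset.Ioc A B) N := by
    calc η ^ 2 / 64 * (N : ℝ) ^ 2 = (η * N / 8) ^ 2 := by ring
      _ ≤ (m : ℝ) ^ 2 := by
        gcongr
        linarith
      _ ≤ _ := by exact_mod_cast Vinogradov.sq_le_triCount hAm hBm
  obtain ⟨a, ha, b, hb, c, hc, hpa, hpb, hpc, habc⟩ :=
    hrep A B (by omega) hBN hcount hodd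
  have hmem : ∀ n ∈ Finset.Ioc A B, l < n ∧ (n : ℝ) < r := fun n hn ↦ by
    rw [Finset.mem_Ioc] at hn
    exact ⟨Nat.lt_of_floor_lt hn.1, Nat.lt_ceil.1 (by omega)⟩
  exact ⟨a, b, c, hpa, hpb, hpc, habc, (hmem a ha).1, (hmem a ha).2, (hmem b hb).1,
    (hmem b hb).2, (hmem c hc).1, (hmem c hc).2⟩
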